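/- Let n ≥ 2 and let u₀ ∈ H^s(ℝⁿ). If 1/2 − 1/(4n) < s ≤ 1 − 3/(2(n+1)), then the divergence set satisfies dim_H D(u₀) ≤ n + 1 − (2 + 2/(2n−1))·s. If 1 − 3/(2(n+1)) ≤ s < n/4, then dim_H D(u₀) ≤ n + 1 − 1/(n+1) − 2s. -/

import Mathlib

open MeasureTheory Metric Filter Set
open scoped ENNReal InnerProductSpace Topology

/-- The frequency-truncated Schrödinger evolution
`∫ ψ(|ξ|/N) F(ξ) e^{i(x·ξ - t|ξ|²)} dξ`, where `F` plays the role of `û₀`. -/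
noncomputable def schroPartial (n : ℕ) (ψ : SchwartzMap ℝ ℝ)
    (F : EuclideanSpace ℝ (Fin n) → ℂ) (x : EuclideanSpace ℝ (Fin n)) (t N : ℝ) : ℂ :=
  ∫ ξ, ((ψ (‖ξ‖ / N) : ℝ) : ℂ) * F ξ *
    Complex.exp (Complex.I * (((⟪x, ξ⟫_ℝ : ℝ) : ℂ) - (t : ℂ) * ((‖ξ‖ ^ 2 : ℝ) : ℂ)))

/-- The pointwise solution `u(x,t) = lim_{N → ∞} ∫ ψ(|ξ|/N) û₀(ξ) e^{i(x·ξ - t|ξ|²)} dξ`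
(junk value if the limit does not exist).  At `t = 0` this is the canonical pointwise
representative of the datum `u₀`. -/
noncomputable def schroSol (n : ℕ) (ψ : SchwartzMap ℝ ℝ)
    (F : EuclideanSpace ℝ (Fin n) → ℂ) (x : EuclideanSpace ℝ (Fin n)) (t : ℝ) : ℂ :=
  limUnder atTop (fun N : ℝ => schroPartial n ψ F x t N)

/-- The divergence set `D(u₀)`: the set of `x` for which it fails that `u(x,t)` is
defined for all small `t ≥ 0` and `u(x,t) → u₀(x)` as `t → 0⁺`. -/
def schroDivergenceSet (n : ℕ) (ψ : SchwartzMap ℝ ℝ)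
    (F : EuclideanSpace ℝ (Fin n) → ℂ) : Set (EuclideanSpace ℝ (Fin n)) :=
  {x | ¬ ((∃ L : ℂ, Tendsto (fun N : ℝ => schroPartial n ψ F x 0 N) atTop (𝓝 L)) ∧
      ∃ t₀ : ℝ, 0 < t₀ ∧
        (∀ t ∈ Ioo (0 : ℝ) t₀,
          ∃ L : ℂ, Tendsto (fun N : ℝ => schroPartial n ψ F x t N) atTop (𝓝 L)) ∧
        Tendsto (fun t => schroSol n ψ F x t) (𝓝[>] (0 : ℝ)) (𝓝 (schroSol n ψ F x 0)))}

namespace SchroAux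

open scoped NNReal Matrix

noncomputable section

section

open scoped ContDiff FourierTransform

/-- The character `e^{ix}`. -/
def ch (x : ℝ) : ℂ := Complex.exp (x * Complex.I)

lemma ch_add (x y : ℝ) : ch (x + y) = ch x * ch y := by
  simp [ch, ← Complex.exp_add, add_mul]

lemma ch_sub (x y : ℝ) : ch (x - y) = ch x * ch (-y) := by
  rw [sub_eq_add_neg, ch_add]

@[simp] lemma ch_zero : ch 0 = 1 := by simp [ch]

@[simp] lemma norm_ch (x : ℝ) : ‖ch x‖ = 1 := by simp [ch, Complex.norm_exp_ofReal_mul_I]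

@[simp] lemma enorm_ch (x : ℝ) : ‖ch x‖ₑ = 1 := by
  rw [← ofReal_norm, norm_ch, ENNReal.ofReal_one]

@[fun_prop] lemma continuous_ch : Continuous ch := by unfold ch; fun_prop

lemma conj_ch (x : ℝ) : (starRingEnd ℂ) (ch x) = ch (-x) := by
  simp [ch, ← Complex.exp_conj]

lemma ch_sum {ι : Type*} (s : Finset ι) (f : ι → ℝ) : ch (∑ i ∈ s, f i) = ∏ i ∈ s, ch (f i) := by
  simp [ch, ← Complex.exp_sum, Finset.sum_mul]

/-- Schwartz kernels with prescribed smooth compactly supported Fourier transform. -/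
lemma exists_kernel_one (χ : ℝ → ℝ) (h1 : ContDiff ℝ ∞ χ) (h2 : HasCompactSupport χ) :
    ∃ K : ℝ → ℂ, Continuous K ∧ (∀ L : ℕ, ∃ C : ℝ, 0 < C ∧ ∀ y, ‖K y‖ ≤ C * ((1 + |y|) ^ L)⁻¹) ∧
      (∀ ξ : ℝ, ∫ y, K y * ch (-(y * ξ)) = χ ξ) ∧
      (∀ y : ℝ, K y = ((2 * Real.pi)⁻¹ : ℝ) * ∫ u, (χ u : ℂ) * ch (u * y)) := by
  have hc : HasCompactSupport (fun x => (χ x : ℂ)) := h2.comp_left (g := Complex.ofReal) rfl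
  have hd : ContDiff ℝ ∞ (fun x => (χ x : ℂ)) := Complex.ofRealCLM.contDiff.comp h1
  let X : SchwartzMap ℝ ℂ := hc.toSchwartzMap hd
  have hX : ∀ x, X x = χ x := fun x => rfl
  let g : SchwartzMap ℝ ℂ := 𝓕⁻ X
  have hpi : (0 : ℝ) < 2 * Real.pi := by positivity
  have hg : ∀ y, g y = ∫ u, (χ u : ℂ) * ch (2 * Real.pi * (u * y)) := by
    intro y
    have : g y = 𝓕⁻ (X : ℝ → ℂ) y := by
      simp only [g]; rw [SchwartzMap.fourierInv_coe]
    rw [this, Real.fourierInv_eq']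
    congr 1; ext u
    simp [hX, ch, mul_comm]
  have hFg : ∀ ξ, ∫ v, g v * ch (-(2 * Real.pi * (v * ξ))) = χ ξ := by
    intro ξ
    have : 𝓕 (g : ℝ → ℂ) ξ = X ξ := by
      rw [← SchwartzMap.fourier_coe]; simp [g]
    rw [← hX, ← this, Real.fourier_eq']
    congr 1; ext u
    simp [ch, mul_comm]
  refine ⟨fun y => ((2 * Real.pi)⁻¹ : ℝ) * g (y / (2 * Real.pi)), ?_, ?_, ?_, ?_⟩
  · have := g.continuous
    fun_prop
  · intro L
    obtain ⟨C, hC⟩ : ∃ C, ∀ x, (1 + ‖x‖) ^ L * ‖g x‖ ≤ C :=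
      ⟨_, fun x => by
        simpa using SchwartzMap.one_add_le_sup_seminorm_apply (𝕜 := ℂ) (m := (L, 0)) (k := L)
          (n := 0) le_rfl le_rfl g x⟩
    have hC0 : 0 ≤ C := le_trans (by positivity) (hC 0)
    refine ⟨(2 * Real.pi)⁻¹ * ((C + 1) * (2 * Real.pi) ^ L), by positivity, fun y => ?_⟩
    rw [norm_mul, Complex.norm_real, Real.norm_of_nonneg (by positivity), mul_assoc]
    gcongr
    have h := hC (y / (2 * Real.pi))
    have hle : 1 + |y| ≤ 2 * Real.pi * (1 + ‖y / (2 * Real.pi)‖) := by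
      rw [norm_div, Real.norm_of_nonneg hpi.le, Real.norm_eq_abs]
      have : 1 ≤ 2 * Real.pi := by linarith [Real.pi_gt_three]
      field_simp
      linarith
    have hp : (1 + |y|) ^ L ≤ (2 * Real.pi) ^ L * (1 + ‖y / (2 * Real.pi)‖) ^ L := by
      rw [← mul_pow]; gcongr
    rw [← div_eq_mul_inv, le_div_iff₀ (by positivity)]
    calc _ ≤ ‖g (y / (2 * Real.pi))‖ * ((2 * Real.pi) ^ L * (1 + ‖y / (2 * Real.pi)‖) ^ L) := by
          gcongr
      _ = ((1 + ‖y / (2 * Real.pi)‖) ^ L * ‖g (y / (2 * Real.pi))‖) * (2 * Real.pi) ^ L := by ring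
      _ ≤ (C + 1) * (2 * Real.pi) ^ L := by gcongr; linarith
  · intro ξ
    have := MeasureTheory.Measure.integral_comp_div
      (fun v => g v * ch (-(2 * Real.pi * (v * ξ)))) (2 * Real.pi)
    rw [hFg, abs_of_pos hpi] at this
    have h2 : ∀ y : ℝ, -(2 * Real.pi * (y / (2 * Real.pi) * ξ)) = -(y * ξ) := by
      intro y; field_simp
    simp only [h2] at this
    simp only [mul_assoc]
    rw [integral_const_mul, this]
    simp
    field_simp
  · intro y
    simp only [hg]
    congr 2; ext u; congr 2; field_simp

variable {ι : Type*} [Fintype ι]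

lemma one_add_norm_le_prod (y : ι → ℝ) : 1 + ‖y‖ ≤ ∏ i, (1 + |y i|) := by
  have h : ∀ i, 1 + |y i| ≤ ∏ i, (1 + |y i|) := fun i => by
    classical
    rw [← Finset.mul_prod_erase _ _ (Finset.mem_univ i)]
    exact le_mul_of_one_le_right (by positivity)
      (Finset.one_le_prod fun j _ => by linarith [abs_nonneg (y j)])
  have h1 : 1 ≤ ∏ i, (1 + |y i|) := Finset.one_le_prod fun j _ => by linarith [abs_nonneg (y j)]
  have := (pi_norm_le_iff_of_nonneg (x := y) (sub_nonneg.2 h1)).2 fun i => by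
    rw [Real.norm_eq_abs]; linarith [h i]
  linarith

lemma integrable_decay {L : ℕ} (hL : Fintype.card ι < L) :
    Integrable (fun y : ι → ℝ => ((1 + ‖y‖) ^ L)⁻¹) := by
  have := integrable_one_add_norm (E := ι → ℝ) (μ := volume) (r := L)
    (by rw [Module.finrank_fintype_fun_eq_card]; exact_mod_cast hL)
  refine this.congr (Eventually.of_forall fun y => ?_)
  simp only
  rw [Real.rpow_neg (by positivity), Real.rpow_natCast]

/-- Product kernels on `ι → ℝ`. -/
lemma exists_kernel (χ : ℝ → ℝ) (h1 : ContDiff ℝ ∞ χ) (h2 : HasCompactSupport χ) :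
    ∃ K : (ι → ℝ) → ℂ, Continuous K ∧
      (∀ L : ℕ, ∃ C : ℝ, 0 < C ∧ ∀ y, ‖K y‖ ≤ C * ((1 + ‖y‖) ^ L)⁻¹) ∧
      (∀ ξ : ι → ℝ, ∫ y, K y * ch (-(y ⬝ᵥ ξ)) = ∏ i, (χ (ξ i) : ℂ)) := by
  obtain ⟨K, hKc, hKd, hKf, -⟩ := exists_kernel_one χ h1 h2
  refine ⟨fun y => ∏ i, K (y i), by fun_prop, fun L => ?_, fun ξ => ?_⟩
  · obtain ⟨C, hC, h⟩ := hKd L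
    refine ⟨C ^ Fintype.card ι, by positivity, fun y => ?_⟩
    rw [norm_prod]
    calc _ ≤ ∏ i, (C * ((1 + |y i|) ^ L)⁻¹) :=
          Finset.prod_le_prod (fun _ _ => norm_nonneg _) fun i _ => h (y i)
      _ = C ^ Fintype.card ι * ((∏ i, (1 + |y i|)) ^ L)⁻¹ := by
          rw [Finset.prod_mul_distrib, Finset.prod_const, Finset.card_univ, Finset.prod_inv_distrib,
            Finset.prod_pow]
      _ ≤ _ := by
          gcongr
          exact one_add_norm_le_prod y
  · simp only [← hKf]
    rw [← integral_fintype_prod_volume_eq_prod (f := fun i y => K y * ch (-(y * ξ i)))]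
    congr 1; ext y
    rw [Finset.prod_mul_distrib, dotProduct, ← Finset.sum_neg_distrib, ch_sum]

/-- The one-dimensional partition function. -/
def psi1 (x : ℝ) : ℝ := Real.smoothTransition (x + 1) - Real.smoothTransition x

lemma contDiff_psi1 : ContDiff ℝ ∞ psi1 := by
  unfold psi1
  exact (Real.smoothTransition.contDiff.comp (contDiff_id.add contDiff_const)).sub
    Real.smoothTransition.contDiff

lemma psi1_eq_zero {x : ℝ} (hx : 1 ≤ |x|) : psi1 x = 0 := by
  unfold psi1
  rcases le_abs.1 hx with h | h
  · rw [Real.smoothTransition.one_of_one_le h, Real.smoothTransition.one_of_one_le (by linarith),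
      sub_self]
  · rw [Real.smoothTransition.zero_of_nonpos (by linarith),
      Real.smoothTransition.zero_of_nonpos (by linarith), sub_self]

lemma hasCompactSupport_psi1 : HasCompactSupport psi1 := by
  refine HasCompactSupport.intro (isCompact_Icc (a := -1) (b := 1)) fun x hx => psi1_eq_zero ?_
  by_contra h
  exact hx (abs_le.1 (not_le.1 h).le)

lemma sum_psi1 {N : ℕ} {x : ℝ} (hx : |x| ≤ N) : ∑ m ∈ Finset.Icc (-(N : ℤ)) N, psi1 (x - m) = 1 := by
  have h : ∀ n : ℕ, ∀ a : ℤ, ∑ m ∈ Finset.Ico a (a + n), psi1 (x - m) =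
      Real.smoothTransition (x + 1 - a) - Real.smoothTransition (x + 1 - (a + n)) := by
    intro n a
    induction n with
    | zero => simp
    | succ n ih =>
      have : Finset.Ico a (a + (n + 1 : ℕ)) = insert (a + n) (Finset.Ico a (a + n)) := by
        ext z; simp; omega
      rw [this, Finset.sum_insert (by simp), ih, psi1]
      push_cast
      ring_nf
  have h2 : Finset.Icc (-(N : ℤ)) N = Finset.Ico (-(N : ℤ)) (-(N : ℤ) + (2 * N + 1 : ℕ)) := by
    ext z; simp; omega
  rw [h2, h]
  push_cast
  rw [abs_le] at hx
  rw [Real.smoothTransition.one_of_one_le (by linarith),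
    Real.smoothTransition.zero_of_nonpos (by linarith), sub_zero]

/-- A smooth compactly supported function equal to one on `[-1,1]`. -/
lemma exists_phi1 : ∃ φ : ℝ → ℝ, ContDiff ℝ ∞ φ ∧ HasCompactSupport φ ∧ (∀ x, |x| ≤ 1 → φ x = 1) ∧
    (∀ x, 2 ≤ |x| → φ x = 0) ∧ ∀ x, 0 ≤ φ x := by
  let f : ContDiffBump (0 : ℝ) := ⟨1, 2, by norm_num, by norm_num⟩
  refine ⟨f, f.contDiff, f.hasCompactSupport, fun x hx => f.one_of_mem_closedBall ?_,
    fun x hx => f.zero_of_le_dist ?_, fun x => f.nonneg⟩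
  · simpa [f] using hx
  · simpa [f] using hx

/-- A nonnegative band-limited function, one-dimensional version. -/
lemma exists_eta_one : ∃ η : ℝ → ℝ, Continuous η ∧ (∀ x, 0 ≤ η x) ∧
    (∀ L : ℕ, ∃ C : ℝ, 0 < C ∧ ∀ y, η y ≤ C * ((1 + |y|) ^ L)⁻¹) ∧ 0 < η 0 ∧
    (∀ ξ : ℝ, 4 ≤ |ξ| → ∫ y, (η y : ℂ) * ch (-(y * ξ)) = 0) := by
  obtain ⟨φ, hφ, hφc, hφ1, hφ2, hφ0⟩ := exists_phi1
  obtain ⟨K, hKc, hKd, hKf, hKe⟩ := exists_kernel_one φ hφ hφc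
  have hφi : Integrable φ := hφ.continuous.integrable_of_hasCompactSupport hφc
  have hKi : Integrable K := by
    obtain ⟨C, hC, h⟩ := hKd 2
    have h3 := (integrable_one_add_norm (E := ℝ) (μ := volume) (r := 2) (by simp)).const_mul C
    refine h3.mono' hKc.aestronglyMeasurable (Eventually.of_forall fun y => (h y).trans_eq ?_)
    rw [Real.rpow_neg (by positivity), Real.norm_eq_abs]; norm_cast
  refine ⟨fun x => ‖K x‖ ^ 2, by fun_prop, fun x => by positivity, fun L => ?_, ?_, fun ξ hξ => ?_⟩
  · obtain ⟨C, hC, h⟩ := hKd L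
    refine ⟨C ^ 2, by positivity, fun y => ?_⟩
    calc ‖K y‖ ^ 2 ≤ (C * ((1 + |y|) ^ L)⁻¹) ^ 2 := by gcongr; exact h y
      _ = C ^ 2 * (((1 + |y|) ^ L)⁻¹ * ((1 + |y|) ^ L)⁻¹) := by ring
      _ ≤ C ^ 2 * (((1 + |y|) ^ L)⁻¹ * 1) := by
          gcongr
          exact inv_le_one_of_one_le₀ (one_le_pow₀ (by linarith [abs_nonneg y]))
      _ = _ := by ring
  · have : 0 < ∫ u, φ u := by
      refine hφ.continuous.integral_pos_of_hasCompactSupport_nonneg_nonzero hφc hφ0 (x := 0) ?_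
      rw [hφ1 0 (by simp)]; norm_num
    have h0 : K 0 = (((2 * Real.pi)⁻¹ * ∫ u, φ u : ℝ) : ℂ) := by
      rw [hKe]; simp [integral_complex_ofReal]
    simp only [h0, Complex.norm_real]
    rw [Real.norm_of_nonneg (by positivity)]
    positivity
  · have hconj : ∀ y, (starRingEnd ℂ) (K y) = ((2 * Real.pi)⁻¹ : ℝ) * ∫ u, (φ u : ℂ) * ch (-(u * y)) := by
      intro y
      rw [hKe, map_mul, Complex.conj_ofReal, ← integral_conj]
      simp [conj_ch]
    have hintg : Integrable (Function.uncurry fun (y u : ℝ) =>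
        K y * ch (-(y * ξ)) * ((φ u : ℂ) * ch (-(u * y)))) (volume.prod volume) := by
      have := hKi.norm.mul_prod hφi.norm
      refine this.mono' (Continuous.aestronglyMeasurable ?_) (Eventually.of_forall fun z => ?_)
      · have := hφ.continuous
        simp only [Function.uncurry_def]
        fun_prop
      · simp [Function.uncurry_def]
    calc ∫ y, ((‖K y‖ ^ 2 : ℝ) : ℂ) * ch (-(y * ξ))
        = ∫ y, ((2 * Real.pi)⁻¹ : ℝ) * ∫ u, K y * ch (-(y * ξ)) * ((φ u : ℂ) * ch (-(u * y))) := by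
          congr 1; ext y
          rw [integral_const_mul, show ((‖K y‖ ^ 2 : ℝ) : ℂ) = K y * (starRingEnd ℂ) (K y) by
            rw [Complex.mul_conj, Complex.normSq_eq_norm_sq], hconj]
          ring
      _ = ((2 * Real.pi)⁻¹ : ℝ) * ∫ u, ∫ y, K y * ch (-(y * ξ)) * ((φ u : ℂ) * ch (-(u * y))) := by
          rw [integral_const_mul, integral_integral_swap hintg]
      _ = ((2 * Real.pi)⁻¹ : ℝ) * ∫ u, (φ u : ℂ) * (φ (u + ξ) : ℂ) := by
          congr 2; ext u
          rw [← hKf (u + ξ), ← integral_const_mul]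
          congr 1; ext y
          rw [show -(y * (u + ξ)) = -(y * ξ) + -(u * y) by ring, ch_add]
          ring
      _ = 0 := by
          have : ∀ u, (φ u : ℂ) * (φ (u + ξ) : ℂ) = 0 := by
            intro u
            by_cases hu : 2 ≤ |u|
            · rw [hφ2 u hu]; simp
            · rw [hφ2 (u + ξ)]
              · simp
              · have := abs_sub_abs_le_abs_sub ξ (-u)
                rw [abs_neg, sub_neg_eq_add, add_comm ξ u] at this
                linarith
          simp [this]

/-- A nonnegative band-limited function on `ι → ℝ`. -/
lemma exists_eta : ∃ η : (ι → ℝ) → ℝ, Continuous η ∧ (∀ x, 0 ≤ η x) ∧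
    (∀ L : ℕ, ∃ C : ℝ, 0 < C ∧ ∀ y, η y ≤ C * ((1 + ‖y‖) ^ L)⁻¹) ∧ 0 < η 0 ∧
    (∀ ξ : ι → ℝ, 4 ≤ ‖ξ‖ → ∫ y, (η y : ℂ) * ch (-(y ⬝ᵥ ξ)) = 0) := by
  obtain ⟨K, hKc, hK0, hKd, hKp, hKf⟩ := exists_eta_one
  refine ⟨fun y => ∏ i, K (y i), by fun_prop, fun x => Finset.prod_nonneg fun i _ => hK0 _,
    fun L => ?_, Finset.prod_pos fun i _ => hKp, fun ξ hξ => ?_⟩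
  · obtain ⟨C, hC, h⟩ := hKd L
    refine ⟨C ^ Fintype.card ι, by positivity, fun y => ?_⟩
    calc _ ≤ ∏ i, (C * ((1 + |y i|) ^ L)⁻¹) :=
          Finset.prod_le_prod (fun _ _ => hK0 _) fun i _ => h (y i)
      _ = C ^ Fintype.card ι * ((∏ i, (1 + |y i|)) ^ L)⁻¹ := by
          rw [Finset.prod_mul_distrib, Finset.prod_const, Finset.card_univ, Finset.prod_inv_distrib,
            Finset.prod_pow]
      _ ≤ _ := by
          gcongr
          exact one_add_norm_le_prod y
  · have h : ∫ y : ι → ℝ, ((∏ i, K (y i) : ℝ) : ℂ) * ch (-(y ⬝ᵥ ξ)) =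
        ∏ i, ∫ y, (K y : ℂ) * ch (-(y * ξ i)) := by
      rw [← integral_fintype_prod_volume_eq_prod (f := fun i y => (K y : ℂ) * ch (-(y * ξ i)))]
      congr 1; ext y
      rw [Finset.prod_mul_distrib, dotProduct, ← Finset.sum_neg_distrib, ch_sum]
      simp
    rw [h]
    obtain ⟨i, hi⟩ : ∃ i, 4 ≤ |ξ i| := by
      by_contra hcon
      push Not at hcon
      exact absurd ((pi_norm_lt_iff (by norm_num)).2 hcon) (not_lt.2 hξ)
    exact Finset.prod_eq_zero (Finset.mem_univ i) (hKf _ hi)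

end

section

variable {ι : Type*} [Fintype ι]

/-- The polynomially decaying weight at scale `r`. -/
def wt (L : ℕ) (r : ℝ) (y : ι → ℝ) : ℝ≥0∞ := ENNReal.ofReal (((1 + ‖y‖ / r) ^ L)⁻¹)

/-- The normalized weight at scale `r`. -/
def om (L : ℕ) (r : ℝ) (y : ι → ℝ) : ℝ≥0∞ :=
  ENNReal.ofReal ((r ^ Fintype.card ι)⁻¹) * wt L r y

/-- Slowly varying functions at scale `R`. -/
structure SV (N : ℕ) (R : ℝ) (g : (ι → ℝ) → ℝ≥0∞) : Prop where
  meas : Measurable g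
  le : ∀ z z', g z ≤ ENNReal.ofReal ((1 + ‖z - z'‖ / R) ^ N) * g z'

/-- The average over the cube of radius `r`. -/
def av (r : ℝ) (f : (ι → ℝ) → ℝ≥0∞) (c : ι → ℝ) : ℝ≥0∞ :=
  (ENNReal.ofReal ((2 * r) ^ Fintype.card ι))⁻¹ * ∫⁻ z in closedBall c r, f z

variable {L N : ℕ} {r R : ℝ}

@[fun_prop] lemma measurable_wt : Measurable (wt L r : (ι → ℝ) → ℝ≥0∞) := by
  unfold wt; fun_prop

@[fun_prop] lemma measurable_om : Measurable (om L r : (ι → ℝ) → ℝ≥0∞) := by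
  unfold om; fun_prop

lemma wt_neg (y : ι → ℝ) : wt L r (-y) = wt L r y := by simp [wt]

lemma om_neg (y : ι → ℝ) : om L r (-y) = om L r y := by simp [om, wt_neg]

lemma om_sub_comm (x y : ι → ℝ) : om L r (x - y) = om L r (y - x) := by
  rw [← om_neg, neg_sub]

lemma wt_ne_top (y : ι → ℝ) : wt L r y ≠ ∞ := ENNReal.ofReal_ne_top

lemma wt_mul_pow {L' : ℕ} (hr : 0 < r) (y : ι → ℝ) :
    ENNReal.ofReal ((1 + ‖y‖ / r) ^ L') * wt (L + L') r y = wt L r y := by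
  unfold wt
  rw [← ENNReal.ofReal_mul (by positivity)]
  congr 1
  rw [pow_add]
  have : 0 < 1 + ‖y‖ / r := by positivity
  field_simp

lemma om_mul_pow {L' : ℕ} (hr : 0 < r) (y : ι → ℝ) :
    ENNReal.ofReal ((1 + ‖y‖ / r) ^ L') * om (L + L') r y = om L r y := by
  unfold om
  rw [mul_left_comm, wt_mul_pow hr]

lemma lintegral_comp_smul (f : (ι → ℝ) → ℝ≥0∞) (hf : Measurable f) {r : ℝ} (hr : 0 < r) :
    ∫⁻ y, f (r • y) = ENNReal.ofReal ((r ^ Fintype.card ι)⁻¹) * ∫⁻ y, f y := by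
  have h := Measure.map_addHaar_smul (volume : Measure (ι → ℝ)) hr.ne'
  rw [Module.finrank_fintype_fun_eq_card, abs_of_pos (by positivity)] at h
  have h2 : Measurable (fun y : ι → ℝ => r • y) := by fun_prop
  have h3 : ∫⁻ y, f (r • y) = ∫⁻ y, f y ∂(Measure.map (r • ·) volume) :=
    (lintegral_map hf h2).symm
  rw [h3, h, lintegral_smul_measure, smul_eq_mul]

lemma wt_smul (hr : 0 < r) (y : ι → ℝ) : wt L r (r • y) = wt L 1 y := by
  unfold wt
  rw [norm_smul, Real.norm_of_nonneg hr.le, mul_div_cancel_left₀ _ hr.ne', div_one]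

lemma lintegral_om (hr : 0 < r) : ∫⁻ y : ι → ℝ, om L r y = ∫⁻ y : ι → ℝ, wt L 1 y := by
  have h := lintegral_comp_smul (wt L r) (measurable_wt (ι := ι)) hr
  simp only [wt_smul hr] at h
  unfold om
  rw [lintegral_const_mul _ measurable_wt, h]

lemma lintegral_wt_one_lt_top (hL : Fintype.card ι < L) : ∫⁻ y : ι → ℝ, wt L 1 y < ∞ := by
  have := (integrable_decay (ι := ι) hL).lintegral_lt_top
  simpa [wt] using this

lemma SV.mono (hr : 0 < r) (h : r ≤ R) {g : (ι → ℝ) → ℝ≥0∞} (hg : SV N R g) : SV N r g := by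
  refine ⟨hg.meas, fun z z' => (hg.le z z').trans ?_⟩
  gcongr
  have := hr.trans_le h
  positivity

lemma SV.le_of_mem (hR : 0 < R) {g : (ι → ℝ) → ℝ≥0∞} (hg : SV N R g) {z z' : ι → ℝ}
    (h : ‖z - z'‖ ≤ R) : g z ≤ 2 ^ N * g z' := by
  refine (hg.le z z').trans ?_
  gcongr
  rw [show (2 : ℝ≥0∞) ^ N = ENNReal.ofReal (2 ^ N) by
    rw [ENNReal.ofReal_pow (by norm_num)]; norm_num]
  apply ENNReal.ofReal_le_ofReal
  have : ‖z - z'‖ / R ≤ 1 := (div_le_one hR).2 h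
  gcongr
  linarith

lemma one_add_le_mul {x y z : ι → ℝ} (hr : 0 < r) :
    1 + ‖x - z‖ / r ≤ (1 + ‖x - y‖ / r) * (1 + ‖y - z‖ / r) := by
  have h : ‖x - z‖ ≤ ‖x - y‖ + ‖y - z‖ := norm_sub_le_norm_sub_add_norm_sub x y z
  have h1 : ‖x - z‖ / r ≤ ‖x - y‖ / r + ‖y - z‖ / r := by rw [← add_div]; gcongr
  have h2 : 0 ≤ ‖x - y‖ / r * (‖y - z‖ / r) := by positivity
  nlinarith

lemma sv_wt (hr : 0 < r) : SV L r (wt L r : (ι → ℝ) → ℝ≥0∞) := by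
  refine ⟨measurable_wt, fun z z' => ?_⟩
  unfold wt
  rw [← ENNReal.ofReal_mul (by positivity)]
  apply ENNReal.ofReal_le_ofReal
  rw [← inv_inv ((1 + ‖z - z'‖ / r) ^ L), ← mul_inv]
  have h : 1 + ‖z'‖ / r ≤ (1 + ‖z - z'‖ / r) * (1 + ‖z‖ / r) := by
    have := one_add_le_mul (x := z') (y := z) (z := 0) hr
    rwa [sub_zero, sub_zero, norm_sub_rev] at this
  apply inv_anti₀ (by positivity)
  rw [inv_mul_le_iff₀ (by positivity), ← mul_pow]
  gcongr

lemma SV.const_mul {g : (ι → ℝ) → ℝ≥0∞} (hg : SV N R g) (c : ℝ≥0∞) :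
    SV N R (fun z => c * g z) :=
  ⟨hg.meas.const_mul c, fun z z' => by
    have := hg.le z z'
    calc c * g z ≤ c * (ENNReal.ofReal ((1 + ‖z - z'‖ / R) ^ N) * g z') := by gcongr
      _ = _ := by ring⟩

lemma SV.translate {g : (ι → ℝ) → ℝ≥0∞} (hg : SV N R g) (c : ι → ℝ) :
    SV N R (fun z => g (z - c)) :=
  ⟨hg.meas.comp (measurable_id.sub_const c), fun z z' => by
    simpa using hg.le (z - c) (z' - c)⟩

lemma sv_om (hr : 0 < r) : SV L r (om L r : (ι → ℝ) → ℝ≥0∞) := (sv_wt hr).const_mul _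

lemma SV.mul {N' : ℕ} {g h : (ι → ℝ) → ℝ≥0∞} (hR : 0 < R) (hg : SV N R g) (hh : SV N' R h) :
    SV (N + N') R (fun z => g z * h z) := by
  refine ⟨hg.meas.mul hh.meas, fun z z' => (mul_le_mul' (hg.le z z') (hh.le z z')).trans_eq ?_⟩
  rw [pow_add, ENNReal.ofReal_mul (by positivity)]
  ring

lemma SV.mono_exp {N' : ℕ} {g : (ι → ℝ) → ℝ≥0∞} (hR : 0 < R) (hg : SV N R g) (h : N ≤ N') :
    SV N' R g := by
  refine ⟨hg.meas, fun z z' => (hg.le z z').trans ?_⟩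
  have : 0 ≤ ‖z - z'‖ / R := by positivity
  gcongr
  linarith

lemma SV.rpow {g : (ι → ℝ) → ℝ≥0∞} (hR : 0 < R) (hg : SV N R g) {p : ℝ} (hp : 0 ≤ p) (hp1 : p ≤ 1) :
    SV N R (fun z => g z ^ p) := by
  refine ⟨hg.meas.pow_const p, fun z z' => (ENNReal.rpow_le_rpow (hg.le z z') hp).trans ?_⟩
  rw [ENNReal.mul_rpow_of_nonneg _ _ hp]
  gcongr
  have h1 : (1 : ℝ≥0∞) ≤ ENNReal.ofReal ((1 + ‖z - z'‖ / R) ^ N) := by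
    rw [← ENNReal.ofReal_one]
    apply ENNReal.ofReal_le_ofReal
    have : 0 ≤ ‖z - z'‖ / R := by positivity
    exact one_le_pow₀ (by linarith)
  calc _ ≤ (ENNReal.ofReal ((1 + ‖z - z'‖ / R) ^ N)) ^ (1 : ℝ) :=
        ENNReal.rpow_le_rpow_of_exponent_le h1 hp1
    _ = _ := ENNReal.rpow_one _

lemma measurable_conv {f k : (ι → ℝ) → ℝ≥0∞} (hf : Measurable f) (hk : Measurable k) :
    Measurable fun z => ∫⁻ y, f y * k (z - y) := by
  have : Measurable (fun p : (ι → ℝ) × (ι → ℝ) => f p.2 * k (p.1 - p.2)) := by fun_prop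
  exact this.lintegral_prod_right'

lemma SV.conv {f k : (ι → ℝ) → ℝ≥0∞} (hf : Measurable f) (hk : SV N r k) :
    SV N r (fun z => ∫⁻ y, f y * k (z - y)) := by
  refine ⟨measurable_conv hf hk.meas, fun z z' => ?_⟩
  have hk' := hk.meas
  rw [← lintegral_const_mul _ (by fun_prop)]
  refine lintegral_mono fun y => ?_
  have := hk.le (z - y) (z' - y)
  rw [sub_sub_sub_cancel_right] at this
  calc f y * k (z - y) ≤ f y * (ENNReal.ofReal ((1 + ‖z - z'‖ / r) ^ N) * k (z' - y)) := by gcongr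
    _ = _ := by ring

lemma lintegral_conv_mul {f k g : (ι → ℝ) → ℝ≥0∞} (hf : Measurable f) (hk : Measurable k)
    (hg : Measurable g) :
    ∫⁻ z, (∫⁻ y, f y * k (z - y)) * g z = ∫⁻ y, f y * ∫⁻ z, k (z - y) * g z := by
  have h1 : ∀ z, (∫⁻ y, f y * k (z - y)) * g z = ∫⁻ y, f y * k (z - y) * g z := fun z =>
    (lintegral_mul_const _ (by fun_prop)).symm
  simp only [h1]
  rw [lintegral_lintegral_swap]
  · congr 1; ext y
    rw [← lintegral_const_mul _ (by fun_prop)]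
    congr 1; ext z; ring
  · apply Measurable.aemeasurable
    simp only [Function.uncurry_def]
    fun_prop

/-- Slowly varying functions are reproduced, up to constants, by averages at a smaller scale. -/
lemma SV.lintegral_om_mul_le (hr : 0 < r) {g : (ι → ℝ) → ℝ≥0∞} (hg : SV N r g) (z : ι → ℝ) :
    ∫⁻ y, om (L + N) r (y - z) * g y ≤ (∫⁻ y : ι → ℝ, wt L 1 y) * g z := by
  calc ∫⁻ y, om (L + N) r (y - z) * g y
      ≤ ∫⁻ y, om L r (y - z) * g z := by
        refine lintegral_mono fun y => ?_
        calc om (L + N) r (y - z) * g y ≤ om (L + N) r (y - z) * (ENNReal.ofReal ((1 + ‖y - z‖ / r) ^ N) * g z) := by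
              gcongr; exact hg.le y z
          _ = ENNReal.ofReal ((1 + ‖y - z‖ / r) ^ N) * om (L + N) r (y - z) * g z := by ring
          _ = om L r (y - z) * g z := by rw [om_mul_pow hr]
    _ = _ := by
        rw [lintegral_mul_const _ (by fun_prop),
          lintegral_sub_right_eq_self (fun y => om L r y) z, lintegral_om hr]

lemma wt_mul_wt_le {r r' : ℝ} (hr : 0 < r) (h : r ≤ r') (x y : ι → ℝ) :
    wt L r (x - y) * wt L r' y ≤ 4 ^ L * wt L r' x *
      (ENNReal.ofReal ((r / r') ^ L) * wt L r' y + wt L r (x - y)) := by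
  have hr' := hr.trans_le h
  unfold wt
  set a := ‖x - y‖ with ha
  set b := ‖y‖ with hb
  have hx : ‖x‖ ≤ a + b := by
    calc ‖x‖ = ‖(x - y) + y‖ := by simp
      _ ≤ _ := norm_add_le _ _
  have ha0 : 0 ≤ a := norm_nonneg _
  have hb0 : 0 ≤ b := norm_nonneg _
  rw [show (4 : ℝ≥0∞) ^ L = ENNReal.ofReal (4 ^ L) by
    rw [ENNReal.ofReal_pow (by norm_num)]; norm_num]
  rw [← ENNReal.ofReal_mul (by positivity), ← ENNReal.ofReal_mul (by positivity),
    ← ENNReal.ofReal_mul (by positivity), ← ENNReal.ofReal_add (by positivity) (by positivity),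
    ← ENNReal.ofReal_mul (by positivity)]
  apply ENNReal.ofReal_le_ofReal
  simp only [← inv_pow, ← mul_pow]
  have hX : (1 + ‖x‖ / r') ≤ (1 + (a + b) / r') := by gcongr
  suffices H : ((1 + a / r)⁻¹ * (1 + b / r')⁻¹) ^ L ≤ (4 * (1 + (a + b) / r')⁻¹) ^ L *
      ((r / r' * (1 + b / r')⁻¹) ^ L + ((1 + a / r)⁻¹) ^ L) by
    refine H.trans ?_
    gcongr
  rcases le_or_gt a (r' + b) with hab | hab
  · -- then `1 + (a+b)/r' ≤ 2 (1 + b / r')`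
    calc ((1 + a / r)⁻¹ * (1 + b / r')⁻¹) ^ L
        ≤ ((4 * (1 + (a + b) / r')⁻¹) * (1 + a / r)⁻¹) ^ L := by
          have h4 : (1 + b / r')⁻¹ ≤ 4 * (1 + (a + b) / r')⁻¹ := by
            rw [← div_eq_mul_inv, ← one_div, div_le_div_iff₀ (by positivity) (by positivity)]
            have : (a + b) / r' ≤ (r' + b + b) / r' := by gcongr
            have h5 : (r' + b + b) / r' = 1 + 2 * (b / r') := by field_simp; ring
            have : 0 ≤ b / r' := by positivity
            linarith
          rw [mul_comm]
          gcongr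
      _ = (4 * (1 + (a + b) / r')⁻¹) ^ L * ((1 + a / r)⁻¹) ^ L := mul_pow _ _ _
      _ ≤ _ := by
          gcongr
          have : 0 ≤ (r / r' * (1 + b / r')⁻¹) ^ L := by positivity
          linarith
  · calc ((1 + a / r)⁻¹ * (1 + b / r')⁻¹) ^ L
        ≤ ((4 * (1 + (a + b) / r')⁻¹) * (r / r' * (1 + b / r')⁻¹)) ^ L := by
          have h4 : (1 + a / r)⁻¹ ≤ 4 * (1 + (a + b) / r')⁻¹ * (r / r') := by
            rw [← div_eq_mul_inv, ← one_div, div_mul_div_comm, div_le_div_iff₀ (by positivity) (by positivity)]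
            have e1 : (1 + (a + b) / r') * r' = r' + a + b := by field_simp; ring
            have e2 : (1 + a / r) * r = r + a := by field_simp
            nlinarith
          calc _ ≤ (4 * (1 + (a + b) / r')⁻¹ * (r / r') * (1 + b / r')⁻¹) ^ L := by gcongr
            _ = _ := by ring
      _ = (4 * (1 + (a + b) / r')⁻¹) ^ L * (r / r' * (1 + b / r')⁻¹) ^ L := mul_pow _ _ _
      _ ≤ _ := by
          gcongr
          have : 0 ≤ ((1 + a / r)⁻¹) ^ L := by positivity
          linarith

/-- Convolutions of weights. -/
lemma lintegral_om_mul_om_le {r r' : ℝ} (hr : 0 < r) (h : r ≤ r') (hL : Fintype.card ι ≤ L)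
    (x : ι → ℝ) :
    ∫⁻ y, om L r (x - y) * om L r' y ≤ 4 ^ L * (2 * ∫⁻ y : ι → ℝ, wt L 1 y) * om L r' x := by
  have hr' := hr.trans_le h
  set c := ∫⁻ y : ι → ℝ, wt L 1 y
  set d := Fintype.card ι
  have key : ∀ y, om L r (x - y) * om L r' y ≤ 4 ^ L * om L r' x * (om L r' y + om L r (x - y)) := by
    intro y
    have h1 := wt_mul_wt_le (L := L) hr h x y
    have h2 : ENNReal.ofReal ((r ^ d)⁻¹) * ENNReal.ofReal ((r / r') ^ L) ≤
        ENNReal.ofReal ((r' ^ d)⁻¹) := by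
      rw [← ENNReal.ofReal_mul (by positivity)]
      apply ENNReal.ofReal_le_ofReal
      have h3 : (r / r') ^ L ≤ (r / r') ^ d :=
        pow_le_pow_of_le_one (by positivity) ((div_le_one hr').2 h) hL
      calc (r ^ d)⁻¹ * (r / r') ^ L ≤ (r ^ d)⁻¹ * (r / r') ^ d := by gcongr
        _ = _ := by rw [div_pow]; field_simp
    unfold om
    calc _ = ENNReal.ofReal ((r ^ d)⁻¹) * ENNReal.ofReal ((r' ^ d)⁻¹) *
          (wt L r (x - y) * wt L r' y) := by ring
      _ ≤ ENNReal.ofReal ((r ^ d)⁻¹) * ENNReal.ofReal ((r' ^ d)⁻¹) * (4 ^ L * wt L r' x *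
      (ENNReal.ofReal ((r / r') ^ L) * wt L r' y + wt L r (x - y))) := by gcongr
      _ = 4 ^ L * (ENNReal.ofReal ((r' ^ d)⁻¹) * wt L r' x) *
        ((ENNReal.ofReal ((r ^ d)⁻¹) * ENNReal.ofReal ((r / r') ^ L)) * wt L r' y +
          ENNReal.ofReal ((r ^ d)⁻¹) * wt L r (x - y)) := by ring
      _ ≤ _ := by gcongr
  calc _ ≤ ∫⁻ y, 4 ^ L * om L r' x * (om L r' y + om L r (x - y)) := lintegral_mono key
    _ = 4 ^ L * om L r' x * (c + c) := by
      rw [lintegral_const_mul _ (by fun_prop), lintegral_add_left (by fun_prop),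
        lintegral_sub_left_eq_self (fun y => om L r y) x, lintegral_om hr, lintegral_om hr']
    _ = _ := by ring

lemma volume_cube (hr : 0 < r) (c : ι → ℝ) :
    volume (closedBall c r) = ENNReal.ofReal ((2 * r) ^ Fintype.card ι) :=
  Real.volume_pi_closedBall c hr.le

lemma measurable_av {f : (ι → ℝ) → ℝ≥0∞} (hf : Measurable f) : Measurable (av r f) := by
  unfold av
  apply Measurable.const_mul
  have : ∀ c : ι → ℝ, ∫⁻ z in closedBall c r, f z =
      ∫⁻ z, f z * (closedBall (0 : ι → ℝ) r).indicator 1 (c - z) := by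
    intro c
    rw [← lintegral_indicator measurableSet_closedBall]
    congr 1; ext z
    by_cases h : z ∈ closedBall c r
    · rw [indicator_of_mem h, indicator_of_mem]
      · simp
      · rw [mem_closedBall, dist_comm, dist_eq_norm] at h; simpa using h
    · rw [indicator_of_notMem h, indicator_of_notMem]
      · simp
      · rw [mem_closedBall, dist_comm, dist_eq_norm] at h; simpa using h
  simp only [this]
  exact measurable_conv hf (measurable_one.indicator measurableSet_closedBall)

lemma lintegral_av (hr : 0 < r) {f : (ι → ℝ) → ℝ≥0∞} (hf : Measurable f) :
    ∫⁻ c, av r f c = ∫⁻ z, f z := by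
  unfold av
  have h0 : ENNReal.ofReal ((2 * r) ^ Fintype.card ι) ≠ 0 := by
    simp only [ne_eq, ENNReal.ofReal_eq_zero, not_le]; positivity
  have h1 : ∀ c : ι → ℝ, ∫⁻ z in closedBall c r, f z =
      ∫⁻ z, f z * (closedBall c r).indicator 1 z := by
    intro c
    rw [← lintegral_indicator measurableSet_closedBall]
    congr 1; ext z
    by_cases h : z ∈ closedBall c r <;> simp [h]
  have hS : MeasurableSet {p : (ι → ℝ) × (ι → ℝ) | p.2 ∈ closedBall p.1 r} :=
    measurableSet_le (f := fun p : (ι → ℝ) × (ι → ℝ) => dist p.2 p.1) (by fun_prop) (by fun_prop)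
  have hm : Measurable (fun p : (ι → ℝ) × (ι → ℝ) =>
      f p.2 * (closedBall p.1 r).indicator (1 : (ι → ℝ) → ℝ≥0∞) p.2) := by
    refine (hf.comp measurable_snd).mul ?_
    have : (fun p : (ι → ℝ) × (ι → ℝ) => (closedBall p.1 r).indicator (1 : (ι → ℝ) → ℝ≥0∞) p.2) =
        {p : (ι → ℝ) × (ι → ℝ) | p.2 ∈ closedBall p.1 r}.indicator 1 := by
      ext p; simp [indicator]
    rw [this]
    exact measurable_one.indicator hS
  simp only [h1]
  rw [lintegral_const_mul _ hm.lintegral_prod_right', lintegral_lintegral_swap hm.aemeasurable]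
  have h2 : ∀ z : ι → ℝ, ∫⁻ c : ι → ℝ, f z * (closedBall c r).indicator 1 z =
      f z * ENNReal.ofReal ((2 * r) ^ Fintype.card ι) := by
    intro z
    have : ∀ c : ι → ℝ, f z * (closedBall c r).indicator 1 z =
        f z * (closedBall z r).indicator 1 c := by
      intro c
      simp [indicator, dist_comm]
    simp only [this]
    rw [lintegral_const_mul _ (measurable_one.indicator measurableSet_closedBall),
      lintegral_indicator_one measurableSet_closedBall, volume_cube hr]
  simp only [h2]
  rw [lintegral_mul_const _ hf, mul_comm, mul_assoc, ENNReal.mul_inv_cancel h0 ENNReal.ofReal_ne_top,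
    mul_one]

lemma av_mono {f g : (ι → ℝ) → ℝ≥0∞} {c : ι → ℝ} (h : ∀ z ∈ closedBall c r, f z ≤ g z) :
    av r f c ≤ av r g c := by
  unfold av
  gcongr 1
  exact setLIntegral_mono_ae' measurableSet_closedBall (Eventually.of_forall h)

lemma av_const (hr : 0 < r) (a : ℝ≥0∞) (c : ι → ℝ) : av r (fun _ => a) c = a := by
  unfold av
  have h0 : ENNReal.ofReal ((2 * r) ^ Fintype.card ι) ≠ 0 := by
    simp only [ne_eq, ENNReal.ofReal_eq_zero, not_le]; positivity
  rw [setLIntegral_const, volume_cube hr, mul_comm, mul_assoc,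
    ENNReal.mul_inv_cancel h0 ENNReal.ofReal_ne_top, mul_one]

lemma av_const_mul {f : (ι → ℝ) → ℝ≥0∞} (hf : Measurable f) (a : ℝ≥0∞) (c : ι → ℝ) :
    av r (fun z => a * f z) c = a * av r f c := by
  unfold av
  rw [lintegral_const_mul _ hf]; ring

lemma av_add {f g : (ι → ℝ) → ℝ≥0∞} (hf : Measurable f) (c : ι → ℝ) :
    av r (fun z => f z + g z) c = av r f c + av r g c := by
  unfold av
  rw [lintegral_add_left hf]; ring

/-- Averages over cubes are dominated by convolutions with the normalized weight. -/
lemma av_le_conv (hr : 0 < r) (f : (ι → ℝ) → ℝ≥0∞) (c : ι → ℝ) :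
    av r f c ≤ 2 ^ L * ∫⁻ y, f y * om L r (c - y) := by
  unfold av
  rw [← lintegral_const_mul' _ _ (by finiteness), ← lintegral_const_mul' _ _ (by simp)]
  refine le_trans ?_ (setLIntegral_le_lintegral (closedBall c r) _)
  refine setLIntegral_mono_ae' measurableSet_closedBall (Eventually.of_forall fun z hz => ?_)
  rw [mul_comm, mul_left_comm]
  gcongr
  have h2 : (2 : ℝ≥0∞) ^ L = ENNReal.ofReal (2 ^ L) := by
    rw [ENNReal.ofReal_pow (by norm_num)]; norm_num
  unfold om wt
  rw [h2, ← ENNReal.ofReal_inv_of_pos (by positivity), ← ENNReal.ofReal_mul (by positivity),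
    ← ENNReal.ofReal_mul (by positivity)]
  apply ENNReal.ofReal_le_ofReal
  have h3 : ‖c - z‖ / r ≤ 1 := by
    rw [mem_closedBall, dist_comm, dist_eq_norm] at hz
    exact (div_le_one hr).2 hz
  have h4 : ((2:ℝ) ^ L)⁻¹ ≤ ((1 + ‖c - z‖ / r) ^ L)⁻¹ := by
    gcongr
    linarith
  calc ((2 * r) ^ Fintype.card ι)⁻¹ ≤ (r ^ Fintype.card ι)⁻¹ := by
        gcongr; linarith
    _ = 2 ^ L * ((r ^ Fintype.card ι)⁻¹ * (2 ^ L)⁻¹) := by field_simp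
    _ ≤ _ := by gcongr

end

section

variable {ι : Type} [Fintype ι] {J : Type} [Fintype J]

/-- Finite exponential sums. -/
def es (ξ : J → ι → ℝ) (a : J → ℂ) (z : ι → ℝ) : ℂ := ∑ j, a j * ch (ξ j ⬝ᵥ z)

/-- The local energy of an exponential sum at scale `r`. -/
def En (L : ℕ) (r : ℝ) (ξ : J → ι → ℝ) (a : J → ℂ) (c : ι → ℝ) : ℝ≥0∞ :=
  ∫⁻ y, ‖es ξ a y‖ₑ ^ 2 * om L r (c - y)

@[fun_prop] lemma continuous_es (ξ : J → ι → ℝ) (a : J → ℂ) : Continuous (es ξ a) := by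
  unfold es
  refine continuous_finsetSum _ fun j _ => continuous_const.mul (continuous_ch.comp ?_)
  unfold dotProduct
  fun_prop

@[fun_prop] lemma measurable_es (ξ : J → ι → ℝ) (a : J → ℂ) : Measurable (es ξ a) :=
  (continuous_es ξ a).measurable

@[fun_prop] lemma continuous_dot (x : ι → ℝ) : Continuous fun y : ι → ℝ => y ⬝ᵥ x := by
  unfold dotProduct; fun_prop

lemma measurable_es_sq (ξ : J → ι → ℝ) (a : J → ℂ) :
    Measurable fun z => ‖es ξ a z‖ₑ ^ 2 :=
  ((continuous_es ξ a).measurable.enorm).pow_const 2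

lemma es_sum {κ : Type*} (s : Finset κ) (ξ : J → ι → ℝ) (a : κ → J → ℂ) (z : ι → ℝ) :
    es ξ (∑ m ∈ s, a m) z = ∑ m ∈ s, es ξ (a m) z := by
  simp only [es, Finset.sum_apply, Finset.sum_mul]
  exact Finset.sum_comm

lemma es_add (ξ : J → ι → ℝ) (a b : J → ℂ) (z : ι → ℝ) :
    es ξ (a + b) z = es ξ a z + es ξ b z := by
  simp only [es, Pi.add_apply, add_mul, Finset.sum_add_distrib]

lemma es_zero (ξ : J → ι → ℝ) (z : ι → ℝ) : es ξ (0 : J → ℂ) z = 0 := by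
  simp [es]

lemma norm_es_le (ξ : J → ι → ℝ) (a : J → ℂ) (z : ι → ℝ) : ‖es ξ a z‖ ≤ ∑ j, ‖a j‖ := by
  refine (norm_sum_le _ _).trans (Finset.sum_le_sum fun j _ => ?_)
  simp

lemma measurable_En {L : ℕ} {r : ℝ} (ξ : J → ι → ℝ) (a : J → ℂ) : Measurable (En L r ξ a) :=
  measurable_conv (measurable_es_sq ξ a) measurable_om

lemma sv_En {L : ℕ} {r : ℝ} (hr : 0 < r) (ξ : J → ι → ℝ) (a : J → ℂ) : SV L r (En L r ξ a) :=
  SV.conv (measurable_es_sq ξ a) (sv_om hr)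

lemma sq_lintegral_mul_le {α : Type*} [MeasurableSpace α] {μ : Measure α} {w f : α → ℝ≥0∞}
    (hw : Measurable w) (hf : Measurable f) :
    (∫⁻ x, w x * f x ∂μ) ^ 2 ≤ (∫⁻ x, w x ∂μ) * ∫⁻ x, w x * f x ^ 2 ∂μ := by
  have h := ENNReal.lintegral_mul_le_Lp_mul_Lq (μ.withDensity w) Real.HolderConjugate.two_two
    (f := f) (g := 1) hf.aemeasurable aemeasurable_const
  have h2 := ENNReal.rpow_le_rpow h (z := 2) (by norm_num)
  rw [ENNReal.mul_rpow_of_nonneg _ _ (by norm_num), ← ENNReal.rpow_mul, ← ENNReal.rpow_mul] at h2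
  norm_num at h2
  rw [lintegral_withDensity_eq_lintegral_mul _ hw hf,
    lintegral_withDensity_eq_lintegral_mul _ hw (hf.pow_const 2)] at h2
  rw [mul_comm (∫⁻ x, w x ∂μ)]
  simpa using h2

lemma sq_sum_le {κ : Type*} (s : Finset κ) (f : κ → ℝ≥0∞) :
    (∑ i ∈ s, f i) ^ 2 ≤ (s.card : ℝ≥0∞) * ∑ i ∈ s, f i ^ 2 := by
  have := ENNReal.inner_le_Lp_mul_Lq s f (fun _ => 1) Real.HolderConjugate.two_two
  have h2 := ENNReal.rpow_le_rpow this (z := 2) (by norm_num)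
  rw [ENNReal.mul_rpow_of_nonneg _ _ (by norm_num), ← ENNReal.rpow_mul, ← ENNReal.rpow_mul] at h2
  norm_num at h2
  rw [mul_comm]
  exact h2

lemma sq_enorm_es_sum_le {κ : Type*} (s : Finset κ) (ξ : J → ι → ℝ) (a : κ → J → ℂ) (z : ι → ℝ) :
    ‖es ξ (∑ m ∈ s, a m) z‖ₑ ^ 2 ≤ (s.card : ℝ≥0∞) * ∑ m ∈ s, ‖es ξ (a m) z‖ₑ ^ 2 := by
  rw [es_sum]
  refine le_trans ?_ (sq_sum_le s _)
  gcongr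
  exact enorm_sum_le _ _

lemma En_sum_le {L : ℕ} {r : ℝ} {κ : Type*} (s : Finset κ) (ξ : J → ι → ℝ) (a : κ → J → ℂ)
    (c : ι → ℝ) : En L r ξ (∑ m ∈ s, a m) c ≤ (s.card : ℝ≥0∞) * ∑ m ∈ s, En L r ξ (a m) c := by
  unfold En
  rw [← lintegral_finsetSum _ (fun i _ => by fun_prop), ← lintegral_const_mul' _ _ (by simp)]
  refine lintegral_mono fun y => ?_
  simp only
  rw [← Finset.sum_mul, ← mul_assoc]
  gcongr
  exact sq_enorm_es_sum_le s ξ a y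

lemma sq_enorm_add_le (x y : ℂ) : ‖x + y‖ₑ ^ 2 ≤ 2 * (‖x‖ₑ ^ 2 + ‖y‖ₑ ^ 2) := by
  have := sq_sum_le (Finset.univ : Finset (Fin 2)) ![‖x‖ₑ, ‖y‖ₑ]
  simp only [Fin.sum_univ_two] at this
  refine le_trans (by gcongr; exact enorm_add_le x y) (this.trans_eq ?_)
  simp

lemma En_add_le {L : ℕ} {r : ℝ} (ξ : J → ι → ℝ) (a b : J → ℂ) (c : ι → ℝ) :
    En L r ξ (a + b) c ≤ 2 * (En L r ξ a c + En L r ξ b c) := by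
  unfold En
  rw [← lintegral_add_left (by fun_prop), ← lintegral_const_mul' _ _ (by simp)]
  refine lintegral_mono fun y => ?_
  simp only
  rw [es_add, ← add_mul, ← mul_assoc]
  gcongr
  exact sq_enorm_add_le _ _

/-- Multipliers act by averaging translates. -/
lemma es_multiplier {K : (ι → ℝ) → ℂ} (hK : Integrable K) {X : (ι → ℝ) → ℂ}
    (hX : ∀ ξ, ∫ y, K y * ch (-(y ⬝ᵥ ξ)) = X ξ) (r : ℝ) (m : ι → ℝ) (ξ : J → ι → ℝ) (a : J → ℂ)
    (z : ι → ℝ) :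
    es ξ (fun j => X (r • ξ j - m) * a j) z = ∫ y, K y * (ch (y ⬝ᵥ m) * es ξ a (z - r • y)) := by
  have hi : ∀ ζ : ι → ℝ, Integrable (fun y => K y * ch (-(y ⬝ᵥ ζ))) := fun ζ => by
    refine hK.mul_bdd (c := 1) (Continuous.aestronglyMeasurable (by fun_prop)) ?_
    exact Eventually.of_forall fun y => by simp
  have h1 : ∀ y, K y * (ch (y ⬝ᵥ m) * es ξ a (z - r • y)) =
      ∑ j, a j * ch (ξ j ⬝ᵥ z) * (K y * ch (-(y ⬝ᵥ (r • ξ j - m)))) := by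
    intro y
    unfold es
    rw [Finset.mul_sum, Finset.mul_sum]
    refine Finset.sum_congr rfl fun j _ => ?_
    have : ch (y ⬝ᵥ m) * ch (ξ j ⬝ᵥ (z - r • y)) =
        ch (ξ j ⬝ᵥ z) * ch (-(y ⬝ᵥ (r • ξ j - m))) := by
      rw [← ch_add, ← ch_add]
      congr 1
      simp only [dotProduct_comm y, dotProduct_sub, dotProduct_smul, sub_dotProduct, smul_dotProduct,
        smul_eq_mul]
      ring
    linear_combination K y * a j * this
  simp only [h1]
  rw [integral_finsetSum _ fun j _ => (hi _).const_mul _]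
  unfold es
  refine Finset.sum_congr rfl fun j _ => ?_
  rw [integral_const_mul, hX]
  ring

lemma decay_enorm {K : (ι → ℝ) → ℂ} {C : ℝ} {L : ℕ} (hC : ∀ y, ‖K y‖ ≤ C * ((1 + ‖y‖) ^ L)⁻¹)
    (y : ι → ℝ) : ‖K y‖ₑ ≤ (C.toNNReal : ℝ≥0∞) * wt L 1 y := by
  rw [← ofReal_norm, wt, div_one]
  refine (ENNReal.ofReal_le_ofReal (hC y)).trans_eq ?_
  have : 0 ≤ C := by
    have := (norm_nonneg _).trans (hC 0)
    simpa using this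
  rw [ENNReal.ofReal_mul this]
  rfl

lemma integrable_of_decay {K : (ι → ℝ) → ℂ} (hK : Continuous K) {C : ℝ} {L : ℕ}
    (hL : Fintype.card ι < L) (hC : ∀ y, ‖K y‖ ≤ C * ((1 + ‖y‖) ^ L)⁻¹) : Integrable K :=
  ((integrable_decay hL).const_mul C).mono' hK.aestronglyMeasurable (Eventually.of_forall hC)

lemma En_eq_lintegral_wt {L : ℕ} {r : ℝ} (hr : 0 < r) (ξ : J → ι → ℝ) (a : J → ℂ) (z : ι → ℝ) :
    ∫⁻ y, wt L 1 y * ‖es ξ a (z - r • y)‖ₑ ^ 2 = En L r ξ a z := by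
  have h1 := lintegral_comp_smul (fun y => wt L r y * ‖es ξ a (z - y)‖ₑ ^ 2) (by fun_prop) hr
  simp only [wt_smul hr] at h1
  have h2 : En L r ξ a z = ∫⁻ y, ‖es ξ a (z - y)‖ₑ ^ 2 * om L r (z - (z - y)) :=
    (lintegral_sub_left_eq_self (μ := (volume : Measure (ι → ℝ)))
      (fun y : ι → ℝ => ‖es ξ a y‖ₑ ^ 2 * om L r (z - y)) z).symm
  rw [h1, h2, ← lintegral_const_mul _ (by fun_prop)]
  refine lintegral_congr fun y => ?_
  simp only [sub_sub_cancel, om]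
  ring

/-- Smooth frequency cut-offs are controlled by the local energy. -/
lemma exists_multiplier_bound {L : ℕ} (hL : Fintype.card ι < L) {χ : ℝ → ℝ}
    (h1 : ContDiff ℝ (⊤ : ℕ∞) χ) (h2 : HasCompactSupport χ) :
    ∃ C : ℝ≥0, ∀ (J : Type) [Fintype J] (ξ : J → ι → ℝ) (a : J → ℂ) (r : ℝ) (_ : 0 < r)
      (m z : ι → ℝ), ‖es ξ (fun j => (∏ i, (χ ((r • ξ j - m) i) : ℂ)) * a j) z‖ₑ ^ 2 ≤
        C * En L r ξ a z := by
  obtain ⟨K, hKc, hKd, hKf⟩ := exists_kernel (ι := ι) χ h1 h2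
  obtain ⟨C, hC, hd⟩ := hKd L
  have hw := lintegral_wt_one_lt_top (ι := ι) hL
  refine ⟨C.toNNReal ^ 2 * (∫⁻ y : ι → ℝ, wt L 1 y).toNNReal, fun J _ ξ a r hr m z => ?_⟩
  rw [es_multiplier (integrable_of_decay hKc hL hd) hKf]
  calc _ ≤ (∫⁻ y, C.toNNReal * (wt L 1 y * ‖es ξ a (z - r • y)‖ₑ)) ^ 2 := by
        gcongr
        refine (enorm_integral_le_lintegral_enorm _).trans (lintegral_mono fun y => ?_)
        simp only [enorm_mul, enorm_ch, one_mul]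
        rw [← mul_assoc]
        gcongr
        exact decay_enorm hd y
    _ ≤ C.toNNReal ^ 2 * ((∫⁻ y : ι → ℝ, wt L 1 y) *
        ∫⁻ y, wt L 1 y * ‖es ξ a (z - r • y)‖ₑ ^ 2) := by
        rw [lintegral_const_mul' _ _ (by simp), mul_pow]
        gcongr
        exact sq_lintegral_mul_le (by fun_prop) (by fun_prop)
    _ = _ := by
        rw [En_eq_lintegral_wt hr, ENNReal.coe_mul, ENNReal.coe_toNNReal hw.ne, ENNReal.coe_pow]
        ring

/-- The locally constant property. -/
lemma exists_locally_constant {L : ℕ} (hL : Fintype.card ι < L) :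
    ∃ C : ℝ≥0, ∀ (J : Type) [Fintype J] (ξ : J → ι → ℝ) (a : J → ℂ) (r : ℝ) (_ : 0 < r)
      (m : ι → ℝ) (_ : ∀ j, a j ≠ 0 → ‖r • ξ j - m‖ ≤ 1) (z : ι → ℝ),
      ‖es ξ a z‖ₑ ^ 2 ≤ C * En L r ξ a z := by
  obtain ⟨φ, hφ, hφc, hφ1, -, -⟩ := exists_phi1
  obtain ⟨C, hC⟩ := exists_multiplier_bound hL hφ hφc
  refine ⟨C, fun J _ ξ a r hr m ha z => ?_⟩
  have : (fun j => (∏ i, (φ ((r • ξ j - m) i) : ℂ)) * a j) = a := by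
    ext j
    by_cases hj : a j = 0
    · simp [hj]
    · rw [Finset.prod_eq_one, one_mul]
      intro i _
      rw [hφ1 _ ((norm_le_pi_norm (r • ξ j - m) i).trans (ha j hj))]
      simp
  simpa only [this] using hC J ξ a r hr m z

end

section

variable {ι : Type} [Fintype ι] {J : Type} [Fintype J]

/-- A band-limited weight comparable to the polynomial weight. -/
lemma exists_band_weight_one {L : ℕ} (hL : Fintype.card ι < L) :
    ∃ Om : (ι → ℝ) → ℝ, Continuous Om ∧ (∀ x, 0 ≤ Om x) ∧
      (∃ C : ℝ≥0, ∀ x, wt L 1 x ≤ C * ENNReal.ofReal (Om x) ∧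
        ENNReal.ofReal (Om x) ≤ C * wt L 1 x) ∧
      ∀ ξ : ι → ℝ, 4 ≤ ‖ξ‖ → ∫ y, (Om y : ℂ) * ch (-(y ⬝ᵥ ξ)) = 0 := by
  obtain ⟨η, hηc, hη0, hηd, hηp, hηf⟩ := exists_eta (ι := ι)
  obtain ⟨C, hC, hd⟩ := hηd L
  have hηi : Integrable η := ((integrable_decay hL).const_mul C).mono' hηc.aestronglyMeasurable
    (Eventually.of_forall fun y => by rw [Real.norm_of_nonneg (hη0 y)]; exact hd y)
  set w : (ι → ℝ) → ℝ := fun x => ((1 + ‖x‖) ^ L)⁻¹ with hw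
  have hwc : Continuous w := by
    refine Continuous.inv₀ (by fun_prop) fun x => by positivity
  have hw0 : ∀ x, 0 ≤ w x := fun x => by positivity
  have hw1 : ∀ x, w x ≤ 1 := fun x =>
    inv_le_one_of_one_le₀ (one_le_pow₀ (by linarith [norm_nonneg x]))
  have hww : ∀ x, ENNReal.ofReal (w x) = wt L 1 x := fun x => by simp [w, wt]
  have hwi : Integrable w := integrable_decay hL
  have hintg : ∀ x, Integrable fun y => η y * w (x - y) := fun x =>
    hηi.mul_bdd (c := 1) (Continuous.aestronglyMeasurable (by fun_prop))
      (Eventually.of_forall fun y => by rw [Real.norm_of_nonneg (hw0 _)]; exact hw1 _)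
  refine ⟨fun x => ∫ y, η y * w (x - y), ?_, fun x => integral_nonneg fun y => mul_nonneg (hη0 _) (hw0 _),
    ?_, ?_⟩
  · refine continuous_of_dominated (bound := η)
      (fun x => (hintg x).aestronglyMeasurable)
      (fun x => Eventually.of_forall fun y => ?_) hηi (Eventually.of_forall fun y => by fun_prop)
    rw [norm_mul, Real.norm_of_nonneg (hη0 _), Real.norm_of_nonneg (hw0 _)]
    exact mul_le_of_le_one_right (hη0 _) (hw1 _)
  · have hlin : ∀ x, ENNReal.ofReal (∫ y, η y * w (x - y)) =
        ∫⁻ y, ENNReal.ofReal (η y) * wt L 1 (x - y) := fun x => by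
      rw [ofReal_integral_eq_lintegral_ofReal (hintg x)
        (Eventually.of_forall fun y => mul_nonneg (hη0 _) (hw0 _))]
      refine lintegral_congr fun y => ?_
      rw [ENNReal.ofReal_mul (hη0 _), hww]
    obtain ⟨δ, hδ, hδη⟩ : ∃ δ > 0, ∀ y ∈ closedBall (0 : ι → ℝ) δ, η 0 / 2 ≤ η y := by
      have h1 : ∀ᶠ y in 𝓝 (0 : ι → ℝ), η 0 / 2 < η y :=
        hηc.continuousAt.eventually (lt_mem_nhds (by linarith))
      obtain ⟨δ, hδ, h⟩ := Metric.nhds_basis_closedBall.eventually_iff.1 h1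
      exact ⟨δ, hδ, fun y hy => (h hy).le⟩
    set δ' := min δ 1
    have hδ' : 0 < δ' := lt_min hδ one_pos
    have hI := lintegral_wt_one_lt_top (ι := ι) hL
    set c1 : ℝ≥0∞ := ENNReal.ofReal (η 0 / 2) * volume (closedBall (0 : ι → ℝ) δ') with hc1
    have hc1t : c1 ≠ ∞ := ENNReal.mul_ne_top ENNReal.ofReal_ne_top measure_closedBall_lt_top.ne
    have hc10 : c1 ≠ 0 := by
      refine mul_ne_zero ?_ (measure_closedBall_pos _ _ hδ').ne'
      simp only [ne_eq, ENNReal.ofReal_eq_zero, not_le]; linarith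
    have lower : ∀ x, c1 * wt L 1 x ≤ 2 ^ L * ENNReal.ofReal (∫ y, η y * w (x - y)) := by
      intro x
      rw [hlin, ← lintegral_const_mul' _ _ (by simp)]
      calc c1 * wt L 1 x = ∫⁻ y in closedBall (0 : ι → ℝ) δ', ENNReal.ofReal (η 0 / 2) * wt L 1 x := by
            rw [setLIntegral_const, hc1]; ring
        _ ≤ ∫⁻ y in closedBall (0 : ι → ℝ) δ', 2 ^ L * (ENNReal.ofReal (η y) * wt L 1 (x - y)) := by
            refine setLIntegral_mono_ae' measurableSet_closedBall (Eventually.of_forall fun y hy => ?_)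
            have h1 := (sv_wt (ι := ι) (L := L) one_pos).le_of_mem one_pos (z := x) (z' := x - y) (by
              rw [sub_sub_cancel]
              rw [mem_closedBall_zero_iff] at hy
              exact hy.trans (min_le_right _ _))
            have h2 := hδη y (closedBall_subset_closedBall (min_le_left _ _) hy)
            calc _ ≤ ENNReal.ofReal (η y) * (2 ^ L * wt L 1 (x - y)) := by gcongr
              _ = _ := by ring
        _ ≤ _ := setLIntegral_le_lintegral _ _
    have upper : ∀ x, ENNReal.ofReal (∫ y, η y * w (x - y)) ≤
        (C.toNNReal * (4 ^ L * (2 * ∫⁻ y : ι → ℝ, wt L 1 y))) * wt L 1 x := by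
      intro x
      rw [hlin]
      calc _ ≤ ∫⁻ y, C.toNNReal * (wt L 1 y * wt L 1 (x - y)) := by
            refine lintegral_mono fun y => ?_
            simp only
            rw [← mul_assoc]
            gcongr
            refine (ENNReal.ofReal_le_ofReal (hd y)).trans_eq ?_
            rw [ENNReal.ofReal_mul hC.le, ← hww]
            rfl
        _ ≤ _ := by
            rw [lintegral_const_mul' _ _ (by simp), mul_assoc]
            gcongr
            have := lintegral_om_mul_om_le (ι := ι) one_pos le_rfl hL.le x
            simpa [om, mul_comm] using this
    set c2 : ℝ≥0∞ := C.toNNReal * (4 ^ L * (2 * ∫⁻ y : ι → ℝ, wt L 1 y)) with hc2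
    have hc2t : c2 ≠ ∞ := by finiteness
    have hc3t : c1⁻¹ * 2 ^ L ≠ ∞ := by finiteness
    refine ⟨max (c1⁻¹ * 2 ^ L).toNNReal c2.toNNReal, fun x => ⟨?_, ?_⟩⟩
    · have h1 : wt L 1 x ≤ (c1⁻¹ * 2 ^ L) * ENNReal.ofReal (∫ y, η y * w (x - y)) := by
        rw [mul_assoc, ← ENNReal.mul_le_iff_le_inv hc10 hc1t]
        exact lower x
      refine h1.trans ?_
      gcongr
      exact (ENNReal.coe_toNNReal hc3t).ge.trans (by exact_mod_cast le_max_left _ _)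
    · refine (upper x).trans ?_
      gcongr
      exact (ENNReal.coe_toNNReal hc2t).ge.trans (by exact_mod_cast le_max_right _ _)
  · intro ξ hξ
    have hint2 : Integrable (Function.uncurry fun (x y : ι → ℝ) =>
        (η y : ℂ) * (w (x - y) : ℂ) * ch (-(x ⬝ᵥ ξ))) (volume.prod volume) := by
      have h1 : Integrable (fun p : (ι → ℝ) × (ι → ℝ) => η p.2 * w (p.1 - p.2))
          (volume.prod volume) := Integrable.convolution_integrand (L := ContinuousLinearMap.mul ℝ ℝ)
            (μ := volume) (ν := volume) hηi hwi
      refine h1.norm.mono' (Continuous.aestronglyMeasurable ?_) (Eventually.of_forall fun p => ?_)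
      · simp only [Function.uncurry_def]; fun_prop
      · simp [Function.uncurry_def]
    calc ∫ x, ((∫ y, η y * w (x - y) : ℝ) : ℂ) * ch (-(x ⬝ᵥ ξ))
        = ∫ x, ∫ y, (η y : ℂ) * (w (x - y) : ℂ) * ch (-(x ⬝ᵥ ξ)) := by
          congr 1; ext x
          rw [integral_mul_const, ← integral_complex_ofReal]
          simp
      _ = ∫ y, ∫ x, (η y : ℂ) * (w (x - y) : ℂ) * ch (-(x ⬝ᵥ ξ)) := integral_integral_swap hint2
      _ = ∫ y, (η y : ℂ) * ch (-(y ⬝ᵥ ξ)) * ∫ x, (w x : ℂ) * ch (-(x ⬝ᵥ ξ)) := by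
          congr 1; ext y
          rw [← integral_sub_right_eq_self (fun x => (w x : ℂ) * ch (-(x ⬝ᵥ ξ))) y,
            ← integral_const_mul]
          congr 1; ext x
          rw [show -(x ⬝ᵥ ξ) = -(y ⬝ᵥ ξ) + -((x - y) ⬝ᵥ ξ) by rw [sub_dotProduct]; ring, ch_add]
          ring
      _ = 0 := by rw [integral_mul_const, hηf ξ hξ, zero_mul]

/-- The quadratic form `|F|² ⋆ Ω_r` as an exponential sum. -/
def bandSum (Om : (ι → ℝ) → ℂ) (ξ : J → ι → ℝ) (a : J → ℂ) : (ι → ℝ) → ℂ :=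
  es (fun p : J × J => ξ p.1 - ξ p.2)
    (fun p => a p.1 * (starRingEnd ℂ) (a p.2) * Om (ξ p.1 - ξ p.2))

lemma sq_norm_es (ξ : J → ι → ℝ) (a : J → ℂ) (z : ι → ℝ) : ((‖es ξ a z‖ ^ 2 : ℝ) : ℂ) =
    ∑ p : J × J, a p.1 * (starRingEnd ℂ) (a p.2) * ch ((ξ p.1 - ξ p.2) ⬝ᵥ z) := by
  rw [← Complex.normSq_eq_norm_sq, ← Complex.mul_conj, es, map_sum, Finset.sum_mul_sum,
    ← Finset.sum_product']
  refine Finset.sum_congr rfl fun p _ => ?_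
  rw [map_mul, conj_ch, sub_dotProduct, ch_sub]
  ring

/-- Band-limited local energies. -/
lemma exists_band {L : ℕ} (hL : Fintype.card ι < L) :
    ∃ (C : ℝ≥0) (Om : ℝ → (ι → ℝ) → ℂ), ∀ r, 0 < r → (∀ ζ, 4 ≤ r * ‖ζ‖ → Om r ζ = 0) ∧
      ∀ (J : Type) [Fintype J] (ξ : J → ι → ℝ) (a : J → ℂ) (c : ι → ℝ),
        En L r ξ a c ≤ C * ‖bandSum (Om r) ξ a c‖ₑ ∧ ‖bandSum (Om r) ξ a c‖ₑ ≤ C * En L r ξ a c := by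
  obtain ⟨Om, hc, h0, ⟨C, hC⟩, hf⟩ := exists_band_weight_one (ι := ι) hL
  have hi : Integrable Om := by
    refine ⟨hc.aestronglyMeasurable, ?_⟩
    calc ∫⁻ x, ‖Om x‖ₑ ≤ ∫⁻ x, C * wt L 1 x := lintegral_mono fun x => by
          rw [Real.enorm_of_nonneg (h0 x)]; exact (hC x).2
      _ < ∞ := by
          rw [lintegral_const_mul _ (by fun_prop)]
          exact ENNReal.mul_lt_top (by simp) (lintegral_wt_one_lt_top hL)
  refine ⟨C, fun r ζ => ∫ y, (Om y : ℂ) * ch (-(y ⬝ᵥ (r • ζ))), fun r hr => ⟨fun ζ hζ => hf _ ?_,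
    fun J _ ξ a c => ?_⟩⟩
  · rwa [norm_smul, Real.norm_of_nonneg hr.le]
  have key : bandSum (fun ζ => ∫ y, (Om y : ℂ) * ch (-(y ⬝ᵥ (r • ζ)))) ξ a c =
      ((∫ y, Om y * ‖es ξ a (c - r • y)‖ ^ 2 : ℝ) : ℂ) := by
    rw [← integral_complex_ofReal]
    have h1 : ∀ y, ((Om y * ‖es ξ a (c - r • y)‖ ^ 2 : ℝ) : ℂ) =
        ∑ p : J × J, (a p.1 * (starRingEnd ℂ) (a p.2) * ch ((ξ p.1 - ξ p.2) ⬝ᵥ c)) *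
          ((Om y : ℂ) * ch (-(y ⬝ᵥ (r • (ξ p.1 - ξ p.2))))) := by
      intro y
      rw [Complex.ofReal_mul, sq_norm_es, Finset.mul_sum]
      refine Finset.sum_congr rfl fun p _ => ?_
      rw [dotProduct_sub, ch_sub, dotProduct_smul, dotProduct_smul, dotProduct_comm y]
      ring
    simp only [h1]
    rw [integral_finsetSum]
    · unfold bandSum es
      refine Finset.sum_congr rfl fun p _ => ?_
      rw [integral_const_mul]
      ring
    · intro p _
      refine Integrable.const_mul ?_ _
      refine hi.ofReal.mul_bdd (c := 1) (Continuous.aestronglyMeasurable (by fun_prop)) ?_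
      exact Eventually.of_forall fun y => by simp
  have hi2 : Integrable (fun y => Om y * ‖es ξ a (c - r • y)‖ ^ 2) := by
    refine hi.mul_bdd (c := (∑ j, ‖a j‖) ^ 2) (Continuous.aestronglyMeasurable (by fun_prop)) ?_
    refine Eventually.of_forall fun y => ?_
    rw [norm_pow, norm_norm]
    gcongr
    exact norm_es_le _ _ _
  have key2 : ‖bandSum (fun ζ => ∫ y, (Om y : ℂ) * ch (-(y ⬝ᵥ (r • ζ)))) ξ a c‖ₑ =
      ∫⁻ y, ENNReal.ofReal (Om y) * ‖es ξ a (c - r • y)‖ₑ ^ 2 := by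
    rw [key, ← ofReal_norm, Complex.norm_real, Real.norm_of_nonneg
      (integral_nonneg fun y => mul_nonneg (h0 y) (by positivity)),
      ofReal_integral_eq_lintegral_ofReal hi2
        (Eventually.of_forall fun y => mul_nonneg (h0 y) (by positivity))]
    refine lintegral_congr fun y => ?_
    rw [ENNReal.ofReal_mul (h0 y), ENNReal.ofReal_pow (norm_nonneg _), ofReal_norm]
  rw [key2, ← En_eq_lintegral_wt hr]
  rw [← lintegral_const_mul' _ _ (by simp), ← lintegral_const_mul' _ _ (by simp)]
  constructor
  · refine lintegral_mono fun y => ?_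
    simp only
    rw [← mul_assoc]
    gcongr
    exact (hC y).1
  · refine lintegral_mono fun y => ?_
    simp only
    rw [← mul_assoc]
    gcongr
    exact (hC y).2

lemma bandSum_sum_of_orthogonal {κ : Type} [DecidableEq κ] (Om : (ι → ℝ) → ℂ) (ξ : J → ι → ℝ) (a : κ → J → ℂ)
    (s : Finset κ) (h : ∀ m ∈ s, ∀ m' ∈ s, m ≠ m' → ∀ j j', a m j ≠ 0 → a m' j' ≠ 0 →
      Om (ξ j - ξ j') = 0) (c : ι → ℝ) :
    bandSum Om ξ (∑ m ∈ s, a m) c = ∑ m ∈ s, bandSum Om ξ (a m) c := by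
  unfold bandSum es
  rw [Finset.sum_comm]
  refine Finset.sum_congr rfl fun p _ => ?_
  rw [← Finset.sum_mul]
  congr 1
  simp only [Finset.sum_apply, map_sum]
  rw [Finset.sum_mul_sum, Finset.sum_mul]
  refine Finset.sum_congr rfl fun m hm => ?_
  rw [Finset.sum_mul, Finset.sum_eq_single_of_mem m hm]
  intro m' hm' hne
  by_cases h1 : a m p.1 = 0
  · simp [h1]
  by_cases h2 : a m' p.2 = 0
  · simp [h2]
  rw [h m hm m' hm' hne.symm _ _ h1 h2, mul_zero]

/-- Local orthogonality of frequency-localized pieces. -/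
lemma exists_orthogonality {L : ℕ} (hL : Fintype.card ι < L) :
    ∃ C : ℝ≥0, ∀ (J : Type) [Fintype J] (ξ : J → ι → ℝ) (r : ℝ) (_ : 0 < r) (s : Finset (ι → ℤ))
      (a : (ι → ℤ) → J → ℂ) (_ : ∀ m ∈ s, ∀ j, a m j ≠ 0 → ‖r • ξ j - (fun i => (m i : ℝ))‖ ≤ 1)
      (c : ι → ℝ), En L r ξ (∑ m ∈ s, a m) c ≤ C * ∑ m ∈ s, En L r ξ (a m) c := by
  classical
  obtain ⟨C, Om, hOm⟩ := exists_band (ι := ι) hL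
  refine ⟨(6 ^ Fintype.card ι) * C ^ 2, fun J _ ξ r hr s a ha c => ?_⟩
  obtain ⟨hv, hE⟩ := hOm r hr
  let cl : (ι → ℤ) → (ι → ZMod 6) := fun m i => (m i : ZMod 6)
  have hsum : ∑ m ∈ s, a m = ∑ κ : ι → ZMod 6, ∑ m ∈ s with cl m = κ, a m :=
    (Finset.sum_fiberwise_of_maps_to (fun m _ => Finset.mem_univ (cl m)) _).symm
  have horth : ∀ κ : ι → ZMod 6, bandSum (Om r) ξ (∑ m ∈ s with cl m = κ, a m) c =
      ∑ m ∈ s with cl m = κ, bandSum (Om r) ξ (a m) c := by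
    intro κ
    apply bandSum_sum_of_orthogonal
    intro m hm m' hm' hne j j' hj hj'
    rw [Finset.mem_filter] at hm hm'
    apply hv
    obtain ⟨i, hi⟩ := Function.ne_iff.1 hne
    have hmod : (m i : ZMod 6) = (m' i : ZMod 6) := by
      have := congrFun (hm.2.trans hm'.2.symm) i
      exact this
    have h6 : (6 : ℝ) ≤ |(m i : ℝ) - m' i| := by
      have hd : (6 : ℤ) ∣ m' i - m i := (ZMod.intCast_eq_intCast_iff_dvd_sub _ _ 6).1 hmod
      have h1 : (6 : ℤ) ≤ |m' i - m i| := by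
        have := Int.le_of_dvd (abs_pos.2 (sub_ne_zero.2 (Ne.symm hi))) ((dvd_abs _ _).2 hd)
        exact this
      rw [abs_sub_comm]
      exact_mod_cast h1
    have e1 := (norm_le_pi_norm _ i).trans (ha m hm.1 j hj)
    have e2 := (norm_le_pi_norm _ i).trans (ha m' hm'.1 j' hj')
    have e3 : ‖(r • (ξ j - ξ j')) i‖ ≤ r * ‖ξ j - ξ j'‖ := by
      have := norm_le_pi_norm (r • (ξ j - ξ j')) i
      rwa [norm_smul r, Real.norm_of_nonneg hr.le] at this
    simp only [Pi.sub_apply, Pi.smul_apply, smul_eq_mul, Real.norm_eq_abs] at e1 e2 e3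
    have h3 := abs_le.1 e1
    have h4 := abs_le.1 e2
    have h5 := abs_le.1 e3
    rcases le_abs.1 h6 with h | h <;> nlinarith
  calc En L r ξ (∑ m ∈ s, a m) c
      ≤ (6 ^ Fintype.card ι) * ∑ κ : ι → ZMod 6, En L r ξ (∑ m ∈ s with cl m = κ, a m) c := by
        rw [hsum]
        refine (En_sum_le Finset.univ ξ _ c).trans_eq ?_
        simp [ZMod.card]
    _ ≤ (6 ^ Fintype.card ι) * ∑ κ : ι → ZMod 6, ∑ m ∈ s with cl m = κ, C * (C * En L r ξ (a m) c) := by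
        gcongr with κ _
        refine (hE J ξ _ c).1.trans ?_
        rw [horth, ← Finset.mul_sum]
        gcongr
        exact (enorm_sum_le _ _).trans (Finset.sum_le_sum fun m _ => (hE J ξ (a m) c).2)
    _ = _ := by
        rw [Finset.sum_fiberwise_of_maps_to (fun m _ => Finset.mem_univ (cl m)), ← Finset.mul_sum,
          ← Finset.mul_sum]
        push_cast
        ring

end

section

variable {ι : Type} [Fintype ι] {J : Type} [Fintype J]

/-- Smooth frequency localization to the cube of side `1 / r` centred at `m / r`. -/
def cut (r : ℝ) (ξ : J → ι → ℝ) (m : ι → ℤ) (a : J → ℂ) : J → ℂ :=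
  fun j => (∏ i, (psi1 ((r • ξ j - fun i => (m i : ℝ)) i) : ℂ)) * a j

/-- The frequency cubes meeting the ball of radius `N`. -/
def box (ι : Type) [Fintype ι] (N : ℕ) : Finset (ι → ℤ) :=
  by classical exact Fintype.piFinset fun _ => Finset.Icc (-(N : ℤ)) N

omit [Fintype J] in
lemma cut_ne_zero {r : ℝ} {ξ : J → ι → ℝ} {m : ι → ℤ} {a : J → ℂ} {j : J}
    (h : cut r ξ m a j ≠ 0) : a j ≠ 0 ∧ ‖r • ξ j - fun i => (m i : ℝ)‖ ≤ 1 := by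
  refine ⟨right_ne_zero_of_mul h, (pi_norm_le_iff_of_nonneg zero_le_one).2 fun i => ?_⟩
  have h1 := (Finset.prod_ne_zero_iff.1 (left_ne_zero_of_mul h)) i (Finset.mem_univ i)
  by_contra hc
  exact h1 (by rw [psi1_eq_zero (not_le.1 hc).le, Complex.ofReal_zero])

omit [Fintype J] in
lemma sum_cut {r : ℝ} {ξ : J → ι → ℝ} {a : J → ℂ} {N : ℕ} (h : ∀ j, a j ≠ 0 → ‖r • ξ j‖ ≤ N) :
    ∑ m ∈ box ι N, cut r ξ m a = a := by
  classical
  ext j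
  rw [Finset.sum_apply]
  by_cases hj : a j = 0
  · simp [cut, hj]
  simp only [cut]
  rw [← Finset.sum_mul]
  have : ∑ m ∈ box ι N, ∏ i, (psi1 ((r • ξ j - fun i => (m i : ℝ)) i) : ℂ) = 1 := by
    have h1 := Finset.prod_univ_sum (fun _ : ι => Finset.Icc (-(N : ℤ)) N)
      (fun i k => (psi1 ((r • ξ j) i - (k : ℝ)) : ℂ))
    have h2 : ∑ m ∈ box ι N, ∏ i, (psi1 ((r • ξ j - fun i => (m i : ℝ)) i) : ℂ) =
      ∑ p ∈ Fintype.piFinset fun _ : ι => Finset.Icc (-(N : ℤ)) N,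
        ∏ x, (psi1 ((r • ξ j) x - (p x : ℝ)) : ℂ) := by
      simp only [box, Pi.sub_apply]
    rw [h2, ← h1]
    refine Finset.prod_eq_one fun i _ => ?_
    rw [← Complex.ofReal_sum, sum_psi1, Complex.ofReal_one]
    exact (norm_le_pi_norm (r • ξ j) i).trans (h j hj)
  rw [this, one_mul]

/-- Bessel's inequality for frequency-localized pieces. -/
lemma exists_sum_cut_le {L : ℕ} (hL : Fintype.card ι < L) :
    ∃ C : ℝ≥0, ∀ (J : Type) [Fintype J] (ξ : J → ι → ℝ) (a : J → ℂ) (r : ℝ) (_ : 0 < r)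
      (s : Finset (ι → ℤ)) (z : ι → ℝ),
      ∑ m ∈ s, ‖es ξ (cut r ξ m a) z‖ₑ ^ 2 ≤ C * En L r ξ a z := by
  classical
  obtain ⟨K, hKc, hKd, hKf⟩ := exists_kernel (ι := ι) psi1 contDiff_psi1 hasCompactSupport_psi1
  obtain ⟨C, hC, hd⟩ := hKd L
  obtain ⟨C2, hC2⟩ := exists_orthogonality (ι := ι) hL
  have hw := lintegral_wt_one_lt_top (ι := ι) hL
  refine ⟨C.toNNReal ^ 2 * (C2 * (∫⁻ y : ι → ℝ, wt L 1 y).toNNReal), fun J _ ξ a r hr s z => ?_⟩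
  set b : s → ℂ := fun m => (starRingEnd ℂ) (es ξ (cut r ξ m a) z) with hb
  set fr : s → ι → ℝ := fun m i => ((m : ι → ℤ) i : ℝ) with hfr
  set S : ℝ≥0∞ := ∑ m ∈ s, ‖es ξ (cut r ξ m a) z‖ₑ ^ 2 with hS
  have hSt : S ≠ ∞ := ENNReal.sum_ne_top.2 fun m _ => by finiteness
  have hi := integrable_of_decay hKc hL hd
  have hdual : S = ‖∫ y, K y * (es ξ a (z - r • y) * es fr b y)‖ₑ := by
    have h1 : (∫ y, K y * (es ξ a (z - r • y) * es fr b y)) = ((∑ m ∈ s, ‖es ξ (cut r ξ m a) z‖ ^ 2 : ℝ) : ℂ) := by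
      have : ∀ y, K y * (es ξ a (z - r • y) * es fr b y) =
          ∑ m : s, b m * (K y * (ch (y ⬝ᵥ fr m) * es ξ a (z - r • y))) := by
        intro y
        rw [show es fr b y = ∑ m : s, b m * ch (fr m ⬝ᵥ y) from rfl, Finset.mul_sum, Finset.mul_sum]
        refine Finset.sum_congr rfl fun m _ => ?_
        rw [dotProduct_comm]; ring
      simp only [this]
      rw [integral_finsetSum]
      · rw [Complex.ofReal_sum, ← Finset.sum_coe_sort s]
        refine Finset.sum_congr rfl fun m _ => ?_
        rw [integral_const_mul, ← es_multiplier hi hKf r (fr m) ξ a z]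
        rw [Complex.ofReal_pow, ← Complex.conj_mul']
        rfl
      · intro m _
        refine Integrable.const_mul (hi.mul_bdd (c := ∑ j, ‖a j‖)
          (Continuous.aestronglyMeasurable (by fun_prop)) (Eventually.of_forall fun y => ?_)) _
        rw [norm_mul, norm_ch, one_mul]
        exact norm_es_le _ _ _
    rw [h1, ← ofReal_norm, Complex.norm_real, Real.norm_of_nonneg (by positivity),
      ENNReal.ofReal_sum_of_nonneg fun _ _ => by positivity, hS]
    refine Finset.sum_congr rfl fun m _ => ?_
    rw [ENNReal.ofReal_pow (norm_nonneg _), ofReal_norm]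
  have hB : En L 1 fr b 0 ≤ C2 * ((∫⁻ y : ι → ℝ, wt L 1 y) * S) := by
    set p : (ι → ℤ) → s → ℂ := fun m j => if (j : ι → ℤ) = m then b j else 0
    have h1 : ∑ m ∈ s, p m = b := by
      ext j; simp [p, Finset.sum_apply]
    have h2 := hC2 s fr 1 one_pos s p (by
      intro m _ j hj
      have : (j : ι → ℤ) = m := by
        by_contra h
        exact hj (if_neg h)
      simp [fr, this]) 0
    rw [h1] at h2
    refine h2.trans ?_
    gcongr
    rw [hS, Finset.mul_sum]
    refine Finset.sum_le_sum fun m hm => ?_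
    have h3 : ∀ y, es fr (p m) y = b ⟨m, hm⟩ * ch (fr ⟨m, hm⟩ ⬝ᵥ y) := by
      intro y
      rw [es, Finset.sum_eq_single ⟨m, hm⟩]
      · simp [p]
      · intro j _ hj
        have : (j : ι → ℤ) ≠ m := fun h => hj (Subtype.ext h)
        simp [p, this]
      · simp
    rw [← En_eq_lintegral_wt one_pos]
    simp only [h3, enorm_mul, enorm_ch, mul_one]
    rw [lintegral_mul_const _ (by fun_prop)]
    gcongr
    simp [hb]
  have hfin : S ^ 2 ≤ (C.toNNReal ^ 2 * (C2 * ∫⁻ y : ι → ℝ, wt L 1 y) * En L r ξ a z) * S := by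
    calc S ^ 2 ≤ (∫⁻ y, C.toNNReal * (wt L 1 y * (‖es ξ a (z - r • y)‖ₑ * ‖es fr b y‖ₑ))) ^ 2 := by
          rw [hdual]
          gcongr
          refine (enorm_integral_le_lintegral_enorm _).trans (lintegral_mono fun y => ?_)
          simp only [enorm_mul]
          rw [← mul_assoc (C.toNNReal : ℝ≥0∞)]
          gcongr
          exact decay_enorm hd y
      _ ≤ C.toNNReal ^ 2 * ((∫⁻ y, wt L 1 y * ‖es ξ a (z - r • y)‖ₑ ^ 2) *
          ∫⁻ y, wt L 1 y * ‖es fr b y‖ₑ ^ 2) := by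
          rw [lintegral_const_mul' _ _ (by simp), mul_pow]
          gcongr
          have h := ENNReal.lintegral_mul_le_Lp_mul_Lq (volume.withDensity (wt L 1))
            Real.HolderConjugate.two_two
            (f := fun y => ‖es ξ a (z - r • y)‖ₑ) (g := fun y => ‖es fr b y‖ₑ)
            (by fun_prop) (by fun_prop)
          have h2 := ENNReal.rpow_le_rpow h (z := 2) (by norm_num)
          rw [ENNReal.mul_rpow_of_nonneg _ _ (by norm_num), ← ENNReal.rpow_mul,
            ← ENNReal.rpow_mul] at h2
          norm_num at h2
          rw [lintegral_withDensity_eq_lintegral_mul _ (by fun_prop) (by fun_prop),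
            lintegral_withDensity_eq_lintegral_mul _ (by fun_prop) (by fun_prop),
            lintegral_withDensity_eq_lintegral_mul _ (by fun_prop) (by fun_prop)] at h2
          exact h2
      _ ≤ C.toNNReal ^ 2 * (En L r ξ a z * (C2 * ((∫⁻ y : ι → ℝ, wt L 1 y) * S))) := by
          rw [En_eq_lintegral_wt hr]
          gcongr
          refine le_trans (le_of_eq ?_) hB
          rw [← En_eq_lintegral_wt one_pos, ← lintegral_neg_eq_self]
          refine lintegral_congr fun y => ?_
          rw [wt_neg]
          simp
      _ = _ := by ring
  rw [ENNReal.coe_mul, ENNReal.coe_mul, ENNReal.coe_toNNReal hw.ne, ENNReal.coe_pow]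
  rcases eq_or_ne S 0 with h0 | h0
  · rw [h0]; exact zero_le
  · rw [sq] at hfin
    exact (ENNReal.mul_le_mul_iff_left h0 hSt).1 hfin

lemma lintegral_om_sub_mul_om_le {L : ℕ} {r r' : ℝ} (hr : 0 < r) (h : r ≤ r')
    (hL : Fintype.card ι ≤ L) (x c : ι → ℝ) :
    ∫⁻ y, om L r (y - x) * om L r' (c - y) ≤
      4 ^ L * (2 * ∫⁻ y : ι → ℝ, wt L 1 y) * om L r' (c - x) := by
  refine le_trans (le_of_eq ?_) (lintegral_om_mul_om_le hr h hL (c - x))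
  rw [← lintegral_sub_left_eq_self _ c]
  refine lintegral_congr fun y => ?_
  rw [sub_sub_cancel, sub_right_comm]

/-- Averaging local energies at a larger scale. -/
lemma exists_lintegral_En_mul_om_le {L : ℕ} (hL : Fintype.card ι < L) :
    ∃ C : ℝ≥0, ∀ (J : Type) [Fintype J] (ξ : J → ι → ℝ) (a : J → ℂ) (r r' : ℝ) (_ : 0 < r)
      (_ : r ≤ r') (c : ι → ℝ), ∫⁻ z, En L r ξ a z * om L r' (c - z) ≤ C * En L r' ξ a c := by
  have hw := lintegral_wt_one_lt_top (ι := ι) hL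
  refine ⟨4 ^ L * (2 * (∫⁻ y : ι → ℝ, wt L 1 y).toNNReal), fun J _ ξ a r r' hr h c => ?_⟩
  have h1 := lintegral_conv_mul (f := fun y => ‖es ξ a y‖ₑ ^ 2) (k := om L r)
    (g := fun z => om L r' (c - z)) (measurable_es_sq ξ a) measurable_om (by fun_prop)
  refine (le_of_eq h1).trans ?_
  rw [En, ← lintegral_const_mul' _ _ ENNReal.coe_ne_top]
  refine lintegral_mono fun y => ?_
  simp only
  rw [← mul_assoc, mul_comm (_ : ℝ≥0∞) (‖es ξ a y‖ₑ ^ 2), mul_assoc]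
  gcongr
  refine (lintegral_om_sub_mul_om_le hr h hL.le y c).trans_eq ?_
  push_cast
  rw [ENNReal.coe_toNNReal hw.ne]

/-- Bessel's inequality for local energies. -/
lemma exists_sum_En_cut_le {L : ℕ} (hL : Fintype.card ι < L) :
    ∃ C : ℝ≥0, ∀ (J : Type) [Fintype J] (ξ : J → ι → ℝ) (a : J → ℂ) (r r' : ℝ) (_ : 0 < r)
      (_ : r ≤ r') (s : Finset (ι → ℤ)) (c : ι → ℝ),
      ∑ m ∈ s, En L r' ξ (cut r ξ m a) c ≤ C * En L r' ξ a c := by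
  obtain ⟨C1, h1⟩ := exists_sum_cut_le (ι := ι) hL
  obtain ⟨C2, h2⟩ := exists_lintegral_En_mul_om_le (ι := ι) hL
  refine ⟨C1 * C2, fun J _ ξ a r r' hr h s c => ?_⟩
  unfold En
  rw [← lintegral_finsetSum _ (fun i _ => by fun_prop (disch := exact measurable_es_sq _ _))]
  calc _ ≤ ∫⁻ y, C1 * (En L r ξ a y * om L r' (c - y)) := by
        refine lintegral_mono fun y => ?_
        simp only
        rw [← Finset.sum_mul, ← mul_assoc]
        gcongr
        exact h1 J ξ a r hr s y
    _ ≤ _ := by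
        rw [lintegral_const_mul' _ _ (by simp), ENNReal.coe_mul, mul_assoc]
        gcongr
        exact h2 J ξ a r r' hr h c

lemma exists_En_cut_le {L : ℕ} (hL : Fintype.card ι < L) :
    ∃ C : ℝ≥0, ∀ (J : Type) [Fintype J] (ξ : J → ι → ℝ) (a : J → ℂ) (r r' : ℝ) (_ : 0 < r)
      (_ : r ≤ r') (m : ι → ℤ) (c : ι → ℝ),
      En L r' ξ (cut r ξ m a) c ≤ C * En L r' ξ a c := by
  obtain ⟨C, hC⟩ := exists_sum_En_cut_le (ι := ι) hL
  refine ⟨C, fun J _ ξ a r r' hr h m c => ?_⟩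
  simpa using hC J ξ a r r' hr h {m} c

end

section Finner

lemma lintegral_prod_rpow_le {α : Type*} [MeasurableSpace α] {μ : Measure α}
    [IsProbabilityMeasure μ] {I : Type*} (s : Finset I) {f : I → α → ℝ≥0∞}
    (hf : ∀ i ∈ s, Measurable (f i)) {p : ℝ} (hp : 0 ≤ p) (h : s.card * p ≤ 1) :
    ∫⁻ a, ∏ i ∈ s, f i a ^ p ∂μ ≤ ∏ i ∈ s, (∫⁻ a, f i a ∂μ) ^ p := by
  have := ENNReal.lintegral_mul_prod_norm_pow_le (μ := μ) s (g := fun _ => 1) (f := f)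
    aemeasurable_const (fun i hi => (hf i hi).aemeasurable) (1 - s.card * p) (p := fun _ => p)
    (by simp) (by linarith) (fun _ _ => hp)
  simpa using this

variable {ι : Type} [DecidableEq ι] {μ : ι → Measure ℝ}

/-- Finner's inequality. -/
lemma finner [∀ l, IsProbabilityMeasure (μ l)] {I : Type} [Fintype I]
    [DecidableEq I] (T : I → Finset ι) {f : I → (ι → ℝ) → ℝ≥0∞} (hf : ∀ i, Measurable (f i))
    (hT : ∀ i, ∀ l ∈ T i, ∀ x y, f i (Function.update x l y) = f i x) {p : ℝ} (hp : 0 ≤ p)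
    (h : ∀ l, ((Finset.univ.filter fun i => l ∉ T i).card : ℝ) * p ≤ 1) (s : Finset ι)
    (x : ι → ℝ) :
    (∫⋯∫⁻_s, (fun z => ∏ i, f i z ^ p) ∂μ) x ≤ ∏ i, ((∫⋯∫⁻_s, f i ∂μ) x) ^ p := by
  induction s using Finset.induction generalizing x with
  | empty => simp
  | insert l s hl ih =>
    have hmeas : Measurable fun z => ∏ i, f i z ^ p := by fun_prop
    rw [lmarginal_insert _ hmeas hl]
    refine (lintegral_mono fun t => ih (Function.update x l t)).trans ?_
    have hg : ∀ i, Measurable fun t => (∫⋯∫⁻_s, f i ∂μ) (Function.update x l t) := fun i =>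
      ((hf i).lmarginal μ).comp (measurable_update x)
    have hind : ∀ i, l ∈ T i → ∀ t, (∫⋯∫⁻_s, f i ∂μ) (Function.update x l t) = (∫⋯∫⁻_s, f i ∂μ) x := by
      intro i hi t
      rw [lmarginal_update_of_notMem (hf i) hl]
      congr 1
      have : f i ∘ (fun z => Function.update z l t) = f i := funext fun z => hT i l hi z t
      rw [this]
    have hins : ∀ i, (∫⋯∫⁻_insert l s, f i ∂μ) x =
        ∫⁻ t, (∫⋯∫⁻_s, f i ∂μ) (Function.update x l t) ∂μ l := fun i => lmarginal_insert _ (hf i) hl x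
    simp only [hins]
    calc _ = ∫⁻ t, (∏ i with l ∈ T i, ((∫⋯∫⁻_s, f i ∂μ) x) ^ p) *
          ∏ i with l ∉ T i, ((∫⋯∫⁻_s, f i ∂μ) (Function.update x l t)) ^ p ∂μ l := by
          refine lintegral_congr fun t => ?_
          rw [← Finset.prod_filter_mul_prod_filter_not Finset.univ (fun i => l ∈ T i)]
          congr 1
          refine Finset.prod_congr rfl fun i hi => ?_
          rw [hind i (Finset.mem_filter.1 hi).2]
      _ ≤ (∏ i with l ∈ T i, ((∫⋯∫⁻_s, f i ∂μ) x) ^ p) * ∏ i with l ∉ T i,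
          (∫⁻ t, (∫⋯∫⁻_s, f i ∂μ) (Function.update x l t) ∂μ l) ^ p := by
          rw [lintegral_const_mul _ (by fun_prop)]
          gcongr
          exact lintegral_prod_rpow_le _ (fun i _ => hg i) hp (h l)
      _ = _ := by
          rw [← Finset.prod_filter_mul_prod_filter_not Finset.univ (fun i => l ∈ T i)]
          congr 1
          refine Finset.prod_congr rfl fun i hi => ?_
          simp only [hind i (Finset.mem_filter.1 hi).2]
          simp

lemma lmarginal_withDensity {ρ : ι → ℝ → ℝ≥0∞} (hρ : ∀ l, Measurable (ρ l))
    [∀ l, SigmaFinite ((volume : Measure ℝ).withDensity (ρ l))] {f : (ι → ℝ) → ℝ≥0∞}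
    (hf : Measurable f) (s : Finset ι) (x : ι → ℝ) :
    (∫⋯∫⁻_s, f ∂(fun l => (volume : Measure ℝ).withDensity (ρ l))) x =
      (∫⋯∫⁻_s, (fun z => (∏ l ∈ s, ρ l (z l)) * f z) ∂(fun _ => (volume : Measure ℝ))) x := by
  induction s using Finset.induction generalizing x with
  | empty => simp
  | insert l s hl ih =>
    rw [lmarginal_insert _ hf hl, lmarginal_insert _ (by fun_prop) hl]
    have hm : Measurable fun t => (∫⋯∫⁻_s, f ∂(fun l => (volume : Measure ℝ).withDensity (ρ l)))
        (Function.update x l t) := (hf.lmarginal _).comp (measurable_update x)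
    rw [lintegral_withDensity_eq_lintegral_mul _ (hρ l) hm]
    refine lintegral_congr fun t => ?_
    simp only [Pi.mul_apply, Finset.prod_insert hl, ih]
    rw [lmarginal, lmarginal, ← lintegral_const_mul]
    · refine lintegral_congr fun y => ?_
      rw [← mul_assoc]
      congr 3
      simp [Function.updateFinset, hl]
    · have : Measurable fun z => (∏ l ∈ s, ρ l (z l)) * f z := by fun_prop
      exact this.comp measurable_updateFinset

lemma lintegral_pi_withDensity [Fintype ι] {ρ : ι → ℝ → ℝ≥0∞} (hρ : ∀ l, Measurable (ρ l))
    [∀ l, SigmaFinite ((volume : Measure ℝ).withDensity (ρ l))] {f : (ι → ℝ) → ℝ≥0∞}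
    (hf : Measurable f) :
    ∫⁻ z, f z ∂(Measure.pi fun l => (volume : Measure ℝ).withDensity (ρ l)) =
      ∫⁻ z, (∏ l, ρ l (z l)) * f z := by
  have := lmarginal_withDensity hρ hf Finset.univ (0 : ι → ℝ)
  simpa [lmarginal_univ, volume_pi] using this

end Finner

section OneDim

lemma lintegral_comp_sub_mul (f : ℝ → ℝ≥0∞) (hf : Measurable f) {r : ℝ} (hr : 0 < r) (c : ℝ) :
    ∫⁻ y, f (c - r * y) = ENNReal.ofReal r⁻¹ * ∫⁻ y, f y := by
  have h := Measure.map_addHaar_smul (volume : Measure ℝ) hr.ne'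
  rw [Module.finrank_self, pow_one, abs_of_pos (by positivity)] at h
  have h3 : ∫⁻ y, f (c - r * y) = ∫⁻ y, f (c - y) ∂(Measure.map (r • ·) volume) :=
    (lintegral_map (f := fun y => f (c - y)) (by fun_prop) (by fun_prop)).symm
  rw [h3, h, lintegral_smul_measure, smul_eq_mul, lintegral_sub_left_eq_self]

/-- The one-dimensional weight. -/
def wt1 (L : ℕ) (y : ℝ) : ℝ≥0∞ := ENNReal.ofReal (((1 + |y|) ^ L)⁻¹)

@[fun_prop] lemma measurable_wt1 {L : ℕ} : Measurable (wt1 L) := by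
  unfold wt1; fun_prop

lemma lintegral_wt1_lt_top {L : ℕ} (hL : 1 < L) : ∫⁻ y, wt1 L y < ∞ := by
  have := (integrable_one_add_norm (E := ℝ) (μ := volume) (r := L) (by simpa using hL))
  have h2 : Integrable fun y : ℝ => ((1 + |y|) ^ L)⁻¹ := by
    refine this.congr (Eventually.of_forall fun y => ?_)
    simp only [Real.norm_eq_abs]
    rw [Real.rpow_neg (by positivity), Real.rpow_natCast]
  exact h2.lintegral_lt_top

lemma lintegral_wt1_ne_zero {L : ℕ} : ∫⁻ y, wt1 L y ≠ 0 := by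
  rw [Ne, lintegral_eq_zero_iff (by fun_prop)]
  intro h
  have : ∀ᵐ y : ℝ, False := by
    filter_upwards [h] with y hy
    have : 0 < wt1 L y := by
      rw [wt1, ENNReal.ofReal_pos]; positivity
    exact this.ne' hy
  have h2 : (volume : Measure ℝ) = 0 := by simpa using this
  exact NeZero.ne _ h2

/-- Density of the normalized one-dimensional weight at scale `r` centred at `c`. -/
def dens (L : ℕ) (r c y : ℝ) : ℝ≥0∞ :=
  (∫⁻ y, wt1 L y)⁻¹ * ENNReal.ofReal r⁻¹ * wt1 L ((c - y) / r)

@[fun_prop] lemma measurable_dens {L : ℕ} {r c : ℝ} : Measurable (dens L r c) := by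
  unfold dens; fun_prop

/-- The normalized one-dimensional weight as a probability measure. -/
def mu (L : ℕ) (r c : ℝ) : Measure ℝ := (volume : Measure ℝ).withDensity (dens L r c)

lemma lintegral_dens_mul {L : ℕ} {r : ℝ} (hr : 0 < r) (c : ℝ) {f : ℝ → ℝ≥0∞} (hf : Measurable f) :
    ∫⁻ y, f y ∂(mu L r c) = (∫⁻ y, wt1 L y)⁻¹ * ∫⁻ y, wt1 L y * f (c - r * y) := by
  have h := lintegral_comp_sub_mul (fun y => wt1 L ((c - y) / r) * f y) (by fun_prop) hr c
  have h2 : ∀ y, (c - (c - r * y)) / r = y := fun y => by field_simp; ring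
  simp only [h2] at h
  rw [h, mu, lintegral_withDensity_eq_lintegral_mul _ (by fun_prop) hf,
    ← lintegral_const_mul _ (by fun_prop), ← lintegral_const_mul _ (by fun_prop)]
  refine lintegral_congr fun y => ?_
  simp only [Pi.mul_apply, dens]; ring

lemma isProbabilityMeasure_mu {L : ℕ} (hL : 1 < L) {r : ℝ} (hr : 0 < r) (c : ℝ) :
    IsProbabilityMeasure (mu L r c) := by
  refine ⟨?_⟩
  have := lintegral_dens_mul (L := L) hr c (f := fun _ => 1) (by fun_prop)
  simp only [lintegral_one, mul_one] at this
  rw [this, ENNReal.inv_mul_cancel lintegral_wt1_ne_zero (lintegral_wt1_lt_top hL).ne]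

variable {ι : Type} [Fintype ι] [DecidableEq ι]

/-- The locally constant property in one coordinate direction. -/
lemma exists_locally_constant_dir {L : ℕ} (hL : 1 < L) :
    ∃ C : ℝ≥0, ∀ (J : Type) [Fintype J] (ξ : J → ι → ℝ) (a : J → ℂ) (r : ℝ) (_ : 0 < r) (l : ι)
      (c : ℝ) (_ : ∀ j, a j ≠ 0 → r * |ξ j l| ≤ 1) (z : ι → ℝ) (_ : |z l - c| ≤ r),
      ‖es ξ a z‖ₑ ≤ C * ∫⁻ y, ‖es ξ a (Function.update z l y)‖ₑ ∂(mu L r c) := by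
  obtain ⟨φ, hφ, hφc, hφ1, -, -⟩ := exists_phi1
  obtain ⟨K, hKc, hKd, hKf, -⟩ := exists_kernel_one φ hφ hφc
  obtain ⟨C, hC, hd⟩ := hKd L
  have hw := lintegral_wt1_lt_top hL
  have hdK : ∀ y, ‖K y‖ₑ ≤ C.toNNReal * wt1 L y := fun y => by
    rw [← ofReal_norm, wt1]
    refine (ENNReal.ofReal_le_ofReal (hd y)).trans_eq ?_
    rw [ENNReal.ofReal_mul hC.le]; rfl
  have hKi : Integrable K := by
    refine ⟨hKc.aestronglyMeasurable, (lintegral_mono hdK).trans_lt ?_⟩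
    rw [lintegral_const_mul _ (by fun_prop)]
    exact ENNReal.mul_lt_top (by simp) hw
  refine ⟨C.toNNReal * 2 ^ L * (∫⁻ y, wt1 L y).toNNReal, fun J _ ξ a r hr l c ha z hz => ?_⟩
  have key : es ξ a z = ∫ y, K y * es ξ a (Function.update z l (z l - r * y)) := by
    have h1 : ∀ y, K y * es ξ a (Function.update z l (z l - r * y)) =
        ∑ j, (a j * ch (ξ j ⬝ᵥ z)) * (K y * ch (-(y * (r * ξ j l)))) := by
      intro y
      rw [es, Finset.mul_sum]
      refine Finset.sum_congr rfl fun j _ => ?_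
      have : Function.update z l (z l - r * y) = z - Pi.single l (r * y) := by
        ext i
        by_cases hi : i = l
        · subst hi; simp
        · simp [hi]
      rw [this, dotProduct_sub, dotProduct_single, ch_sub]
      rw [show ξ j l * (r * y) = y * (r * ξ j l) by ring]
      ring
    simp only [h1]
    rw [integral_finsetSum]
    · rw [es]
      refine Finset.sum_congr rfl fun j _ => ?_
      rw [integral_const_mul, hKf]
      by_cases hj : a j = 0
      · simp [hj]
      · rw [hφ1]
        · simp
        · rw [abs_mul, abs_of_pos hr]; exact ha j hj
    · intro j _
      refine Integrable.const_mul (hKi.mul_bdd (c := 1)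
        (Continuous.aestronglyMeasurable (by fun_prop)) (Eventually.of_forall fun y => ?_)) _
      simp
  have hmeas : Measurable fun y => ‖es ξ a (Function.update z l y)‖ₑ :=
    ((continuous_es ξ a).measurable.comp (measurable_update z)).enorm
  set f : ℝ → ℝ≥0∞ := fun y => ‖es ξ a (Function.update z l y)‖ₑ with hf
  calc ‖es ξ a z‖ₑ ≤ ∫⁻ y, C.toNNReal * (wt1 L y * f (z l - r * y)) := by
        rw [key]
        refine (enorm_integral_le_lintegral_enorm _).trans (lintegral_mono fun y => ?_)
        simp only [enorm_mul, hf]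
        rw [← mul_assoc]
        gcongr
        exact hdK y
    _ = C.toNNReal * (∫⁻ y, wt1 L y * f (z l - r * y)) := lintegral_const_mul' _ _ (by simp)
    _ = C.toNNReal * ((∫⁻ y, wt1 L y) * ∫⁻ y, f y ∂(mu L r (z l))) := by
        rw [lintegral_dens_mul hr _ hmeas, ← mul_assoc (∫⁻ y, wt1 L y),
          ENNReal.mul_inv_cancel lintegral_wt1_ne_zero hw.ne, one_mul]
    _ ≤ C.toNNReal * ((∫⁻ y, wt1 L y) * (2 ^ L * ∫⁻ y, f y ∂(mu L r c))) := by
        gcongr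
        rw [mu, mu, lintegral_withDensity_eq_lintegral_mul _ (by fun_prop) hmeas,
          lintegral_withDensity_eq_lintegral_mul _ (by fun_prop) hmeas,
          ← lintegral_const_mul _ (by fun_prop)]
        refine lintegral_mono fun y => ?_
        simp only [Pi.mul_apply, ← mul_assoc]
        gcongr
        unfold dens
        rw [mul_left_comm]
        gcongr
        unfold wt1
        rw [show (2 : ℝ≥0∞) ^ L = ENNReal.ofReal (2 ^ L) by
          rw [ENNReal.ofReal_pow (by norm_num)]; norm_num, ← ENNReal.ofReal_mul (by positivity)]
        apply ENNReal.ofReal_le_ofReal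
        rw [← div_eq_mul_inv, inv_le_iff_one_le_mul₀ (by positivity), div_mul_eq_mul_div,
          one_le_div (by positivity), ← mul_pow]
        gcongr
        have h1 : |(c - y) / r| ≤ |(z l - y) / r| + 1 := by
          rw [abs_div, abs_div, abs_of_pos hr, div_add_one hr.ne']
          gcongr
          calc |c - y| = |(z l - y) - (z l - c)| := by ring_nf
            _ ≤ |z l - y| + |z l - c| := abs_sub _ _
            _ ≤ _ := by gcongr
        linarith [abs_nonneg ((z l - y) / r)]
    _ = _ := by
        push_cast
        rw [ENNReal.coe_toNNReal hw.ne]; ring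

end OneDim

section

lemma lmarginal_lmarginal {ι : Type} [DecidableEq ι] {μ : ι → Measure ℝ}
    [∀ l, IsProbabilityMeasure (μ l)] (s : Finset ι) (f : (ι → ℝ) → ℝ≥0∞) :
    ∫⋯∫⁻_s, (∫⋯∫⁻_s, f ∂μ) ∂μ = ∫⋯∫⁻_s, f ∂μ := by
  ext x
  have h : ∀ y : (i : s) → ℝ, (∫⋯∫⁻_s, f ∂μ) (Function.updateFinset x s y) = (∫⋯∫⁻_s, f ∂μ) x :=
    fun y => lmarginal_congr μ f fun i hi => by simp [Function.updateFinset, hi]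
  conv_lhs => rw [lmarginal]
  simp only [h]
  simp

variable {ι : Type} [Fintype ι]

lemma prod_dens_le {L : ℕ} {r : ℝ} (hr : 0 < r) (c z : ι → ℝ) :
    ∏ l, dens L r (c l) (z l) ≤ ((∫⁻ y, wt1 L y)⁻¹) ^ Fintype.card ι * om L r (c - z) := by
  unfold dens
  rw [Finset.prod_mul_distrib, Finset.prod_mul_distrib]
  simp only [Finset.prod_const, Finset.card_univ]
  rw [mul_assoc, om]
  gcongr
  · rw [← ENNReal.ofReal_pow (by positivity), inv_pow]
  · simp only [wt1, wt]
    rw [← ENNReal.ofReal_prod_of_nonneg fun _ _ => by positivity]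
    apply ENNReal.ofReal_le_ofReal
    rw [Finset.prod_inv_distrib, Finset.prod_pow]
    gcongr
    have h := one_add_norm_le_prod (fun l => (c l - z l) / r)
    refine le_trans (le_of_eq ?_) h
    have : (fun l => (c l - z l) / r) = r⁻¹ • (c - z) := by
      ext l; simp [div_eq_inv_mul]
    rw [this, norm_smul, Real.norm_of_nonneg (by positivity), div_eq_inv_mul]

lemma le_prod_dens {L : ℕ} (hL : 1 < L) {r : ℝ} (hr : 0 < r) (c z : ι → ℝ)
    (hz : z ∈ closedBall c r) :
    (ENNReal.ofReal ((2 * r) ^ Fintype.card ι))⁻¹ ≤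
      (2 ^ L * ∫⁻ y, wt1 L y) ^ Fintype.card ι * ∏ l, dens L r (c l) (z l) := by
  have hw := lintegral_wt1_lt_top hL
  have h1 : ∀ l, ENNReal.ofReal r⁻¹ ≤ (2 ^ L * ∫⁻ y, wt1 L y) * dens L r (c l) (z l) := by
    intro l
    unfold dens
    have h2 : (2 ^ L * ∫⁻ y, wt1 L y) * ((∫⁻ y, wt1 L y)⁻¹ * ENNReal.ofReal r⁻¹ *
        wt1 L ((c l - z l) / r)) = ((∫⁻ y, wt1 L y) * (∫⁻ y, wt1 L y)⁻¹) *
        (ENNReal.ofReal r⁻¹ * (2 ^ L * wt1 L ((c l - z l) / r))) := by ring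
    rw [h2, ENNReal.mul_inv_cancel lintegral_wt1_ne_zero hw.ne, one_mul]
    refine le_mul_of_one_le_right (by simp) ?_
    unfold wt1
    rw [show (2 : ℝ≥0∞) ^ L = ENNReal.ofReal (2 ^ L) by
      rw [ENNReal.ofReal_pow (by norm_num)]; norm_num, ← ENNReal.ofReal_mul (by positivity),
      ← ENNReal.ofReal_one]
    apply ENNReal.ofReal_le_ofReal
    rw [← div_eq_mul_inv, one_le_div (by positivity)]
    gcongr
    have h3 := norm_le_pi_norm (z - c) l
    rw [mem_closedBall, dist_eq_norm] at hz
    rw [abs_div, abs_of_pos hr, abs_sub_comm]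
    have : |z l - c l| / r ≤ 1 := by
      rw [div_le_one hr]; exact h3.trans hz
    linarith
  calc (ENNReal.ofReal ((2 * r) ^ Fintype.card ι))⁻¹ ≤ ∏ _l : ι, ENNReal.ofReal r⁻¹ := by
        rw [Finset.prod_const, Finset.card_univ, ← ENNReal.ofReal_inv_of_pos (by positivity),
          ← ENNReal.ofReal_pow (by positivity), inv_pow]
        apply ENNReal.ofReal_le_ofReal
        gcongr
        linarith
    _ ≤ ∏ l, (2 ^ L * ∫⁻ y, wt1 L y) * dens L r (c l) (z l) := by
        gcongr with l _
        exact h1 l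
    _ = _ := by
        rw [Finset.prod_mul_distrib]; simp

/-- One step of the induction on scales for multilinear estimates. -/
lemma exists_ml_step {L : ℕ} (hL : Fintype.card ι < L) (hL1 : 1 < L) (I : Type) [Fintype I]
    {p : ℝ} (hp : 0 ≤ p) :
    ∃ C : ℝ≥0, ∀ (J : Type) [Fintype J] (ξ : J → ι → ℝ) (T : I → Finset ι)
      (_ : ∀ l, ∀ s : Finset I, (∀ i ∈ s, l ∉ T i) → (s.card : ℝ) * p ≤ 1) (a : I → J → ℂ)
      (r r' : ℝ) (_ : 0 < r) (_ : r ≤ r')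
      (_ : ∀ i, ∀ j j', a i j ≠ 0 → a i j' ≠ 0 → r * ‖ξ j - ξ j'‖ < 4 →
        ∀ l ∈ T i, r' * |ξ j l - ξ j' l| ≤ 1) (c : ι → ℝ),
      av r' (fun z => ∏ i, En L r ξ (a i) z ^ p) c ≤ C * ∏ i, En L r' ξ (a i) c ^ p := by
  classical
  obtain ⟨C0, Om, hOm⟩ := exists_band (ι := ι) hL
  obtain ⟨C1, hC1⟩ := exists_locally_constant_dir (ι := ι) hL1
  obtain ⟨C2, hC2⟩ := exists_lintegral_En_mul_om_le (ι := ι) hL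
  set Z : ℝ≥0∞ := ∫⁻ y, wt1 L y with hZ
  have hZt : Z ≠ ∞ := (lintegral_wt1_lt_top hL1).ne
  have hZ0 : Z ≠ 0 := lintegral_wt1_ne_zero
  set d := Fintype.card ι with hd
  set D : ℝ≥0 := max 1 C1 with hD
  set A : ℝ≥0 := ((C0 * D ^ d) ^ p) ^ Fintype.card I with hA
  set B : ℝ≥0 := (2 ^ L * Z.toNNReal) ^ d with hB
  set E : ℝ≥0 := ((C0 * (Z.toNNReal⁻¹ ^ d * C2)) ^ p) ^ Fintype.card I with hE
  refine ⟨A * B * E, fun J _ ξ T hT a r r' hr hrr hfreq c => ?_⟩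
  have hr' : 0 < r' := hr.trans_le hrr
  obtain ⟨hv, hen⟩ := hOm r hr
  set μ : ι → Measure ℝ := fun l => mu L r' (c l) with hμ
  have : ∀ l, IsProbabilityMeasure (μ l) := fun l => isProbabilityMeasure_mu hL1 hr' _
  set P : I → (ι → ℝ) → ℝ≥0∞ := fun i z => ‖bandSum (Om r) ξ (a i) z‖ₑ with hP
  have hPm : ∀ i, Measurable (P i) := fun i => (continuous_es _ _).measurable.enorm
  have hloc : ∀ i, ∀ S ⊆ T i, ∀ z : ι → ℝ, (∀ l ∈ S, |z l - c l| ≤ r') →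
      P i z ≤ D ^ S.card * (∫⋯∫⁻_S, P i ∂μ) z := by
    intro i S
    induction S using Finset.induction with
    | empty => intro _ z _; simp
    | insert l S hl ih =>
      intro hS z hz
      have h1 := hC1 (J × J) (fun p : J × J => ξ p.1 - ξ p.2)
        (fun p => a i p.1 * (starRingEnd ℂ) (a i p.2) * Om r (ξ p.1 - ξ p.2)) r' hr' l (c l) (by
          intro q hq
          have hq1 := left_ne_zero_of_mul (left_ne_zero_of_mul hq)
          have hq2 : a i q.2 ≠ 0 := by
            have := right_ne_zero_of_mul (left_ne_zero_of_mul hq)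
            simpa using this
          refine hfreq i q.1 q.2 hq1 hq2 ?_ l (hS (Finset.mem_insert_self _ _))
          by_contra hc
          exact right_ne_zero_of_mul hq (hv _ (not_lt.1 hc))) z (hz l (Finset.mem_insert_self _ _))
      calc P i z ≤ C1 * ∫⁻ y, P i (Function.update z l y) ∂(μ l) := h1
        _ ≤ D * ∫⁻ y, D ^ S.card * (∫⋯∫⁻_S, P i ∂μ) (Function.update z l y) ∂(μ l) := by
            gcongr with y
            · exact le_max_right _ _
            · refine ih (fun x hx => hS (Finset.mem_insert_of_mem hx)) _ fun l' hl' => ?_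
              have : l' ≠ l := fun h => hl (h ▸ hl')
              rw [Function.update_of_ne this]
              exact hz l' (Finset.mem_insert_of_mem hl')
        _ = _ := by
            rw [lintegral_const_mul' _ _ (by finiteness), ← mul_assoc, lmarginal_insert _ (hPm i) hl,
              Finset.card_insert_of_notMem hl, pow_succ' (D : ℝ≥0∞)]
  set F : I → (ι → ℝ) → ℝ≥0∞ := fun i => ∫⋯∫⁻_(T i), P i ∂μ with hF
  have hFm : ∀ i, Measurable (F i) := fun i => (hPm i).lmarginal μ
  have hEnF : ∀ z ∈ closedBall c r', ∏ i, En L r ξ (a i) z ^ p ≤ A * ∏ i, F i z ^ p := by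
    intro z hz
    have h1 : ∀ i, En L r ξ (a i) z ≤ (C0 * D ^ d : ℝ≥0) * F i z := by
      intro i
      refine ((hen J ξ (a i) z).1).trans ?_
      push_cast
      rw [mul_assoc]
      gcongr
      refine (hloc i (T i) subset_rfl z fun l _ => ?_).trans ?_
      · rw [mem_closedBall, dist_eq_norm] at hz
        exact (norm_le_pi_norm (z - c) l).trans hz
      · gcongr
        · exact_mod_cast le_max_left _ _
        · exact Finset.card_le_univ _
    calc ∏ i, En L r ξ (a i) z ^ p ≤ ∏ i, (((C0 * D ^ d : ℝ≥0) : ℝ≥0∞) ^ p * F i z ^ p) := by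
          gcongr with i _
          rw [← ENNReal.mul_rpow_of_nonneg _ _ hp]
          gcongr
          exact h1 i
      _ = _ := by
          rw [Finset.prod_mul_distrib, hA]
          simp [ENNReal.coe_rpow_of_nonneg _ hp]
  have hintg : av r' (fun z => ∏ i, F i z ^ p) c ≤ B * ∫⁻ z, ∏ i, F i z ^ p ∂(Measure.pi μ) := by
    have hBe : (B : ℝ≥0∞) = (2 ^ L * Z) ^ d := by
      rw [hB]; push_cast; rw [ENNReal.coe_toNNReal hZt]
    have : ∀ l, SigmaFinite ((volume : Measure ℝ).withDensity ((fun l => dens L r' (c l)) l)) :=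
      fun l => (inferInstance : SigmaFinite (μ l))
    have h2 := lintegral_pi_withDensity (ι := ι) (ρ := fun l => dens L r' (c l))
      (fun l => by fun_prop) (f := fun z => ∏ i, F i z ^ p) (by fun_prop)
    have h3 : ∫⁻ z, ∏ i, F i z ^ p ∂(Measure.pi μ) = ∫⁻ z, (∏ l, dens L r' (c l) (z l)) *
      ∏ i, F i z ^ p := h2
    rw [h3, hBe, av, ← lintegral_const_mul' _ _ (by
      simp only [ne_eq, ENNReal.inv_eq_top, ENNReal.ofReal_eq_zero, not_le]; positivity),
      ← lintegral_const_mul' _ _ (by finiteness)]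
    refine le_trans ?_ (setLIntegral_le_lintegral (closedBall c r') _)
    refine setLIntegral_mono_ae' measurableSet_closedBall (Eventually.of_forall fun z hz => ?_)
    rw [← mul_assoc]
    gcongr
    exact le_prod_dens hL1 hr' c z hz
  have hPint : ∀ i, ∫⁻ z, P i z ∂(Measure.pi μ) ≤
      (C0 * (Z.toNNReal⁻¹ ^ d * C2) : ℝ≥0) * En L r' ξ (a i) c := by
    intro i
    have : ∀ l, SigmaFinite ((volume : Measure ℝ).withDensity ((fun l => dens L r' (c l)) l)) :=
      fun l => (inferInstance : SigmaFinite (μ l))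
    have h2 := lintegral_pi_withDensity (ι := ι) (ρ := fun l => dens L r' (c l))
      (fun l => by fun_prop) (f := P i) (hPm i)
    have h3 : ∫⁻ z, P i z ∂(Measure.pi μ) = ∫⁻ z, (∏ l, dens L r' (c l) (z l)) * P i z := h2
    have hZi : ((Z.toNNReal⁻¹ : ℝ≥0) : ℝ≥0∞) = Z⁻¹ := by
      rw [ENNReal.coe_inv (by
        simp only [ne_eq, ENNReal.toNNReal_eq_zero_iff, not_or]; exact ⟨hZ0, hZt⟩),
        ENNReal.coe_toNNReal hZt]
    have hZit : Z⁻¹ ≠ ∞ := ENNReal.inv_ne_top.2 hZ0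
    calc ∫⁻ z, P i z ∂(Measure.pi μ)
        ≤ ∫⁻ z, (C0 * Z⁻¹ ^ d) * (En L r ξ (a i) z * om L r' (c - z)) := by
          rw [h3]
          refine lintegral_mono fun z => ?_
          simp only
          calc _ ≤ (Z⁻¹ ^ d * om L r' (c - z)) * (C0 * En L r ξ (a i) z) := by
                gcongr
                · exact prod_dens_le hr' c z
                · exact (hen J ξ (a i) z).2
            _ = _ := by ring
      _ ≤ (C0 * Z⁻¹ ^ d) * (C2 * En L r' ξ (a i) c) := by
          rw [lintegral_const_mul' _ _ (by finiteness)]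
          gcongr
          exact hC2 J ξ (a i) r r' hr hrr c
      _ = _ := by
          push_cast
          rw [hZi]; ring
  calc av r' (fun z => ∏ i, En L r ξ (a i) z ^ p) c
      ≤ av r' (fun z => A * ∏ i, F i z ^ p) c := av_mono hEnF
    _ = A * av r' (fun z => ∏ i, F i z ^ p) c := av_const_mul (by fun_prop) _ _
    _ ≤ A * (B * ∏ i, (∫⁻ z, F i z ∂(Measure.pi μ)) ^ p) := by
        gcongr
        refine hintg.trans ?_
        gcongr
        have := finner (μ := μ) T hFm (fun i l hl x y => lmarginal_update_of_mem μ hl _ _ _) hp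
          (fun l => hT l _ fun i hi => (Finset.mem_filter.1 hi).2) Finset.univ (0 : ι → ℝ)
        simpa [lmarginal_univ] using this
    _ ≤ A * (B * ∏ i, ((C0 * (Z.toNNReal⁻¹ ^ d * C2) : ℝ≥0) ^ p * En L r' ξ (a i) c ^ p)) := by
        gcongr with i _
        rw [← ENNReal.mul_rpow_of_nonneg _ _ hp]
        gcongr
        refine le_trans (le_of_eq ?_) (hPint i)
        have h1 := lmarginal_eq_of_subset (μ := μ) (Finset.subset_univ (T i)) (hFm i) (hPm i)
          (lmarginal_lmarginal (μ := μ) (T i) (P i))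
        simpa [lmarginal_univ] using congrFun h1 0
    _ = _ := by
        rw [Finset.prod_mul_distrib, hE]
        simp only [Finset.prod_const, Finset.card_univ, ENNReal.coe_mul, ENNReal.coe_pow,
          ENNReal.coe_rpow_of_nonneg _ hp]
        ring

end

section

variable {ι : Type} [Fintype ι] {L : ℕ}

lemma wt_le_mul {K r r' : ℝ} (hK : 1 ≤ K) (hr : 0 < r) (hr' : 0 < r') {y y' : ι → ℝ}
    (h : ‖y'‖ / r' ≤ K * (‖y‖ / r)) : wt L r y ≤ ENNReal.ofReal (K ^ L) * wt L r' y' := by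
  unfold wt
  rw [← ENNReal.ofReal_mul (by positivity)]
  apply ENNReal.ofReal_le_ofReal
  have h1 : 1 + ‖y'‖ / r' ≤ K * (1 + ‖y‖ / r) := by linarith
  have h2 : (1 + ‖y'‖ / r') ^ L ≤ K ^ L * (1 + ‖y‖ / r) ^ L := by
    rw [← mul_pow]; gcongr
  rw [← div_eq_mul_inv, inv_eq_one_div, div_le_div_iff₀ (by positivity) (by positivity), one_mul]
  exact h2

lemma om_le_mul {K r r' : ℝ} (hK : 1 ≤ K) (hr : 0 < r) (hr' : 0 < r') {y y' : ι → ℝ}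
    (h : ‖y'‖ / r' ≤ K * (‖y‖ / r)) (h' : r' ≤ K * r) :
    om L r y ≤ ENNReal.ofReal (K ^ (L + Fintype.card ι)) * om L r' y' := by
  unfold om
  rw [pow_add, mul_comm (K ^ L), ENNReal.ofReal_mul (by positivity), mul_mul_mul_comm]
  refine mul_le_mul' ?_ (wt_le_mul hK hr hr' h)
  rw [← ENNReal.ofReal_mul (by positivity)]
  apply ENNReal.ofReal_le_ofReal
  rw [← div_eq_mul_inv, inv_eq_one_div, div_le_div_iff₀ (by positivity) (by positivity), one_mul,
    ← mul_pow]
  gcongr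

lemma En_le_mul {K r r' : ℝ} (hK : 1 ≤ K) (hr : 0 < r) (hr' : 0 < r') (h : r ≤ K * r')
    (h' : r' ≤ K * r) {J : Type} [Fintype J] (ξ : J → ι → ℝ) (a : J → ℂ) (c : ι → ℝ) :
    En L r ξ a c ≤ ENNReal.ofReal (K ^ (L + Fintype.card ι)) * En L r' ξ a c := by
  unfold En
  rw [← lintegral_const_mul' _ _ (by simp)]
  refine lintegral_mono fun y => ?_
  simp only
  rw [mul_left_comm]
  gcongr
  refine om_le_mul hK hr hr' ?_ h'
  rw [mul_div_assoc', div_le_div_iff₀ hr' hr]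
  nlinarith [norm_nonneg (c - y)]

lemma SV.rpow_nat {N : ℕ} {R : ℝ} {g : (ι → ℝ) → ℝ≥0∞} (hR : 0 < R) (hg : SV N R g) {p : ℝ}
    (hp : 0 ≤ p) {P : ℕ} (hP : p ≤ P) : SV (N * P) R (fun z => g z ^ p) := by
  refine ⟨hg.meas.pow_const p, fun z z' => (ENNReal.rpow_le_rpow (hg.le z z') hp).trans ?_⟩
  rw [ENNReal.mul_rpow_of_nonneg _ _ hp]
  gcongr
  have h1 : 0 ≤ ‖z - z'‖ / R := by positivity
  rw [ENNReal.ofReal_rpow_of_nonneg (by positivity) hp]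
  apply ENNReal.ofReal_le_ofReal
  rw [pow_mul, ← Real.rpow_natCast _ P]
  exact Real.rpow_le_rpow_of_exponent_le (one_le_pow₀ (by linarith)) hP

lemma SV.prod {N : ℕ} {R : ℝ} {I : Type} {g : I → (ι → ℝ) → ℝ≥0∞} (s : Finset I) (hR : 0 < R)
    (hg : ∀ i ∈ s, SV N R (g i)) : SV (N * s.card) R (fun z => ∏ i ∈ s, g i z) := by
  classical
  induction s using Finset.induction with
  | empty => exact ⟨by simp, by simp⟩
  | insert i s hi ih =>
    have h := (hg i (Finset.mem_insert_self _ _)).mul hR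
      (ih fun j hj => hg j (Finset.mem_insert_of_mem hj))
    simp only [Finset.prod_insert hi, Finset.card_insert_of_notMem hi]
    convert h using 1
    ring

/-- Replacing a function by its averages against a slowly varying weight. -/
lemma lintegral_mul_le_av {H : ℕ} {r : ℝ} (hr : 0 < r) {f h : (ι → ℝ) → ℝ≥0∞} (hf : Measurable f)
    (hh : SV H r h) : ∫⁻ z, f z * h z ≤ 2 ^ H * ∫⁻ c, av r f c * h c := by
  have hm := hh.meas
  rw [← lintegral_av hr (by fun_prop), ← lintegral_const_mul' _ _ (by finiteness)]
  refine lintegral_mono fun c => ?_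
  simp only
  calc av r (fun z => f z * h z) c ≤ av r (fun z => (2 ^ H * h c) * f z) c := by
        refine av_mono fun z hz => ?_
        rw [mul_comm]
        gcongr
        exact hh.le_of_mem hr (by rwa [mem_closedBall, dist_eq_norm] at hz)
    _ = _ := by rw [av_const_mul hf]; ring

lemma exists_ml_int_step (hL : Fintype.card ι < L) (hL1 : 1 < L) (I : Type) [Fintype I]
    {p : ℝ} (hp : 0 ≤ p) (H : ℕ) :
    ∃ C : ℝ≥0, ∀ (J : Type) [Fintype J] (ξ : J → ι → ℝ) (T : I → Finset ι)
      (_ : ∀ l, ∀ s : Finset I, (∀ i ∈ s, l ∉ T i) → (s.card : ℝ) * p ≤ 1) (a : I → J → ℂ)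
      (r r' : ℝ) (_ : 0 < r) (_ : r ≤ r')
      (_ : ∀ i, ∀ j j', a i j ≠ 0 → a i j' ≠ 0 → r * ‖ξ j - ξ j'‖ < 4 →
        ∀ l ∈ T i, r' * |ξ j l - ξ j' l| ≤ 1) (h : (ι → ℝ) → ℝ≥0∞) (_ : SV H r' h),
      ∫⁻ z, (∏ i, En L r ξ (a i) z ^ p) * h z ≤ C * ∫⁻ z, (∏ i, En L r' ξ (a i) z ^ p) * h z := by
  obtain ⟨C, hC⟩ := exists_ml_step hL hL1 I hp
  refine ⟨2 ^ H * C, fun J _ ξ T hT a r r' hr hrr hfreq h hh => ?_⟩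
  have hr' := hr.trans_le hrr
  have hm : ∀ r i, Measurable (En L r ξ (a i)) := fun r i => measurable_En ξ (a i)
  refine (lintegral_mul_le_av hr' (by fun_prop) hh).trans ?_
  push_cast
  rw [mul_assoc, ← lintegral_const_mul' _ _ ENNReal.coe_ne_top]
  gcongr 2 ^ H * ?_
  refine lintegral_mono fun z => ?_
  simp only
  rw [← mul_assoc]
  gcongr
  exact hC J ξ T hT a r r' hr hrr hfreq z

/-- Iterating the multilinear step through a geometric sequence of scales. -/
lemma exists_ml_scales (hL : Fintype.card ι < L) (hL1 : 1 < L) (I : Type) [Fintype I]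
    {p : ℝ} (hp : 0 ≤ p) (H : ℕ) {ε : ℝ} (hε : 0 < ε) :
    ∃ δ : ℝ, 0 < δ ∧ ∀ E r₀ : ℝ, 1 ≤ E → 1 ≤ r₀ →
    ∃ C : ℝ≥0, ∀ (J : Type) [Fintype J] (ξ : J → ι → ℝ) (T : I → Finset ι)
      (_ : ∀ l, ∀ s : Finset I, (∀ i ∈ s, l ∉ T i) → (s.card : ℝ) * p ≤ 1) (a : I → J → ℂ)
      (R : ℝ) (_ : 1 ≤ R)
      (_ : ∀ i, ∀ j j', a i j ≠ 0 → a i j' ≠ 0 →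
        ∀ l ∈ T i, |ξ j l - ξ j' l| ≤ δ * ‖ξ j - ξ j'‖ + E / R)
      (h : (ι → ℝ) → ℝ≥0∞) (_ : SV H R h),
      ∫⁻ z, (∏ i, En L r₀ ξ (a i) z ^ p) * h z ≤
        C * ENNReal.ofReal (R ^ ε) * ∫⁻ z, (∏ i, En L R ξ (a i) z ^ p) * h z := by
  obtain ⟨C1, hC1⟩ := exists_ml_int_step hL hL1 I hp H
  set q : ℝ := max 2 ((C1 : ℝ) ^ ε⁻¹) with hq
  have hq2 : 2 ≤ q := le_max_left _ _
  have hq0 : 0 < q := by linarith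
  have hCq : (C1 : ℝ) ≤ q ^ ε := by
    calc (C1 : ℝ) = ((C1 : ℝ) ^ ε⁻¹) ^ ε := by
          rw [← Real.rpow_mul C1.coe_nonneg, inv_mul_cancel₀ hε.ne', Real.rpow_one]
      _ ≤ q ^ ε := by gcongr; exact le_max_right _ _
  refine ⟨1 / (8 * q), by positivity, fun E r₀ hE hr₀ => ?_⟩
  set K : ℝ := 2 * E * r₀ * q with hK
  have hK1 : 1 ≤ K := by
    rw [hK]; nlinarith [mul_le_mul hE hr₀ zero_le_one (by linarith)]
  refine ⟨((Real.toNNReal (K ^ (L + Fintype.card ι))) ^ p) ^ Fintype.card I,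
    fun J _ ξ T hT a R hR hfreq h hh => ?_⟩
  have hstep : ∀ k : ℕ, (k = 0 ∨ r₀ * q ^ k ≤ R / (2 * E)) →
      ∫⁻ z, (∏ i, En L r₀ ξ (a i) z ^ p) * h z ≤
        (C1 : ℝ≥0∞) ^ k * ∫⁻ z, (∏ i, En L (r₀ * q ^ k) ξ (a i) z ^ p) * h z := by
    intro k
    induction k with
    | zero => intro _; simp
    | succ k ih =>
      intro hk
      have hk' : r₀ * q ^ (k + 1) ≤ R / (2 * E) := by simpa using hk
      have hmono : r₀ * q ^ k ≤ r₀ * q ^ (k + 1) := by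
        gcongr; exacts [by linarith, Nat.le_succ k]
      have hER : R / (2 * E) ≤ R := div_le_self (by linarith) (by linarith)
      refine (ih (Or.inr (hmono.trans hk'))).trans ?_
      rw [pow_succ, mul_assoc]
      gcongr
      refine hC1 J ξ T hT a _ _ (by positivity) hmono (fun i j j' hj hj' hlt l hl => ?_) h
        (hh.mono (by positivity) (hk'.trans hER))
      calc r₀ * q ^ (k + 1) * |ξ j l - ξ j' l|
          ≤ r₀ * q ^ (k + 1) * (1 / (8 * q) * ‖ξ j - ξ j'‖ + E / R) := by
            gcongr; exact hfreq i j j' hj hj' l hl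
        _ = (r₀ * q ^ k * ‖ξ j - ξ j'‖) / 8 + r₀ * q ^ (k + 1) * (E / R) := by
            rw [pow_succ]; field_simp
        _ ≤ 4 / 8 + R / (2 * E) * (E / R) := by gcongr
        _ = 1 := by field_simp; norm_num
  obtain ⟨m, hm1, hm2⟩ : ∃ m : ℕ, (m = 0 ∨ r₀ * q ^ m ≤ R / (2 * E)) ∧
      R / (2 * E) < r₀ * q ^ (m + 1) := by
    by_cases hc : r₀ ≤ R / (2 * E)
    · obtain ⟨m, h1, h2⟩ := exists_nat_pow_near (x := R / (2 * E) / r₀) (y := q)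
        ((one_le_div (by positivity)).2 hc) (by linarith)
      rw [le_div_iff₀ (by positivity)] at h1
      rw [div_lt_iff₀ (by positivity)] at h2
      exact ⟨m, Or.inr (by linarith), by linarith⟩
    · refine ⟨0, Or.inl rfl, ?_⟩
      push Not at hc
      nlinarith
  have hER : R / (2 * E) ≤ R := div_le_self (by linarith) (by linarith)
  have hrm1 : r₀ * q ^ m ≤ K * R := by
    rcases hm1 with h0 | h0
    · rw [h0, hK, pow_zero, mul_one]
      have : 1 ≤ 2 * E * q * R := by
        have := mul_le_mul hE hR zero_le_one (by linarith); nlinarith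
      nlinarith
    · nlinarith
  have hrm2 : R ≤ K * (r₀ * q ^ m) := by
    rw [div_lt_iff₀ (by positivity)] at hm2
    calc R ≤ 2 * E * q * (r₀ * q ^ m) := by rw [pow_succ] at hm2; linarith
      _ ≤ K * (r₀ * q ^ m) := by
        gcongr; rw [hK]; nlinarith [mul_pos (show 0 < E by linarith) hq0]
  have hCm : (C1 : ℝ≥0∞) ^ m ≤ ENNReal.ofReal (R ^ ε) := by
    rw [← ENNReal.ofReal_coe_nnreal, ← ENNReal.ofReal_pow C1.coe_nonneg]
    apply ENNReal.ofReal_le_ofReal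
    have hqm : q ^ m ≤ R := by
      rcases hm1 with h0 | h0
      · simpa [h0] using hR
      · have : 0 < q ^ m := by positivity
        nlinarith
    calc (C1 : ℝ) ^ m ≤ (q ^ ε) ^ m := by gcongr
      _ = (q ^ m) ^ ε := by
          rw [← Real.rpow_natCast, ← Real.rpow_natCast, ← Real.rpow_mul hq0.le,
            ← Real.rpow_mul hq0.le, mul_comm]
      _ ≤ R ^ ε := by gcongr
  refine (hstep m hm1).trans ?_
  rw [mul_comm (_ : ℝ≥0∞) (ENNReal.ofReal (R ^ ε)), mul_assoc,
    ← lintegral_const_mul' _ _ ENNReal.coe_ne_top]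
  gcongr ?_ * ?_
  refine lintegral_mono fun z => ?_
  simp only
  rw [← mul_assoc]
  gcongr
  calc ∏ i, En L (r₀ * q ^ m) ξ (a i) z ^ p
      ≤ ∏ i, (ENNReal.ofReal (K ^ (L + Fintype.card ι)) ^ p * En L R ξ (a i) z ^ p) := by
        gcongr with i
        rw [← ENNReal.mul_rpow_of_nonneg _ _ hp]
        gcongr
        exact En_le_mul hK1 (by positivity) (by linarith) hrm1 hrm2 ξ (a i) z
    _ = _ := by
        rw [Finset.prod_mul_distrib]
        simp [ENNReal.coe_rpow_of_nonneg _ hp, ENNReal.ofReal]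

end

section

variable {ι : Type} [Fintype ι] [DecidableEq ι] {L : ℕ}

/-- A matrix whose distortion is at most `K`. -/
structure Distort (K : ℝ) (A : Matrix ι ι ℝ) : Prop where
  le : ∀ w, ‖A *ᵥ w‖ ≤ K * ‖w‖
  ge : ∀ w, ‖w‖ ≤ K * ‖A *ᵥ w‖

lemma Distort.det_ne_zero {K : ℝ} {A : Matrix ι ι ℝ} (h : Distort K A) : A.det ≠ 0 := by
  intro h0
  obtain ⟨v, hv, hv0⟩ := Matrix.exists_mulVec_eq_zero_iff.2 h0
  have := h.ge v
  rw [hv0, norm_zero, mul_zero] at this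
  exact hv (norm_le_zero_iff.1 this)

lemma Distort.det_le {K : ℝ} {A : Matrix ι ι ℝ} (h : Distort K A) :
    |A.det| ≤ (Fintype.card ι).factorial * K ^ Fintype.card ι := by
  have h1 : ∀ i j, AbsoluteValue.abs (A i j) ≤ K := by
    intro i j
    have h2 := h.le (Pi.single j 1)
    rw [Pi.norm_single, norm_one, mul_one, Matrix.mulVec_single_one] at h2
    exact (norm_le_pi_norm (A.col j) i).trans h2
  simpa using Matrix.det_le h1

lemma lintegral_eq_det_mul {A : Matrix ι ι ℝ} (hA : A.det ≠ 0) {f : (ι → ℝ) → ℝ≥0∞}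
    (hf : Measurable f) : ∫⁻ y, f y = ENNReal.ofReal |A.det| * ∫⁻ w, f (A *ᵥ w) := by
  have h := Real.map_matrix_volume_pi_eq_smul_volume_pi hA
  have hm : Measurable (Matrix.toLin' A) :=
    (LinearMap.continuous_of_finiteDimensional _).measurable
  have h2 : ∫⁻ w, f (A *ᵥ w) = ∫⁻ y, f y ∂(Measure.map (Matrix.toLin' A) volume) := by
    rw [lintegral_map hf hm]; simp
  rw [h2, h, lintegral_smul_measure, smul_eq_mul, ← mul_assoc, ← ENNReal.ofReal_mul (abs_nonneg _),
    ← abs_mul, mul_inv_cancel₀ hA]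
  simp

omit [DecidableEq ι] in
lemma es_mulVec {J : Type} [Fintype J] (A : Matrix ι ι ℝ) (ξ : J → ι → ℝ) (a : J → ℂ)
    (w : ι → ℝ) : es ξ a (A *ᵥ w) = es (fun j => Aᵀ *ᵥ ξ j) a w := by
  simp only [es]
  refine Finset.sum_congr rfl fun j _ => ?_
  rw [Matrix.dotProduct_mulVec, Matrix.mulVec_transpose]

omit [DecidableEq ι] in
lemma Distort.om_mulVec_le {K r : ℝ} (hK : 1 ≤ K) (hr : 0 < r) {A : Matrix ι ι ℝ}
    (h : Distort K A) (v : ι → ℝ) :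
    om L r (A *ᵥ v) ≤ ENNReal.ofReal (K ^ (L + Fintype.card ι)) * om L r v := by
  refine om_le_mul hK hr hr ?_ (by nlinarith)
  rw [← mul_div_assoc]
  gcongr
  exact h.ge v

omit [DecidableEq ι] in
lemma Distort.om_le_mulVec {K r : ℝ} (hK : 1 ≤ K) (hr : 0 < r) {A : Matrix ι ι ℝ}
    (h : Distort K A) (v : ι → ℝ) :
    om L r v ≤ ENNReal.ofReal (K ^ (L + Fintype.card ι)) * om L r (A *ᵥ v) := by
  refine om_le_mul hK hr hr ?_ (by nlinarith)
  rw [← mul_div_assoc]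
  gcongr
  exact h.le v

lemma Distort.En_mulVec_le {K r : ℝ} (hK : 1 ≤ K) (hr : 0 < r) {A : Matrix ι ι ℝ}
    (h : Distort K A) {J : Type} [Fintype J] (ξ : J → ι → ℝ) (a : J → ℂ) (c : ι → ℝ) :
    En L r ξ a (A *ᵥ c) ≤ ENNReal.ofReal (K ^ (L + Fintype.card ι)) *
      (ENNReal.ofReal |A.det| * En L r (fun j => Aᵀ *ᵥ ξ j) a c) := by
  unfold En
  rw [lintegral_eq_det_mul h.det_ne_zero (by fun_prop (disch := exact measurable_es_sq _ _)),
    mul_left_comm]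
  refine mul_le_mul' le_rfl ?_
  rw [← lintegral_const_mul' _ _ (by simp)]
  refine lintegral_mono fun w => ?_
  simp only
  rw [es_mulVec, mul_left_comm, ← Matrix.mulVec_sub]
  gcongr
  exact h.om_mulVec_le hK hr _

lemma Distort.det_mul_En_le {K r : ℝ} (hK : 1 ≤ K) (hr : 0 < r) {A : Matrix ι ι ℝ}
    (h : Distort K A) {J : Type} [Fintype J] (ξ : J → ι → ℝ) (a : J → ℂ) (c : ι → ℝ) :
    ENNReal.ofReal |A.det| * En L r (fun j => Aᵀ *ᵥ ξ j) a c ≤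
      ENNReal.ofReal (K ^ (L + Fintype.card ι)) * En L r ξ a (A *ᵥ c) := by
  unfold En
  rw [lintegral_eq_det_mul h.det_ne_zero (f := fun y => ‖es ξ a y‖ₑ ^ 2 * om L r (A *ᵥ c - y))
    (by fun_prop (disch := exact measurable_es_sq _ _)),
    mul_left_comm]
  refine mul_le_mul' le_rfl ?_
  rw [← lintegral_const_mul' _ _ (by simp)]
  refine lintegral_mono fun w => ?_
  simp only
  rw [es_mulVec, mul_left_comm, ← Matrix.mulVec_sub]
  gcongr
  exact h.om_le_mulVec hK hr _

/-- Multi-scale multilinear estimate after a linear change of variables. -/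
lemma exists_ml_lin (hL : Fintype.card ι < L) (hL1 : 1 < L) (I : Type) [Fintype I]
    {p : ℝ} (hp : 0 ≤ p) {K : ℝ} (hK : 1 ≤ K) {ε : ℝ} (hε : 0 < ε) :
    ∃ δ : ℝ, 0 < δ ∧ ∀ E r₀ : ℝ, 1 ≤ E → 1 ≤ r₀ →
    ∃ C : ℝ≥0, ∀ (J : Type) [Fintype J] (ξ : J → ι → ℝ) (T : I → Finset ι)
      (_ : ∀ l, ∀ s : Finset I, (∀ i ∈ s, l ∉ T i) → (s.card : ℝ) * p ≤ 1) (a : I → J → ℂ)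
      (R : ℝ) (_ : 1 ≤ R) (A : Matrix ι ι ℝ) (_ : Distort K A)
      (_ : ∀ i, ∀ j j', a i j ≠ 0 → a i j' ≠ 0 → ∀ l ∈ T i,
        |(Aᵀ *ᵥ (ξ j - ξ j')) l| ≤ δ * ‖Aᵀ *ᵥ (ξ j - ξ j')‖ + E / R) (c : ι → ℝ),
      av R (fun z => ∏ i, En L r₀ ξ (a i) z ^ p) c ≤
        C * ENNReal.ofReal (R ^ ε) * ∏ i, En L R ξ (a i) c ^ p := by
  obtain ⟨P, hP⟩ := exists_nat_ge p
  set d := Fintype.card ι with hd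
  set H := (d + 1) + L * P * Fintype.card I with hH
  obtain ⟨δ, hδ, hml⟩ := exists_ml_scales hL hL1 I hp H hε
  refine ⟨δ, hδ, fun E r₀ hE hr₀ => ?_⟩
  obtain ⟨C, hC⟩ := hml E r₀ hE hr₀
  set W : ℝ≥0∞ := ∫⁻ y : ι → ℝ, wt (d + 1) 1 y with hW
  have hWt : W ≠ ∞ := (lintegral_wt_one_lt_top (by omega)).ne
  set D : ℝ := d.factorial * K ^ d with hD
  set κ : ℝ≥0 := Real.toNNReal (K ^ (L + d)) with hκ
  set κ' : ℝ≥0 := Real.toNNReal (K ^ (H + d)) with hκ'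
  refine ⟨2 ^ H * (D.toNNReal * (κ' * ((κ ^ p) ^ Fintype.card I * (C *
    (W.toNNReal * (κ ^ p) ^ Fintype.card I))))), fun J _ ξ T hT a R hR A hA hfreq c₀ => ?_⟩
  have hR0 : 0 < R := by linarith
  have hm : ∀ {κ : Type} [Fintype κ] r (ξ : κ → ι → ℝ) (a : κ → ℂ), Measurable (En L r ξ a) :=
    fun r ξ a => measurable_En ξ a
  obtain ⟨c, rfl⟩ : ∃ c, A *ᵥ c = c₀ := by
    refine ⟨A⁻¹ *ᵥ c₀, ?_⟩
    rw [Matrix.mulVec_mulVec, Matrix.mul_nonsing_inv _ (isUnit_iff_ne_zero.2 hA.det_ne_zero),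
      Matrix.one_mulVec]
  set ξ' : J → ι → ℝ := fun j => Aᵀ *ᵥ ξ j with hξ'
  set S : ℝ≥0∞ := ENNReal.ofReal |A.det| with hS
  have hSD : S ≤ D.toNNReal := ENNReal.ofReal_le_ofReal hA.det_le
  have hSt : S ≠ ∞ := ENNReal.ofReal_ne_top
  have hpow : ∀ (x y : ℝ≥0∞) (f g : I → ℝ≥0∞), (∀ i, x * f i ≤ y * g i) →
      (x ^ p) ^ Fintype.card I * ∏ i, f i ^ p ≤ (y ^ p) ^ Fintype.card I * ∏ i, g i ^ p := by
    intro x y f g h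
    have h1 : ∀ (x : ℝ≥0∞) (f : I → ℝ≥0∞),
        (x ^ p) ^ Fintype.card I * ∏ i, f i ^ p = ∏ i, (x * f i) ^ p := fun x f => by
      simp only [ENNReal.mul_rpow_of_nonneg _ _ hp, Finset.prod_mul_distrib]
      simp
    rw [h1, h1]
    refine Finset.prod_le_prod' fun i _ => ?_
    exact ENNReal.rpow_le_rpow (h i) hp
  set G : (ι → ℝ) → ℝ≥0∞ := fun w => ∏ i, En L r₀ ξ' (a i) w ^ p with hG
  set G' : (ι → ℝ) → ℝ≥0∞ := fun w => ∏ i, En L R ξ' (a i) w ^ p with hG'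
  have hGm : Measurable G := by fun_prop
  have hG'm : SV (L * P * Fintype.card I) R G' :=
    SV.prod Finset.univ hR0 fun i _ => (sv_En hR0 ξ' (a i)).rpow_nat hR0 hp hP
  have h1 : ∫⁻ w, G w * om H R (c - w) ≤ C * ENNReal.ofReal (R ^ ε) * (W * G' c) := by
    have h2 := hC J ξ' T hT a R hR (fun i j j' hj hj' l hl => by
        simpa only [hξ', ← Matrix.mulVec_sub, ← Pi.sub_apply] using hfreq i j j' hj hj' l hl)
        (fun w => om H R (w - c)) ((sv_om hR0).translate c)
    simp only [← om_sub_comm c] at h2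
    refine h2.trans ?_
    gcongr
    refine le_trans (le_of_eq ?_) (hG'm.lintegral_om_mul_le (L := d + 1) hR0 c)
    refine lintegral_congr fun w => ?_
    rw [mul_comm, om_sub_comm]
  calc av R (fun z => ∏ i, En L r₀ ξ (a i) z ^ p) (A *ᵥ c)
      ≤ 2 ^ H * ∫⁻ y, (∏ i, En L r₀ ξ (a i) y ^ p) * om H R (A *ᵥ c - y) := av_le_conv hR0 _ _
    _ = 2 ^ H * (S * ∫⁻ w, (∏ i, En L r₀ ξ (a i) (A *ᵥ w) ^ p) * om H R (A *ᵥ c - A *ᵥ w)) := by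
        rw [lintegral_eq_det_mul hA.det_ne_zero (by fun_prop)]
    _ ≤ 2 ^ H * (S * ∫⁻ w, κ' * ((κ ^ p) ^ Fintype.card I * (S ^ p) ^ Fintype.card I) *
          (G w * om H R (c - w))) := by
        refine mul_le_mul' le_rfl (mul_le_mul' le_rfl (lintegral_mono fun w => ?_))
        simp only
        rw [← Matrix.mulVec_sub]
        have h3 : ∏ i, En L r₀ ξ (a i) (A *ᵥ w) ^ p ≤
            ((κ ^ p) ^ Fintype.card I * (S ^ p) ^ Fintype.card I) * G w := by
          have := hpow 1 (κ * S) (fun i => En L r₀ ξ (a i) (A *ᵥ w)) (fun i => En L r₀ ξ' (a i) w)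
            fun i => by
              rw [one_mul, mul_assoc]
              exact hA.En_mulVec_le hK (by linarith) ξ (a i) w
          rw [ENNReal.mul_rpow_of_nonneg _ _ hp, mul_pow] at this
          simpa using this
        calc _ ≤ ((κ ^ p) ^ Fintype.card I * (S ^ p) ^ Fintype.card I) * G w *
              (κ' * om H R (c - w)) := by
              gcongr
              exact hA.om_mulVec_le hK hR0 _
          _ = _ := by ring
    _ = 2 ^ H * (S * (κ' * ((κ ^ p) ^ Fintype.card I * (S ^ p) ^ Fintype.card I) *
          ∫⁻ w, G w * om H R (c - w))) := by
        rw [lintegral_const_mul]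
        fun_prop
    _ ≤ 2 ^ H * (D.toNNReal * (κ' * ((κ ^ p) ^ Fintype.card I * (S ^ p) ^ Fintype.card I) *
          (C * ENNReal.ofReal (R ^ ε) * (W * G' c)))) := by gcongr
    _ = 2 ^ H * (D.toNNReal * (κ' * ((κ ^ p) ^ Fintype.card I *
          (C * ENNReal.ofReal (R ^ ε) * (W * ((S ^ p) ^ Fintype.card I * G' c)))))) := by ring
    _ ≤ 2 ^ H * (D.toNNReal * (κ' * ((κ ^ p) ^ Fintype.card I *
          (C * ENNReal.ofReal (R ^ ε) * (W * ((κ ^ p) ^ Fintype.card I *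
            ∏ i, En L R ξ (a i) (A *ᵥ c) ^ p)))))) := by
        refine mul_le_mul' le_rfl (mul_le_mul' le_rfl (mul_le_mul' le_rfl (mul_le_mul' le_rfl
          (mul_le_mul' le_rfl (mul_le_mul' le_rfl ?_)))))
        exact hpow _ _ _ _ fun i => hA.det_mul_En_le hK hR0 ξ (a i) c
    _ = _ := by
        push_cast
        rw [ENNReal.coe_toNNReal hWt, ENNReal.coe_rpow_of_nonneg _ hp]
        ring

end

section

variable {n k : ℕ}

/-- The lift of a frequency to the paraboloid. -/
def Lam (x : Fin n → ℝ) : Fin (n + 1) → ℝ := Fin.cons (-(x ⬝ᵥ x)) x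

/-- The normal direction of the paraboloid. -/
def Nor (p : Fin n → ℝ) : Fin (n + 1) → ℝ := Fin.cons 1 (2 • p)

/-- Caps all of whose normals are linearly independent. -/
def Trans (M : ℝ) (τ : Fin k → Fin (n + 1) → ℤ) : Prop :=
  ∀ p : Fin k → Fin n → ℝ, (∀ i l, |M * p i l - τ i l.succ| ≤ 2) →
    LinearIndependent ℝ fun i => Nor (p i)

lemma dotProduct_cons (a : ℝ) (x : Fin n → ℝ) (v : Fin (n + 1) → ℝ) :
    (Fin.cons a x : Fin (n + 1) → ℝ) ⬝ᵥ v = a * v 0 + x ⬝ᵥ Fin.tail v := by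
  simp [dotProduct, Fin.sum_univ_succ, Fin.tail]

lemma abs_dotProduct_le {ι : Type} [Fintype ι] (x y : ι → ℝ) :
    |x ⬝ᵥ y| ≤ Fintype.card ι * ‖x‖ * ‖y‖ := by
  unfold dotProduct
  calc |∑ i, x i * y i| ≤ ∑ i, |x i * y i| := Finset.abs_sum_le_sum_abs _ _
    _ ≤ ∑ _i : ι, ‖x‖ * ‖y‖ := by
        gcongr with i
        rw [abs_mul]
        exact mul_le_mul (norm_le_pi_norm x i) (norm_le_pi_norm y i) (abs_nonneg _) (norm_nonneg _)
    _ = _ := by simp [mul_assoc]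

lemma Nor_dot_Lam_sub (p x x' : Fin n → ℝ) :
    Nor p ⬝ᵥ (Lam x - Lam x') = -((x - x') ⬝ᵥ (x + x' - (2 : ℝ) • p)) := by
  rw [Nor, dotProduct_cons]
  have : Fin.tail (Lam x - Lam x') = x - x' := by
    ext l; simp [Fin.tail, Lam]
  rw [this]
  simp only [Lam, Pi.sub_apply, Fin.cons_zero, sub_dotProduct, dotProduct_sub, dotProduct_add,
    dotProduct_smul, smul_dotProduct, dotProduct_comm p, dotProduct_comm x' x]
  simp
  ring

lemma norm_sub_le_norm_Lam_sub (x x' : Fin n → ℝ) : ‖x - x'‖ ≤ ‖Lam x - Lam x'‖ := by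
  refine (pi_norm_le_iff_of_nonneg (norm_nonneg _)).2 fun l => ?_
  simpa [Lam] using norm_le_pi_norm (Lam x - Lam x') l.succ

/-- The matrix with columns `Nor (p i)` followed by `(0, u l)`. -/
def frame (q : (Fin k → Fin n → ℝ) × (Fin (n + 1) → Fin n → ℝ)) :
    Matrix (Fin (n + 1)) (Fin (n + 1)) ℝ :=
  fun r l => (if h : (l : ℕ) < k then Nor (q.1 ⟨l, h⟩) r else 0) +
    (Fin.cons 0 (q.2 l) : Fin (n + 1) → ℝ) r

lemma continuous_frame : Continuous (frame (n := n) (k := k)) := by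
  refine continuous_matrix fun r l => ?_
  unfold frame Nor
  by_cases h : (l : ℕ) < k
  · simp only [h, dite_true]
    refine Fin.cases ?_ (fun r => ?_) r
    · simp only [Fin.cons_zero]; fun_prop
    · simp only [Fin.cons_succ]; fun_prop
  · simp only [h, dite_false]
    refine Fin.cases ?_ (fun r => ?_) r
    · simp only [Fin.cons_zero]; fun_prop
    · simp only [Fin.cons_succ]; fun_prop

/-- The admissible frames attached to a tuple of caps. -/
def frames (M : ℝ) (τ : Fin k → Fin (n + 1) → ℤ) :
    Set ((Fin k → Fin n → ℝ) × (Fin (n + 1) → Fin n → ℝ)) :=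
  {q | (∀ i l, |M * q.1 i l - τ i l.succ| ≤ 2) ∧
    (∀ l l' : Fin (n + 1), q.2 l ⬝ᵥ q.2 l' = if l = l' ∧ k ≤ l then 1 else 0) ∧
    ∀ l i i', q.2 l ⬝ᵥ (q.1 i - q.1 i') = 0}

lemma norm_le_of_mem_frames {M : ℝ} (hM : 0 < M) {τ : Fin k → Fin (n + 1) → ℤ} :
    ∃ B : ℝ, 0 ≤ B ∧ ∀ q ∈ frames M τ, (∀ i, ‖q.1 i‖ ≤ B) ∧ ∀ l, ‖q.2 l‖ ≤ 1 := by
  refine ⟨(‖fun (i : Fin k) (l : Fin (n + 1)) => (τ i l : ℝ)‖ + 2) / M, by positivity,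
    fun q hq => ⟨fun i => ?_, fun l => ?_⟩⟩
  · refine (pi_norm_le_iff_of_nonneg (by positivity)).2 fun l => ?_
    rw [le_div_iff₀ hM, Real.norm_eq_abs,
      show |q.1 i l| * M = |M * q.1 i l| by rw [abs_mul, abs_of_pos hM, mul_comm]]
    have h1 := hq.1 i l
    have h2 : |(τ i l.succ : ℝ)| ≤ ‖fun (i : Fin k) (l : Fin (n + 1)) => (τ i l : ℝ)‖ :=
      (norm_le_pi_norm (fun l : Fin (n + 1) => (τ i l : ℝ)) l.succ).trans
        (norm_le_pi_norm (fun (i : Fin k) (l : Fin (n + 1)) => (τ i l : ℝ)) i)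
    calc |M * q.1 i l| = |(τ i l.succ : ℝ) + (M * q.1 i l - τ i l.succ)| := by ring_nf
      _ ≤ _ := (abs_add_le _ _).trans (add_le_add h2 h1)
  · refine (pi_norm_le_iff_of_nonneg zero_le_one).2 fun s => ?_
    have h1 : q.2 l ⬝ᵥ q.2 l ≤ 1 := by
      rw [hq.2.1]; split_ifs <;> norm_num
    have h2 : q.2 l s * q.2 l s ≤ q.2 l ⬝ᵥ q.2 l :=
      Finset.single_le_sum (f := fun s => q.2 l s * q.2 l s)
        (fun i _ => mul_self_nonneg _) (Finset.mem_univ s)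
    rw [Real.norm_eq_abs]
    exact abs_le_one_iff_mul_self_le_one.2 (h2.trans h1)

lemma isCompact_frames {M : ℝ} (hM : 0 < M) (τ : Fin k → Fin (n + 1) → ℤ) :
    IsCompact (frames M τ) := by
  obtain ⟨B, hB, hb⟩ := norm_le_of_mem_frames hM (τ := τ)
  refine Metric.isCompact_of_isClosed_isBounded ?_ ?_
  · unfold frames dotProduct
    simp only [Set.ofPred_and, Set.ofPred_forall]
    refine (isClosed_iInter fun i => isClosed_iInter fun l => ?_).inter
      ((isClosed_iInter fun l => isClosed_iInter fun l' => ?_).inter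
      (isClosed_iInter fun l => isClosed_iInter fun i => isClosed_iInter fun i' => ?_))
    · exact isClosed_le (by fun_prop) (by fun_prop)
    · exact isClosed_eq (by fun_prop) (by fun_prop)
    · exact isClosed_eq (by fun_prop) (by fun_prop)
  · refine (isBounded_closedBall (x := 0) (r := max B 1)).subset fun q hq => ?_
    rw [mem_closedBall_zero_iff, Prod.norm_def]
    refine max_le_max ?_ ?_
    · exact (pi_norm_le_iff_of_nonneg hB).2 (hb q hq).1
    · exact (pi_norm_le_iff_of_nonneg zero_le_one).2 (hb q hq).2

lemma frame_mulVec (hk : k ≤ n + 1) (q : (Fin k → Fin n → ℝ) × (Fin (n + 1) → Fin n → ℝ))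
    (w : Fin (n + 1) → ℝ) : frame q *ᵥ w =
      ∑ i : Fin k, w (Fin.castLE hk i) • Nor (q.1 i) + Fin.cons 0 (∑ l, w l • q.2 l) := by
  ext r
  have h1 : ∑ l : Fin (n + 1), (if h : (l : ℕ) < k then Nor (q.1 ⟨l, h⟩) r else 0) * w l =
      ∑ i : Fin k, w (Fin.castLE hk i) * Nor (q.1 i) r := by
    symm
    refine Finset.sum_of_injOn (Fin.castLE hk) (Fin.castLE_injective hk).injOn
      (fun _ _ => Finset.mem_coe.2 (Finset.mem_univ _)) (fun l _ hl => ?_) (fun i _ => ?_)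
    · have : ¬ (l : ℕ) < k := fun h => hl ⟨⟨l, h⟩, by simp⟩
      simp [this]
    · simp [mul_comm]
  have h2 : ∑ l : Fin (n + 1), (Fin.cons 0 (q.2 l) : Fin (n + 1) → ℝ) r * w l =
      (Fin.cons 0 (∑ l, w l • q.2 l) : Fin (n + 1) → ℝ) r := by
    refine Fin.cases ?_ (fun r => ?_) r
    · simp
    · simp [Finset.sum_apply, mul_comm]
  simp only [Matrix.mulVec, dotProduct, frame, add_mul, Finset.sum_add_distrib, h1, h2]
  simp

lemma frame_mulVec_eq_zero (hk : k ≤ n + 1) (hk1 : 0 < k) {M : ℝ}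
    {τ : Fin k → Fin (n + 1) → ℤ} (hτ : Trans M τ)
    {q : (Fin k → Fin n → ℝ) × (Fin (n + 1) → Fin n → ℝ)} (hq : q ∈ frames M τ)
    {w : Fin (n + 1) → ℝ} (hw : frame q *ᵥ w = 0) : w = 0 := by
  rw [frame_mulVec hk] at hw
  set y := ∑ l, w l • q.2 l with hy
  have h0 : ∑ i : Fin k, w (Fin.castLE hk i) = 0 := by
    simpa [Nor] using congrFun hw 0
  have hs : (2 : ℝ) • ∑ i : Fin k, w (Fin.castLE hk i) • q.1 i + y = 0 := by
    ext l
    have := congrFun hw l.succ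
    simp only [Nor, Pi.add_apply, Finset.sum_apply, Pi.smul_apply, Fin.cons_succ, Pi.zero_apply,
      smul_eq_mul] at this ⊢
    rw [Finset.mul_sum, ← this]
    congr 1
    refine Finset.sum_congr rfl fun i _ => ?_
    simp
    ring
  have hyp : ∀ i i', y ⬝ᵥ (q.1 i - q.1 i') = 0 := fun i i' => by
    rw [hy, sum_dotProduct]
    exact Finset.sum_eq_zero fun l _ => by rw [smul_dotProduct, hq.2.2 l i i', smul_zero]
  have hyy : y ⬝ᵥ y = 0 := by
    have h1 : y ⬝ᵥ ∑ i : Fin k, w (Fin.castLE hk i) • q.1 i = 0 := by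
      have h2 : ∑ i : Fin k, w (Fin.castLE hk i) • q.1 i =
          ∑ i : Fin k, w (Fin.castLE hk i) • (q.1 i - q.1 ⟨0, hk1⟩) := by
        simp only [smul_sub, Finset.sum_sub_distrib, ← Finset.sum_smul, h0, zero_smul, sub_zero]
      rw [h2, dotProduct_sum]
      exact Finset.sum_eq_zero fun i _ => by rw [dotProduct_smul, hyp, smul_zero]
    have h3 := congrArg (fun v => y ⬝ᵥ v) hs
    simpa [dotProduct_add, dotProduct_smul, h1] using h3
  have hy0 : y = 0 := dotProduct_self_eq_zero.1 hyy
  have hA : ∀ i : Fin k, w (Fin.castLE hk i) = 0 := by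
    rw [hy0] at hw
    have h1 : (Fin.cons 0 (0 : Fin n → ℝ) : Fin (n + 1) → ℝ) = 0 := by
      ext r; refine Fin.cases ?_ (fun r => ?_) r <;> simp
    rw [h1, add_zero] at hw
    exact fun i => Fintype.linearIndependent_iff.1 (hτ q.1 hq.1) _ hw i
  ext l
  by_cases hl : (l : ℕ) < k
  · exact hA ⟨l, hl⟩
  · have h1 : y ⬝ᵥ q.2 l = w l := by
      rw [hy, sum_dotProduct, Finset.sum_eq_single l]
      · rw [smul_dotProduct, hq.2.1]; simp [not_lt.1 hl]
      · intro l' _ hl'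
        rw [smul_dotProduct, hq.2.1]; simp [hl']
      · simp
    rw [← h1, hy0]; simp

lemma exists_mem_frames (hk1 : 0 < k) {M : ℝ} {τ : Fin k → Fin (n + 1) → ℤ}
    {p : Fin k → Fin n → ℝ} (hp : ∀ i l, |M * p i l - τ i l.succ| ≤ 2) :
    ∃ u, (p, u) ∈ frames M τ := by
  set i0 : Fin k := ⟨0, hk1⟩ with hi0
  set b : {i : Fin k // i ≠ i0} → EuclideanSpace ℝ (Fin n) :=
    fun i => WithLp.toLp 2 (p i - p i0) with hb
  set V := Submodule.span ℝ (Set.range b) with hV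
  have h1 : Module.finrank ℝ V ≤ k - 1 := by
    refine (finrank_range_le_card b).trans ?_
    simp [Fintype.card_subtype_compl]
  have h2 := Submodule.finrank_add_finrank_orthogonal V
  rw [finrank_euclideanSpace_fin] at h2
  set o := stdOrthonormalBasis ℝ Vᗮ with ho
  have hlt : ∀ l : Fin (n + 1), k ≤ l → (l : ℕ) - k < Module.finrank ℝ Vᗮ := fun l hl => by
    have := l.2; omega
  set u : Fin (n + 1) → Fin n → ℝ := fun l =>
    if h : k ≤ l then WithLp.ofLp (o ⟨l - k, hlt l h⟩ : EuclideanSpace ℝ (Fin n)) else 0 with hu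
  refine ⟨u, hp, fun l l' => ?_, fun l i i' => ?_⟩
  · by_cases hl : k ≤ (l : ℕ)
    · by_cases hl' : k ≤ (l' : ℕ)
      · have h3 := orthonormal_iff_ite.1 o.orthonormal ⟨l' - k, hlt l' hl'⟩ ⟨l - k, hlt l hl⟩
        rw [Submodule.coe_inner, EuclideanSpace.inner_eq_star_dotProduct] at h3
        simp only [hu, hl, hl', dite_true, and_true]
        have h4 : ((⟨l' - k, hlt l' hl'⟩ : Fin (Module.finrank ℝ Vᗮ)) = ⟨l - k, hlt l hl⟩) ↔
            l = l' := by
          rw [Fin.mk.injEq, Fin.ext_iff]; omega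
        simp only [h4] at h3
        exact h3
      · have h5 : ¬ l = l' := fun h => hl' (h ▸ hl)
        simp [hu, hl', h5]
    · simp [hu, hl]
  · by_cases hl : k ≤ (l : ℕ)
    · have h3 : ∀ i, u l ⬝ᵥ (p i - p i0) = 0 := by
        intro i
        by_cases hi : i = i0
        · simp [hi]
        · have h4 := (Submodule.mem_orthogonal V _).1 (o ⟨l - k, hlt l hl⟩).2 (b ⟨i, hi⟩)
            (Submodule.subset_span ⟨_, rfl⟩)
          rw [EuclideanSpace.inner_eq_star_dotProduct] at h4
          simpa [hu, hl, hb] using h4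
      have : p i - p i' = (p i - p i0) - (p i' - p i0) := by abel
      simp only [this, dotProduct_sub (u l) (p i - p i0), h3, sub_zero]
    · simp [hu, hl]

lemma exists_distort {X : Type*} [TopologicalSpace X] {S : Set X} (hS : IsCompact S)
    {ι : Type} [Fintype ι] [DecidableEq ι] {A : X → Matrix ι ι ℝ} (hA : Continuous A)
    (h0 : ∀ x ∈ S, ∀ w, A x *ᵥ w = 0 → w = 0) : ∃ K : ℝ, 1 ≤ K ∧ ∀ x ∈ S, Distort K (A x) := by
  have hc : IsCompact (S ×ˢ sphere (0 : ι → ℝ) 1) := hS.prod (isCompact_sphere _ _)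
  have hf : Continuous fun q : X × (ι → ℝ) => ‖A q.1 *ᵥ q.2‖ := by
    refine continuous_norm.comp ?_
    exact (hA.comp continuous_fst).matrix_mulVec continuous_snd
  have hpos : ∀ q ∈ S ×ˢ sphere (0 : ι → ℝ) 1, ‖A q.1 *ᵥ q.2‖ ≠ 0 := by
    rintro ⟨x, w⟩ ⟨hx, hw⟩ h
    have := h0 x hx w (norm_eq_zero.1 h)
    simp [this] at hw
  obtain ⟨K1, hK1⟩ := hc.bddAbove_image hf.continuousOn
  obtain ⟨K2, hK2⟩ := hc.bddAbove_image (hf.continuousOn.inv₀ hpos)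
  refine ⟨max 1 (max K1 K2), le_max_left _ _, fun x hx => ?_⟩
  have key : ∀ w : ι → ℝ, w ≠ 0 → ‖A x *ᵥ w‖ ≤ K1 * ‖w‖ ∧ ‖w‖ ≤ K2 * ‖A x *ᵥ w‖ := by
    intro w hw
    have hw' : 0 < ‖w‖ := norm_pos_iff.2 hw
    have hmem : (x, ‖w‖⁻¹ • w) ∈ S ×ˢ sphere (0 : ι → ℝ) 1 := by
      refine ⟨hx, ?_⟩
      simp [norm_smul, hw'.ne']
    have h1 := hK1 (mem_image_of_mem _ hmem)
    have h2 := hK2 (mem_image_of_mem _ hmem)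
    have h3 := hpos _ hmem
    simp only [Pi.inv_apply, Matrix.mulVec_smul, norm_smul, norm_inv, norm_norm] at h1 h2 h3
    have h4 : ‖A x *ᵥ w‖ ≠ 0 := right_ne_zero_of_mul h3
    have h5 : 0 < ‖A x *ᵥ w‖ := lt_of_le_of_ne (norm_nonneg _) h4.symm
    constructor
    · rwa [← div_eq_inv_mul, div_le_iff₀ hw'] at h1
    · rwa [← div_eq_inv_mul, inv_div, div_le_iff₀ h5] at h2
  refine ⟨fun w => ?_, fun w => ?_⟩
  · by_cases hw : w = 0
    · simp [hw]
    · refine (key w hw).1.trans ?_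
      gcongr
      exact (le_max_left _ _).trans (le_max_right _ _)
  · by_cases hw : w = 0
    · simp [hw]
    · refine (key w hw).2.trans ?_
      gcongr
      exact (le_max_right _ _).trans (le_max_right _ _)

lemma exists_distort_frames (hk : k ≤ n + 1) (hk1 : 0 < k) {M : ℝ} (hM : 0 < M)
    {τ : Fin k → Fin (n + 1) → ℤ} (hτ : Trans M τ) :
    ∃ K : ℝ, 1 ≤ K ∧ ∀ q ∈ frames M τ, Distort K (frame q) ∧ Distort K (frame q)ᵀ := by
  have hmono : ∀ {K K' : ℝ} {A : Matrix (Fin (n + 1)) (Fin (n + 1)) ℝ}, K ≤ K' → Distort K A →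
      Distort K' A := fun h hA =>
    ⟨fun w => (hA.le w).trans (by gcongr), fun w => (hA.ge w).trans (by gcongr)⟩
  obtain ⟨K1, h1, hK1⟩ := exists_distort (isCompact_frames hM τ) continuous_frame
    fun q hq w hw => frame_mulVec_eq_zero hk hk1 hτ hq hw
  obtain ⟨K2, h2, hK2⟩ := exists_distort (isCompact_frames hM τ)
    (A := fun q => (frame q)ᵀ) continuous_frame.matrix_transpose fun q hq w hw => by
      by_contra hw0
      refine (hK1 q hq).det_ne_zero ?_
      rw [← Matrix.det_transpose]
      exact Matrix.exists_mulVec_eq_zero_iff.1 ⟨w, hw0, hw⟩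
  exact ⟨max K1 K2, h1.trans (le_max_left _ _), fun q hq =>
    ⟨hmono (le_max_left _ _) (hK1 q hq), hmono (le_max_right _ _) (hK2 q hq)⟩⟩

end

section

variable {n k : ℕ}

lemma frame_transpose_mulVec_of_lt {M : ℝ} {τ : Fin k → Fin (n + 1) → ℤ}
    {q : (Fin k → Fin n → ℝ) × (Fin (n + 1) → Fin n → ℝ)} (hq : q ∈ frames M τ) (i : Fin k)
    {l : Fin (n + 1)} (hl : (l : ℕ) = i) (v : Fin (n + 1) → ℝ) :
    ((frame q)ᵀ *ᵥ v) l = Nor (q.1 i) ⬝ᵥ v := by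
  have hlk : (l : ℕ) < k := hl ▸ i.2
  have hi : (⟨l, hlk⟩ : Fin k) = i := Fin.ext hl
  have hu : q.2 l = 0 := by
    refine dotProduct_self_eq_zero.1 ?_
    rw [hq.2.1]; simp [hlk]
  simp only [Matrix.mulVec, dotProduct, Matrix.transpose_apply, frame, hlk, dite_true, hi, hu]
  refine Finset.sum_congr rfl fun r _ => ?_
  refine Fin.cases ?_ (fun r => ?_) r <;> simp

lemma frame_transpose_mulVec_of_le (q : (Fin k → Fin n → ℝ) × (Fin (n + 1) → Fin n → ℝ))
    {l : Fin (n + 1)} (hl : k ≤ l) (v : Fin (n + 1) → ℝ) :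
    ((frame q)ᵀ *ᵥ v) l = q.2 l ⬝ᵥ Fin.tail v := by
  simp only [Matrix.mulVec, dotProduct, Matrix.transpose_apply, frame, not_lt.2 hl, dite_false,
    zero_add, Fin.sum_univ_succ, Fin.cons_zero, zero_mul, Fin.cons_succ, Fin.tail]

lemma abs_dotProduct_sub_le {u y y' : Fin n → ℝ} {p : Fin k → Fin n → ℝ} {b B η : ℝ}
    (hu : ‖u‖ ≤ 1) (hb : ∀ i, u ⬝ᵥ p i = b) (hB : |b| ≤ B)
    (hy : ∃ w : Fin k → ℝ, ‖Nor y - ∑ i, w i • Nor (p i)‖ ≤ η)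
    (hy' : ∃ w : Fin k → ℝ, ‖Nor y' - ∑ i, w i • Nor (p i)‖ ≤ η) :
    |u ⬝ᵥ (y - y')| ≤ (2 * B + n) * η := by
  have key : ∀ z : Fin n → ℝ, (∃ w : Fin k → ℝ, ‖Nor z - ∑ i, w i • Nor (p i)‖ ≤ η) →
      |2 * (u ⬝ᵥ z) - 2 * b| ≤ (2 * B + n) * η := by
    rintro z ⟨w, hw⟩
    set e := Nor z - ∑ i, w i • Nor (p i) with he
    have h0 : e 0 = 1 - ∑ i, w i := by
      simp [he, Nor, Finset.sum_apply]
    have hs : Fin.tail e = (2 : ℝ) • z - (2 : ℝ) • ∑ i, w i • p i := by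
      ext l
      simp only [he, Nor, Fin.tail, Pi.sub_apply, Finset.sum_apply, Pi.smul_apply, Fin.cons_succ,
        smul_eq_mul, Finset.mul_sum]
      congr 1
      · simp
      · refine Finset.sum_congr rfl fun i _ => ?_
        simp; ring
    have h1 : 2 * (u ⬝ᵥ z) - 2 * b = u ⬝ᵥ Fin.tail e - 2 * b * e 0 := by
      rw [hs, h0, dotProduct_sub, dotProduct_smul, dotProduct_smul, dotProduct_sum]
      simp only [dotProduct_smul, hb, smul_eq_mul, ← Finset.sum_mul]
      ring
    have h2 : |u ⬝ᵥ Fin.tail e| ≤ n * η := by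
      refine (abs_dotProduct_le _ _).trans ?_
      have : ‖Fin.tail e‖ ≤ η := by
        refine (pi_norm_le_iff_of_nonneg ((norm_nonneg _).trans hw)).2 fun l => ?_
        exact (norm_le_pi_norm e l.succ).trans hw
      rw [Fintype.card_fin]
      calc (n : ℝ) * ‖u‖ * ‖Fin.tail e‖ ≤ n * 1 * η := by gcongr
        _ = _ := by ring
    have h3 : |2 * b * e 0| ≤ 2 * B * η := by
      rw [abs_mul, abs_mul, abs_two]
      have : |e 0| ≤ η := (norm_le_pi_norm e 0).trans hw
      have hB0 : 0 ≤ B := (abs_nonneg b).trans hB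
      gcongr
    rw [h1]
    refine (abs_sub _ _).trans ?_
    linarith
  have h1 := key y hy
  have h2 := key y' hy'
  rw [dotProduct_sub]
  rw [abs_le] at *
  constructor <;> linarith [h1.1, h1.2, h2.1, h2.2]

lemma exists_ml_small {L : ℕ} (hn : 0 < n) (hL : n + 1 < L) (hk : k ≤ n + 1) (hk1 : 0 < k) {p : ℝ}
    (hp : 0 < p) (hkp : (k - 1 : ℝ) * p ≤ 1) {M : ℝ} (hM : 1 ≤ M) {τ : Fin k → Fin (n + 1) → ℤ}
    (hτ : Trans M τ) {ε : ℝ} (hε : 0 < ε) : ∃ ρ : ℝ, 0 < ρ ∧ ∀ E : ℝ, 1 ≤ E → ∃ C : ℝ≥0,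
    ∀ (J : Type) [Fintype J] (x : J → Fin n → ℝ) (a : Fin k → J → ℂ)
      (_ : ∀ i j, a i j ≠ 0 → ∀ l, |M * x j l - τ i l.succ| ≤ 2)
      (_ : ∀ i j j', a i j ≠ 0 → a i j' ≠ 0 → ‖x j - x j'‖ ≤ ρ) (R : ℝ) (_ : 1 ≤ R)
      (_ : ∀ sel : Fin k → J, (∀ i, a i (sel i) ≠ 0) → ∀ i j, a i j ≠ 0 →
        ∃ w : Fin k → ℝ, ‖Nor (x j) - ∑ i, w i • Nor (x (sel i))‖ ≤ E / R) (c : Fin (n + 1) → ℝ),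
      av R (fun z => ∏ i, En L M (fun j => Lam (x j)) (a i) z ^ p) c ≤
        C * ENNReal.ofReal (R ^ ε) * ∏ i, En L R (fun j => Lam (x j)) (a i) c ^ p := by
  have hM0 : 0 < M := by linarith
  obtain ⟨B, hB, hBq⟩ := norm_le_of_mem_frames hM0 (τ := τ)
  obtain ⟨K, hK, hKq⟩ := exists_distort_frames hk hk1 hM0 hτ
  obtain ⟨δ, hδ, hml⟩ := exists_ml_lin (ι := Fin (n + 1)) (L := L) (by simpa using hL) (by omega)
    (Fin k) hp.le hK hε
  refine ⟨δ / (2 * n * K), by positivity, fun E hE => ?_⟩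
  obtain ⟨C, hC⟩ := hml (max 1 ((2 * (n * B) + n) * E)) M (le_max_left _ _) hM
  refine ⟨C, fun J _ x a hsupp hdiam R hR hspan c => ?_⟩
  have hR0 : 0 < R := by linarith
  by_cases hz : ∃ i, a i = 0
  · obtain ⟨i, hi⟩ := hz
    have h0 : ∀ z, ∏ i, En L M (fun j => Lam (x j)) (a i) z ^ p = 0 := fun z =>
      Finset.prod_eq_zero (Finset.mem_univ i) (by
        have : En L M (fun j => Lam (x j)) (a i) z = 0 := by simp [En, hi, es_zero]
        rw [this, ENNReal.zero_rpow_of_pos hp])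
    simp [h0, av]
  push Not at hz
  choose sel hsel using fun i => Function.ne_iff.1 (hz i)
  simp only [Pi.zero_apply] at hsel
  obtain ⟨u, hu⟩ := exists_mem_frames hk1 (M := M) (τ := τ) (p := fun i => x (sel i))
    fun i l => hsupp i _ (hsel i) l
  obtain ⟨hd, hd'⟩ := hKq _ hu
  refine hC J _ (fun i => Finset.univ.filter fun l => (l : ℕ) = i ∨ k ≤ l) (fun l s hs => ?_) a R hR
    _ hd (fun i j j' hj hj' l hl => ?_) c
  · refine le_trans ?_ hkp
    gcongr
    by_cases hlk : k ≤ l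
    · have : s = ∅ := Finset.eq_empty_of_forall_notMem fun i hi => hs i hi (by simp [hlk])
      have h1 : (1 : ℝ) ≤ k := by exact_mod_cast hk1
      simp [this, h1]
    · have h1 : s.card ≤ k - 1 := by
        have : s ⊆ Finset.univ.erase ⟨l, not_le.1 hlk⟩ := fun i hi => by
          have := hs i hi
          simp only [Finset.mem_filter, Finset.mem_univ, true_and, not_or] at this
          simp only [Finset.mem_erase, Finset.mem_univ, and_true]
          rintro rfl
          exact this.1 rfl
        simpa using Finset.card_le_card this
      have h2 : s.card + 1 ≤ k := by omega
      have : ((s.card + 1 : ℕ) : ℝ) ≤ k := by exact_mod_cast h2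
      push_cast at this
      linarith
  · simp only [Finset.mem_filter, Finset.mem_univ, true_and] at hl
    rcases hl with hl | hl
    · rw [frame_transpose_mulVec_of_lt hu i hl, Nor_dot_Lam_sub, abs_neg]
      refine le_add_of_le_of_nonneg ?_ (by positivity)
      have h1 : ‖x j + x j' - (2 : ℝ) • x (sel i)‖ ≤ 2 * (δ / (2 * n * K)) := by
        rw [show x j + x j' - (2 : ℝ) • x (sel i) = (x j - x (sel i)) + (x j' - x (sel i)) by
          rw [two_smul]; abel, two_mul]
        exact (norm_add_le _ _).trans
          (add_le_add (hdiam i _ _ hj (hsel i)) (hdiam i _ _ hj' (hsel i)))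
      refine (abs_dotProduct_le _ _).trans ?_
      have h2 := (norm_sub_le_norm_Lam_sub (x j) (x j')).trans (hd'.ge _)
      rw [Fintype.card_fin]
      calc _ ≤ (n : ℝ) * (K * ‖(frame (fun i => x (sel i), u))ᵀ *ᵥ (Lam (x j) - Lam (x j'))‖) *
            (2 * (δ / (2 * n * K))) := by gcongr
        _ = _ := by field_simp
    · rw [frame_transpose_mulVec_of_le _ hl]
      refine le_add_of_nonneg_of_le (by positivity) ?_
      have ht : Fin.tail (Lam (x j) - Lam (x j')) = x j - x j' := by
        ext l; simp [Fin.tail, Lam]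
      have hb : ∀ i, u l ⬝ᵥ x (sel i) = u l ⬝ᵥ x (sel ⟨0, hk1⟩) := fun i => by
        have := hu.2.2 l i ⟨0, hk1⟩
        simp only [dotProduct_sub] at this
        linarith
      have hbB : |u l ⬝ᵥ x (sel ⟨0, hk1⟩)| ≤ n * B := by
        refine (abs_dotProduct_le _ _).trans ?_
        rw [Fintype.card_fin]
        have h1 := (hBq _ hu).2 l
        have h2 := (hBq _ hu).1 ⟨0, hk1⟩
        simp only at h1 h2
        calc (n : ℝ) * ‖u l‖ * ‖x (sel ⟨0, hk1⟩)‖ ≤ n * 1 * B := by gcongr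
          _ = _ := by ring
      rw [ht]
      have h3 := abs_dotProduct_sub_le ((hBq _ hu).2 l) hb hbB (hspan sel hsel i j hj)
        (hspan sel hsel i j' hj')
      refine h3.trans ?_
      rw [← mul_div_assoc]
      gcongr
      exact le_max_right _ _

end

section

lemma rpow_sum_le {κ : Type*} (s : Finset κ) (x : κ → ℝ≥0∞) {p : ℝ} (hp : 0 < p) :
    (∑ i ∈ s, x i) ^ p ≤ (s.card : ℝ≥0∞) ^ p * ∑ i ∈ s, x i ^ p := by
  rcases s.eq_empty_or_nonempty with rfl | hs
  · simp [hp]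
  obtain ⟨m, hm, hmax⟩ := s.exists_max_image x hs
  calc (∑ i ∈ s, x i) ^ p ≤ (s.card * x m) ^ p := by
        gcongr
        rw [← nsmul_eq_mul]
        exact Finset.sum_le_card_nsmul s x _ hmax
    _ = (s.card : ℝ≥0∞) ^ p * x m ^ p := ENNReal.mul_rpow_of_nonneg _ _ hp.le
    _ ≤ _ := by
        gcongr
        exact Finset.single_le_sum (f := fun i => x i ^ p) (fun _ _ => zero_le) hm

lemma av_sum {ι : Type} [Fintype ι] {κ : Type*} {r : ℝ} (s : Finset κ)
    {f : κ → (ι → ℝ) → ℝ≥0∞} (hf : ∀ m, Measurable (f m)) (c : ι → ℝ) :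
    av r (fun z => ∑ m ∈ s, f m z) c = ∑ m ∈ s, av r (f m) c := by
  unfold av
  rw [lintegral_finsetSum _ fun m _ => hf m, Finset.mul_sum]

lemma exists_En_cut_le_of_one_le {ι : Type} [Fintype ι] {L : ℕ} (hL : Fintype.card ι < L) {r : ℝ}
    (hr : 1 ≤ r) : ∃ C : ℝ≥0, ∀ (J : Type) [Fintype J] (ξ : J → ι → ℝ) (a : J → ℂ) (R : ℝ)
      (_ : 1 ≤ R) (m : ι → ℤ) (c : ι → ℝ), En L R ξ (cut r ξ m a) c ≤ C * En L R ξ a c := by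
  obtain ⟨C, hC⟩ := exists_En_cut_le (ι := ι) hL
  set D := (r ^ (L + Fintype.card ι)).toNNReal
  have hr0 : 0 < r := by linarith
  have hD : 1 ≤ D := by
    rw [← NNReal.coe_le_coe, Real.coe_toNNReal _ (by positivity)]
    exact one_le_pow₀ hr
  refine ⟨D * C * D, fun J _ ξ a R hR m c => ?_⟩
  have hR0 : 0 < R := by linarith
  rcases le_total r R with h | h
  · refine (hC J ξ a r R hr0 h m c).trans ?_
    gcongr
    calc C = 1 * C * 1 := by ring
      _ ≤ D * C * D := by gcongr
  · have h1 : r ≤ r * R := le_mul_of_one_le_right hr0.le hR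
    have h2 : R ≤ r * r := h.trans (le_mul_of_one_le_right hr0.le hr)
    calc _ ≤ D * En L r ξ (cut r ξ m a) c := En_le_mul hr hR0 hr0 h2 h1 _ _ _
      _ ≤ D * (C * (D * En L R ξ a c)) := by
        gcongr
        refine (hC J ξ a r r hr0 le_rfl m c).trans ?_
        gcongr
        exact En_le_mul hr hr0 hR0 h1 h2 _ _ _
      _ = _ := by push_cast; ring

variable {n k : ℕ}

lemma norm_Lam_le {x : Fin n → ℝ} {B : ℝ} (hx : ‖x‖ ≤ B) : ‖Lam x‖ ≤ n * B * B + B := by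
  have hB : 0 ≤ B := (norm_nonneg _).trans hx
  refine (pi_norm_le_iff_of_nonneg (by positivity)).2 fun l => ?_
  refine Fin.cases ?_ (fun l => ?_) l
  · simp only [Lam, Fin.cons_zero, norm_neg, Real.norm_eq_abs]
    refine (abs_dotProduct_le x x).trans ?_
    rw [Fintype.card_fin]
    have : (n : ℝ) * ‖x‖ * ‖x‖ ≤ n * B * B := by gcongr
    linarith
  · simp only [Lam, Fin.cons_succ]
    have h1 := (norm_le_pi_norm x l).trans hx
    have : 0 ≤ (n : ℝ) * B * B := by positivity
    linarith

/-- Multilinear restriction estimate for transversal caps near a `k`-plane. -/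
lemma exists_ml {L : ℕ} (hn : 0 < n) (hL : n + 1 < L) (hk : k ≤ n + 1) (hk1 : 0 < k) {p : ℝ}
    (hp : 0 < p) (hkp : (k - 1 : ℝ) * p ≤ 1) {M : ℝ} (hM : 1 ≤ M) {τ : Fin k → Fin (n + 1) → ℤ}
    (hτ : Trans M τ) {ε : ℝ} (hε : 0 < ε) {E : ℝ} (hE : 1 ≤ E) : ∃ C : ℝ≥0,
    ∀ (J : Type) [Fintype J] (x : J → Fin n → ℝ) (a : Fin k → J → ℂ)
      (_ : ∀ i j, a i j ≠ 0 → ∀ l, |M * x j l - τ i l.succ| ≤ 2) (R : ℝ) (_ : 1 ≤ R)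
      (_ : ∀ sel : Fin k → J, (∀ i, a i (sel i) ≠ 0) → ∀ i j, a i j ≠ 0 →
        ∃ w : Fin k → ℝ, ‖Nor (x j) - ∑ i, w i • Nor (x (sel i))‖ ≤ E / R) (c : Fin (n + 1) → ℝ),
      av R (fun z => ∏ i, En L M (fun j => Lam (x j)) (a i) z ^ p) c ≤
        C * ENNReal.ofReal (R ^ ε) * ∏ i, En L R (fun j => Lam (x j)) (a i) c ^ p := by
  classical
  have hM0 : 0 < M := by linarith
  obtain ⟨ρ, hρ, hsmall⟩ := exists_ml_small hn hL hk hk1 hp hkp hM hτ hε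
  obtain ⟨C1, hC1⟩ := hsmall E hE
  set r : ℝ := max 1 (2 / ρ) with hr
  have hr1 : 1 ≤ r := le_max_left _ _
  have hr0 : 0 < r := by linarith
  obtain ⟨C2, hC2⟩ := exists_En_cut_le_of_one_le (ι := Fin (n + 1)) (L := L) (by simpa using hL) hr1
  set B : ℝ := (‖fun (i : Fin k) (l : Fin (n + 1)) => (τ i l : ℝ)‖ + 2) / M with hB
  have hB0 : 0 ≤ B := by positivity
  set N : ℕ := ⌈r * (n * B * B + B)⌉₊ with hN
  set S := box (Fin (n + 1)) N with hS
  set P : ℝ≥0∞ := ((S.card : ℝ≥0∞) ^ p * (S.card : ℝ≥0∞) ^ p) ^ k with hP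
  have hPtop : P ≠ ⊤ := by
    have : (S.card : ℝ≥0∞) ^ p ≠ ⊤ := ENNReal.rpow_ne_top_of_nonneg hp.le (by simp)
    finiteness
  refine ⟨P.toNNReal * (((Fintype.piFinset fun _ : Fin k => S).card : ℝ≥0) * (C1 * (C2 ^ p) ^ k)),
    fun J _ x a hsupp R hR hspan c => ?_⟩
  set ξ : J → Fin (n + 1) → ℝ := fun j => Lam (x j) with hξ
  have hxB : ∀ i j, a i j ≠ 0 → ‖x j‖ ≤ B := fun i j hj => by
    refine (pi_norm_le_iff_of_nonneg hB0).2 fun l => ?_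
    rw [hB, le_div_iff₀ hM0, Real.norm_eq_abs,
      show |x j l| * M = |M * x j l| by rw [abs_mul, abs_of_pos hM0, mul_comm]]
    have h1 := hsupp i j hj l
    have h2 : |(τ i l.succ : ℝ)| ≤ ‖fun (i : Fin k) (l : Fin (n + 1)) => (τ i l : ℝ)‖ :=
      (norm_le_pi_norm (fun l : Fin (n + 1) => (τ i l : ℝ)) l.succ).trans
        (norm_le_pi_norm (fun (i : Fin k) (l : Fin (n + 1)) => (τ i l : ℝ)) i)
    calc |M * x j l| = |(τ i l.succ : ℝ) + (M * x j l - τ i l.succ)| := by ring_nf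
      _ ≤ _ := (abs_add_le _ _).trans (add_le_add h2 h1)
  have hsum : ∀ i, ∑ m ∈ S, cut r ξ m (a i) = a i := fun i => sum_cut fun j hj => by
    rw [norm_smul, Real.norm_of_nonneg hr0.le]
    refine le_trans ?_ (Nat.le_ceil _)
    gcongr
    exact norm_Lam_le (hxB i j hj)
  have hmeas : ∀ (f : Fin k → Fin (n + 1) → ℤ),
      Measurable fun z => ∏ i, En L M ξ (cut r ξ (f i) (a i)) z ^ p := fun f =>
    Finset.measurable_fun_prod _ fun i _ => (measurable_En _ _).pow_const p
  have hpt : ∀ z, ∏ i, En L M ξ (a i) z ^ p ≤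
      P * ∑ f ∈ Fintype.piFinset fun _ : Fin k => S,
        ∏ i, En L M ξ (cut r ξ (f i) (a i)) z ^ p := fun z => by
    rw [← Finset.prod_univ_sum (fun _ => S) (fun i m => En L M ξ (cut r ξ m (a i)) z ^ p)]
    have hPk : P = ∏ _i : Fin k, ((S.card : ℝ≥0∞) ^ p * (S.card : ℝ≥0∞) ^ p) := by simp [hP]
    rw [hPk, ← Finset.prod_mul_distrib]
    refine Finset.prod_le_prod' fun i _ => ?_
    calc En L M ξ (a i) z ^ p = En L M ξ (∑ m ∈ S, cut r ξ m (a i)) z ^ p := by rw [hsum]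
      _ ≤ (S.card * ∑ m ∈ S, En L M ξ (cut r ξ m (a i)) z) ^ p := by
        gcongr; exact En_sum_le _ _ _ _
      _ ≤ _ := by
        rw [ENNReal.mul_rpow_of_nonneg _ _ hp.le, mul_assoc]
        gcongr
        exact rpow_sum_le _ _ hp
  have hterm : ∀ f : Fin k → Fin (n + 1) → ℤ,
      av R (fun z => ∏ i, En L M ξ (cut r ξ (f i) (a i)) z ^ p) c ≤
      C1 * ENNReal.ofReal (R ^ ε) * ((C2 ^ p : ℝ≥0) ^ k * ∏ i, En L R ξ (a i) c ^ p) := fun f => by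
    refine (hC1 J x (fun i => cut r ξ (f i) (a i)) (fun i j hj => hsupp i j (cut_ne_zero hj).1)
      (fun i j j' hj hj' => ?_) R hR (fun sel hsel i j hj => hspan sel
        (fun i => (cut_ne_zero (hsel i)).1) i j (cut_ne_zero hj).1) c).trans ?_
    · refine (norm_sub_le_norm_Lam_sub _ _).trans ?_
      have h1 := (cut_ne_zero hj).2
      have h2 := (cut_ne_zero hj').2
      have h3 : r * ‖ξ j - ξ j'‖ ≤ 2 := by
        rw [← Real.norm_of_nonneg hr0.le, ← norm_smul, smul_sub,
          ← sub_sub_sub_cancel_right _ _ (fun l => ((f i l : ℤ) : ℝ))]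
        exact (norm_sub_le _ _).trans (by linarith)
      have h4 : 2 ≤ r * ρ := by
        have : 2 / ρ ≤ r := le_max_right _ _
        rwa [div_le_iff₀ hρ] at this
      exact le_of_mul_le_mul_left (h3.trans h4) hr0
    · refine mul_le_mul' le_rfl ?_
      have : ((C2 ^ p : ℝ≥0) : ℝ≥0∞) ^ k = ∏ _i : Fin k, ((C2 ^ p : ℝ≥0) : ℝ≥0∞) := by simp
      rw [this, ← Finset.prod_mul_distrib]
      refine Finset.prod_le_prod' fun i _ => ?_
      rw [ENNReal.coe_rpow_of_nonneg _ hp.le, ← ENNReal.mul_rpow_of_nonneg _ _ hp.le]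
      exact ENNReal.rpow_le_rpow (hC2 J ξ (a i) R hR (f i) c) hp.le
  calc _ ≤ av R (fun z => P * ∑ f ∈ Fintype.piFinset fun _ : Fin k => S,
        ∏ i, En L M ξ (cut r ξ (f i) (a i)) z ^ p) c := av_mono fun z _ => hpt z
    _ = P * ∑ f ∈ Fintype.piFinset fun _ : Fin k => S,
        av R (fun z => ∏ i, En L M ξ (cut r ξ (f i) (a i)) z ^ p) c := by
        rw [av_const_mul (Finset.measurable_fun_sum _ fun f _ => hmeas f), av_sum _ hmeas]
    _ ≤ P * ∑ f ∈ Fintype.piFinset fun _ : Fin k => S,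
        C1 * ENNReal.ofReal (R ^ ε) * ((C2 ^ p : ℝ≥0) ^ k * ∏ i, En L R ξ (a i) c ^ p) := by
        gcongr with f
        exact hterm f
    _ = _ := by
        rw [Finset.sum_const, nsmul_eq_mul]
        push_cast
        rw [ENNReal.coe_toNNReal hPtop]
        ring

end

section

variable {n k : ℕ}

/-- Labels of the caps of size `1 / M` meeting the paraboloid. -/
def caps (n M : ℕ) : Finset (Fin (n + 1) → ℤ) := box (Fin (n + 1)) (M * (n + 1))

/-- Transversal tuples of caps. -/
def tuples (n k M : ℕ) : Finset (Fin k → Fin (n + 1) → ℤ) := by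
  classical exact (Fintype.piFinset fun _ => caps n M).filter (Trans (M : ℝ))

lemma mem_tuples {M : ℕ} {τ : Fin k → Fin (n + 1) → ℤ} :
    τ ∈ tuples n k M ↔ (∀ i, τ i ∈ caps n M) ∧ Trans (M : ℝ) τ := by
  classical
  simp [tuples, Fintype.mem_piFinset]

/-- The `k`-broad part at level `M`. -/
def Ik {J : Type} [Fintype J] (L k M : ℕ) (x : J → Fin n → ℝ) (a : J → ℂ)
    (z : Fin (n + 1) → ℝ) : ℝ≥0∞ :=
  ∑ τ ∈ tuples n k M, ∏ i, En L M (fun j => Lam (x j)) (cut M (fun j => Lam (x j)) (τ i) a) z ^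
    (1 / k : ℝ)

lemma measurable_Ik {J : Type} [Fintype J] {L k M : ℕ} (x : J → Fin n → ℝ) (a : J → ℂ) :
    Measurable (Ik L k M x a) :=
  Finset.measurable_fun_sum _ fun _ _ => Finset.measurable_fun_prod _ fun _ _ =>
    (measurable_En _ _).pow_const _

lemma sum_caps {J : Type} {M : ℕ} {x : J → Fin n → ℝ} (hx : ∀ j, ‖x j‖ ≤ 1) (a : J → ℂ) :
    ∑ m ∈ caps n M, cut M (fun j => Lam (x j)) m a = a := by
  refine sum_cut fun j _ => ?_
  rw [norm_smul, RCLike.norm_natCast]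
  push_cast
  gcongr
  exact (norm_Lam_le (hx j)).trans (by linarith)

lemma abs_sub_le_of_cut_ne_zero {J : Type} {M : ℝ} {x : J → Fin n → ℝ} {m : Fin (n + 1) → ℤ}
    {a : J → ℂ} {j : J} (h : cut M (fun j => Lam (x j)) m a j ≠ 0) (l : Fin n) :
    |M * x j l - m l.succ| ≤ 1 := by
  simpa [Lam] using (norm_le_pi_norm _ l.succ).trans (cut_ne_zero h).2

lemma norm_Nor_sub_le (p q : Fin n → ℝ) : ‖Nor p - Nor q‖ ≤ 2 * ‖p - q‖ := by
  refine (pi_norm_le_iff_of_nonneg (by positivity)).2 fun l => ?_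
  refine Fin.cases ?_ (fun l => ?_) l
  · simp [Nor]
  · have := norm_le_pi_norm (p - q) l
    simp only [Nor, Pi.sub_apply, Fin.cons_succ, Pi.smul_apply, ← smul_sub] at this ⊢
    simpa using this

lemma norm_Nor_le {p : Fin n → ℝ} {B : ℝ} (hp : ‖p‖ ≤ B) : ‖Nor p‖ ≤ 1 + 2 * B := by
  have hB := (norm_nonneg p).trans hp
  refine (pi_norm_le_iff_of_nonneg (by positivity)).2 fun l => ?_
  refine Fin.cases ?_ (fun l => ?_) l
  · simp [Nor, hB]
  · have := (norm_le_pi_norm p l).trans hp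
    simp only [Nor, Fin.cons_succ, nsmul_eq_mul] at this ⊢
    norm_num
    rw [Real.norm_eq_abs] at this
    linarith

/-- Points of caps which fail to be transversal lie close to a common `k`-plane. -/
lemma exists_span_const (hk : k ≤ n + 1) (hk1 : 0 < k) {M : ℝ} (hM : 1 ≤ M)
    {τ : Fin k → Fin (n + 1) → ℤ} (hτ : Trans M τ) : ∃ E : ℝ, 1 ≤ E ∧ ∀ (M' : ℝ) (_ : 3 * M ≤ M')
    (σ : Fin (k + 1) → Fin (n + 1) → ℤ) (_ : ¬ Trans M' σ) (y : Fin (k + 1) → Fin n → ℝ)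
    (_ : ∀ i : Fin k, ∀ l, |M * y i.castSucc l - τ i l.succ| ≤ 1)
    (_ : ∀ i, ∀ l, |M' * y i l - σ i l.succ| ≤ 1) (_ : ‖y (Fin.last k)‖ ≤ 1),
    ∃ w : Fin k → ℝ, ‖Nor (y (Fin.last k)) - ∑ i, w i • Nor (y i.castSucc)‖ ≤ E / M' := by
  have hM0 : 0 < M := by linarith
  obtain ⟨K, hK, hKq⟩ := exists_distort_frames hk hk1 hM0 hτ
  refine ⟨6 + k * (K * 9 * 6), le_add_of_le_of_nonneg (by norm_num) (by positivity),
    fun M' hM' σ hσ y hy hyσ hlast => ?_⟩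
  have hM'0 : 0 < M' := by linarith
  unfold Trans at hσ
  push Not at hσ
  obtain ⟨p, hp, hdep⟩ := hσ
  have hpy : ∀ i l, |p i l - y i l| ≤ 3 / M' := fun i l => by
    rw [le_div_iff₀ hM'0,
      show |p i l - y i l| * M' = |(p i l - y i l) * M'| by rw [abs_mul, abs_of_pos hM'0]]
    have h1 := abs_le.1 (hp i l)
    have h2 := abs_le.1 (hyσ i l)
    rw [abs_le]; constructor <;> linarith [h1.1, h1.2, h2.1, h2.2]
  have hpyn : ∀ i, ‖y i - p i‖ ≤ 3 / M' := fun i => by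
    rw [norm_sub_rev]
    exact (pi_norm_le_iff_of_nonneg (by positivity)).2 fun l => hpy i l
  have hpτ : ∀ (i : Fin k) l, |M * p i.castSucc l - τ i l.succ| ≤ 2 := fun i l => by
    have h1 := abs_le.1 (hpy i.castSucc l)
    have h2 := abs_le.1 (hy i l)
    have h3 : M * (3 / M') ≤ 1 := by
      rw [mul_div_assoc', div_le_one hM'0]; linarith
    have h4 := mul_le_mul_of_nonneg_left h1.1 hM0.le
    have h5 := mul_le_mul_of_nonneg_left h1.2 hM0.le
    rw [abs_le]; constructor <;> linarith [h2.1, h2.2]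
  have hind := hτ (fun i => p i.castSucc) hpτ
  rw [Fintype.linearIndependent_iff] at hdep
  push Not at hdep
  obtain ⟨w, hw, i0, hi0⟩ := hdep
  rw [Fin.sum_univ_castSucc] at hw
  have hwl : w (Fin.last k) ≠ 0 := fun h => by
    rw [h, zero_smul, add_zero] at hw
    have h1 := Fintype.linearIndependent_iff.1 hind (fun i => w i.castSucc) hw
    refine hi0 ?_
    refine Fin.lastCases h (fun i => h1 i) i0
  set w' : Fin k → ℝ := fun i => -(w (Fin.last k))⁻¹ * w i.castSucc with hw'
  have hcomb : Nor (p (Fin.last k)) = ∑ i, w' i • Nor (p i.castSucc) := by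
    have h1 : Nor (p (Fin.last k)) = (w (Fin.last k))⁻¹ • (w (Fin.last k) • Nor (p (Fin.last k))) := by
      rw [smul_smul, inv_mul_cancel₀ hwl, one_smul]
    rw [h1, eq_neg_of_add_eq_zero_right hw, smul_neg, ← neg_smul, Finset.smul_sum]
    simp only [hw', smul_smul]
  obtain ⟨u, hu⟩ := exists_mem_frames hk1 hpτ
  set W : Fin (n + 1) → ℝ := fun l => if h : (l : ℕ) < k then w' ⟨l, h⟩ else 0 with hW
  have hWf : frame (fun i : Fin k => p i.castSucc, u) *ᵥ W = Nor (p (Fin.last k)) := by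
    rw [frame_mulVec hk, hcomb]
    have h1 : ∑ l, W l • u l = 0 := Finset.sum_eq_zero fun l _ => by
      by_cases hl : (l : ℕ) < k
      · have : u l = 0 := by
          refine dotProduct_self_eq_zero.1 ?_
          have h2 : u l ⬝ᵥ u l = if l = l ∧ k ≤ (l : ℕ) then 1 else 0 := hu.2.1 l l
          rw [h2, if_neg (by omega)]
        rw [this, smul_zero]
      · simp [hW, hl]
    simp only [h1]
    have h2 : (Fin.cons 0 (0 : Fin n → ℝ) : Fin (n + 1) → ℝ) = 0 := by
      ext r; refine Fin.cases ?_ (fun r => ?_) r <;> simp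
    rw [h2, add_zero]
    refine Finset.sum_congr rfl fun i _ => ?_
    simp [hW]
  have hWn : ∀ i, |w' i| ≤ K * 9 := fun i => by
    have h1 := (hKq _ hu).1.ge W
    rw [hWf] at h1
    have h2 : ‖p (Fin.last k)‖ ≤ 4 := by
      have h3 : 3 / M' ≤ 3 := by
        rw [div_le_iff₀ hM'0]; linarith
      have := norm_sub_le (y (Fin.last k)) (y (Fin.last k) - p (Fin.last k))
      rw [sub_sub_cancel] at this
      linarith [hpyn (Fin.last k)]
    have h4 := norm_le_pi_norm W (Fin.castLE hk i)
    have h5 : W (Fin.castLE hk i) = w' i := by simp [hW]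
    rw [h5, Real.norm_eq_abs] at h4
    refine h4.trans (h1.trans ?_)
    gcongr
    exact (norm_Nor_le h2).trans (by norm_num)
  refine ⟨w', ?_⟩
  have h1 : Nor (y (Fin.last k)) - ∑ i, w' i • Nor (y i.castSucc) =
      (Nor (y (Fin.last k)) - Nor (p (Fin.last k))) -
        ∑ i, w' i • (Nor (y i.castSucc) - Nor (p i.castSucc)) := by
    simp only [smul_sub, Finset.sum_sub_distrib, ← hcomb]
    abel
  have hN : ∀ i, ‖Nor (y i) - Nor (p i)‖ ≤ 6 / M' := fun i =>
    (norm_Nor_sub_le _ _).trans (by linarith [hpyn i, show 6 / M' = 2 * (3 / M') by ring])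
  rw [h1]
  calc _ ≤ 6 / M' + ∑ i : Fin k, K * 9 * (6 / M') := by
        refine (norm_sub_le _ _).trans (add_le_add (hN _) ((norm_sum_le _ _).trans ?_))
        refine Finset.sum_le_sum fun i _ => ?_
        rw [norm_smul, Real.norm_eq_abs]
        exact mul_le_mul (hWn i) (hN _) (norm_nonneg _) (by positivity)
    _ = _ := by
        rw [Finset.sum_const, Finset.card_univ, Fintype.card_fin, nsmul_eq_mul]; ring

lemma prod_add_mul_le {κ : Type*} (s : Finset κ) {x : κ → ℝ≥0∞} {X θ : ℝ≥0∞}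
    (hx : ∀ i ∈ s, x i ≤ X) (hθ : θ ≤ 1) :
    ∏ i ∈ s, (x i + θ * X) ≤ ∏ i ∈ s, x i + 2 ^ s.card * θ * X ^ s.card := by
  classical
  induction s using Finset.induction_on with
  | empty => simp
  | insert b s hb ih =>
    have ih' := ih fun i hi => hx i (Finset.mem_insert_of_mem hi)
    have hbX := hx b (Finset.mem_insert_self _ _)
    have h2 : ∏ i ∈ s, (x i + θ * X) ≤ 2 ^ s.card * X ^ s.card := by
      rw [← mul_pow, ← Finset.prod_const]
      refine Finset.prod_le_prod' fun i hi => ?_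
      rw [two_mul]
      refine add_le_add (hx i (Finset.mem_insert_of_mem hi)) ?_
      calc θ * X ≤ 1 * X := by gcongr
        _ = X := one_mul _
    rw [Finset.prod_insert hb, Finset.prod_insert hb, Finset.card_insert_of_notMem hb, add_mul]
    calc _ ≤ x b * (∏ i ∈ s, x i + 2 ^ s.card * θ * X ^ s.card) +
          θ * X * (2 ^ s.card * X ^ s.card) := by gcongr
      _ ≤ x b * ∏ i ∈ s, x i + X * (2 ^ s.card * θ * X ^ s.card) +
          θ * X * (2 ^ s.card * X ^ s.card) := by
        rw [mul_add]; gcongr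
      _ = _ := by ring

end

section

section General

variable {ι : Type} [Fintype ι]

/-- Hölder's inequality for averages over cubes. -/
lemma av_mul_rpow_le {r : ℝ} {f v : (ι → ℝ) → ℝ≥0∞} (hf : Measurable f)
    (hv : Measurable v) {q : ℝ} (hq : 1 < q) (c : ι → ℝ) :
    av r (fun z => f z * v z ^ (1 / q)) c ≤
      (av r (fun z => f z ^ (q / (q - 1))) c) ^ ((q - 1) / q) * (av r v c) ^ (1 / q) := by
  have hq0 : 0 < q := by linarith
  set μ : Measure (ι → ℝ) := (ENNReal.ofReal ((2 * r) ^ Fintype.card ι))⁻¹ •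
    volume.restrict (closedBall c r) with hμ
  have hav : ∀ g : (ι → ℝ) → ℝ≥0∞, av r g c = ∫⁻ z, g z ∂μ := fun g => by
    rw [hμ, lintegral_smul_measure]; rfl
  have hpq : (q / (q - 1)).HolderConjugate q := by
    have := (Real.HolderConjugate.conjExponent hq).symm
    simpa [Real.conjExponent] using this
  have h := ENNReal.lintegral_mul_le_Lp_mul_Lq μ hpq hf.aemeasurable
    (hv.pow_const (1 / q)).aemeasurable
  have h1 : ∀ z, (v z ^ (1 / q)) ^ q = v z := fun z => by
    rw [← ENNReal.rpow_mul, one_div, inv_mul_cancel₀ hq0.ne', ENNReal.rpow_one]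
  simp only [hav, Pi.mul_apply, h1] at h ⊢
  rwa [one_div_div] at h

lemma av_rpow_le {r : ℝ} (hr : 0 < r) {v : (ι → ℝ) → ℝ≥0∞} (hv : Measurable v) {q : ℝ}
    (hq : 1 < q) (c : ι → ℝ) : av r (fun z => v z ^ (1 / q)) c ≤ (av r v c) ^ (1 / q) := by
  have h := av_mul_rpow_le (r := r) (f := fun _ : ι → ℝ => 1) measurable_const hv hq c
  simpa [av_const hr] using h

lemma av_le_conv_of_nat {r : ℝ} (hr : 0 < r) {N : ℕ} {v : (ι → ℝ) → ℝ≥0∞} (c : ι → ℝ) {p : ℝ}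
    (hp : 0 ≤ p) (hp1 : p ≤ 1) :
    (av r v c) ^ p ≤ 2 ^ N * (∫⁻ y, v y * om N r (c - y)) ^ p := by
  refine (ENNReal.rpow_le_rpow (av_le_conv (L := N) hr v c) hp).trans ?_
  rw [ENNReal.mul_rpow_of_nonneg _ _ hp]
  gcongr
  calc ((2 : ℝ≥0∞) ^ N) ^ p ≤ ((2 : ℝ≥0∞) ^ N) ^ (1 : ℝ) :=
        ENNReal.rpow_le_rpow_of_exponent_le (one_le_pow₀ (by norm_num)) hp1
    _ = _ := ENNReal.rpow_one _

lemma exists_En_cut_near {L : ℕ} (hL : Fintype.card ι < L) {M M' : ℕ} (hM : 1 ≤ M)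
    (hMM : M ≤ M') : ∃ D : ℝ≥0, ∀ (J : Type) [Fintype J] (ξ : J → ι → ℝ) (b : J → ℂ) (τ : ι → ℤ)
      (c z : ι → ℝ) (_ : z ∈ closedBall c M'),
      En L M ξ (cut M ξ τ b) z ≤ D * En L M' ξ b c := by
  obtain ⟨C, hC⟩ := exists_En_cut_le (ι := ι) hL
  refine ⟨((M' : ℝ) ^ (L + Fintype.card ι)).toNNReal * C * 2 ^ L, fun J _ ξ b τ c z hz => ?_⟩
  have hM1 : (1 : ℝ) ≤ M := by exact_mod_cast hM
  have hMM1 : (M : ℝ) ≤ M' := by exact_mod_cast hMM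
  have hM0 : (0 : ℝ) < M := by linarith
  have hM'0 : (0 : ℝ) < M' := by linarith
  rw [mem_closedBall, dist_eq_norm] at hz
  calc En L M ξ (cut M ξ τ b) z
      ≤ ENNReal.ofReal ((M' : ℝ) ^ (L + Fintype.card ι)) * En L M' ξ (cut M ξ τ b) z :=
        En_le_mul (by linarith) hM0 hM'0 (by nlinarith) (by nlinarith) _ _ _
    _ ≤ ENNReal.ofReal ((M' : ℝ) ^ (L + Fintype.card ι)) * (C * (2 ^ L * En L M' ξ b c)) := by
        gcongr
        exact (hC J ξ b M M' hM0 hMM1 τ z).trans (by gcongr; exact (sv_En hM'0 ξ b).le_of_mem hM'0 hz)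
    _ = _ := by push_cast; rw [ENNReal.ofReal]; ring

end General

variable {n k : ℕ}

lemma prod_rpow_const (hk : 0 < k) (y : ℝ≥0∞) : ∏ _i : Fin k, y ^ (1 / k : ℝ) = y := by
  have hk' : (0 : ℝ) < k := by exact_mod_cast hk
  rw [Finset.prod_const, Finset.card_univ, Fintype.card_fin, ← ENNReal.rpow_natCast,
    ← ENNReal.rpow_mul, one_div, inv_mul_cancel₀ hk'.ne', ENNReal.rpow_one]

section Stage

variable {L M M' : ℕ} {J : Type} [Fintype J] {x : J → Fin n → ℝ} {a : J → ℂ} {D : ℝ≥0}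

local notation "ξ[" x "]" => fun j => Lam (x j)

/-- The total energy of the caps of level `M'`. -/
def tot (L M' : ℕ) (x : J → Fin n → ℝ) (a : J → ℂ) (c : Fin (n + 1) → ℝ) : ℝ≥0∞ :=
  ∑ σ ∈ caps n M', En L M' ξ[x] (cut M' ξ[x] σ a) c

lemma En_le_tot (hx : ∀ j, ‖x j‖ ≤ 1) (c : Fin (n + 1) → ℝ) :
    En L M' ξ[x] a c ≤ (caps n M').card * tot L M' x a c := by
  conv_lhs => rw [← sum_caps (M := M') hx a]
  exact En_sum_le _ _ _ _

lemma Ik_le_tot (hk : 0 < k) (hx : ∀ j, ‖x j‖ ≤ 1) {c z : Fin (n + 1) → ℝ}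
    (hD : ∀ b : J → ℂ, ∀ τ, En L M ξ[x] (cut M ξ[x] τ b) z ≤ D * En L M' ξ[x] b c) :
    Ik L k M x a z ≤ (tuples n k M).card * (D * (caps n M').card) * tot L M' x a c := by
  rw [mul_assoc, ← nsmul_eq_mul]
  refine Finset.sum_le_card_nsmul _ _ _ fun τ _ => ?_
  calc _ ≤ ∏ _i : Fin k, (D * (caps n M').card * tot L M' x a c) ^ (1 / k : ℝ) := by
        refine Finset.prod_le_prod' fun i _ => ENNReal.rpow_le_rpow ?_ (by positivity)
        refine (hD a (τ i)).trans ?_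
        rw [mul_assoc]
        gcongr
        exact En_le_tot hx c
    _ = _ := prod_rpow_const hk _

lemma le_Ik_of_mem_tuples (hM' : 0 < M') {c z : Fin (n + 1) → ℝ} (hz : z ∈ closedBall c M')
    (hk : 0 < k) {θ : Fin k → Fin (n + 1) → ℤ} (hθ : θ ∈ tuples n k M') {y : ℝ≥0∞}
    (hy : ∀ i, y ≤ En L M' ξ[x] (cut M' ξ[x] (θ i) a) c) :
    y ≤ 2 ^ L * Ik L k M' x a z := by
  have hM'0 : (0 : ℝ) < M' := by exact_mod_cast hM'
  rw [mem_closedBall, dist_eq_norm, norm_sub_rev] at hz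
  have hk' : (0 : ℝ) < k := by exact_mod_cast hk
  calc y = ∏ _i : Fin k, y ^ (1 / k : ℝ) := (prod_rpow_const hk y).symm
    _ ≤ ∏ i : Fin k, ((2 ^ L) ^ (1 / k : ℝ) *
          En L M' ξ[x] (cut M' ξ[x] (θ i) a) z ^ (1 / k : ℝ)) := by
        refine Finset.prod_le_prod' fun i _ => ?_
        rw [← ENNReal.mul_rpow_of_nonneg _ _ (by positivity)]
        refine ENNReal.rpow_le_rpow ((hy i).trans ?_) (by positivity)
        exact (sv_En hM'0 _ _).le_of_mem hM'0 hz
    _ = 2 ^ L * ∏ i : Fin k, En L M' ξ[x] (cut M' ξ[x] (θ i) a) z ^ (1 / k : ℝ) := by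
        rw [Finset.prod_mul_distrib, prod_rpow_const hk]
    _ ≤ _ := by
        gcongr
        exact Finset.single_le_sum (f := fun θ : Fin k → Fin (n + 1) → ℤ =>
          ∏ i, En L M' ξ[x] (cut M' ξ[x] (θ i) a) z ^ (1 / k : ℝ)) (fun _ _ => zero_le) hθ

lemma Ik_le_of_small (hk : 0 < k) (hx : ∀ j, ‖x j‖ ≤ 1) {c z : Fin (n + 1) → ℝ}
    (hD : ∀ b : J → ℂ, ∀ τ, En L M ξ[x] (cut M ξ[x] τ b) z ≤ D * En L M' ξ[x] b c)
    {S : Finset (Fin (n + 1) → ℤ)} (hS : S ⊆ caps n M') {l : ℝ≥0∞} (hl : l ≤ 1)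
    (hsm : ∀ σ ∈ caps n M', σ ∉ S → En L M' ξ[x] (cut M' ξ[x] σ a) c ≤ l * tot L M' x a c) :
    Ik L k M x a z ≤ 2 * ∑ τ ∈ tuples n k M, ∏ i,
        En L M ξ[x] (cut M ξ[x] (τ i) (∑ σ ∈ S, cut M' ξ[x] σ a)) z ^ (1 / k : ℝ) +
      (tuples n k M).card * (2 * 2 ^ k * (D * (caps n M').card ^ 2)) * l ^ (1 / k : ℝ) *
        tot L M' x a c := by
  classical
  set A := tot L M' x a c with hA
  set m : ℝ≥0∞ := ((caps n M').card : ℝ≥0∞) with hm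
  have hk' : (0 : ℝ) < k := by exact_mod_cast hk
  have hp : (0 : ℝ) ≤ 1 / k := by positivity
  set b := ∑ σ ∈ S, cut M' ξ[x] σ a with hb
  set b' := ∑ σ ∈ caps n M' \ S, cut M' ξ[x] σ a with hb'
  have hab : a = b + b' := by
    rw [hb, hb', add_comm, Finset.sum_sdiff hS, sum_caps hx]
  set Q : ℝ≥0∞ := D * m ^ 2 * A with hQ
  have hEb : En L M' ξ[x] b c ≤ m ^ 2 * A := by
    by_cases hm0 : caps n M' = ∅
    · have : b = 0 := by rw [hb, Finset.subset_empty.1 (hS.trans hm0.subset), Finset.sum_empty]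
      rw [this]; simp [En, es_zero]
    have hm1 : 1 ≤ m := by
      rw [hm]; exact_mod_cast Finset.card_pos.2 (Finset.nonempty_iff_ne_empty.2 hm0)
    calc _ ≤ (S.card : ℝ≥0∞) * ∑ σ ∈ S, En L M' ξ[x] (cut M' ξ[x] σ a) c := En_sum_le _ _ _ _
      _ ≤ m * A := by
        refine mul_le_mul' (by rw [hm]; exact_mod_cast Finset.card_le_card hS) ?_
        exact Finset.sum_le_sum_of_subset hS
      _ ≤ _ := by
        rw [pow_two, mul_assoc]; exact le_mul_of_one_le_left' hm1
  have hEb' : En L M' ξ[x] b' c ≤ l * (m ^ 2 * A) := by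
    calc _ ≤ ((caps n M' \ S).card : ℝ≥0∞) *
          ∑ σ ∈ caps n M' \ S, En L M' ξ[x] (cut M' ξ[x] σ a) c := En_sum_le _ _ _ _
      _ ≤ m * (m * (l * A)) := by
        have hc : ((caps n M' \ S).card : ℝ≥0∞) ≤ m := by
          rw [hm]; exact_mod_cast Finset.card_le_card Finset.sdiff_subset
        refine mul_le_mul' hc ?_
        refine (Finset.sum_le_card_nsmul _ _ (l * A) fun σ hσ => ?_).trans ?_
        · rw [Finset.mem_sdiff] at hσ
          exact hsm σ hσ.1 hσ.2
        · rw [nsmul_eq_mul]; gcongr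
      _ = _ := by ring
  have hα : ∀ τ, En L M ξ[x] (cut M ξ[x] τ b) z ≤ Q := fun τ =>
    (hD b τ).trans (by rw [hQ, mul_assoc]; gcongr)
  have he : ∀ τ, En L M ξ[x] (cut M ξ[x] τ b') z ≤ l * Q := fun τ =>
    (hD b' τ).trans ((mul_le_mul' le_rfl hEb').trans_eq (by rw [hQ]; ring))
  have hl1 : l ^ (1 / k : ℝ) ≤ 1 := by
    calc l ^ (1 / k : ℝ) ≤ 1 ^ (1 / k : ℝ) := by gcongr
      _ = 1 := ENNReal.one_rpow _
  have hQk : (Q ^ (1 / k : ℝ)) ^ k = Q := by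
    have := prod_rpow_const hk Q
    simpa using this
  have hτ : ∀ τ : Fin k → Fin (n + 1) → ℤ,
      ∏ i, En L M ξ[x] (cut M ξ[x] (τ i) a) z ^ (1 / k : ℝ) ≤
      2 * (∏ i, En L M ξ[x] (cut M ξ[x] (τ i) b) z ^ (1 / k : ℝ) +
        2 ^ k * l ^ (1 / k : ℝ) * Q) := fun τ => by
    calc _ ≤ ∏ i, (2 ^ (1 / k : ℝ) * (En L M ξ[x] (cut M ξ[x] (τ i) b) z ^ (1 / k : ℝ) +
          l ^ (1 / k : ℝ) * Q ^ (1 / k : ℝ))) := by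
          refine Finset.prod_le_prod' fun i _ => ?_
          have h1 : En L M ξ[x] (cut M ξ[x] (τ i) a) z ≤
              2 * (En L M ξ[x] (cut M ξ[x] (τ i) b) z + l * Q) := by
            have h2 : cut M ξ[x] (τ i) a = cut M ξ[x] (τ i) b + cut M ξ[x] (τ i) b' := by
              rw [hab]; ext j; simp only [cut, Pi.add_apply, mul_add]
            rw [h2]
            refine (En_add_le _ _ _ _).trans ?_
            gcongr
            exact he _
          refine (ENNReal.rpow_le_rpow h1 hp).trans ?_
          rw [ENNReal.mul_rpow_of_nonneg 2 _ hp, ← ENNReal.mul_rpow_of_nonneg l Q hp]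
          refine mul_le_mul' le_rfl ?_
          refine ENNReal.rpow_add_le_add_rpow _ _ hp ?_
          rw [div_le_one hk']; exact_mod_cast hk
      _ ≤ _ := by
          rw [Finset.prod_mul_distrib, prod_rpow_const hk]
          refine mul_le_mul' le_rfl ?_
          refine (prod_add_mul_le Finset.univ (fun i _ =>
            ENNReal.rpow_le_rpow (hα (τ i)) hp) hl1).trans_eq ?_
          rw [Finset.card_univ, Fintype.card_fin, hQk]
  calc Ik L k M x a z ≤ ∑ τ ∈ tuples n k M,
        2 * (∏ i, En L M ξ[x] (cut M ξ[x] (τ i) b) z ^ (1 / k : ℝ) +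
          2 ^ k * l ^ (1 / k : ℝ) * Q) := Finset.sum_le_sum fun τ _ => hτ τ
    _ = _ := by
        rw [← Finset.mul_sum, Finset.sum_add_distrib, Finset.sum_const, nsmul_eq_mul, hQ]
        ring

end Stage

end

section

variable {n k : ℕ}

local notation "ξ[" x "]" => fun j => Lam (x j)

lemma exists_orthogonality_tot {L : ℕ} (hL : n + 1 < L) :
    ∃ C : ℝ≥0, ∀ (J : Type) [Fintype J] (x : J → Fin n → ℝ) (a : J → ℂ) (M' : ℕ) (_ : 0 < M')
      (S : Finset (Fin (n + 1) → ℤ)) (_ : S ⊆ caps n M') (c : Fin (n + 1) → ℝ),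
      En L M' ξ[x] (∑ σ ∈ S, cut M' ξ[x] σ a) c ≤ C * tot L M' x a c := by
  obtain ⟨C, hC⟩ := exists_orthogonality (ι := Fin (n + 1)) (L := L) (by simpa using hL)
  refine ⟨C, fun J _ x a M' hM' S hS c => ?_⟩
  refine (hC J ξ[x] M' (by exact_mod_cast hM') S (fun σ => cut M' ξ[x] σ a)
    (fun m _ j hj => (cut_ne_zero hj).2) c).trans ?_
  refine mul_le_mul' le_rfl ?_
  exact Finset.sum_le_sum_of_subset hS

/-- The multilinear estimate for the part of the frequencies lying in a family of caps which
contains no transversal `(k + 1)`-tuple. -/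
lemma exists_ml_cut (hn : 0 < n) {L : ℕ} (hL : n + 1 < L) (hk : k ≤ n) (hk1 : 0 < k) {p : ℝ}
    (hp : 0 < p) (hkp : (k - 1 : ℝ) * p ≤ 1) {M : ℕ} (hM : 1 ≤ M)
    {τ : Fin k → Fin (n + 1) → ℤ} (hτ : Trans (M : ℝ) τ) {ε : ℝ} (hε : 0 < ε) :
    ∃ C : ℝ≥0, ∀ (M' : ℕ) (_ : 3 * M ≤ M') (J : Type) [Fintype J] (x : J → Fin n → ℝ)
      (_ : ∀ j, ‖x j‖ ≤ 1) (a : J → ℂ) (S : Finset (Fin (n + 1) → ℤ)) (_ : S ⊆ caps n M')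
      (_ : ∀ θ : Fin (k + 1) → Fin (n + 1) → ℤ, (∀ i, θ i ∈ S) → ¬ Trans (M' : ℝ) θ)
      (c : Fin (n + 1) → ℝ),
      av M' (fun z => ∏ i, En L M ξ[x] (cut M ξ[x] (τ i) (∑ σ ∈ S, cut M' ξ[x] σ a)) z ^ p) c ≤
        C * ENNReal.ofReal ((M' : ℝ) ^ ε) * tot L M' x a c ^ (k * p) := by
  have hM1 : (1 : ℝ) ≤ M := by exact_mod_cast hM
  obtain ⟨E, hE, hspan⟩ := exists_span_const (hk.trans n.le_succ) hk1 hM1 hτ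
  obtain ⟨C, hC⟩ := exists_ml hn hL (hk.trans n.le_succ) hk1 hp hkp hM1 hτ hε hE
  obtain ⟨C1, hC1⟩ := exists_orthogonality_tot (n := n) hL
  obtain ⟨C2, hC2⟩ := exists_En_cut_le (ι := Fin (n + 1)) (L := L) (by simpa using hL)
  refine ⟨C * (C2 * C1) ^ (k * p), fun M' hMM J _ x hx a S hS hST c => ?_⟩
  have hMM0 : (M : ℝ) ≤ M' := by exact_mod_cast (by omega : M ≤ M')
  have hMM1 : 3 * (M : ℝ) ≤ M' := by exact_mod_cast hMM
  have hb : ∀ j, (∑ σ ∈ S, cut M' ξ[x] σ a) j ≠ 0 → ∃ σ ∈ S, cut M' ξ[x] σ a j ≠ 0 := by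
    intro j hj
    rw [Finset.sum_apply] at hj
    exact Finset.exists_ne_zero_of_sum_ne_zero hj
  set b := ∑ σ ∈ S, cut M' ξ[x] σ a with hbdef
  refine (hC J x (fun i => cut M ξ[x] (τ i) b) (fun i j hj l =>
    (abs_sub_le_of_cut_ne_zero hj l).trans one_le_two) M' (hM1.trans hMM0) ?_ c).trans ?_
  · intro sel hsel i j hj
    have hsel' : ∀ i : Fin (k + 1), b ((Fin.snoc sel j : Fin (k + 1) → J) i) ≠ 0 := by
      refine Fin.lastCases ?_ fun i => ?_
      · simpa using (cut_ne_zero hj).1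
      · simpa using (cut_ne_zero (hsel i)).1
    choose θ hθS hθ using fun i => hb _ (hsel' i)
    obtain ⟨w, hw⟩ := hspan M' hMM1 θ (hST θ hθS) (fun i => x ((Fin.snoc sel j : Fin (k + 1) → J) i))
      (fun i l => by simpa using abs_sub_le_of_cut_ne_zero (hsel i) l)
      (fun i l => abs_sub_le_of_cut_ne_zero (hθ i) l) (hx _)
    exact ⟨w, by simpa using hw⟩
  · have h1 : ∀ i, En L M' ξ[x] (cut M ξ[x] (τ i) b) c ≤ C2 * C1 * tot L M' x a c := fun i => by
      refine (hC2 J ξ[x] b M M' (by linarith) hMM0 (τ i) c).trans ?_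
      rw [mul_assoc]
      exact mul_le_mul' le_rfl (hC1 J x a M' (by omega) S hS c)
    have h2 : ∏ i, En L M' ξ[x] (cut M ξ[x] (τ i) b) c ^ p ≤
        (C2 * C1 : ℝ≥0∞) ^ (k * p) * tot L M' x a c ^ (k * p) := by
      refine (Finset.prod_le_prod' fun i _ => ENNReal.rpow_le_rpow (h1 i) hp.le).trans_eq ?_
      rw [Finset.prod_const, Finset.card_univ, Fintype.card_fin, ← ENNReal.rpow_natCast,
        ← ENNReal.rpow_mul, mul_comm p, ENNReal.mul_rpow_of_nonneg _ _ (by positivity)]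
    refine (mul_le_mul' le_rfl h2).trans_eq ?_
    rw [ENNReal.coe_mul, ENNReal.coe_rpow_of_nonneg _ (by positivity)]
    push_cast
    ring

lemma exists_ml_cut_mul (hn : 2 ≤ n) {L : ℕ} (hL : n + 1 < L) (hk : k ≤ n) (hk1 : 0 < k) (N : ℕ)
    {M : ℕ} (hM : 1 ≤ M) {τ : Fin k → Fin (n + 1) → ℤ} (hτ : Trans (M : ℝ) τ) {ε : ℝ}
    (hε : 0 < ε) :
    ∃ C : ℝ≥0, ∀ (M' : ℕ) (_ : 3 * M ≤ M') (J : Type) [Fintype J] (x : J → Fin n → ℝ)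
      (_ : ∀ j, ‖x j‖ ≤ 1) (a : J → ℂ) (S : Finset (Fin (n + 1) → ℤ)) (_ : S ⊆ caps n M')
      (_ : ∀ θ : Fin (k + 1) → Fin (n + 1) → ℤ, (∀ i, θ i ∈ S) → ¬ Trans (M' : ℝ) θ)
      (v : (Fin (n + 1) → ℝ) → ℝ≥0∞) (_ : Measurable v) (c : Fin (n + 1) → ℝ),
      av M' (fun z => (∏ i, En L M ξ[x] (cut M ξ[x] (τ i) (∑ σ ∈ S, cut M' ξ[x] σ a)) z ^
        (1 / k : ℝ)) * v z ^ (1 / n : ℝ)) c ≤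
        C * ENNReal.ofReal ((M' : ℝ) ^ ε) * (tot L M' x a c *
          (∫⁻ y, v y * om N M' (c - y)) ^ (1 / n : ℝ)) := by
  have hn2 : (2 : ℝ) ≤ n := by exact_mod_cast hn
  have hk1' : (1 : ℝ) ≤ k := by exact_mod_cast hk1
  have hkn : (k : ℝ) ≤ n := by exact_mod_cast hk
  have hn1 : (0 : ℝ) < n - 1 := by linarith
  set q : ℝ := n / (n - 1) with hq
  have hq0 : 0 < q := by positivity
  obtain ⟨C, hC⟩ := exists_ml_cut (by omega) hL hk hk1 (p := 1 / k * q) (by positivity) (by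
    rw [hq, div_mul_div_comm, one_mul, ← mul_div_assoc, div_le_one (by positivity)]
    nlinarith) hM hτ hε
  refine ⟨C ^ ((n - 1) / n : ℝ) * 2 ^ N, fun M' hMM J _ x hx a S hS hST v hv c => ?_⟩
  have hM'1 : (1 : ℝ) ≤ M' := by exact_mod_cast (by omega : 1 ≤ M')
  have hM'0 : (0 : ℝ) < M' := by linarith
  have hr0 : (0 : ℝ) ≤ (n - 1) / n := by positivity
  set b := ∑ σ ∈ S, cut M' ξ[x] σ a with hb
  refine (av_mul_rpow_le (Finset.measurable_fun_prod _ fun _ _ =>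
    (measurable_En _ _).pow_const _) hv (q := n) (by linarith) c).trans ?_
  have h1 : ∀ z, (∏ i, En L M ξ[x] (cut M ξ[x] (τ i) b) z ^ (1 / k : ℝ)) ^ (n / (n - 1) : ℝ) =
      ∏ i, En L M ξ[x] (cut M ξ[x] (τ i) b) z ^ (1 / k * q : ℝ) := fun z => by
    rw [← ENNReal.prod_rpow_of_nonneg hq0.le]
    simp_rw [← ENNReal.rpow_mul]
  simp_rw [h1]
  have h2 := ENNReal.rpow_le_rpow (hC M' hMM J x hx a S hS hST c) hr0
  have h3 : (C * ENNReal.ofReal ((M' : ℝ) ^ ε) * tot L M' x a c ^ (k * (1 / k * q))) ^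
      ((n - 1) / n : ℝ) ≤ (C ^ ((n - 1) / n : ℝ) : ℝ≥0) * ENNReal.ofReal ((M' : ℝ) ^ ε) *
        tot L M' x a c := by
    rw [ENNReal.mul_rpow_of_nonneg _ _ hr0, ENNReal.mul_rpow_of_nonneg _ _ hr0,
      ← ENNReal.rpow_mul, show (k : ℝ) * (1 / k * q) * ((n - 1) / n) = 1 by
        rw [hq]; field_simp, ENNReal.rpow_one, ENNReal.coe_rpow_of_nonneg _ hr0]
    refine mul_le_mul' (mul_le_mul' le_rfl ?_) le_rfl
    calc _ ≤ ENNReal.ofReal ((M' : ℝ) ^ ε) ^ (1 : ℝ) := by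
          refine ENNReal.rpow_le_rpow_of_exponent_le ?_ ?_
          · rw [← ENNReal.ofReal_one]
            exact ENNReal.ofReal_le_ofReal (Real.one_le_rpow hM'1 hε.le)
          · rw [div_le_one (by linarith)]; linarith
      _ = _ := ENNReal.rpow_one _
  refine (mul_le_mul' (h2.trans h3) (av_le_conv_of_nat hM'0 (N := N) c (by positivity) (by
    rw [div_le_one (by linarith)]; linarith))).trans_eq ?_
  rw [ENNReal.coe_mul]
  push_cast
  ring

lemma exists_stage_pointwise (hn : 2 ≤ n) {L : ℕ} (hL : n + 1 < L) (hk : k ≤ n) (hk1 : 0 < k)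
    (N N' : ℕ) {M : ℕ} (hM : 1 ≤ M) {ε : ℝ} (hε : 0 < ε) :
    ∃ C : ℝ≥0, ∀ (M' : ℕ) (_ : 3 * M ≤ M'), ∃ K : ℝ≥0, ∀ (J : Type) [Fintype J]
      (x : J → Fin n → ℝ) (_ : ∀ j, ‖x j‖ ≤ 1) (a : J → ℂ)
      (v : (Fin (n + 1) → ℝ) → ℝ≥0∞) (_ : Measurable v) (g : (Fin (n + 1) → ℝ) → ℝ≥0∞) (R : ℝ)
      (_ : M' ≤ R) (_ : SV N' R g) (c : Fin (n + 1) → ℝ),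
      av M' (fun z => Ik L k M x a z * v z ^ (1 / n : ℝ) * g z) c ≤
        K * av M' (fun z => Ik L (k + 1) M' x a z * v z ^ (1 / n : ℝ) * g z) c +
        C * ENNReal.ofReal ((M' : ℝ) ^ ε) * (tot L M' x a c *
          (∫⁻ y, v y * om N M' (c - y)) ^ (1 / n : ℝ) * g c) := by
  classical
  have hC : ∀ τ : Fin k → Fin (n + 1) → ℤ, ∃ C : ℝ≥0, ∀ (_ : τ ∈ tuples n k M) (M' : ℕ)
      (_ : 3 * M ≤ M') (J : Type) [Fintype J] (x : J → Fin n → ℝ)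
      (_ : ∀ j, ‖x j‖ ≤ 1) (a : J → ℂ) (S : Finset (Fin (n + 1) → ℤ)) (_ : S ⊆ caps n M')
      (_ : ∀ θ : Fin (k + 1) → Fin (n + 1) → ℤ, (∀ i, θ i ∈ S) → ¬ Trans (M' : ℝ) θ)
      (v : (Fin (n + 1) → ℝ) → ℝ≥0∞) (_ : Measurable v) (c : Fin (n + 1) → ℝ),
      av M' (fun z => (∏ i, En L M ξ[x] (cut M ξ[x] (τ i) (∑ σ ∈ S, cut M' ξ[x] σ a)) z ^
        (1 / k : ℝ)) * v z ^ (1 / n : ℝ)) c ≤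
        C * ENNReal.ofReal ((M' : ℝ) ^ ε) * (tot L M' x a c *
          (∫⁻ y, v y * om N M' (c - y)) ^ (1 / n : ℝ)) := fun τ => by
    by_cases hτ : τ ∈ tuples n k M
    · obtain ⟨C, hC⟩ := exists_ml_cut_mul hn hL hk hk1 N hM (mem_tuples.1 hτ).2 hε
      exact ⟨C, fun _ => hC⟩
    · exact ⟨0, fun h => absurd h hτ⟩
  choose C hC using hC
  refine ⟨2 ^ N' * (2 * ∑ τ ∈ tuples n k M, C τ + 2 ^ N), fun M' hMM => ?_⟩
  have hM'1 : (1 : ℝ) ≤ M' := by exact_mod_cast (by omega : 1 ≤ M')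
  have hM'0 : (0 : ℝ) < M' := by linarith
  have hn2 : (2 : ℝ) ≤ n := by exact_mod_cast hn
  have hk1' : (1 : ℝ) ≤ k := by exact_mod_cast hk1
  obtain ⟨D, hD⟩ := exists_En_cut_near (ι := Fin (n + 1)) (L := L) (by simpa using hL) hM
    (by omega : M ≤ M')
  set X : ℝ≥0 := (tuples n k M).card * (2 * 2 ^ k * (D * (caps n M').card ^ 2)) with hX
  set l : ℝ≥0 := ((X + 1)⁻¹) ^ k with hl
  have hl0 : l ≠ 0 := by positivity
  have hl1 : l ≤ 1 := pow_le_one₀ zero_le (inv_le_one_of_one_le₀ (by simp))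
  have hlX : (X : ℝ≥0∞) * (l : ℝ≥0∞) ^ (1 / k : ℝ) ≤ 1 := by
    rw [← ENNReal.coe_rpow_of_nonneg _ (by positivity), hl, ← NNReal.rpow_natCast,
      ← NNReal.rpow_mul, mul_one_div_cancel (by positivity), NNReal.rpow_one]
    rw [← ENNReal.coe_mul]
    norm_cast
    rw [← div_eq_mul_inv]
    exact div_le_one_of_le₀ (by simp) (by simp)
  refine ⟨(tuples n k M).card * (D * (caps n M').card) * l⁻¹ * 2 ^ L,
    fun J _ x hx a v hv g R hR hg c => ?_⟩
  set A := tot L M' x a c with hA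
  set V := (∫⁻ y, v y * om N M' (c - y)) ^ (1 / n : ℝ) with hV
  have hgm := hg.meas
  set S := (caps n M').filter fun σ => l * A ≤ En L M' ξ[x] (cut M' ξ[x] σ a) c with hS
  by_cases hST : ∃ θ : Fin (k + 1) → Fin (n + 1) → ℤ, (∀ i, θ i ∈ S) ∧ Trans (M' : ℝ) θ
  · obtain ⟨θ, hθS, hθ⟩ := hST
    refine le_trans ?_ le_self_add
    have hm : Measurable fun z => Ik L (k + 1) M' x a z * v z ^ (1 / n : ℝ) * g z :=
      ((measurable_Ik x a).mul (hv.pow_const _)).mul hgm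
    rw [← av_const_mul hm]
    refine av_mono fun z hz => ?_
    rw [← mul_assoc, ← mul_assoc]
    refine mul_le_mul' (mul_le_mul' ?_ le_rfl) le_rfl
    refine (Ik_le_tot hk1 hx fun b τ => hD J ξ[x] b τ c z hz).trans ?_
    have h1 : (l : ℝ≥0∞) * A ≤ 2 ^ L * Ik L (k + 1) M' x a z := by
      refine le_Ik_of_mem_tuples (by omega) hz (by omega) (mem_tuples.2
        ⟨fun i => (Finset.mem_filter.1 (hθS i)).1, hθ⟩) fun i => (Finset.mem_filter.1 (hθS i)).2
    have h2 : A ≤ (l : ℝ≥0∞)⁻¹ * (2 ^ L * Ik L (k + 1) M' x a z) := by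
      calc A = (l : ℝ≥0∞)⁻¹ * (l * A) := by
            rw [← mul_assoc, ENNReal.inv_mul_cancel (by simpa using hl0) (by simp), one_mul]
        _ ≤ _ := by gcongr
    refine (mul_le_mul' le_rfl h2).trans_eq ?_
    push_cast
    rw [ENNReal.coe_inv hl0]
    ring
  · push Not at hST
    refine le_trans ?_ le_add_self
    have hsub : S ⊆ caps n M' := Finset.filter_subset _ _
    set b := ∑ σ ∈ S, cut M' ξ[x] σ a with hb
    set P : (Fin k → Fin (n + 1) → ℤ) → (Fin (n + 1) → ℝ) → ℝ≥0∞ := fun τ z =>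
      (∏ i, En L M ξ[x] (cut M ξ[x] (τ i) b) z ^ (1 / k : ℝ)) * v z ^ (1 / n : ℝ) with hP
    have hPm : ∀ τ, Measurable (P τ) := fun τ => (Finset.measurable_fun_prod _ fun _ _ =>
      (measurable_En _ _).pow_const _).mul (hv.pow_const _)
    have hpt : ∀ z ∈ closedBall c (M' : ℝ), Ik L k M x a z * v z ^ (1 / n : ℝ) * g z ≤
        2 ^ N' * g c * (2 * ∑ τ ∈ tuples n k M, P τ z + A * v z ^ (1 / n : ℝ)) := by
      intro z hz
      have h1 := Ik_le_of_small (L := L) (k := k) (M := M) hk1 hx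
        (fun b τ => hD J ξ[x] b τ c z hz) hsub
        (by exact_mod_cast hl1 : (l : ℝ≥0∞) ≤ 1) (a := a) fun σ hσ hσS => by
          simp only [hS, Finset.mem_filter, hσ, true_and, not_le] at hσS
          exact hσS.le
      have h2 : g z ≤ 2 ^ N' * g c := hg.le_of_mem (hM'0.trans_le hR)
        ((by simpa [dist_eq_norm] using hz : ‖z - c‖ ≤ M').trans hR)
      have h3 : Ik L k M x a z ≤ 2 * ∑ τ ∈ tuples n k M, ∏ i,
          En L M ξ[x] (cut M ξ[x] (τ i) b) z ^ (1 / k : ℝ) + A := by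
        refine h1.trans (add_le_add le_rfl ?_)
        refine (mul_le_mul' ?_ le_rfl).trans_eq (one_mul A)
        rw [hX] at hlX
        push_cast at hlX
        exact hlX
      calc _ ≤ (2 * ∑ τ ∈ tuples n k M, ∏ i,
            En L M ξ[x] (cut M ξ[x] (τ i) b) z ^ (1 / k : ℝ) + A) * v z ^ (1 / n : ℝ) *
              (2 ^ N' * g c) := mul_le_mul' (mul_le_mul' h3 le_rfl) h2
        _ = _ := by
          simp only [hP]
          rw [← Finset.sum_mul]
          ring
    refine (av_mono hpt).trans ?_
    have hsm : Measurable fun z => ∑ τ ∈ tuples n k M, P τ z :=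
      Finset.measurable_fun_sum _ fun τ _ => hPm τ
    have hvm : Measurable fun z => v z ^ (1 / n : ℝ) := hv.pow_const _
    have hm : Measurable fun z => 2 * ∑ τ ∈ tuples n k M, P τ z + A * v z ^ (1 / n : ℝ) :=
      (hsm.const_mul _).add (hvm.const_mul _)
    rw [av_const_mul hm, av_add (hsm.const_mul _),
      av_const_mul hsm, av_const_mul hvm, av_sum _ fun τ => hPm τ]
    have h4 : ∑ τ ∈ tuples n k M, av M' (P τ) c ≤ ((∑ τ ∈ tuples n k M, C τ : ℝ≥0) : ℝ≥0∞) *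
        (ENNReal.ofReal ((M' : ℝ) ^ ε) * (A * V)) := by
      rw [ENNReal.ofNNReal_finsetSum, Finset.sum_mul]
      refine Finset.sum_le_sum fun τ hτ => ?_
      exact (hC τ hτ M' hMM J x hx a S hsub hST v hv c).trans_eq (mul_assoc _ _ _)
    have h5 : av M' (fun z => v z ^ (1 / n : ℝ)) c ≤ 2 ^ N * V :=
      (av_rpow_le hM'0 hv (by linarith) c).trans (av_le_conv_of_nat hM'0 (N := N) c
        (by positivity) (by rw [div_le_one (by linarith)]; linarith))
    have h6 : 1 ≤ ENNReal.ofReal ((M' : ℝ) ^ ε) := by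
      rw [← ENNReal.ofReal_one]
      exact ENNReal.ofReal_le_ofReal (Real.one_le_rpow hM'1 hε.le)
    calc _ ≤ 2 ^ N' * g c * (2 * (((∑ τ ∈ tuples n k M, C τ : ℝ≥0) : ℝ≥0∞) *
        (ENNReal.ofReal ((M' : ℝ) ^ ε) * (A * V))) +
          A * (2 ^ N * (ENNReal.ofReal ((M' : ℝ) ^ ε) * V))) := by
          refine mul_le_mul' le_rfl (add_le_add (mul_le_mul' le_rfl h4) (mul_le_mul' le_rfl
            (h5.trans (mul_le_mul' le_rfl (le_mul_of_one_le_left' h6)))))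
      _ = _ := by
        push_cast
        ring

end

section

variable {n k : ℕ}

local notation "ξ[" x "]" => fun j => Lam (x j)

lemma lintegral_En_mul_le {ι : Type} [Fintype ι] {L N : ℕ} {J : Type} [Fintype J] {r : ℝ}
    (hr : 0 < r) (ξ : J → ι → ℝ) (a : J → ℂ) {h : (ι → ℝ) → ℝ≥0∞} (hh : SV N r h) :
    ∫⁻ c, En (L + N) r ξ a c * h c ≤
      (∫⁻ y : ι → ℝ, wt L 1 y) * ∫⁻ z, ‖es ξ a z‖ₑ ^ 2 * h z := by
  have hm := measurable_es_sq ξ a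
  have hhm := hh.meas
  unfold En
  have hm' : Measurable fun z => ‖es ξ a z‖ₑ ^ 2 * h z := hm.mul hhm
  rw [lintegral_conv_mul hm measurable_om hh.meas, ← lintegral_const_mul _ hm']
  refine lintegral_mono fun y => ?_
  simp only
  refine (mul_le_mul' le_rfl (hh.lintegral_om_mul_le hr y)).trans_eq ?_
  ring

/-- One step of the passage from `k`-broad to `(k + 1)`-broad parts. -/
lemma exists_stage (hn : 2 ≤ n) (hk : k ≤ n) (hk1 : 0 < k) (N N' : ℕ) {M : ℕ} (hM : 1 ≤ M)
    {ε : ℝ} (hε : 0 < ε) :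
    ∃ C : ℝ≥0, ∀ (M' : ℕ) (_ : 3 * M ≤ M'), ∃ K : ℝ≥0, ∀ (J : Type) [Fintype J]
      (x : J → Fin n → ℝ) (_ : ∀ j, ‖x j‖ ≤ 1) (a : J → ℂ)
      (v : (Fin (n + 1) → ℝ) → ℝ≥0∞) (_ : Measurable v) (g : (Fin (n + 1) → ℝ) → ℝ≥0∞) (R : ℝ)
      (_ : M' ≤ R) (_ : SV N' R g),
      ∫⁻ z, Ik (n + 2 + (N + N')) k M x a z * v z ^ (1 / n : ℝ) * g z ≤
        K * (∫⁻ z, Ik (n + 2 + (N + N')) (k + 1) M' x a z * v z ^ (1 / n : ℝ) * g z) +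
        C * ENNReal.ofReal ((M' : ℝ) ^ ε) * ∑ σ ∈ caps n M',
          ∫⁻ z, ‖es ξ[x] (cut M' ξ[x] σ a) z‖ₑ ^ 2 *
            ((∫⁻ y, v y * om N M' (z - y)) ^ (1 / n : ℝ) * g z) := by
  obtain ⟨C, hC⟩ := exists_stage_pointwise hn (L := n + 2 + (N + N')) (by omega) hk hk1 N N' hM hε
  have hW : (∫⁻ y : Fin (n + 1) → ℝ, wt (n + 2) 1 y) ≠ ∞ :=
    (lintegral_wt_one_lt_top (by simp)).ne
  set W := (∫⁻ y : Fin (n + 1) → ℝ, wt (n + 2) 1 y).toNNReal with hWdef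
  have hWc : (W : ℝ≥0∞) = ∫⁻ y : Fin (n + 1) → ℝ, wt (n + 2) 1 y := ENNReal.coe_toNNReal hW
  refine ⟨C * W, fun M' hMM => ?_⟩
  obtain ⟨K, hK⟩ := hC M' hMM
  refine ⟨K, fun J _ x hx a v hv g R hR hg => ?_⟩
  have hn2 : (2 : ℝ) ≤ n := by exact_mod_cast hn
  have hM'0 : (0 : ℝ) < M' := by exact_mod_cast (by omega : 0 < M')
  have hgm := hg.meas
  have hm : ∀ k M, Measurable fun z => Ik (n + 2 + (N + N')) k M x a z * v z ^ (1 / n : ℝ) * g z :=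
    fun k M => ((measurable_Ik x a).mul (hv.pow_const _)).mul hgm
  set V : (Fin (n + 1) → ℝ) → ℝ≥0∞ := fun z => ∫⁻ y, v y * om N M' (z - y) with hV
  have hVsv : SV N M' V := SV.conv hv (sv_om hM'0)
  have hh : SV (N + N') M' (fun z => V z ^ (1 / n : ℝ) * g z) :=
    SV.mul hM'0 (hVsv.rpow hM'0 (by positivity) (by rw [div_le_one (by linarith)]; linarith))
      (hg.mono hM'0 hR)
  have hhm := hh.meas
  rw [← lintegral_av hM'0 (hm k M), ← lintegral_av hM'0 (hm (k + 1) M')]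
  refine (lintegral_mono fun c => hK J x hx a v hv g R hR hg c).trans ?_
  rw [lintegral_add_left ((measurable_av (hm _ _)).const_mul _),
    lintegral_const_mul _ (measurable_av (hm _ _))]
  refine add_le_add le_rfl ?_
  have hEm : ∀ σ ∈ caps n M', Measurable fun c =>
      En (n + 2 + (N + N')) M' ξ[x] (cut M' ξ[x] σ a) c * (V c ^ (1 / n : ℝ) * g c) :=
    fun σ _ => (measurable_En _ _).mul hhm
  calc _ = ∫⁻ c, (C * ENNReal.ofReal ((M' : ℝ) ^ ε)) * ∑ σ ∈ caps n M',
        En (n + 2 + (N + N')) M' ξ[x] (cut M' ξ[x] σ a) c * (V c ^ (1 / n : ℝ) * g c) := by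
        refine lintegral_congr fun c => ?_
        rw [← Finset.sum_mul, tot, mul_assoc (Finset.sum _ _)]
    _ = (C * ENNReal.ofReal ((M' : ℝ) ^ ε)) * ∑ σ ∈ caps n M', ∫⁻ c,
        En (n + 2 + (N + N')) M' ξ[x] (cut M' ξ[x] σ a) c * (V c ^ (1 / n : ℝ) * g c) := by
        rw [lintegral_const_mul _ (Finset.measurable_fun_sum _ hEm), lintegral_finsetSum' _ fun σ hσ =>
          (hEm σ hσ).aemeasurable]
    _ ≤ (C * ENNReal.ofReal ((M' : ℝ) ^ ε)) * ∑ σ ∈ caps n M',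
          W * ∫⁻ z, ‖es ξ[x] (cut M' ξ[x] σ a) z‖ₑ ^ 2 * (V z ^ (1 / n : ℝ) * g z) := by
        refine mul_le_mul' le_rfl (Finset.sum_le_sum fun σ _ => ?_)
        rw [hWc]
        exact lintegral_En_mul_le hM'0 _ _ hh
    _ = _ := by
        rw [← Finset.mul_sum]
        push_cast
        ring

end

section

section Thin

variable {ι : Type} [Fintype ι]

/-- A weight whose mass on balls of radius `ρ ≥ 1` is at most `ρ ^ α`. -/
def Thin (α : ℝ) (v : (ι → ℝ) → ℝ≥0∞) : Prop :=
  ∀ z ρ, 1 ≤ ρ → ∫⁻ y in closedBall z ρ, v y ≤ ENNReal.ofReal (ρ ^ α)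

lemma Thin.av_one_le {α : ℝ} {v : (ι → ℝ) → ℝ≥0∞} (hv : Thin α v) (c : ι → ℝ) :
    av 1 v c ≤ 1 := by
  unfold av
  have h1 : (ENNReal.ofReal ((2 * 1 : ℝ) ^ Fintype.card ι))⁻¹ ≤ 1 := by
    rw [ENNReal.inv_le_one, ← ENNReal.ofReal_one]
    exact ENNReal.ofReal_le_ofReal (one_le_pow₀ (by norm_num))
  simpa using mul_le_mul' h1 (hv c 1 le_rfl)

lemma Thin.av_av_le {α : ℝ} {v : (ι → ℝ) → ℝ≥0∞} (hv : Thin α v) (hvm : Measurable v)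
    (hα : α ≤ Fintype.card ι) {R : ℝ} (hR : 1 ≤ R) (c : ι → ℝ) :
    av R (av 1 v) c ≤ ENNReal.ofReal (R ^ (α - Fintype.card ι)) := by
  have hR0 : 0 < R := by linarith
  have h2R : 0 < 2 * R := by linarith
  set B := closedBall c (2 * R) with hB
  have hBm : MeasurableSet B := measurableSet_closedBall
  have h1 : ∫⁻ z in closedBall c R, av 1 v z ≤ ENNReal.ofReal ((2 * R) ^ α) := by
    calc ∫⁻ z in closedBall c R, av 1 v z
        ≤ ∫⁻ z in closedBall c R, av 1 (B.indicator v) z := by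
          refine setLIntegral_mono' measurableSet_closedBall fun z hz => av_mono fun y hy => ?_
          rw [indicator_of_mem]
          rw [hB, mem_closedBall]
          rw [mem_closedBall] at hy hz
          linarith [dist_triangle y z c]
      _ ≤ ∫⁻ z, av 1 (B.indicator v) z := setLIntegral_le_lintegral _ _
      _ = ∫⁻ z in B, v z := by
          rw [lintegral_av one_pos (hvm.indicator hBm), lintegral_indicator hBm]
      _ ≤ _ := hv c _ (by linarith)
  calc av R (av 1 v) c ≤ (ENNReal.ofReal ((2 * R) ^ Fintype.card ι))⁻¹ *
        ENNReal.ofReal ((2 * R) ^ α) := mul_le_mul' le_rfl h1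
    _ = ENNReal.ofReal ((2 * R) ^ (α - Fintype.card ι)) := by
        rw [← ENNReal.ofReal_inv_of_pos (by positivity), ← ENNReal.ofReal_mul (by positivity),
          Real.rpow_sub h2R, Real.rpow_natCast, div_eq_inv_mul]
    _ ≤ _ := by
        refine ENNReal.ofReal_le_ofReal ?_
        exact Real.rpow_le_rpow_of_nonpos hR0 (by linarith) (by linarith)

end Thin

variable {n k : ℕ}

local notation "ξ[" x "]" => fun j => Lam (x j)

lemma Trans.exists_eq_sum {M : ℝ} {τ : Fin (n + 1) → Fin (n + 1) → ℤ} (hτ : Trans M τ)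
    {p : Fin (n + 1) → Fin n → ℝ} (hp : ∀ i l, |M * p i l - τ i l.succ| ≤ 2)
    (y : Fin (n + 1) → ℝ) : ∃ w : Fin (n + 1) → ℝ, y = ∑ i, w i • Nor (p i) := by
  have h := (hτ p hp).span_eq_top_of_card_eq_finrank' (by simp)
  have hy : y ∈ Submodule.span ℝ (Set.range fun i => Nor (p i)) := by rw [h]; trivial
  obtain ⟨w, hw⟩ := (Submodule.mem_span_range_iff_exists_fun ℝ).1 hy
  exact ⟨w, hw.symm⟩

lemma exists_broad_av (hn : 0 < n) {L : ℕ} (hL : n + 1 < L) {M : ℕ} (hM : 1 ≤ M)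
    {τ : Fin (n + 1) → Fin (n + 1) → ℤ} (hτ : Trans (M : ℝ) τ) {ε : ℝ} (hε : 0 < ε) {α : ℝ}
    (hα : α ≤ n + 1) :
    ∃ C : ℝ≥0, ∀ (J : Type) [Fintype J] (x : J → Fin n → ℝ) (a : J → ℂ)
      (v : (Fin (n + 1) → ℝ) → ℝ≥0∞) (_ : Measurable v) (_ : Thin α v) (R : ℝ) (_ : M ≤ R)
      (c : Fin (n + 1) → ℝ),
      av R (fun z => (∏ i, En L M ξ[x] (cut M ξ[x] (τ i) a) z ^ (1 / (n + 1) : ℝ)) *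
        av 1 v z ^ (1 / (n + 1) : ℝ)) c ≤
        C * ENNReal.ofReal (R ^ (α / (n + 1) - 1 + ε)) * En L R ξ[x] a c := by
  have hn1 : (1 : ℝ) ≤ n := by exact_mod_cast hn
  have hn0 : (0 : ℝ) < n := by linarith
  have hM1 : (1 : ℝ) ≤ M := by exact_mod_cast hM
  obtain ⟨C, hC⟩ := exists_ml (k := n + 1) (p := 1 / n) hn hL le_rfl (by omega) (by positivity)
    (by push_cast; field_simp; linarith) hM1 hτ hε le_rfl
  obtain ⟨C2, hC2⟩ := exists_En_cut_le (ι := Fin (n + 1)) (L := L) (by simpa using hL)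
  have hr0 : (0 : ℝ) ≤ n / (n + 1) := by positivity
  refine ⟨C ^ (n / (n + 1) : ℝ) * C2, fun J _ x a v hvm hv R hR c => ?_⟩
  have hR1 : 1 ≤ R := hM1.trans hR
  have hR0 : 0 < R := by linarith
  have hq : (1 : ℝ) < n + 1 := by linarith
  refine (av_mul_rpow_le (Finset.measurable_fun_prod _ fun _ _ =>
    (measurable_En _ _).pow_const _) (measurable_av hvm) (q := n + 1) hq c).trans ?_
  rw [add_sub_cancel_right]
  have h1 : ∀ z, (∏ i, En L M ξ[x] (cut M ξ[x] (τ i) a) z ^ (1 / (n + 1) : ℝ)) ^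
      ((n + 1) / n : ℝ) = ∏ i, En L M ξ[x] (cut M ξ[x] (τ i) a) z ^ (1 / n : ℝ) := fun z => by
    rw [← ENNReal.prod_rpow_of_nonneg (by positivity)]
    simp_rw [← ENNReal.rpow_mul]
    rw [show (1 / (n + 1) * ((n + 1) / n) : ℝ) = 1 / n by field_simp]
  simp_rw [h1]
  have h2 := hC J x (fun i => cut M ξ[x] (τ i) a) (fun i j hj l =>
    (abs_sub_le_of_cut_ne_zero hj l).trans one_le_two) R hR1 (fun sel hsel i j _ => by
      obtain ⟨w, hw⟩ := hτ.exists_eq_sum (p := fun i => x (sel i)) (fun i l =>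
        (abs_sub_le_of_cut_ne_zero (hsel i) l).trans one_le_two) (Nor (x j))
      refine ⟨w, ?_⟩
      rw [hw, sub_self, norm_zero]
      positivity) c
  have h3 : ∏ i : Fin (n + 1), En L R ξ[x] (cut M ξ[x] (τ i) a) c ^ (1 / n : ℝ) ≤
      (C2 * En L R ξ[x] a c) ^ ((n + 1) / n : ℝ) := by
    refine (Finset.prod_le_prod' fun i _ => ENNReal.rpow_le_rpow
      (hC2 J ξ[x] a M R (by linarith) hR (τ i) c) (by positivity)).trans_eq ?_
    rw [Finset.prod_const, Finset.card_univ, Fintype.card_fin, ← ENNReal.rpow_natCast,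
      ← ENNReal.rpow_mul]
    congr 1
    push_cast
    field_simp
  have h4 := ENNReal.rpow_le_rpow (h2.trans (mul_le_mul' le_rfl h3)) hr0
  have h5 := ENNReal.rpow_le_rpow (hv.av_av_le hvm (by simpa using hα) hR1 c)
    (by positivity : (0 : ℝ) ≤ 1 / (n + 1))
  refine (mul_le_mul' h4 h5).trans ?_
  rw [ENNReal.mul_rpow_of_nonneg _ _ hr0, ENNReal.mul_rpow_of_nonneg _ _ hr0, ← ENNReal.rpow_mul,
    show ((n + 1) / n : ℝ) * (n / (n + 1)) = 1 by field_simp, ENNReal.rpow_one,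
    ENNReal.ofReal_rpow_of_pos (by positivity), ENNReal.ofReal_rpow_of_pos (by positivity),
    ← Real.rpow_mul hR0.le, ← Real.rpow_mul hR0.le, Fintype.card_fin, ENNReal.coe_mul,
    ENNReal.coe_rpow_of_nonneg _ hr0]
  have h6 : ENNReal.ofReal (R ^ (ε * (n / (n + 1)))) * ENNReal.ofReal
      (R ^ ((α - (n + 1 : ℕ)) * (1 / (n + 1)))) ≤ ENNReal.ofReal (R ^ (α / (n + 1) - 1 + ε)) := by
    rw [← ENNReal.ofReal_mul (by positivity), ← Real.rpow_add hR0]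
    refine ENNReal.ofReal_le_ofReal (Real.rpow_le_rpow_of_exponent_le hR1 ?_)
    have e1 : (α - (n + 1 : ℕ)) * (1 / (n + 1)) = α / (n + 1) - 1 := by push_cast; field_simp
    have e2 : ε * (n / (n + 1)) ≤ ε := by
      refine mul_le_of_le_one_right hε.le ?_
      rw [div_le_one (by positivity)]; linarith
    rw [e1]; linarith
  calc _ = (C : ℝ≥0∞) ^ (n / (n + 1) : ℝ) * C2 * (ENNReal.ofReal (R ^ (ε * (n / (n + 1)))) *
        ENNReal.ofReal (R ^ ((α - (n + 1 : ℕ)) * (1 / (n + 1))))) * En L R ξ[x] a c := by ring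
    _ ≤ _ := mul_le_mul' (mul_le_mul' le_rfl h6) le_rfl

/-- The estimate for the `(n + 1)`-broad part. -/
lemma exists_broad (hn : 2 ≤ n) (N N' : ℕ) {M : ℕ} (hM : 1 ≤ M) {ε : ℝ} (hε : 0 < ε) {α : ℝ}
    (hα : α ≤ n + 1) :
    ∃ C : ℝ≥0, ∀ (J : Type) [Fintype J] (x : J → Fin n → ℝ) (a : J → ℂ)
      (v : (Fin (n + 1) → ℝ) → ℝ≥0∞) (_ : Measurable v) (_ : Thin α v)
      (g : (Fin (n + 1) → ℝ) → ℝ≥0∞) (R : ℝ) (_ : M ≤ R) (_ : SV N' R g),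
      ∫⁻ z, Ik (n + 2 + (N + N')) (n + 1) M x a z * v z ^ (1 / n : ℝ) * g z ≤
        C * ENNReal.ofReal (R ^ (α / (n + 1) - 1 + ε)) * ∫⁻ z, ‖es ξ[x] a z‖ₑ ^ 2 * g z := by
  classical
  set L := n + 2 + (N + N') with hLdef
  have hC : ∀ τ : Fin (n + 1) → Fin (n + 1) → ℤ, ∃ C : ℝ≥0, ∀ (_ : τ ∈ tuples n (n + 1) M)
      (J : Type) [Fintype J] (x : J → Fin n → ℝ) (a : J → ℂ)
      (v : (Fin (n + 1) → ℝ) → ℝ≥0∞) (_ : Measurable v) (_ : Thin α v) (R : ℝ) (_ : M ≤ R)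
      (c : Fin (n + 1) → ℝ),
      av R (fun z => (∏ i, En L M ξ[x] (cut M ξ[x] (τ i) a) z ^ (1 / (n + 1) : ℝ)) *
        av 1 v z ^ (1 / (n + 1) : ℝ)) c ≤
        C * ENNReal.ofReal (R ^ (α / (n + 1) - 1 + ε)) * En L R ξ[x] a c := fun τ => by
    by_cases hτ : τ ∈ tuples n (n + 1) M
    · obtain ⟨C, hC⟩ := exists_broad_av (by omega) (L := L) (by omega) hM (mem_tuples.1 hτ).2 hε hα
      exact ⟨C, fun _ => hC⟩
    · exact ⟨0, fun h => absurd h hτ⟩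
  choose C hC using hC
  set W := (∫⁻ y : Fin (n + 1) → ℝ, wt (n + 2) 1 y).toNNReal with hWdef
  have hWc : (W : ℝ≥0∞) = ∫⁻ y : Fin (n + 1) → ℝ, wt (n + 2) 1 y :=
    ENNReal.coe_toNNReal (lintegral_wt_one_lt_top (by simp)).ne
  set H := L * (n + 1) + N' with hH
  refine ⟨2 ^ H * 2 ^ N' * (∑ τ ∈ tuples n (n + 1) M, C τ) * W,
    fun J _ x a v hvm hv g R hR hg => ?_⟩
  have hM1 : (1 : ℝ) ≤ M := by exact_mod_cast hM
  have hR1 : 1 ≤ R := hM1.trans hR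
  have hR0 : 0 < R := by linarith
  have hn2 : (2 : ℝ) ≤ n := by exact_mod_cast hn
  have hgm := hg.meas
  set P : (Fin (n + 1) → Fin (n + 1) → ℤ) → (Fin (n + 1) → ℝ) → ℝ≥0∞ := fun τ z =>
      ∏ i, En L M ξ[x] (cut M ξ[x] (τ i) a) z ^ (1 / (n + 1) : ℝ) with hP
  have hPm : ∀ τ, Measurable (P τ) := fun τ => Finset.measurable_fun_prod _ fun _ _ =>
      (measurable_En _ _).pow_const _
  have hvm1 : Measurable fun z => av 1 v z ^ (1 / (n + 1) : ℝ) := (measurable_av hvm).pow_const _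
  set X := ENNReal.ofReal (R ^ (α / (n + 1) - 1 + ε)) with hX
  have key : ∀ τ ∈ tuples n (n + 1) M, ∫⁻ z, P τ z * v z ^ (1 / n : ℝ) * g z ≤
      2 ^ H * (2 ^ N' * (C τ * X * (W * ∫⁻ z, ‖es ξ[x] a z‖ₑ ^ 2 * g z))) := by
    intro τ hτ
    have hsv : SV H 1 (fun z => P τ z * g z) := by
      have h2 := SV.prod (N := L) (R := 1) (g := fun i z =>
        En L M ξ[x] (cut M ξ[x] (τ i) a) z ^ (1 / (n + 1) : ℝ)) Finset.univ one_pos fun i _ =>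
          ((sv_En (by linarith) _ _).mono one_pos hM1).rpow one_pos (by positivity)
            (by rw [div_le_one (by positivity)]; linarith)
      have h3 := SV.mul one_pos h2 (hg.mono one_pos hR1)
      simpa [hP, hH] using h3
    have hm2 : Measurable fun z => P τ z * av 1 v z ^ (1 / (n + 1) : ℝ) := (hPm τ).mul hvm1
    have hm3 : Measurable fun z => P τ z * av 1 v z ^ (1 / (n + 1) : ℝ) * g z := hm2.mul hgm
    calc ∫⁻ z, P τ z * v z ^ (1 / n : ℝ) * g z
        = ∫⁻ z, v z ^ (1 / n : ℝ) * (P τ z * g z) := lintegral_congr fun z => by ring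
      _ ≤ 2 ^ H * ∫⁻ c, av 1 (fun z => v z ^ (1 / n : ℝ)) c * (P τ c * g c) :=
          lintegral_mul_le_av one_pos (hvm.pow_const _) hsv
      _ ≤ 2 ^ H * ∫⁻ c, P τ c * av 1 v c ^ (1 / (n + 1) : ℝ) * g c := by
          refine mul_le_mul' le_rfl (lintegral_mono fun c => ?_)
          have h1 : av 1 (fun z => v z ^ (1 / n : ℝ)) c ≤ av 1 v c ^ (1 / (n + 1) : ℝ) := by
            refine (av_rpow_le one_pos hvm (by linarith) c).trans ?_
            refine ENNReal.rpow_le_rpow_of_exponent_ge (hv.av_one_le c) ?_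
            exact one_div_le_one_div_of_le (by linarith) (by linarith)
          refine (mul_le_mul' h1 le_rfl).trans_eq ?_
          ring
      _ = 2 ^ H * ∫⁻ c, av R (fun z => P τ z * av 1 v z ^ (1 / (n + 1) : ℝ) * g z) c := by
          rw [lintegral_av hR0 hm3]
      _ ≤ 2 ^ H * ∫⁻ c, 2 ^ N' * (C τ * X * (En L R ξ[x] a c * g c)) := by
          refine mul_le_mul' le_rfl (lintegral_mono fun c => ?_)
          calc _ ≤ av R (fun z => 2 ^ N' * g c * (P τ z * av 1 v z ^ (1 / (n + 1) : ℝ))) c := by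
                refine av_mono fun z hz => ?_
                rw [mul_comm]
                refine mul_le_mul' (hg.le_of_mem hR0 ?_) le_rfl
                simpa [dist_eq_norm] using hz
            _ = 2 ^ N' * g c * av R (fun z => P τ z * av 1 v z ^ (1 / (n + 1) : ℝ)) c :=
                av_const_mul hm2 _ _
            _ ≤ 2 ^ N' * g c * (C τ * X * En L R ξ[x] a c) :=
                mul_le_mul' le_rfl (hC τ hτ J x a v hvm hv R hR c)
            _ = _ := by ring
      _ = 2 ^ H * (2 ^ N' * (C τ * X * ∫⁻ c, En L R ξ[x] a c * g c)) := by
          have hm4 : Measurable fun c => En L R ξ[x] a c * g c := (measurable_En _ _).mul hgm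
          rw [lintegral_const_mul _ (hm4.const_mul _), lintegral_const_mul _ hm4]
      _ ≤ _ := by
          refine mul_le_mul' le_rfl (mul_le_mul' le_rfl (mul_le_mul' le_rfl ?_))
          rw [hWc]
          exact lintegral_En_mul_le hR0 _ _ (hg.mono_exp hR0 (by omega))
  have hIk : ∀ z, Ik L (n + 1) M x a z * v z ^ (1 / n : ℝ) * g z =
      ∑ τ ∈ tuples n (n + 1) M, P τ z * v z ^ (1 / n : ℝ) * g z := fun z => by
    rw [← Finset.sum_mul, ← Finset.sum_mul, Ik]
    simp [hP]
  simp_rw [hIk]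
  have hm5 : ∀ τ ∈ tuples n (n + 1) M, Measurable fun z => P τ z * v z ^ (1 / n : ℝ) * g z :=
    fun τ _ => ((hPm τ).mul (hvm.pow_const _)).mul hgm
  rw [lintegral_finsetSum _ hm5]
  refine (Finset.sum_le_sum key).trans_eq ?_
  rw [← Finset.mul_sum, ← Finset.mul_sum, ← Finset.sum_mul, ← Finset.sum_mul]
  push_cast
  ring

end

section Thin

variable {ι : Type} [Fintype ι]

lemma Thin.conv_om_le {α : ℝ} {v : (ι → ℝ) → ℝ≥0∞} (hv : Thin α v) (hvm : Measurable v)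
    {N : ℕ} (hN : α + 1 ≤ N) {s : ℝ} (hs : 1 ≤ s) (c : ι → ℝ) :
    ∫⁻ y, v y * om N s (c - y) ≤ 2 ^ (N + 1) * ENNReal.ofReal (s ^ (α - Fintype.card ι)) := by
  have hs0 : 0 < s := by linarith
  set d := Fintype.card ι with hd
  set q : ℕ → ℝ := fun k => 2 ^ N * (s ^ d)⁻¹ * ((2 ^ k) ^ N)⁻¹ with hq
  have hpt : ∀ y, v y * om N s (c - y) ≤
      ∑' k : ℕ, ENNReal.ofReal (q k) * (closedBall c (2 ^ k * s)).indicator v y := by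
    intro y
    set t := ‖c - y‖ / s with ht
    have ht0 : 0 ≤ t := by positivity
    obtain ⟨m, hm1, hm2⟩ := exists_nat_pow_near (x := 1 + t) (y := 2) (by linarith) one_lt_two
    refine le_trans ?_ (ENNReal.le_tsum (m + 1))
    rw [indicator_of_mem, mul_comm]
    · refine mul_le_mul' ?_ le_rfl
      unfold om wt
      rw [← ENNReal.ofReal_mul (by positivity)]
      refine ENNReal.ofReal_le_ofReal ?_
      simp only [hq]
      rw [← ht, mul_comm (2 ^ N) _, mul_assoc]
      refine mul_le_mul_of_nonneg_left ?_ (by positivity)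
      have h1 : (2 : ℝ) ^ N * ((2 ^ (m + 1)) ^ N)⁻¹ = ((2 ^ m) ^ N)⁻¹ := by
        rw [pow_succ, mul_pow]; field_simp
      rw [h1]
      exact inv_anti₀ (by positivity) (pow_le_pow_left₀ (by positivity) hm1 N)
    · rw [mem_closedBall, dist_comm, dist_eq_norm]
      have : ‖c - y‖ = t * s := by rw [ht]; field_simp
      rw [this]
      exact mul_le_mul_of_nonneg_right (by linarith) hs0.le
  have hmk : ∀ k : ℕ, Measurable fun y => (closedBall c (2 ^ k * s)).indicator v y := fun k =>
    hvm.indicator measurableSet_closedBall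
  calc ∫⁻ y, v y * om N s (c - y)
      ≤ ∫⁻ y, ∑' k : ℕ, ENNReal.ofReal (q k) * (closedBall c (2 ^ k * s)).indicator v y :=
        lintegral_mono hpt
    _ = ∑' k : ℕ, ENNReal.ofReal (q k) * ∫⁻ y in closedBall c (2 ^ k * s), v y := by
        rw [lintegral_tsum fun k => ((hmk k).const_mul _).aemeasurable]
        refine tsum_congr fun k => ?_
        rw [lintegral_const_mul _ (hmk k), lintegral_indicator measurableSet_closedBall]
    _ ≤ ∑' k : ℕ, 2 ^ N * ENNReal.ofReal (s ^ (α - d)) * (2⁻¹) ^ k := by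
        refine ENNReal.tsum_le_tsum fun k => ?_
        have h2k : (1 : ℝ) ≤ 2 ^ k := one_le_pow₀ one_le_two
        refine (mul_le_mul' le_rfl (hv c _ (by nlinarith))).trans ?_
        have e1 : (2 : ℝ≥0∞) ^ N * ENNReal.ofReal (s ^ (α - d)) * (2⁻¹) ^ k =
            ENNReal.ofReal (2 ^ N * s ^ (α - d) * (2⁻¹) ^ k) := by
          rw [ENNReal.ofReal_mul (by positivity), ENNReal.ofReal_mul (by positivity),
            ENNReal.ofReal_pow (by norm_num), ENNReal.ofReal_pow (by norm_num),
            ENNReal.ofReal_inv_of_pos (by norm_num), ENNReal.ofReal_ofNat]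
        rw [e1, ← ENNReal.ofReal_mul (by positivity)]
        refine ENNReal.ofReal_le_ofReal ?_
        simp only [hq]
        rw [Real.mul_rpow (by positivity) hs0.le, Real.rpow_sub hs0, Real.rpow_natCast]
        have h3 : ((2 : ℝ) ^ k) ^ α ≤ (2 ^ k) ^ N * (2⁻¹) ^ k := by
          calc ((2 : ℝ) ^ k) ^ α ≤ (2 ^ k) ^ ((N : ℝ) - 1) :=
                Real.rpow_le_rpow_of_exponent_le h2k (by linarith)
            _ = _ := by
              rw [Real.rpow_sub (by positivity), Real.rpow_natCast, Real.rpow_one, inv_pow,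
                div_eq_mul_inv]
        calc 2 ^ N * (s ^ d)⁻¹ * ((2 ^ k) ^ N)⁻¹ * ((2 ^ k) ^ α * s ^ α)
            ≤ 2 ^ N * (s ^ d)⁻¹ * ((2 ^ k) ^ N)⁻¹ * ((2 ^ k) ^ N * (2⁻¹) ^ k * s ^ α) := by
              gcongr
          _ = _ := by field_simp
    _ = _ := by
        rw [ENNReal.tsum_mul_left, ENNReal.tsum_geometric, ENNReal.one_sub_inv_two, inv_inv,
          pow_succ]
        ring

lemma exists_lintegral_comp (T : (ι → ℝ) ≃ₗ[ℝ] (ι → ℝ)) : ∃ D : ℝ≥0∞, D ≠ 0 ∧ D ≠ ∞ ∧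
    ∀ F : (ι → ℝ) → ℝ≥0∞, Measurable F → ∫⁻ z, F (T z) = D * ∫⁻ z, F z := by
  have h0 : LinearMap.det (T : (ι → ℝ) →ₗ[ℝ] (ι → ℝ)) ≠ 0 := T.isUnit_det'.ne_zero
  refine ⟨ENNReal.ofReal |(LinearMap.det (T : (ι → ℝ) →ₗ[ℝ] (ι → ℝ)))⁻¹|, ?_, by simp,
    fun F hF => ?_⟩
  · simpa using h0
  · have h1 := Measure.map_linearMap_addHaar_eq_smul_addHaar (volume : Measure (ι → ℝ)) h0
    rw [← smul_eq_mul, ← lintegral_smul_measure, ← h1, lintegral_map hF]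
    · rfl
    · exact (LinearMap.continuous_of_finiteDimensional _).measurable

/-- Thinness of a mollified weight after a linear change of variables. -/
lemma Thin.exists_comp {α : ℝ} (hα : α ≤ Fintype.card ι) {N : ℕ} (hN : Fintype.card ι + 1 ≤ N) :
    ∃ B : ℝ≥0, B ≠ 0 ∧ ∀ (v : (ι → ℝ) → ℝ≥0∞) (_ : Measurable v) (_ : Thin α v) (M : ℝ) (_ : 1 ≤ M)
      (T : (ι → ℝ) ≃ₗ[ℝ] (ι → ℝ)) (_ : ∀ z, M * ‖T z‖ ≤ 5 * ‖z‖),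
      Thin α fun w => ((B : ℝ≥0∞) * ENNReal.ofReal (M ^ (α - Fintype.card ι)))⁻¹ *
        ∫⁻ y, v y * om N M (T.symm w - y) := by
  set d := Fintype.card ι with hd
  have hW : (∫⁻ y : ι → ℝ, wt N 1 y) ≠ ∞ := (lintegral_wt_one_lt_top (by omega)).ne
  set W := (∫⁻ y : ι → ℝ, wt N 1 y).toNNReal with hWdef
  have hWc : (W : ℝ≥0∞) = ∫⁻ y : ι → ℝ, wt N 1 y := ENNReal.coe_toNNReal hW
  set B : ℝ≥0 := 12 ^ d * (2 ^ N * (4 ^ N * (2 * W) * 2 ^ (N + 1))) + 1 with hB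
  refine ⟨B, by positivity, fun v hvm hv M hM T hT z₀ ρ hρ => ?_⟩
  have hM0 : 0 < M := by linarith
  have hρ0 : 0 < ρ := by linarith
  set s := M * ρ with hs
  have hMs : M ≤ s := by rw [hs]; nlinarith
  have hs1 : 1 ≤ s := hM.trans hMs
  have hs0 : 0 < s := by linarith
  obtain ⟨D, hD0, hD, hDT⟩ := exists_lintegral_comp T
  set V : (ι → ℝ) → ℝ≥0∞ := fun z => ∫⁻ y, v y * om N M (z - y) with hV
  have hVm : Measurable V := (SV.conv hvm (sv_om hM0)).meas
  have hTm : Measurable T := T.toContinuousLinearEquiv.continuous.measurable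
  have hTsm : Measurable T.symm := T.symm.toContinuousLinearEquiv.continuous.measurable
  have hVT : Measurable fun w => V (T.symm w) := hVm.comp hTsm
  have hsup : ∀ c, av s V c ≤ 2 ^ N * (4 ^ N * (2 * W) * 2 ^ (N + 1)) *
      ENNReal.ofReal (s ^ (α - d)) := by
    intro c
    refine (av_le_conv (L := N) hs0 V c).trans ?_
    rw [mul_assoc]
    refine mul_le_mul' le_rfl ?_
    calc ∫⁻ z, V z * om N s (c - z)
        = ∫⁻ y, v y * ∫⁻ z, om N M (z - y) * om N s (c - z) :=
          lintegral_conv_mul (g := fun z => om N s (c - z)) hvm measurable_om (by fun_prop)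
      _ ≤ ∫⁻ y, v y * (4 ^ N * (2 * W) * om N s (c - y)) := by
          refine lintegral_mono fun y => mul_le_mul' le_rfl ?_
          have h := lintegral_om_mul_om_le (L := N) hM0 hMs (by omega) (c - y)
          rw [← hWc] at h
          refine le_trans (le_of_eq ?_) h
          rw [← lintegral_sub_left_eq_self (fun u => om N M ((c - y) - u) * om N s u) c]
          refine lintegral_congr fun z => ?_
          rw [show c - y - (c - z) = z - y by abel]
      _ = 4 ^ N * (2 * W) * ∫⁻ y, v y * om N s (c - y) := by
          rw [← lintegral_const_mul _ (by fun_prop)]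
          refine lintegral_congr fun y => ?_
          ring
      _ ≤ 4 ^ N * (2 * W) * (2 ^ (N + 1) * ENNReal.ofReal (s ^ (α - d))) :=
          mul_le_mul' le_rfl (hv.conv_om_le hvm (by
            have : (d : ℝ) + 1 ≤ N := by exact_mod_cast hN
            linarith) hs1 c)
      _ = _ := by ring
  set X : ℝ≥0∞ := (B : ℝ≥0∞) * ENNReal.ofReal (M ^ (α - d)) with hX
  have hX0 : X ≠ 0 := by
    simp only [hX, ne_eq, mul_eq_zero, ENNReal.coe_eq_zero, ENNReal.ofReal_eq_zero, not_or, not_le]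
    exact ⟨by positivity, by positivity⟩
  have hXt : X ≠ ∞ := by simp only [hX]; finiteness
  have key : ∫⁻ w in closedBall z₀ ρ, V (T.symm w) ≤ X * ENNReal.ofReal (ρ ^ α) := by
    set Bρ := closedBall z₀ ρ
    set B6 := closedBall z₀ (6 * ρ)
    have hBm : MeasurableSet Bρ := measurableSet_closedBall
    have hB6m : MeasurableSet B6 := measurableSet_closedBall
    have h1 : D * ∫⁻ w in Bρ, V (T.symm w) = ∫⁻ z, (T ⁻¹' Bρ).indicator V z := by
      rw [← lintegral_indicator hBm, ← hDT _ (hVT.indicator hBm)]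
      refine lintegral_congr fun z => ?_
      by_cases h : T z ∈ Bρ
      · rw [indicator_of_mem h, indicator_of_mem (show z ∈ T ⁻¹' Bρ from h)]; simp
      · rw [indicator_of_notMem h, indicator_of_notMem (show z ∉ T ⁻¹' Bρ from h)]
    have h2 : ∀ c, av s ((T ⁻¹' Bρ).indicator V) c ≤ B6.indicator (fun _ =>
        2 ^ N * (4 ^ N * (2 * W) * 2 ^ (N + 1)) * ENNReal.ofReal (s ^ (α - d))) (T c) := by
      intro c
      by_cases h : T c ∈ B6
      · rw [indicator_of_mem h]
        exact (av_mono fun z _ => indicator_le_self _ _ z).trans (hsup c)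
      · rw [indicator_of_notMem h]
        refine (av_mono (g := fun _ => 0) fun z hz => ?_).trans_eq (av_const hs0 0 c)
        rw [indicator_of_notMem]
        intro hz2
        refine h ?_
        change T z ∈ closedBall z₀ ρ at hz2
        rw [mem_closedBall] at *
        have h3 : dist (T c) (T z) ≤ 5 * ρ := by
          have h4 := hT (c - z)
          rw [map_sub, ← dist_eq_norm, ← dist_eq_norm, dist_comm c z] at h4
          have : M * dist (T c) (T z) ≤ M * (5 * ρ) := by rw [hs] at hz; linarith
          exact le_of_mul_le_mul_left this hM0
        linarith [dist_triangle (T c) (T z) z₀]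
    have h3 : D * ∫⁻ w in Bρ, V (T.symm w) ≤ D * (X * ENNReal.ofReal (ρ ^ α)) := by
      rw [h1, ← lintegral_av hs0 (hVm.indicator (hTm hBm))]
      refine (lintegral_mono h2).trans ?_
      rw [hDT (fun w => B6.indicator _ w) (measurable_const.indicator hB6m),
        lintegral_indicator hB6m, setLIntegral_const, volume_cube (by positivity)]
      refine mul_le_mul' le_rfl ?_
      have e1 : ENNReal.ofReal ((2 * (6 * ρ)) ^ d) = 12 ^ d * ENNReal.ofReal (ρ ^ d) := by
        rw [show 2 * (6 * ρ) = 12 * ρ by ring, mul_pow, ENNReal.ofReal_mul (by positivity),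
          ENNReal.ofReal_pow (by norm_num), ENNReal.ofReal_ofNat]
      have e2 : ENNReal.ofReal (s ^ (α - d)) * ENNReal.ofReal (ρ ^ d) =
          ENNReal.ofReal (M ^ (α - d)) * ENNReal.ofReal (ρ ^ α) := by
        rw [← ENNReal.ofReal_mul (by positivity), ← ENNReal.ofReal_mul (by positivity), hs,
          Real.mul_rpow hM0.le hρ0.le, mul_assoc, ← Real.rpow_natCast ρ d, ← Real.rpow_add hρ0,
          sub_add_cancel]
      rw [e1]
      calc _ = 12 ^ d * (2 ^ N * (4 ^ N * (2 * W) * 2 ^ (N + 1))) *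
            (ENNReal.ofReal (s ^ (α - d)) * ENNReal.ofReal (ρ ^ d)) := by ring
        _ ≤ B * (ENNReal.ofReal (s ^ (α - d)) * ENNReal.ofReal (ρ ^ d)) := by
            refine mul_le_mul' ?_ le_rfl
            rw [hB]
            push_cast
            exact le_self_add
        _ = _ := by rw [e2, hX]; ring
    exact (ENNReal.mul_le_mul_iff_right hD0 hD).1 h3
  change ∫⁻ w in closedBall z₀ ρ, X⁻¹ * V (T.symm w) ≤ _
  rw [lintegral_const_mul _ hVT]
  calc X⁻¹ * ∫⁻ w in closedBall z₀ ρ, V (T.symm w) ≤ X⁻¹ * (X * ENNReal.ofReal (ρ ^ α)) :=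
        mul_le_mul' le_rfl key
    _ = _ := by rw [← mul_assoc, ENNReal.inv_mul_cancel hX0 hXt, one_mul]

end Thin

section Rescale

variable {n : ℕ}

local notation "ξ[" x "]" => fun j => Lam (x j)

/-- The weighted `L²` estimate for exponential sums on the paraboloid at scale `R`. -/
def MainAt (n : ℕ) (α κ : ℝ) (N' : ℕ) (C : ℝ≥0) (R : ℝ) : Prop :=
  ∀ (J : Type) [Fintype J] (x : J → Fin n → ℝ) (_ : ∀ j, ‖x j‖ ≤ 1) (a : J → ℂ)
    (v : (Fin (n + 1) → ℝ) → ℝ≥0∞) (_ : Measurable v) (_ : Thin α v)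
    (g : (Fin (n + 1) → ℝ) → ℝ≥0∞) (_ : SV N' R g),
    ∫⁻ z, ‖es ξ[x] a z‖ₑ ^ 2 * (v z ^ (1 / n : ℝ) * g z) ≤
      C * ENNReal.ofReal (R ^ κ) * ∫⁻ z, ‖es ξ[x] a z‖ₑ ^ 2 * g z

/-- The parabolic rescaling adapted to the cap centred at `m / M` of radius `1 / M`. -/
def parab (M : ℝ) (hM : M ≠ 0) (m : Fin n → ℝ) :
    (Fin (n + 1) → ℝ) ≃ₗ[ℝ] (Fin (n + 1) → ℝ) where
  toFun z := Fin.cons (z 0 / M ^ 2) fun l => z l.succ / M - 2 * z 0 * m l / M ^ 2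
  invFun w := Fin.cons (M ^ 2 * w 0) fun l => M * w l.succ + 2 * M * w 0 * m l
  map_add' z z' := by
    ext i
    refine Fin.cases ?_ (fun l => ?_) i <;> simp <;> ring
  map_smul' c z := by
    ext i
    refine Fin.cases ?_ (fun l => ?_) i <;> simp <;> ring
  left_inv z := by
    ext i
    refine Fin.cases ?_ (fun l => ?_) i <;> simp <;> field_simp; ring
  right_inv w := by
    ext i
    refine Fin.cases ?_ (fun l => ?_) i <;> simp <;> field_simp; ring

lemma parab_zero (M : ℝ) (hM : M ≠ 0) (m : Fin n → ℝ) (z : Fin (n + 1) → ℝ) :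
    parab M hM m z 0 = z 0 / M ^ 2 := rfl

lemma parab_succ (M : ℝ) (hM : M ≠ 0) (m : Fin n → ℝ) (z : Fin (n + 1) → ℝ) (l : Fin n) :
    parab M hM m z l.succ = z l.succ / M - 2 * z 0 * m l / M ^ 2 := rfl

lemma parab_symm_zero (M : ℝ) (hM : M ≠ 0) (m : Fin n → ℝ) (z : Fin (n + 1) → ℝ) :
    (parab M hM m).symm z 0 = M ^ 2 * z 0 := rfl

lemma parab_symm_succ (M : ℝ) (hM : M ≠ 0) (m : Fin n → ℝ) (z : Fin (n + 1) → ℝ) (l : Fin n) :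
    (parab M hM m).symm z l.succ = M * z l.succ + 2 * M * z 0 * m l := rfl

lemma norm_parab_le {M : ℝ} (hM1 : 1 ≤ M) (hM : M ≠ 0) {m : Fin n → ℝ}
    (hm : ∀ l, |m l| ≤ 2 * M) (z : Fin (n + 1) → ℝ) : M * ‖parab M hM m z‖ ≤ 5 * ‖z‖ := by
  have hM0 : 0 < M := by linarith
  have h0 : |z 0| ≤ ‖z‖ := norm_le_pi_norm z 0
  rw [← le_div_iff₀' hM0, pi_norm_le_iff_of_nonneg (by positivity)]
  intro i
  refine Fin.cases ?_ (fun l => ?_) i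
  · rw [parab_zero, Real.norm_eq_abs, abs_div, abs_of_pos (by positivity : 0 < M ^ 2),
      div_le_div_iff₀ (by positivity) hM0]
    have : M ≤ M ^ 2 := by nlinarith
    nlinarith [abs_nonneg (z 0), norm_nonneg z]
  · have h1 : |z l.succ| ≤ ‖z‖ := norm_le_pi_norm z _
    rw [parab_succ, Real.norm_eq_abs]
    have h2 : |2 * z 0 * m l / M ^ 2| ≤ 4 * ‖z‖ / M := by
      rw [abs_div, abs_of_pos (by positivity : 0 < M ^ 2), abs_mul, abs_mul, abs_two,
        div_le_div_iff₀ (by positivity) hM0]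
      have h3 : |z 0| * |m l| ≤ ‖z‖ * (2 * M) := by gcongr; exact hm l
      nlinarith
    have h4 : |z l.succ / M| ≤ ‖z‖ / M := by
      rw [abs_div, abs_of_pos hM0]; gcongr
    calc _ ≤ |z l.succ / M| + |2 * z 0 * m l / M ^ 2| := abs_sub _ _
      _ ≤ ‖z‖ / M + 4 * ‖z‖ / M := add_le_add h4 h2
      _ = _ := by ring

lemma norm_parab_symm_le {M : ℝ} (hM1 : 1 ≤ M) (hM : M ≠ 0) {m : Fin n → ℝ}
    (hm : ∀ l, |m l| ≤ 2 * M) (z : Fin (n + 1) → ℝ) :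
    ‖(parab M hM m).symm z‖ ≤ 5 * M ^ 2 * ‖z‖ := by
  have hM0 : 0 < M := by linarith
  have h0 : |z 0| ≤ ‖z‖ := norm_le_pi_norm z 0
  rw [pi_norm_le_iff_of_nonneg (by positivity)]
  intro i
  refine Fin.cases ?_ (fun l => ?_) i
  · rw [parab_symm_zero, Real.norm_eq_abs, abs_mul, abs_of_pos (by positivity : 0 < M ^ 2)]
    nlinarith [abs_nonneg (z 0), norm_nonneg z, sq_nonneg M]
  · have h1 : |z l.succ| ≤ ‖z‖ := norm_le_pi_norm z _
    rw [parab_symm_succ, Real.norm_eq_abs]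
    calc _ ≤ |M * z l.succ| + |2 * M * z 0 * m l| := abs_add_le _ _
      _ = M * |z l.succ| + 2 * M * (|z 0| * |m l|) := by
        rw [abs_mul, abs_mul, abs_mul, abs_mul, abs_two, abs_of_pos hM0]; ring
      _ ≤ M ^ 2 * ‖z‖ + 2 * M * (‖z‖ * (2 * M)) := by
        gcongr
        · nlinarith
        · exact hm l
      _ = _ := by ring

lemma Lam_dot_parab (M : ℝ) (hM : M ≠ 0) (m p : Fin n → ℝ) (z : Fin (n + 1) → ℝ) :
    Lam p ⬝ᵥ z = (-(z 0 * (m ⬝ᵥ m)) / M ^ 2 + (m ⬝ᵥ Fin.tail z) / M) +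
      Lam (M • p - m) ⬝ᵥ parab M hM m z := by
  unfold Lam
  rw [dotProduct_cons, dotProduct_cons, parab_zero]
  simp only [dotProduct, Fin.tail, parab_succ, Pi.sub_apply, Pi.smul_apply, smul_eq_mul]
  simp only [Finset.mul_sum, Finset.sum_mul, Finset.sum_div, neg_mul, ← Finset.sum_neg_distrib,
    ← Finset.sum_add_distrib, neg_div]
  refine Finset.sum_congr rfl fun l _ => ?_
  field_simp
  ring

lemma norm_es_parab {J : Type} [Fintype J] (x ζ : J → Fin n → ℝ) (a : J → ℂ) (M : ℝ) (hM : M ≠ 0)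
    (m : Fin n → ℝ) (hζ : ∀ j, a j ≠ 0 → ζ j = M • x j - m) (z : Fin (n + 1) → ℝ) :
    ‖es ξ[x] a z‖ₑ = ‖es ξ[ζ] a (parab M hM m z)‖ₑ := by
  have h : es ξ[x] a z = ch (-(z 0 * (m ⬝ᵥ m)) / M ^ 2 + (m ⬝ᵥ Fin.tail z) / M) *
      es ξ[ζ] a (parab M hM m z) := by
    unfold es
    rw [Finset.mul_sum]
    refine Finset.sum_congr rfl fun j _ => ?_
    by_cases ha : a j = 0
    · simp [ha]
    · simp only [Lam_dot_parab M hM m (x j) z, ch_add, hζ j ha]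
      ring
  rw [h, enorm_mul, enorm_ch, one_mul]

lemma SV.comp_linear {ι : Type} [Fintype ι] {N : ℕ} {R D : ℝ} {g : (ι → ℝ) → ℝ≥0∞}
    (hR : 0 < R) (hD : 0 < D) (hg : SV N R g) (T : (ι → ℝ) ≃ₗ[ℝ] (ι → ℝ)) (hT : ∀ z, ‖T z‖ ≤ D * ‖z‖) :
    SV N (R / D) fun z => g (T z) where
  meas := hg.meas.comp T.toContinuousLinearEquiv.continuous.measurable
  le z z' := by
    refine (hg.le (T z) (T z')).trans (mul_le_mul' (ENNReal.ofReal_le_ofReal ?_) le_rfl)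
    have := hD.le
    refine pow_le_pow_left₀ (by positivity) (add_le_add le_rfl ?_) N
    rw [← map_sub, div_div_eq_mul_div, mul_comm]
    gcongr
    simpa only [mul_comm] using hT (z - z')

lemma exists_rescale {α : ℝ} (hα : α ≤ n + 1) {N : ℕ} (hN : n + 2 ≤ N) (N' : ℕ) :
    ∃ C₁ : ℝ≥0, ∀ (κ : ℝ) (C : ℝ≥0) (R M : ℝ) (_ : 0 < R) (_ : 1 ≤ M)
      (_ : MainAt n α κ N' C (R / (5 * M ^ 2))) (J : Type) [Fintype J] (x : J → Fin n → ℝ)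
      (_ : ∀ j, ‖x j‖ ≤ 1) (a : J → ℂ) (m : Fin n → ℝ)
      (_ : ∀ j, a j ≠ 0 → ‖M • x j - m‖ ≤ 1)
      (v : (Fin (n + 1) → ℝ) → ℝ≥0∞) (_ : Measurable v) (_ : Thin α v)
      (g : (Fin (n + 1) → ℝ) → ℝ≥0∞) (_ : SV N' R g),
      ∫⁻ z, ‖es ξ[x] a z‖ₑ ^ 2 * ((∫⁻ y, v y * om N M (z - y)) ^ (1 / n : ℝ) * g z) ≤
        C₁ * C * ENNReal.ofReal (M ^ ((α - (n + 1)) / n)) *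
          ENNReal.ofReal ((R / (5 * M ^ 2)) ^ κ) * ∫⁻ z, ‖es ξ[x] a z‖ₑ ^ 2 * g z := by
  obtain ⟨B, hB, hthin⟩ := Thin.exists_comp (ι := Fin (n + 1)) (α := α) (by simpa using hα)
    (N := N) (by rw [Fintype.card_fin]; omega)
  refine ⟨B ^ (1 / n : ℝ), fun κ C R M hR hM hmain J _ x hx a m hm v hvm hv g hg => ?_⟩
  have hM0 : 0 < M := by linarith
  by_cases hex : ∃ j, a j ≠ 0
  swap
  · push Not at hex
    have : a = 0 := funext hex
    subst this
    simp [es_zero]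
  obtain ⟨j₀, hj₀⟩ := hex
  have hml : ∀ l, |m l| ≤ 2 * M := by
    intro l
    have h1 := (norm_le_pi_norm _ l).trans (hm j₀ hj₀)
    have h2 := (norm_le_pi_norm _ l).trans (hx j₀)
    simp only [Pi.sub_apply, Pi.smul_apply, smul_eq_mul, Real.norm_eq_abs] at h1 h2
    rw [abs_le] at *
    constructor <;> nlinarith
  set T := parab M hM0.ne' m with hT
  have hth := hthin v hvm hv M hM T (norm_parab_le hM hM0.ne' hml)
  simp only [Fintype.card_fin, Nat.cast_add, Nat.cast_one] at hth
  set X : ℝ≥0∞ := (B : ℝ≥0∞) * ENNReal.ofReal (M ^ (α - (n + 1))) with hX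
  have hX0 : X ≠ 0 := by
    simp only [hX, ne_eq, mul_eq_zero, ENNReal.coe_eq_zero, ENNReal.ofReal_eq_zero, not_or, not_le]
    exact ⟨hB, by positivity⟩
  have hXt : X ≠ ∞ := by simp only [hX]; finiteness
  set V : (Fin (n + 1) → ℝ) → ℝ≥0∞ := fun z => ∫⁻ y, v y * om N M (z - y) with hV
  have hVm : Measurable V := (SV.conv hvm (sv_om hM0)).meas
  have hTsm : Measurable T.symm := T.symm.toContinuousLinearEquiv.continuous.measurable
  have hVT : Measurable fun w => V (T.symm w) := hVm.comp hTsm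
  have hgT : Measurable fun w => g (T.symm w) := hg.meas.comp hTsm
  have hV' : Measurable fun w => X⁻¹ * V (T.symm w) := hVT.const_mul _
  obtain ⟨D, hD0, hD, hDT⟩ := exists_lintegral_comp T
  classical
  set ζ : J → Fin n → ℝ := fun j => if a j = 0 then 0 else M • x j - m with hζ
  have hζ1 : ∀ j, ‖ζ j‖ ≤ 1 := by
    intro j
    by_cases h : a j = 0
    · simp [hζ, h]
    · simpa [hζ, h] using hm j h
  have hes : ∀ z, ‖es ξ[x] a z‖ₑ = ‖es ξ[ζ] a (T z)‖ₑ :=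
    norm_es_parab x ζ a M hM0.ne' m fun j hj => by simp [hζ, hj]
  have hesm : Measurable fun w => ‖es ξ[ζ] a w‖ₑ ^ 2 := measurable_es_sq _ _
  have hP := hmain J ζ hζ1 a _ hV' hth _
    (SV.comp_linear hR (by positivity : 0 < 5 * M ^ 2) hg T.symm (norm_parab_symm_le hM hM0.ne' hml))
  have hn0 : (0 : ℝ) ≤ 1 / n := by positivity
  have e1 : ∫⁻ z, ‖es ξ[x] a z‖ₑ ^ 2 * (V z ^ (1 / n : ℝ) * g z) =
      D * ∫⁻ w, ‖es ξ[ζ] a w‖ₑ ^ 2 * (V (T.symm w) ^ (1 / n : ℝ) * g (T.symm w)) := by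
    have hmm : Measurable fun w => ‖es ξ[ζ] a w‖ₑ ^ 2 *
        (V (T.symm w) ^ (1 / n : ℝ) * g (T.symm w)) := hesm.mul ((hVT.pow_const _).mul hgT)
    rw [← hDT _ hmm]
    refine lintegral_congr fun z => ?_
    rw [hes, T.symm_apply_apply]
  have e2 : ∫⁻ z, ‖es ξ[x] a z‖ₑ ^ 2 * g z =
      D * ∫⁻ w, ‖es ξ[ζ] a w‖ₑ ^ 2 * g (T.symm w) := by
    have hmm : Measurable fun w => ‖es ξ[ζ] a w‖ₑ ^ 2 * g (T.symm w) := hesm.mul hgT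
    rw [← hDT _ hmm]
    refine lintegral_congr fun z => ?_
    rw [hes, T.symm_apply_apply]
  have e3 : ∫⁻ w, ‖es ξ[ζ] a w‖ₑ ^ 2 * (V (T.symm w) ^ (1 / n : ℝ) * g (T.symm w)) =
      X ^ (1 / n : ℝ) * ∫⁻ w, ‖es ξ[ζ] a w‖ₑ ^ 2 *
        ((X⁻¹ * V (T.symm w)) ^ (1 / n : ℝ) * g (T.symm w)) := by
    have hmm : Measurable fun w => ‖es ξ[ζ] a w‖ₑ ^ 2 *
        ((X⁻¹ * V (T.symm w)) ^ (1 / n : ℝ) * g (T.symm w)) :=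
      hesm.mul ((hV'.pow_const _).mul hgT)
    rw [← lintegral_const_mul _ hmm]
    refine lintegral_congr fun w => ?_
    have : V (T.symm w) = X * (X⁻¹ * V (T.symm w)) := by
      rw [← mul_assoc, ENNReal.mul_inv_cancel hX0 hXt, one_mul]
    conv_lhs => rw [this, ENNReal.mul_rpow_of_nonneg _ _ hn0]
    ring
  have e4 : X ^ (1 / n : ℝ) = ((B ^ (1 / n : ℝ) : ℝ≥0) : ℝ≥0∞) *
      ENNReal.ofReal (M ^ ((α - (n + 1)) / n)) := by
    rw [hX, ENNReal.mul_rpow_of_nonneg _ _ hn0, ENNReal.coe_rpow_of_nonneg _ hn0,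
      ENNReal.ofReal_rpow_of_nonneg (by positivity) hn0, ← Real.rpow_mul hM0.le, mul_one_div]
  rw [e1, e2, e3]
  calc _ ≤ D * (X ^ (1 / n : ℝ) * (C * ENNReal.ofReal ((R / (5 * M ^ 2)) ^ κ) *
        ∫⁻ w, ‖es ξ[ζ] a w‖ₑ ^ 2 * g (T.symm w))) := by
        exact mul_le_mul' le_rfl (mul_le_mul' le_rfl hP)
    _ = D * (((B ^ (1 / n : ℝ) : ℝ≥0) : ℝ≥0∞) * ENNReal.ofReal (M ^ ((α - (n + 1)) / n)) *
        (C * ENNReal.ofReal ((R / (5 * M ^ 2)) ^ κ) *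
        ∫⁻ w, ‖es ξ[ζ] a w‖ₑ ^ 2 * g (T.symm w))) := by rw [e4]
    _ = _ := by ring

end Rescale

section Induction

variable {n k : ℕ}

local notation "ξ[" x "]" => fun j => Lam (x j)

lemma exists_sq_le_En {L : ℕ} (hL : n + 1 < L) :
    ∃ C : ℝ≥0, ∀ (J : Type) [Fintype J] (x : J → Fin n → ℝ) (_ : ∀ j, ‖x j‖ ≤ 1) (a : J → ℂ)
      (z : Fin (n + 1) → ℝ), ‖es ξ[x] a z‖ₑ ^ 2 ≤ C * En L 1 ξ[x] a z := by
  obtain ⟨C, hC⟩ := exists_locally_constant (ι := Fin (n + 1)) (L := L) (by simpa using hL)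
  have hn1 : (1 : ℝ) ≤ n + 1 := by linarith [Nat.cast_nonneg (α := ℝ) n]
  refine ⟨C * Real.toNNReal (((n : ℝ) + 1) ^ (L + Fintype.card (Fin (n + 1)))),
    fun J _ x hx a z => ?_⟩
  refine (hC J ξ[x] a (((n : ℝ) + 1)⁻¹) (by positivity) 0 (fun j _ => ?_) z).trans ?_
  · rw [sub_zero, norm_smul, norm_inv, Real.norm_of_nonneg (by positivity), inv_mul_le_iff₀ (by positivity)]
    have := norm_Lam_le (hx j)
    linarith
  · rw [ENNReal.coe_mul, mul_assoc]
    refine mul_le_mul' le_rfl (En_le_mul hn1 (by positivity) one_pos ?_ ?_ _ _ _)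
    · exact (inv_le_one_of_one_le₀ hn1).trans (by linarith)
    · rw [mul_inv_cancel₀ (by positivity)]

lemma exists_main_base (hn : 2 ≤ n) (N' : ℕ) :
    ∃ C : ℝ≥0, ∀ (J : Type) [Fintype J] (x : J → Fin n → ℝ) (_ : ∀ j, ‖x j‖ ≤ 1) (a : J → ℂ)
      (v : (Fin (n + 1) → ℝ) → ℝ≥0∞) (_ : Measurable v) (α : ℝ) (_ : Thin α v)
      (g : (Fin (n + 1) → ℝ) → ℝ≥0∞) (R : ℝ) (_ : 1 ≤ R) (_ : SV N' R g),
      ∫⁻ z, ‖es ξ[x] a z‖ₑ ^ 2 * (v z ^ (1 / n : ℝ) * g z) ≤ C * ∫⁻ z, ‖es ξ[x] a z‖ₑ ^ 2 * g z := by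
  set L := n + 2 + N' with hL
  obtain ⟨C, hC⟩ := exists_sq_le_En (n := n) (L := L) (by omega)
  have hW : (∫⁻ y : Fin (n + 1) → ℝ, wt (n + 2) 1 y) ≠ ∞ :=
    (lintegral_wt_one_lt_top (by simp)).ne
  set W := (∫⁻ y : Fin (n + 1) → ℝ, wt (n + 2) 1 y).toNNReal with hWdef
  have hWc : (W : ℝ≥0∞) = ∫⁻ y : Fin (n + 1) → ℝ, wt (n + 2) 1 y := ENNReal.coe_toNNReal hW
  refine ⟨C * 2 ^ (L + N') * W, fun J _ x hx a v hvm α hv g R hR hg => ?_⟩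
  have hg1 := hg.mono one_pos hR
  have hE := sv_En (L := L) one_pos ξ[x] a
  have hh := SV.mul one_pos hE hg1
  have hn1 : (1 : ℝ) < n := by exact_mod_cast (by omega : 1 < n)
  have hvn : Measurable fun z => v z ^ (1 / n : ℝ) := hvm.pow_const _
  calc ∫⁻ z, ‖es ξ[x] a z‖ₑ ^ 2 * (v z ^ (1 / n : ℝ) * g z)
      ≤ ∫⁻ z, C * (v z ^ (1 / n : ℝ) * (En L 1 ξ[x] a z * g z)) := by
        refine lintegral_mono fun z => (mul_le_mul' (hC J x hx a z) le_rfl).trans_eq ?_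
        ring
    _ = C * ∫⁻ z, v z ^ (1 / n : ℝ) * (En L 1 ξ[x] a z * g z) := by
        rw [lintegral_const_mul' _ _ (by simp)]
    _ ≤ C * (2 ^ (L + N') * ∫⁻ c, av 1 (fun z => v z ^ (1 / n : ℝ)) c * (En L 1 ξ[x] a c * g c)) :=
        mul_le_mul' le_rfl (lintegral_mul_le_av one_pos hvn hh)
    _ ≤ C * (2 ^ (L + N') * ∫⁻ c, En L 1 ξ[x] a c * g c) := by
        refine mul_le_mul' le_rfl (mul_le_mul' le_rfl (lintegral_mono fun c => ?_))
        refine (mul_le_mul' ((av_rpow_le one_pos hvm hn1 c).trans ?_) le_rfl).trans_eq (one_mul _)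
        exact (ENNReal.rpow_le_rpow (hv.av_one_le c) (by positivity)).trans_eq (ENNReal.one_rpow _)
    _ ≤ C * (2 ^ (L + N') * (W * ∫⁻ z, ‖es ξ[x] a z‖ₑ ^ 2 * g z)) := by
        rw [hWc]
        exact mul_le_mul' le_rfl (mul_le_mul' le_rfl (lintegral_En_mul_le one_pos _ _ hg1))
    _ = _ := by push_cast; ring

lemma exists_sum_lintegral_cut_le (N' : ℕ) :
    ∃ C : ℝ≥0, ∀ (J : Type) [Fintype J] (ξ : J → Fin (n + 1) → ℝ) (a : J → ℂ)
      (s : Finset (Fin (n + 1) → ℤ)) (r : ℝ) (_ : 0 < r)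
      (g : (Fin (n + 1) → ℝ) → ℝ≥0∞) (_ : SV N' r g),
      ∑ σ ∈ s, ∫⁻ z, ‖es ξ (cut r ξ σ a) z‖ₑ ^ 2 * g z ≤ C * ∫⁻ z, ‖es ξ a z‖ₑ ^ 2 * g z := by
  obtain ⟨C, hC⟩ := exists_sum_cut_le (ι := Fin (n + 1)) (L := n + 2 + N')
    (by rw [Fintype.card_fin]; omega)
  have hW : (∫⁻ y : Fin (n + 1) → ℝ, wt (n + 2) 1 y) ≠ ∞ :=
    (lintegral_wt_one_lt_top (by simp)).ne
  refine ⟨C * (∫⁻ y : Fin (n + 1) → ℝ, wt (n + 2) 1 y).toNNReal, fun J _ ξ a s r hr g hg => ?_⟩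
  have hgm := hg.meas
  have hm : ∀ σ, Measurable fun z => ‖es ξ (cut r ξ σ a) z‖ₑ ^ 2 * g z := fun σ =>
    (measurable_es_sq _ _).mul hgm
  rw [← lintegral_finsetSum _ fun σ _ => hm σ, ENNReal.coe_mul, ENNReal.coe_toNNReal hW, mul_assoc]
  refine le_trans ?_ (mul_le_mul' le_rfl (lintegral_En_mul_le hr ξ a hg))
  rw [← lintegral_const_mul' _ _ (by simp)]
  refine lintegral_mono fun z => ?_
  rw [← Finset.sum_mul, ← mul_assoc]
  exact mul_le_mul' (hC J ξ a r hr s z) le_rfl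

lemma exists_stage_rescaled (hn : 2 ≤ n) (hk : k ≤ n) (hk1 : 0 < k) (N' : ℕ) {M : ℕ} (hM : 1 ≤ M)
    {ε : ℝ} (hε : 0 < ε) {α κ : ℝ} (hα : α ≤ n + 1) (hκ : 2 * κ = (α - (n + 1)) / n + 2 * ε) :
    ∃ C : ℝ≥0, ∀ (M' : ℕ) (_ : 3 * M ≤ M'), ∃ K : ℝ≥0, ∀ (C_P : ℝ≥0) (R : ℝ) (_ : 5 * (M' : ℝ) ^ 2 ≤ R)
      (_ : MainAt n α κ N' C_P (R / (5 * (M' : ℝ) ^ 2))) (J : Type) [Fintype J]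
      (x : J → Fin n → ℝ) (_ : ∀ j, ‖x j‖ ≤ 1) (a : J → ℂ)
      (v : (Fin (n + 1) → ℝ) → ℝ≥0∞) (_ : Measurable v) (_ : Thin α v)
      (g : (Fin (n + 1) → ℝ) → ℝ≥0∞) (_ : SV N' R g),
      ∫⁻ z, Ik (n + 2 + (n + 2 + N')) k M x a z * v z ^ (1 / n : ℝ) * g z ≤
        K * (∫⁻ z, Ik (n + 2 + (n + 2 + N')) (k + 1) M' x a z * v z ^ (1 / n : ℝ) * g z) +
        C * C_P * ENNReal.ofReal ((M' : ℝ) ^ (-ε)) * ENNReal.ofReal (R ^ κ) *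
          ∫⁻ z, ‖es ξ[x] a z‖ₑ ^ 2 * g z := by
  obtain ⟨C₀, hC₀⟩ := exists_stage hn hk hk1 (n + 2) N' hM hε
  obtain ⟨C₁, hC₁⟩ := exists_rescale hα le_rfl N' (N := n + 2)
  obtain ⟨C₂, hC₂⟩ := exists_sum_lintegral_cut_le (n := n) N'
  refine ⟨C₀ * C₁ * C₂ * Real.toNNReal (5 ^ (-κ)), fun M' hM' => ?_⟩
  obtain ⟨K, hK⟩ := hC₀ M' hM'
  refine ⟨K, fun C_P R hR hmain J _ x hx a v hvm hv g hg => ?_⟩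
  have hM1 : (1 : ℝ) ≤ M' := by exact_mod_cast (by omega : 1 ≤ M')
  have hM0 : (0 : ℝ) < M' := by linarith
  have hMR : (M' : ℝ) ≤ R := by nlinarith
  have hR0 : 0 < R := by linarith
  refine (hK J x hx a v hvm g R hMR hg).trans (add_le_add le_rfl ?_)
  have hσ : ∀ σ ∈ caps n M', ∫⁻ z, ‖es ξ[x] (cut M' ξ[x] σ a) z‖ₑ ^ 2 *
      ((∫⁻ y, v y * om (n + 2) M' (z - y)) ^ (1 / n : ℝ) * g z) ≤
      C₁ * C_P * ENNReal.ofReal ((M' : ℝ) ^ ((α - (n + 1)) / n)) *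
          ENNReal.ofReal ((R / (5 * (M' : ℝ) ^ 2)) ^ κ) *
          ∫⁻ z, ‖es ξ[x] (cut M' ξ[x] σ a) z‖ₑ ^ 2 * g z := by
    intro σ _
    refine hC₁ κ C_P R M' hR0 hM1 hmain J x hx (cut M' ξ[x] σ a) (fun l => (σ l.succ : ℝ))
      (fun j hj => ?_) v hvm hv g hg
    refine (pi_norm_le_iff_of_nonneg zero_le_one).2 fun l => ?_
    have h := (norm_le_pi_norm _ l.succ).trans (cut_ne_zero hj).2
    simpa [Lam] using h
  have hreal : (M' : ℝ) ^ ε * ((M' : ℝ) ^ ((α - (n + 1)) / n) * (R / (5 * (M' : ℝ) ^ 2)) ^ κ) =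
      5 ^ (-κ) * ((M' : ℝ) ^ (-ε) * R ^ κ) := by
    rw [Real.div_rpow hR0.le (by positivity), Real.mul_rpow (by norm_num) (by positivity),
      ← Real.rpow_natCast (M' : ℝ) 2, ← Real.rpow_mul hM0.le, Real.rpow_neg (by norm_num),
      Real.rpow_neg hM0.le]
    have e : (α - (n + 1)) / n = (2 : ℕ) * κ - 2 * ε := by push_cast; linarith
    rw [e, Real.rpow_sub hM0, two_mul, Real.rpow_add hM0]
    field_simp
  calc _ ≤ C₀ * ENNReal.ofReal ((M' : ℝ) ^ ε) * ∑ σ ∈ caps n M',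
        C₁ * C_P * ENNReal.ofReal ((M' : ℝ) ^ ((α - (n + 1)) / n)) *
          ENNReal.ofReal ((R / (5 * (M' : ℝ) ^ 2)) ^ κ) *
          ∫⁻ z, ‖es ξ[x] (cut M' ξ[x] σ a) z‖ₑ ^ 2 * g z :=
        mul_le_mul' le_rfl (Finset.sum_le_sum hσ)
    _ ≤ C₀ * ENNReal.ofReal ((M' : ℝ) ^ ε) * (C₁ * C_P * ENNReal.ofReal ((M' : ℝ) ^ ((α - (n + 1)) / n)) *
          ENNReal.ofReal ((R / (5 * (M' : ℝ) ^ 2)) ^ κ) * (C₂ * ∫⁻ z, ‖es ξ[x] a z‖ₑ ^ 2 * g z)) := by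
        rw [← Finset.mul_sum]
        exact mul_le_mul' le_rfl (mul_le_mul' le_rfl
          (hC₂ J ξ[x] a _ M' hM0 g (hg.mono hM0 hMR)))
    _ = C₀ * C₁ * C₂ * C_P * (ENNReal.ofReal ((M' : ℝ) ^ ε) *
          (ENNReal.ofReal ((M' : ℝ) ^ ((α - (n + 1)) / n)) *
          ENNReal.ofReal ((R / (5 * (M' : ℝ) ^ 2)) ^ κ))) * ∫⁻ z, ‖es ξ[x] a z‖ₑ ^ 2 * g z := by ring
    _ = _ := by
        rw [← ENNReal.ofReal_mul (by positivity), ← ENNReal.ofReal_mul (by positivity), hreal,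
          ENNReal.ofReal_mul (by positivity), ENNReal.ofReal_mul (by positivity)]
        push_cast
        rw [ENNReal.ofReal]
        ring

lemma exists_sq_le_Ik_one {L : ℕ} (hL : n + 1 < L) :
    ∃ C : ℝ≥0, ∀ (J : Type) [Fintype J] (x : J → Fin n → ℝ) (_ : ∀ j, ‖x j‖ ≤ 1) (a : J → ℂ)
      (z : Fin (n + 1) → ℝ), ‖es ξ[x] a z‖ₑ ^ 2 ≤ C * Ik L 1 1 x a z := by
  obtain ⟨C, hC⟩ := exists_locally_constant (ι := Fin (n + 1)) (L := L)
    (by rwa [Fintype.card_fin])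
  refine ⟨(caps n 1).card * C, fun J _ x hx a z => ?_⟩
  have hcut : ∀ m, ‖es ξ[x] (cut (1 : ℕ) ξ[x] m a) z‖ₑ ^ 2 ≤
      C * En L (1 : ℕ) ξ[x] (cut (1 : ℕ) ξ[x] m a) z := fun m =>
    hC J ξ[x] (cut (1 : ℕ) ξ[x] m a) (1 : ℕ) (by norm_num) (fun i => (m i : ℝ))
      (fun j hj => (cut_ne_zero hj).2) z
  have hinj : Function.Injective
      (fun (m : Fin (n + 1) → ℤ) (_ : Fin 1) => m) := fun m m' h => congrFun h 0
  have hI : ∑ m ∈ caps n 1, En L (1 : ℕ) ξ[x] (cut (1 : ℕ) ξ[x] m a) z ≤ Ik L 1 1 x a z := by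
    calc ∑ m ∈ caps n 1, En L (1 : ℕ) ξ[x] (cut (1 : ℕ) ξ[x] m a) z
        = ∑ τ ∈ (caps n 1).map ⟨_, hinj⟩, ∏ i : Fin 1, En L (1 : ℕ) ξ[x]
            (cut (1 : ℕ) ξ[x] (τ i) a) z ^ (1 / (1 : ℕ) : ℝ) := by
          rw [Finset.sum_map]
          refine Finset.sum_congr rfl fun m _ => ?_
          simp
      _ ≤ _ := by
          refine Finset.sum_le_sum_of_subset fun τ hτ => ?_
          obtain ⟨m, hm, rfl⟩ := Finset.mem_map.1 hτ
          refine mem_tuples.2 ⟨fun _ => hm, fun p _ => ?_⟩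
          have hne : Nor (p 0) ≠ 0 := fun h => by simpa [Nor] using congrFun h 0
          exact LinearIndependent.of_subsingleton (0 : Fin 1) hne
  calc ‖es ξ[x] a z‖ₑ ^ 2
      = ‖es ξ[x] (∑ m ∈ caps n 1, cut (1 : ℕ) ξ[x] m a) z‖ₑ ^ 2 := by rw [sum_caps hx a]
    _ ≤ (caps n 1).card * ∑ m ∈ caps n 1, ‖es ξ[x] (cut (1 : ℕ) ξ[x] m a) z‖ₑ ^ 2 :=
        sq_enorm_es_sum_le _ _ _ _
    _ ≤ (caps n 1).card * ∑ m ∈ caps n 1, C * En L (1 : ℕ) ξ[x] (cut (1 : ℕ) ξ[x] m a) z :=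
        mul_le_mul' le_rfl (Finset.sum_le_sum fun m _ => hcut m)
    _ ≤ (caps n 1).card * (C * Ik L 1 1 x a z) := by
        rw [← Finset.mul_sum]
        exact mul_le_mul' le_rfl (mul_le_mul' le_rfl hI)
    _ = _ := by push_cast; ring

/-- Reduction of the weighted estimate to its `k`-broad part. -/
lemma exists_reduction (hn : 2 ≤ n) (N' : ℕ) {ε : ℝ} (hε : 0 < ε) {α κ : ℝ} (hα : α ≤ n + 1)
    (hκ : 2 * κ = (α - (n + 1)) / n + 2 * ε) (hk1 : 1 ≤ k) (hk : k ≤ n + 1) :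
    ∀ δ : ℝ≥0, 0 < δ → ∃ (M : ℕ) (K : ℝ≥0) (R₀ : ℝ), 1 ≤ M ∧ 1 ≤ R₀ ∧ ∀ (C_P : ℝ≥0) (R : ℝ)
      (_ : R₀ ≤ R) (_ : ∀ R', 1 ≤ R' → R' ≤ R / 5 → MainAt n α κ N' C_P R') (J : Type) [Fintype J]
      (x : J → Fin n → ℝ) (_ : ∀ j, ‖x j‖ ≤ 1) (a : J → ℂ)
      (v : (Fin (n + 1) → ℝ) → ℝ≥0∞) (_ : Measurable v) (_ : Thin α v)
      (g : (Fin (n + 1) → ℝ) → ℝ≥0∞) (_ : SV N' R g),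
      ∫⁻ z, ‖es ξ[x] a z‖ₑ ^ 2 * (v z ^ (1 / n : ℝ) * g z) ≤
        K * (∫⁻ z, Ik (n + 2 + (n + 2 + N')) k M x a z * v z ^ (1 / n : ℝ) * g z) +
        δ * C_P * ENNReal.ofReal (R ^ κ) * ∫⁻ z, ‖es ξ[x] a z‖ₑ ^ 2 * g z := by
  induction k, hk1 using Nat.le_induction with
  | base =>
    intro δ hδ
    obtain ⟨C, hC⟩ := exists_sq_le_Ik_one (n := n) (L := n + 2 + (n + 2 + N')) (by omega)
    refine ⟨1, C, 1, le_rfl, le_rfl, fun C_P R hR _ J _ x hx a v hvm hv g hg => ?_⟩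
    refine le_add_right ?_
    rw [← lintegral_const_mul' _ _ ENNReal.coe_ne_top]
    refine lintegral_mono fun z => ?_
    rw [mul_assoc (Ik _ _ _ _ _ _), ← mul_assoc (C : ℝ≥0∞)]
    exact mul_le_mul' (hC J x hx a z) le_rfl
  | succ k hk1 ih =>
    intro δ hδ
    obtain ⟨M, K, R₀, hM, hR₀, hmain⟩ := ih (by omega) (δ / 2) (by positivity)
    obtain ⟨C, hC⟩ := exists_stage_rescaled hn (by omega : k ≤ n) hk1 N' hM hε hα hκ
    obtain ⟨M', hM', hsmall⟩ : ∃ M' : ℕ, 3 * M ≤ M' ∧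
        ((K * C : ℝ≥0) : ℝ≥0∞) * ENNReal.ofReal ((M' : ℝ) ^ (-ε)) ≤ (δ / 2 : ℝ≥0) := by
      have h1 : Tendsto (fun m : ℕ => ((K * C : ℝ≥0) : ℝ≥0∞) * ENNReal.ofReal ((m : ℝ) ^ (-ε)))
          atTop (𝓝 (((K * C : ℝ≥0) : ℝ≥0∞) * ENNReal.ofReal 0)) :=
        ENNReal.Tendsto.const_mul (ENNReal.tendsto_ofReal
          ((tendsto_rpow_neg_atTop hε).comp tendsto_natCast_atTop_atTop)) (Or.inr ENNReal.coe_ne_top)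
      rw [ENNReal.ofReal_zero, mul_zero] at h1
      have h2 := (h1.eventually_lt_const (u := ((δ / 2 : ℝ≥0) : ℝ≥0∞))
        (by exact_mod_cast (by positivity : 0 < δ / 2))).and (eventually_ge_atTop (3 * M))
      obtain ⟨m, hm⟩ := h2.exists
      exact ⟨m, hm.2, hm.1.le⟩
    obtain ⟨K', hK'⟩ := hC M' hM'
    have hM1 : (1 : ℝ) ≤ M' := by exact_mod_cast (by omega : 1 ≤ M')
    refine ⟨M', K * K', max R₀ (5 * (M' : ℝ) ^ 2), by omega, hR₀.trans (le_max_left _ _),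
      fun C_P R hR hmn J _ x hx a v hvm hv g hg => ?_⟩
    have hR1 := (le_max_left _ _).trans hR
    have hR2 := (le_max_right _ _).trans hR
    have hR0 : 0 < R := by linarith
    have h1 := hmain C_P R hR1 hmn J x hx a v hvm hv g hg
    have hsc : MainAt n α κ N' C_P (R / (5 * (M' : ℝ) ^ 2)) := by
      refine hmn _ ?_ ?_
      · rwa [le_div_iff₀ (by positivity), one_mul]
      · exact div_le_div_of_nonneg_left hR0.le (by norm_num) (by nlinarith)
    have h2 := hK' C_P R hR2 hsc J x hx a v hvm hv g hg
    set I := ∫⁻ z, ‖es ξ[x] a z‖ₑ ^ 2 * g z with hI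
    set I' := ∫⁻ z, Ik (n + 2 + (n + 2 + N')) (k + 1) M' x a z * v z ^ (1 / n : ℝ) * g z with hI'
    calc _ ≤ K * (K' * I' + C * C_P * ENNReal.ofReal ((M' : ℝ) ^ (-ε)) * ENNReal.ofReal (R ^ κ) * I) +
          (δ / 2 : ℝ≥0) * C_P * ENNReal.ofReal (R ^ κ) * I :=
          h1.trans (add_le_add (mul_le_mul' le_rfl h2) le_rfl)
      _ = (K * K' : ℝ≥0) * I' + (((K * C : ℝ≥0) : ℝ≥0∞) * ENNReal.ofReal ((M' : ℝ) ^ (-ε))) *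
            (C_P * ENNReal.ofReal (R ^ κ) * I) +
          (δ / 2 : ℝ≥0) * (C_P * ENNReal.ofReal (R ^ κ) * I) := by push_cast; ring
      _ ≤ (K * K' : ℝ≥0) * I' + (δ / 2 : ℝ≥0) * (C_P * ENNReal.ofReal (R ^ κ) * I) +
          (δ / 2 : ℝ≥0) * (C_P * ENNReal.ofReal (R ^ κ) * I) :=
          add_le_add (add_le_add le_rfl (mul_le_mul' hsmall le_rfl)) le_rfl
      _ = (K * K' : ℝ≥0) * I' + ((δ / 2 + δ / 2 : ℝ≥0) : ℝ≥0∞) * (C_P * ENNReal.ofReal (R ^ κ) * I) := by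
          push_cast; ring
      _ = _ := by rw [add_halves]; ring

/-- The weighted `L²` estimate for exponential sums on the paraboloid. -/
lemma exists_main (hn : 2 ≤ n) (N' : ℕ) {ε : ℝ} (hε : 0 < ε) {α κ : ℝ} (hα : α ≤ n + 1)
    (hκ : 2 * κ = (α - (n + 1)) / n + 2 * ε) :
    ∃ C : ℝ≥0, ∀ R, 1 ≤ R → MainAt n α κ N' C R := by
  obtain ⟨M, K, R₀, hM, hR₀, hred⟩ := exists_reduction hn N' hε hα hκ (k := n + 1) (by omega) le_rfl
    (1 / 2) (by norm_num)
  obtain ⟨Cb, hCb⟩ := exists_main_base hn N'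
  obtain ⟨Cd, hCd⟩ := exists_broad hn (n + 2) N' hM hε hα
  have hn0 : (2 : ℝ) ≤ n := by exact_mod_cast hn
  have hexp : α / (n + 1) - 1 + ε ≤ κ := by
    have h1 : (α - (n + 1)) / n / 2 + ε = κ := by linarith
    rw [← h1, div_sub_one (by positivity), div_div]
    refine add_le_add ?_ le_rfl
    rw [div_le_div_iff₀ (by positivity) (by positivity)]
    nlinarith
  set R₁ : ℝ := max R₀ M with hR₁
  have hR₁1 : 1 ≤ R₁ := hR₀.trans (le_max_left _ _)
  set C : ℝ≥0 := Cb * Real.toNNReal (R₁ ^ |κ|) + 2 * (K * Cd) with hC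
  refine ⟨C, ?_⟩
  have hind : ∀ m : ℕ, ∀ R, 1 ≤ R → R ≤ R₁ * 4 ^ m → MainAt n α κ N' C R := by
    intro m
    induction m with
    | zero =>
      intro R hR hR' J _ x hx a v hvm hv g hg
      rw [pow_zero, mul_one] at hR'
      refine (hCb J x hx a v hvm α hv g R hR hg).trans (mul_le_mul' ?_ le_rfl)
      have h1 : (Cb : ℝ≥0∞) ≤ Cb * (ENNReal.ofReal (R₁ ^ |κ|) * ENNReal.ofReal (R ^ κ)) := by
        refine le_mul_of_one_le_right' ?_
        rw [← ENNReal.ofReal_mul (by positivity), ← ENNReal.ofReal_one]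
        refine ENNReal.ofReal_le_ofReal ?_
        have h2 : R₁ ^ (-|κ|) ≤ R ^ κ := by
          calc R₁ ^ (-|κ|) ≤ R ^ (-|κ|) :=
                Real.rpow_le_rpow_of_nonpos (by linarith) hR' (by simp)
            _ ≤ R ^ κ := Real.rpow_le_rpow_of_exponent_le hR (neg_abs_le κ)
        calc (1 : ℝ) = R₁ ^ |κ| * R₁ ^ (-|κ|) := by
              rw [← Real.rpow_add (by linarith), add_neg_cancel, Real.rpow_zero]
          _ ≤ _ := mul_le_mul_of_nonneg_left h2 (by positivity)
      refine h1.trans ?_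
      rw [← mul_assoc]
      refine mul_le_mul' ?_ le_rfl
      rw [hC, ENNReal.coe_add, ENNReal.coe_mul]
      exact le_self_add
    | succ m ih =>
      intro R hR hR'
      by_cases hRm : R ≤ R₁
      · exact ih R hR (hRm.trans (le_mul_of_one_le_right (by linarith) (one_le_pow₀ (by norm_num))))
      push Not at hRm
      intro J _ x hx a v hvm hv g hg
      have h1 := hred C R ((le_max_left _ _).trans hRm.le) (fun R' h1 h2 => ih R' h1 (by
        rw [pow_succ] at hR'
        have : 0 < R₁ * 4 ^ m := by positivity
        linarith)) J x hx a v hvm hv g hg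
      have h2 := hCd J x a v hvm hv g R ((le_max_right _ _).trans hRm.le) hg
      set I := ∫⁻ z, ‖es ξ[x] a z‖ₑ ^ 2 * g z with hI
      have h3 : ENNReal.ofReal (R ^ (α / (n + 1) - 1 + ε)) ≤ ENNReal.ofReal (R ^ κ) :=
        ENNReal.ofReal_le_ofReal (Real.rpow_le_rpow_of_exponent_le hR hexp)
      calc _ ≤ K * (Cd * ENNReal.ofReal (R ^ κ) * I) +
            ((1 / 2 : ℝ≥0) : ℝ≥0∞) * C * ENNReal.ofReal (R ^ κ) * I :=
            h1.trans (add_le_add (mul_le_mul' le_rfl (h2.trans (mul_le_mul' (mul_le_mul' le_rfl h3)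
              le_rfl))) le_rfl)
        _ = ((K * Cd + 1 / 2 * C : ℝ≥0) : ℝ≥0∞) * ENNReal.ofReal (R ^ κ) * I := by push_cast; ring
        _ ≤ _ := by
            refine mul_le_mul' (mul_le_mul' (ENNReal.coe_le_coe.2 ?_) le_rfl) le_rfl
            have h4 : 2 * (K * Cd) ≤ C := le_add_self
            calc K * Cd + 1 / 2 * C = 1 / 2 * (2 * (K * Cd)) + 1 / 2 * C := by
                  rw [← mul_assoc]; norm_num
              _ ≤ 1 / 2 * C + 1 / 2 * C := by gcongr
              _ = C := by rw [← add_mul]; norm_num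
  intro R hR
  obtain ⟨m, hm⟩ := pow_unbounded_of_one_lt R (by norm_num : (1 : ℝ) < 4)
  refine hind m R hR (hm.le.trans ?_)
  exact le_mul_of_one_le_left (by positivity) hR₁1

end Induction

section Points

variable {n : ℕ}

local notation "ξ[" x "]" => fun j => Lam (x j)

/-- A finite family of masses which is at most `α`-dimensional at scales at least one. -/
def ThinPts {ι P : Type} [Fintype ι] (α : ℝ) (s : Finset P) (z : P → ι → ℝ) (μ : P → ℝ≥0) : Prop :=
  ∀ c ρ, 1 ≤ ρ → ∀ t ⊆ s, (∀ p ∈ t, ‖z p - c‖ ≤ ρ) →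
    ∑ p ∈ t, (μ p : ℝ≥0∞) ≤ ENNReal.ofReal (ρ ^ α)

lemma ThinPts.exists_thin {α : ℝ} (hα0 : 0 ≤ α) (hα : α ≤ n + 1) :
    ∃ B : ℝ≥0, ∀ (P : Type) (s : Finset P) (z : P → Fin (n + 1) → ℝ) (μ : P → ℝ≥0)
      (_ : ThinPts α s z μ), ∃ v : (Fin (n + 1) → ℝ) → ℝ≥0∞, Measurable v ∧ Thin α v ∧
        ∀ y, ∑ p ∈ s, μ p * om (n + 2) 1 (z p - y) ≤ B * v y ^ (1 / n : ℝ) := by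
  classical
  set N := n + 2 with hN
  have hcard : Fintype.card (Fin (n + 1)) = n + 1 := Fintype.card_fin _
  obtain ⟨B, hB0, hB⟩ := Thin.exists_comp (ι := Fin (n + 1)) (α := α) (by rw [hcard]; exact_mod_cast hα)
    (N := N) (by rw [hcard])
  set K : ℝ≥0 := 2 ^ (n + 1) * 2 ^ (n + 1) with hK
  have hK0 : (K : ℝ≥0∞) ≠ 0 := by simp [hK]
  set B' : ℝ≥0 := B + 2 ^ (N + 1) with hB'
  have hB'0 : (B' : ℝ≥0∞) ≠ 0 := by
    rw [ENNReal.coe_ne_zero]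
    positivity
  refine ⟨2 ^ N * K * B', fun P s z μ hμ => ?_⟩
  set v₀ : (Fin (n + 1) → ℝ) → ℝ≥0∞ := fun y =>
    ∑ p ∈ s, (K : ℝ≥0∞)⁻¹ * μ p * (closedBall (z p) 1).indicator 1 y with hv₀
  have hmi : ∀ p, Measurable fun y => (closedBall (z p) 1).indicator (1 : (Fin (n + 1) → ℝ) → ℝ≥0∞) y :=
    fun p => measurable_one.indicator measurableSet_closedBall
  have hmi' : ∀ p, Measurable fun y =>
      (K : ℝ≥0∞)⁻¹ * μ p * (closedBall (z p) 1).indicator (1 : (Fin (n + 1) → ℝ) → ℝ≥0∞) y :=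
    fun p => (hmi p).const_mul _
  have hv₀m : Measurable v₀ := Finset.measurable_fun_sum _ fun p _ => hmi' p
  have hthin : Thin α v₀ := by
    intro c ρ hρ
    set t := s.filter fun p => ‖z p - c‖ ≤ ρ + 1 with ht
    have h1 := hμ c (ρ + 1) (by linarith) t (Finset.filter_subset _ _)
      (fun p hp => (Finset.mem_filter.1 hp).2)
    have h2 : ∀ p ∈ s, ∫⁻ y in closedBall c ρ,
        (K : ℝ≥0∞)⁻¹ * μ p * (closedBall (z p) 1).indicator 1 y ≤
        if ‖z p - c‖ ≤ ρ + 1 then (K : ℝ≥0∞)⁻¹ * μ p * 2 ^ (n + 1) else 0 := by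
      intro p _
      split_ifs with h
      · rw [lintegral_const_mul _ (hmi p)]
        refine mul_le_mul' le_rfl ((setLIntegral_le_lintegral _ _).trans ?_)
        rw [lintegral_indicator_one measurableSet_closedBall, volume_cube one_pos, hcard, mul_one,
          ENNReal.ofReal_pow zero_le_two]
        simp
      · refine (setLIntegral_congr_fun measurableSet_closedBall (g := fun _ => 0) ?_).le.trans
          (by simp)
        intro y hy
        dsimp only
        rw [indicator_of_notMem, mul_zero]
        intro hy'
        refine h ?_
        rw [mem_closedBall, dist_eq_norm] at hy hy'
        calc ‖z p - c‖ = ‖(y - c) - (y - z p)‖ := by congr 1; abel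
          _ ≤ ρ + 1 := (norm_sub_le _ _).trans (add_le_add hy hy')
    calc ∫⁻ y in closedBall c ρ, v₀ y = ∑ p ∈ s, ∫⁻ y in closedBall c ρ,
          (K : ℝ≥0∞)⁻¹ * μ p * (closedBall (z p) 1).indicator 1 y :=
          lintegral_finsetSum _ fun p _ => hmi' p
      _ ≤ ∑ p ∈ t, (K : ℝ≥0∞)⁻¹ * μ p * 2 ^ (n + 1) := by
          rw [ht, Finset.sum_filter]
          exact Finset.sum_le_sum h2
      _ = (K : ℝ≥0∞)⁻¹ * (∑ p ∈ t, (μ p : ℝ≥0∞)) * 2 ^ (n + 1) := by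
          rw [Finset.mul_sum, Finset.sum_mul]
      _ ≤ (K : ℝ≥0∞)⁻¹ * (2 ^ (n + 1) * ENNReal.ofReal (ρ ^ α)) * 2 ^ (n + 1) := by
          refine mul_le_mul' (mul_le_mul' le_rfl (h1.trans ?_)) le_rfl
          have e : (2 : ℝ≥0∞) ^ (n + 1) = ENNReal.ofReal (2 ^ (n + 1)) := by
            rw [ENNReal.ofReal_pow zero_le_two]; simp
          rw [e, ← ENNReal.ofReal_mul (by positivity)]
          refine ENNReal.ofReal_le_ofReal ?_
          calc (ρ + 1) ^ α ≤ (2 * ρ) ^ α := Real.rpow_le_rpow (by linarith) (by linarith) hα0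
            _ = 2 ^ α * ρ ^ α := Real.mul_rpow zero_le_two (by linarith)
            _ ≤ 2 ^ (n + 1) * ρ ^ α := by
                refine mul_le_mul_of_nonneg_right ?_ (by positivity)
                rw [← Real.rpow_natCast]
                exact Real.rpow_le_rpow_of_exponent_le one_le_two (by exact_mod_cast hα)
      _ = (K : ℝ≥0∞)⁻¹ * K * ENNReal.ofReal (ρ ^ α) := by
          rw [hK]; push_cast; ring
      _ = ENNReal.ofReal (ρ ^ α) := by
          rw [ENNReal.inv_mul_cancel hK0 ENNReal.coe_ne_top, one_mul]
  set V : (Fin (n + 1) → ℝ) → ℝ≥0∞ := fun w => ∫⁻ y, v₀ y * om N 1 (w - y) with hV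
  have hVm : Measurable V := (SV.conv hv₀m (sv_om one_pos)).meas
  have hVs : ∀ w, V w ≤ B' := by
    intro w
    have := hthin.conv_om_le hv₀m (N := N) (by rw [hN]; push_cast; linarith) le_rfl w
    rw [Real.one_rpow, ENNReal.ofReal_one, mul_one] at this
    refine this.trans ?_
    rw [hB']; push_cast
    exact le_add_self
  have hVt : Thin α fun w => (B' : ℝ≥0∞)⁻¹ * V w := by
    intro c ρ hρ
    have := hB v₀ hv₀m hthin 1 le_rfl (LinearEquiv.refl ℝ _) (fun z => by
      rw [one_mul, LinearEquiv.refl_apply]; linarith [norm_nonneg z]) c ρ hρ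
    refine (lintegral_mono fun w => ?_).trans this
    rw [Real.one_rpow, ENNReal.ofReal_one, mul_one]
    refine mul_le_mul' (ENNReal.inv_le_inv.2 (ENNReal.coe_le_coe.2 le_self_add)) le_rfl
  refine ⟨_, hVm.const_mul _, hVt, fun y => ?_⟩
  have h3 : ∀ p, om N 1 (z p - y) ≤ 2 ^ N * K * ((K : ℝ≥0∞)⁻¹ *
      ∫⁻ y', (closedBall (z p) 1).indicator 1 y' * om N 1 (y - y')) := by
    intro p
    have hmo : Measurable fun y' : Fin (n + 1) → ℝ => om N 1 (y - y') := by fun_prop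
    have e : ∫⁻ y', (closedBall (z p) 1).indicator 1 y' * om N 1 (y - y') =
        ∫⁻ y' in closedBall (z p) 1, om N 1 (y - y') := by
      rw [← lintegral_indicator measurableSet_closedBall]
      refine lintegral_congr fun y' => ?_
      by_cases h : y' ∈ closedBall (z p) 1 <;> simp [h]
    have h4 : om N 1 (z p - y) * 2 ^ (n + 1) ≤ 2 ^ N * ∫⁻ y' in closedBall (z p) 1, om N 1 (y - y') := by
      rw [← lintegral_const_mul _ hmo]
      have h5 : om N 1 (z p - y) * 2 ^ (n + 1) = ∫⁻ _ in closedBall (z p) 1, om N 1 (z p - y) := by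
        rw [setLIntegral_const, volume_cube one_pos, hcard, mul_one, ENNReal.ofReal_pow zero_le_two]
        simp
      rw [h5]
      refine setLIntegral_mono (by fun_prop) fun y' hy' => ?_
      rw [om_sub_comm]
      refine (sv_om one_pos).le_of_mem one_pos ?_
      rw [mem_closedBall, dist_eq_norm] at hy'
      rwa [sub_sub_sub_cancel_left]
    rw [e, mul_assoc (2 ^ N), ← mul_assoc (K : ℝ≥0∞), ENNReal.mul_inv_cancel hK0 ENNReal.coe_ne_top,
      one_mul]
    refine le_trans ?_ h4
    exact le_mul_of_one_le_right' (one_le_pow₀ one_le_two)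
  have h6 : ∑ p ∈ s, μ p * om N 1 (z p - y) ≤ 2 ^ N * K * V y := by
    have hV' : V y = ∑ p ∈ s, μ p * ((K : ℝ≥0∞)⁻¹ *
        ∫⁻ y', (closedBall (z p) 1).indicator 1 y' * om N 1 (y - y')) := by
      have hmo : ∀ p, Measurable fun y' : Fin (n + 1) → ℝ =>
          (closedBall (z p) 1).indicator 1 y' * om N 1 (y - y') := fun p => by
        have := hmi p
        fun_prop
      have hmo' : ∀ p, Measurable fun y' : Fin (n + 1) → ℝ =>
          μ p * ((K : ℝ≥0∞)⁻¹ * ((closedBall (z p) 1).indicator 1 y' * om N 1 (y - y'))) :=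
        fun p => ((hmo p).const_mul _).const_mul _
      calc V y = ∫⁻ y', ∑ p ∈ s, μ p * ((K : ℝ≥0∞)⁻¹ *
            ((closedBall (z p) 1).indicator 1 y' * om N 1 (y - y'))) := by
            refine lintegral_congr fun y' => ?_
            rw [hv₀, Finset.sum_mul]
            refine Finset.sum_congr rfl fun p _ => by ring
        _ = _ := by
            rw [lintegral_finsetSum _ fun p _ => hmo' p]
            refine Finset.sum_congr rfl fun p _ => ?_
            rw [lintegral_const_mul _ ((hmo p).const_mul _), lintegral_const_mul _ (hmo p)]
    rw [hV', Finset.mul_sum]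
    refine Finset.sum_le_sum fun p _ => ?_
    rw [mul_left_comm]
    exact mul_le_mul' le_rfl (h3 p)
  refine h6.trans ?_
  push_cast
  rw [mul_assoc (2 ^ N * (K : ℝ≥0∞))]
  refine mul_le_mul' le_rfl ?_
  have h7 : V y = B' * ((B' : ℝ≥0∞)⁻¹ * V y) := by
    rw [← mul_assoc, ENNReal.mul_inv_cancel hB'0 ENNReal.coe_ne_top, one_mul]
  have h8 : (B' : ℝ≥0∞)⁻¹ * V y ≤ 1 := by
    calc _ ≤ (B' : ℝ≥0∞)⁻¹ * B' := mul_le_mul' le_rfl (hVs y)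
      _ = 1 := ENNReal.inv_mul_cancel hB'0 ENNReal.coe_ne_top
  conv_lhs => rw [h7]
  refine mul_le_mul' le_rfl ?_
  set q := (B' : ℝ≥0∞)⁻¹ * V y
  rcases Nat.eq_zero_or_pos n with h | h
  · subst h; simpa using h8
  conv_lhs => rw [← ENNReal.rpow_one q]
  refine ENNReal.rpow_le_rpow_of_exponent_ge h8 ?_
  rw [div_le_one (by positivity)]
  exact_mod_cast h

lemma exists_points (hn : 2 ≤ n) (N' : ℕ) {ε : ℝ} (hε : 0 < ε) {α κ : ℝ} (hα0 : 0 ≤ α)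
    (hα : α ≤ n + 1) (hκ : 2 * κ = (α - (n + 1)) / n + 2 * ε) :
    ∃ C : ℝ≥0, ∀ (J : Type) [Fintype J] (x : J → Fin n → ℝ) (_ : ∀ j, ‖x j‖ ≤ 1) (a : J → ℂ)
      (P : Type) (s : Finset P) (z : P → Fin (n + 1) → ℝ) (μ : P → ℝ≥0) (_ : ThinPts α s z μ)
      (R : ℝ) (_ : 1 ≤ R) (g : (Fin (n + 1) → ℝ) → ℝ≥0∞) (_ : SV N' R g),
      ∑ p ∈ s, μ p * (‖es ξ[x] a (z p)‖ₑ ^ 2 * g (z p)) ≤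
        C * ENNReal.ofReal (R ^ κ) * ∫⁻ z, ‖es ξ[x] a z‖ₑ ^ 2 * g z := by
  set L := n + 2 + N' with hL
  obtain ⟨C₁, hC₁⟩ := exists_sq_le_En (n := n) (L := L) (by omega)
  obtain ⟨B, hB⟩ := ThinPts.exists_thin hα0 hα
  obtain ⟨C₂, hC₂⟩ := exists_main hn N' hε hα hκ
  refine ⟨C₁ * B * C₂, fun J _ x hx a P s z μ hμ R hR g hg => ?_⟩
  obtain ⟨v, hvm, hv, hle⟩ := hB P s z μ hμ
  have hes : Measurable fun y => ‖es ξ[x] a y‖ₑ ^ 2 := measurable_es_sq _ _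
  have hgm := hg.meas
  have hg1 : SV N' 1 g := hg.mono one_pos hR
  have hmt : ∀ p, Measurable fun y => ‖es ξ[x] a y‖ₑ ^ 2 * (om (n + 2) 1 (z p - y) * g y) :=
    fun p => by fun_prop
  have hpt : ∀ p, ‖es ξ[x] a (z p)‖ₑ ^ 2 * g (z p) ≤
      C₁ * ∫⁻ y, ‖es ξ[x] a y‖ₑ ^ 2 * (om (n + 2) 1 (z p - y) * g y) := by
    intro p
    refine (mul_le_mul' (hC₁ J x hx a (z p)) le_rfl).trans ?_
    rw [mul_assoc]
    refine mul_le_mul' le_rfl ?_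
    unfold En
    have hmo : Measurable fun y => ‖es ξ[x] a y‖ₑ ^ 2 * om L 1 (z p - y) := by fun_prop
    rw [← lintegral_mul_const _ hmo]
    refine lintegral_mono fun y => ?_
    rw [mul_assoc]
    refine mul_le_mul' le_rfl ?_
    rw [← om_mul_pow (L := n + 2) (L' := N') one_pos, mul_comm (ENNReal.ofReal _), mul_assoc]
    exact mul_le_mul' le_rfl (hg1.le _ _)
  calc ∑ p ∈ s, μ p * (‖es ξ[x] a (z p)‖ₑ ^ 2 * g (z p))
      ≤ ∑ p ∈ s, C₁ * ∫⁻ y, μ p * (‖es ξ[x] a y‖ₑ ^ 2 * (om (n + 2) 1 (z p - y) * g y)) := by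
        refine Finset.sum_le_sum fun p _ => ?_
        rw [lintegral_const_mul _ (hmt p), mul_left_comm (C₁ : ℝ≥0∞)]
        exact mul_le_mul' le_rfl (hpt p)
    _ = C₁ * ∫⁻ y, ‖es ξ[x] a y‖ₑ ^ 2 * ((∑ p ∈ s, μ p * om (n + 2) 1 (z p - y)) * g y) := by
        rw [← Finset.mul_sum, ← lintegral_finsetSum _ fun p _ => (hmt p).const_mul _]
        congr 1
        refine lintegral_congr fun y => ?_
        rw [Finset.sum_mul, Finset.mul_sum]
        exact Finset.sum_congr rfl fun p _ => by ring
    _ ≤ C₁ * ∫⁻ y, B * (‖es ξ[x] a y‖ₑ ^ 2 * (v y ^ (1 / n : ℝ) * g y)) := by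
        refine mul_le_mul' le_rfl (lintegral_mono fun y => ?_)
        calc _ ≤ ‖es ξ[x] a y‖ₑ ^ 2 * (B * v y ^ (1 / n : ℝ) * g y) :=
              mul_le_mul' le_rfl (mul_le_mul' (hle y) le_rfl)
          _ = _ := by ring
    _ ≤ C₁ * (B * (C₂ * ENNReal.ofReal (R ^ κ) * ∫⁻ z, ‖es ξ[x] a z‖ₑ ^ 2 * g z)) := by
        rw [lintegral_const_mul' _ _ ENNReal.coe_ne_top]
        exact mul_le_mul' le_rfl (mul_le_mul' le_rfl (hC₂ R hR J x hx a v hvm hv g hg))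
    _ = _ := by push_cast; ring

end Points

section Extension

variable {n : ℕ}

local notation "ξ[" x "]" => fun j => Lam (x j)

/-- The Fourier extension operator of the paraboloid. -/
def Ext (f : (Fin n → ℝ) → ℂ) (z : Fin (n + 1) → ℝ) : ℂ := ∫ η, f η * ch (Lam η ⬝ᵥ z)

lemma continuous_Lam : Continuous (Lam : (Fin n → ℝ) → Fin (n + 1) → ℝ) := by
  refine continuous_pi fun i => ?_
  refine Fin.cases ?_ (fun j => ?_) i
  · simp only [Lam, Fin.cons_zero, dotProduct]; fun_prop
  · simp only [Lam, Fin.cons_succ]; fun_prop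

lemma continuous_ch_Lam (z : Fin (n + 1) → ℝ) : Continuous fun η : Fin n → ℝ => ch (Lam η ⬝ᵥ z) :=
  continuous_ch.comp ((continuous_dot z).comp continuous_Lam)

lemma integrable_ext {f : (Fin n → ℝ) → ℂ} (hf : Integrable f) (z : Fin (n + 1) → ℝ) :
    Integrable fun η => f η * ch (Lam η ⬝ᵥ z) :=
  hf.mul_bdd (c := 1) (continuous_ch_Lam z).aestronglyMeasurable (by simp [norm_ch])

lemma norm_ext_le (f : (Fin n → ℝ) → ℂ) (z : Fin (n + 1) → ℝ) : ‖Ext f z‖ ≤ ∫ η, ‖f η‖ := by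
  refine (norm_integral_le_integral_norm _).trans (le_of_eq ?_)
  simp [norm_ch]

lemma continuous_ext {f : (Fin n → ℝ) → ℂ} (hf : Integrable f) : Continuous (Ext f) := by
  refine continuous_of_dominated (bound := fun η => ‖f η‖)
    (fun z => (integrable_ext hf z).aestronglyMeasurable) (fun z => ?_) hf.norm ?_
  · simp [norm_ch]
  · refine Eventually.of_forall fun η => ?_
    have h : Continuous fun z : Fin (n + 1) → ℝ => Lam η ⬝ᵥ z := by unfold dotProduct; fun_prop
    exact continuous_const.mul (continuous_ch.comp h)

/-- Extensions are limits of exponential sums. -/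
lemma exists_es_tendsto_ext {f : (Fin n → ℝ) → ℂ} (hf : Integrable f) (hs : ∀ η, f η ≠ 0 → ‖η‖ ≤ 1) :
    ∃ (J : ℕ → Type) (_ : ∀ K, Fintype (J K)) (x : ∀ K, J K → Fin n → ℝ) (a : ∀ K, J K → ℂ),
      (∀ K j, ‖x K j‖ ≤ 1) ∧ (∀ K z, ‖es ξ[x K] (a K) z‖ ≤ ∫ η, ‖f η‖) ∧
      ∀ z, Tendsto (fun K => es ξ[x K] (a K) z) atTop (𝓝 (Ext f z)) := by
  classical
  let N : ℕ → ℤ := fun K => (K : ℤ) + 1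
  let r : ℕ → (Fin n → ℝ) → Fin n → ℝ := fun K η i => (⌊(N K : ℝ) * η i⌋ : ℝ) / N K
  let x : ∀ K, (Fin n → Finset.Icc (-(N K)) (N K)) → Fin n → ℝ := fun K m i => ((m i : ℤ) : ℝ) / N K
  let S : ∀ K, (Fin n → Finset.Icc (-(N K)) (N K)) → Set (Fin n → ℝ) :=
    fun K m => {η | ∀ i, ⌊(N K : ℝ) * η i⌋ = m i}
  let a : ∀ K, (Fin n → Finset.Icc (-(N K)) (N K)) → ℂ := fun K m => ∫ η in S K m, f η
  have hN0 : ∀ K, (0 : ℝ) < N K := fun K => by simp only [N]; push_cast; positivity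
  have hSm : ∀ K m, MeasurableSet (S K m) := by
    intro K m
    have : S K m = ⋂ i, {η : Fin n → ℝ | ⌊(N K : ℝ) * η i⌋ = m i} := by ext; simp [S]
    rw [this]
    refine MeasurableSet.iInter fun i => ?_
    have hm : Measurable fun η : Fin n → ℝ => ⌊(N K : ℝ) * η i⌋ :=
      Int.measurable_floor.comp (by fun_prop)
    exact hm (measurableSet_singleton _)
  have hes : ∀ K z, es ξ[x K] (a K) z = ∫ η, f η * ch (Lam (r K η) ⬝ᵥ z) := by
    intro K z
    have h1 : ∀ m, a K m * ch (Lam (x K m) ⬝ᵥ z) =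
        ∫ η, (S K m).indicator f η * ch (Lam (x K m) ⬝ᵥ z) := by
      intro m
      rw [integral_mul_const, integral_indicator (hSm K m)]
    unfold es
    rw [Finset.sum_congr rfl fun m _ => h1 m, ← integral_finsetSum _ fun m _ =>
      (hf.indicator (hSm K m)).mul_const _]
    refine integral_congr_ae (Eventually.of_forall fun η => ?_)
    dsimp only
    by_cases h0 : f η = 0
    · rw [h0, zero_mul]
      refine Finset.sum_eq_zero fun m _ => ?_
      rw [indicator_apply]; split_ifs <;> simp [h0]
    have hb : ∀ i, ⌊(N K : ℝ) * η i⌋ ∈ Finset.Icc (-(N K)) (N K) := by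
      intro i
      have h2 := abs_le.1 ((norm_le_pi_norm η i).trans (hs η h0))
      rw [Finset.mem_Icc, Int.le_floor]
      have := hN0 K
      refine ⟨by push_cast; nlinarith, ?_⟩
      have h3 : (⌊(N K : ℝ) * η i⌋ : ℝ) ≤ N K := (Int.floor_le _).trans (by nlinarith)
      exact_mod_cast h3
    rw [Finset.sum_eq_single (fun i => ⟨_, hb i⟩)]
    · rw [indicator_of_mem]
      simp [S]
    · intro m _ hm
      rw [indicator_of_notMem, zero_mul]
      intro hmem
      refine hm (funext fun i => Subtype.ext ?_)
      exact (hmem i).symm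
    · simp
  have hrm : ∀ K, Measurable (r K) := by
    intro K
    refine measurable_pi_lambda _ fun i => ?_
    have hm : Measurable fun η : Fin n → ℝ => ⌊(N K : ℝ) * η i⌋ :=
      Int.measurable_floor.comp (by fun_prop)
    have hc : Measurable fun k : ℤ => (k : ℝ) / N K := measurable_of_countable _
    exact hc.comp hm
  have hintg : ∀ K z, AEStronglyMeasurable (fun η => f η * ch (Lam (r K η) ⬝ᵥ z)) volume := by
    intro K z
    exact hf.aestronglyMeasurable.mul
      ((continuous_ch_Lam z).measurable.comp (hrm K)).aestronglyMeasurable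
  refine ⟨fun K => Fin n → Finset.Icc (-(N K)) (N K), fun K => inferInstance, x, a, ?_, ?_, ?_⟩
  · intro K m
    refine (pi_norm_le_iff_of_nonneg zero_le_one).2 fun i => ?_
    have h := Finset.mem_Icc.1 (m i).2
    simp only [x]
    rw [Real.norm_eq_abs, abs_div, abs_of_pos (hN0 K), div_le_one (hN0 K), abs_le]
    exact_mod_cast h
  · intro K z
    rw [hes]
    refine (norm_integral_le_integral_norm _).trans (le_of_eq ?_)
    simp [norm_ch]
  · intro z
    simp_rw [hes]
    refine tendsto_integral_of_dominated_convergence (fun η => ‖f η‖) (fun K => hintg K z) hf.norm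
      (fun K => Eventually.of_forall fun η => by simp [norm_ch]) (Eventually.of_forall fun η => ?_)
    refine tendsto_const_nhds.mul ((continuous_ch_Lam z).tendsto η |>.comp ?_)
    refine tendsto_pi_nhds.2 fun i => ?_
    have h1 : ∀ K, |r K η i - η i| ≤ 1 / ((K : ℝ) + 1) := by
      intro K
      have e : ((N K : ℤ) : ℝ) = (K : ℝ) + 1 := by simp [N]
      have hp := hN0 K
      have : r K η i - η i = -(Int.fract ((N K : ℝ) * η i)) / N K := by
        simp only [r, Int.fract]; field_simp; ring
      rw [this, ← e, abs_div, abs_neg, abs_of_pos hp, abs_of_nonneg (Int.fract_nonneg _)]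
      exact div_le_div_of_nonneg_right (Int.fract_lt_one _).le hp.le
    rw [tendsto_iff_dist_tendsto_zero]
    refine squeeze_zero (fun _ => dist_nonneg) (fun K => ?_) tendsto_one_div_add_atTop_nhds_zero_nat
    rw [Real.dist_eq]
    exact h1 K

lemma exists_points_ext (hn : 2 ≤ n) (N' : ℕ) {ε : ℝ} (hε : 0 < ε) {α κ : ℝ} (hα0 : 0 ≤ α)
    (hα : α ≤ n + 1) (hκ : 2 * κ = (α - (n + 1)) / n + 2 * ε) :
    ∃ C : ℝ≥0, ∀ (f : (Fin n → ℝ) → ℂ) (_ : Integrable f) (_ : ∀ η, f η ≠ 0 → ‖η‖ ≤ 1)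
      (P : Type) (s : Finset P) (z : P → Fin (n + 1) → ℝ) (μ : P → ℝ≥0) (_ : ThinPts α s z μ)
      (R : ℝ) (_ : 1 ≤ R) (g : (Fin (n + 1) → ℝ) → ℝ≥0∞) (_ : SV N' R g) (_ : ∀ z, g z ≠ ∞)
      (_ : ∫⁻ z, g z ≠ ∞),
      ∑ p ∈ s, μ p * (‖Ext f (z p)‖ₑ ^ 2 * g (z p)) ≤
        C * ENNReal.ofReal (R ^ κ) * ∫⁻ z, ‖Ext f z‖ₑ ^ 2 * g z := by
  obtain ⟨C, hC⟩ := exists_points hn N' hε hα0 hα hκ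
  refine ⟨C, fun f hf hfs P s z μ hμ R hR g hg hgt hgi => ?_⟩
  obtain ⟨J, _, x, a, hx, hb, ht⟩ := exists_es_tendsto_ext hf hfs
  have ht2 : ∀ z, Tendsto (fun K => ‖es ξ[x K] (a K) z‖ₑ ^ 2 * g z) atTop (𝓝 (‖Ext f z‖ₑ ^ 2 * g z)) := by
    intro z
    exact ENNReal.Tendsto.mul_const (ENNReal.Tendsto.pow (ht z).enorm) (Or.inr (hgt z))
  refine le_of_tendsto_of_tendsto' (tendsto_finsetSum s fun p _ =>
    ENNReal.Tendsto.const_mul (ht2 (z p)) (Or.inr ENNReal.coe_ne_top))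
    (ENNReal.Tendsto.const_mul (b := ∫⁻ z, ‖Ext f z‖ₑ ^ 2 * g z) ?_
      (Or.inr (ENNReal.mul_ne_top ENNReal.coe_ne_top ENNReal.ofReal_ne_top)))
    (fun K => hC (J K) (x K) (hx K) (a K) P s z μ hμ R hR g hg)
  refine tendsto_lintegral_of_dominated_convergence
    (fun z => ENNReal.ofReal (∫ η, ‖f η‖) ^ 2 * g z)
    (fun K => (measurable_es_sq _ _).mul hg.meas) (fun K => Eventually.of_forall fun z => ?_) ?_
    (Eventually.of_forall ht2)
  · refine mul_le_mul' (pow_le_pow_left' ?_ 2) le_rfl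
    rw [← ofReal_norm]
    exact ENNReal.ofReal_le_ofReal (hb K z)
  · rw [lintegral_const_mul _ hg.meas]
    exact ENNReal.mul_ne_top (ENNReal.pow_ne_top ENNReal.ofReal_ne_top) hgi

end Extension

section LocalSmoothing

lemma volume_slab_le {m : ℕ} {η : Fin (m + 1) → ℝ} (hη : 1 / 2 ≤ ‖η‖) {R : ℝ} (hR : 16 ≤ R) :
    volume {ζ : Fin (m + 1) → ℝ | ‖η - ζ‖ < 4 / R ∧ |η ⬝ᵥ η - ζ ⬝ᵥ ζ| < 4 / R ^ 2} ≤
      ENNReal.ofReal ((8 / R) ^ m * (32 / R ^ 2)) := by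
  have hR0 : 0 < R := by linarith
  set S := {ζ : Fin (m + 1) → ℝ | ‖η - ζ‖ < 4 / R ∧ |η ⬝ᵥ η - ζ ⬝ᵥ ζ| < 4 / R ^ 2} with hS
  obtain ⟨i, hi⟩ : ∃ i, 1 / 2 ≤ |η i| := by
    by_contra! h
    exact absurd ((pi_norm_lt_iff (by norm_num)).2 h) (not_lt.2 hη)
  have hSm : MeasurableSet S := by
    have h1 : Continuous fun ζ : Fin (m + 1) → ℝ => |η ⬝ᵥ η - ζ ⬝ᵥ ζ| := by
      unfold dotProduct; fun_prop
    have h2 : Continuous fun ζ : Fin (m + 1) → ℝ => ‖η - ζ‖ := by fun_prop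
    exact ((isOpen_lt h2 continuous_const).inter
      (isOpen_lt h1 continuous_const)).measurableSet
  have he := (volume_preserving_piFinSuccAbove (fun _ : Fin (m + 1) => ℝ) i).symm
  rw [← he.measure_preimage hSm.nullMeasurableSet]
  have hTm : MeasurableSet ((MeasurableEquiv.piFinSuccAbove (fun _ : Fin (m + 1) => ℝ) i).symm ⁻¹' S) :=
    he.measurable hSm
  rw [Measure.volume_eq_prod, Measure.prod_apply_symm hTm]
  have hsec : ∀ y : Fin m → ℝ, volume ((fun u : ℝ => (u, y)) ⁻¹'
      ((MeasurableEquiv.piFinSuccAbove (fun _ : Fin (m + 1) => ℝ) i).symm ⁻¹' S)) ≤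
      (closedBall (fun j => η (i.succAbove j)) (4 / R)).indicator
        (fun _ => ENNReal.ofReal (32 / R ^ 2)) y := by
    intro y
    set U := (fun u : ℝ => (u, y)) ⁻¹'
      ((MeasurableEquiv.piFinSuccAbove (fun _ : Fin (m + 1) => ℝ) i).symm ⁻¹' S) with hU
    obtain ⟨ins, hins⟩ : ∃ ins : ℝ → Fin (m + 1) → ℝ,
      ins = fun u => Fin.insertNth (α := fun _ => ℝ) i u y := ⟨_, rfl⟩
    have hsame : ∀ u, ins u i = u := fun u => by rw [hins]; exact Fin.insertNth_apply_same ..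
    have habove : ∀ u j, ins u (i.succAbove j) = y j := fun u j => by
      rw [hins]; exact Fin.insertNth_apply_succAbove ..
    have hmem : ∀ u, u ∈ U ↔ ins u ∈ S := fun u => by rw [hins]; exact Iff.rfl
    have hdot : ∀ u, ins u ⬝ᵥ ins u = u * u + y ⬝ᵥ y := by
      intro u
      simp only [dotProduct, Fin.sum_univ_succAbove _ i, hsame, habove]
    rcases U.eq_empty_or_nonempty with h | ⟨u₀, hu₀⟩
    · rw [h, measure_empty]; exact zero_le
    have hu₀' := (hmem _).1 hu₀
    have hco : ∀ u ∈ U, |η i - u| < 4 / R := by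
      intro u hu
      have h2 := (norm_le_pi_norm (η - ins u) i).trans_lt ((hmem u).1 hu).1
      rwa [Pi.sub_apply, hsame] at h2
    rw [indicator_of_mem]
    · have hsub : U ⊆ closedBall u₀ (16 / R ^ 2) := by
        intro u hu
        rw [mem_closedBall, Real.dist_eq]
        have h3 := abs_lt.1 ((hmem u).1 hu).2
        have h4 := abs_lt.1 hu₀'.2
        rw [hdot] at h3 h4
        have h5 : |(u - u₀) * (u + u₀)| ≤ 8 / R ^ 2 := by
          have e : (8 : ℝ) / R ^ 2 = 4 / R ^ 2 + 4 / R ^ 2 := by ring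
          rw [abs_le, e]
          constructor <;> nlinarith
        have h6 : 4 / R ≤ 1 / 4 := by rw [div_le_iff₀ hR0]; linarith
        have h7 : 1 / 2 ≤ |u + u₀| := by
          have a1 := abs_lt.1 (hco u hu)
          have a2 := abs_lt.1 (hco u₀ hu₀)
          rcases le_abs'.1 hi with h | h
          · rw [le_abs']; left; linarith
          · rw [le_abs']; right; linarith
        rw [abs_mul] at h5
        have e : (16 : ℝ) / R ^ 2 = 2 * (8 / R ^ 2) := by ring
        rw [e]
        nlinarith [abs_nonneg (u - u₀)]
      refine (measure_mono hsub).trans ?_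
      rw [Real.volume_closedBall]
      exact ENNReal.ofReal_le_ofReal (by ring_nf; rfl)
    · rw [mem_closedBall, dist_comm, dist_eq_norm]
      refine (pi_norm_le_iff_of_nonneg (by positivity)).2 fun j => ?_
      have h2 := (norm_le_pi_norm (η - ins u₀) (i.succAbove j)).trans hu₀'.1.le
      rwa [Pi.sub_apply, habove] at h2
  refine (lintegral_mono hsec).trans ?_
  rw [lintegral_indicator measurableSet_closedBall, setLIntegral_const, volume_cube (by positivity),
    ← ENNReal.ofReal_mul (by positivity), Fintype.card_fin]
  exact ENNReal.ofReal_le_ofReal (by ring_nf; rfl)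

variable {n : ℕ}

/-- The parabolic dilation. -/
def dil (n : ℕ) (R : ℝ) : Fin (n + 1) → ℝ := Fin.cons (R ^ 2) fun _ => R

lemma exists_schur (hn : 2 ≤ n) : ∃ C : ℝ≥0, ∀ (R : ℝ) (_ : 1 ≤ R) (η : Fin n → ℝ)
    (_ : R ≤ 16 ∨ 1 / 2 ≤ ‖η‖),
    volume {ζ : Fin n → ℝ | ‖ζ‖ ≤ 1 ∧ ‖dil n R * (Lam η - Lam ζ)‖ < 4} ≤
      C * ENNReal.ofReal ((R ^ (n + 1))⁻¹) := by
  obtain ⟨m, rfl⟩ : ∃ m, n = m + 1 := ⟨n - 1, by omega⟩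
  refine ⟨Real.toNNReal (2 ^ (m + 1) * 16 ^ (m + 2)) + Real.toNNReal (8 ^ m * 32), fun R hR η h => ?_⟩
  have hR0 : 0 < R := by linarith
  rw [ENNReal.coe_add, add_mul]
  by_cases hR16 : R ≤ 16
  · refine le_trans ?_ le_self_add
    refine (measure_mono (t := closedBall 0 1) fun ζ hζ => by simpa using hζ.1).trans ?_
    rw [volume_cube one_pos, Fintype.card_fin]
    change _ ≤ ENNReal.ofReal _ * _
    rw [← ENNReal.ofReal_mul (by positivity)]
    refine ENNReal.ofReal_le_ofReal ?_
    rw [mul_one, mul_assoc]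
    refine le_mul_of_one_le_right (by positivity) ?_
    rw [← div_eq_mul_inv, one_le_div (by positivity)]
    exact pow_le_pow_left₀ hR0.le hR16 _
  · refine le_trans ?_ le_add_self
    push Not at hR16
    refine (measure_mono fun ζ hζ => ?_).trans
      ((volume_slab_le (h.resolve_left (not_le.2 hR16)) hR16.le).trans ?_)
    · have h1 : ∀ l, |dil (m + 1) R l * (Lam η l - Lam ζ l)| < 4 := fun l =>
        (norm_le_pi_norm (dil (m + 1) R * (Lam η - Lam ζ)) l).trans_lt hζ.2
      refine ⟨(pi_norm_lt_iff (by positivity)).2 fun l => ?_, ?_⟩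
      · have := h1 l.succ
        simp only [dil, Lam, Fin.cons_succ, abs_mul, abs_of_pos hR0] at this
        rw [lt_div_iff₀ hR0, mul_comm]
        exact this
      · have := h1 0
        simp only [dil, Lam, Fin.cons_zero, abs_mul, abs_of_pos (pow_pos hR0 2)] at this
        rw [lt_div_iff₀ (by positivity), mul_comm]
        have e : -(η ⬝ᵥ η - ζ ⬝ᵥ ζ) = -(η ⬝ᵥ η) - -(ζ ⬝ᵥ ζ) := by ring
        rwa [← abs_neg, e]
    · change _ ≤ ENNReal.ofReal _ * _
      rw [← ENNReal.ofReal_mul (by positivity)]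
      refine ENNReal.ofReal_le_ofReal (le_of_eq ?_)
      rw [div_pow, pow_add R m 2]
      field_simp

lemma lintegral_dil {R : ℝ} (hR : 0 < R) {F : (Fin (n + 1) → ℝ) → ℝ≥0∞} (hF : Measurable F) :
    ∫⁻ z, F z = ENNReal.ofReal (R ^ (n + 2)) * ∫⁻ w, F (dil n R * w) := by
  classical
  have hdet : (Matrix.diagonal (dil n R)).det = R ^ (n + 2) := by
    rw [Matrix.det_diagonal, Fin.prod_univ_succ]
    simp [dil]; ring
  have h := Real.smul_map_diagonal_volume_pi (D := dil n R) (by rw [hdet]; positivity)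
  rw [hdet, abs_of_pos (by positivity)] at h
  conv_lhs => rw [← h]
  have hT : ∀ w, Matrix.toLin' (Matrix.diagonal (dil n R)) w = dil n R * w := by
    intro w
    ext l
    rw [Matrix.toLin'_apply, Matrix.mulVec_diagonal]; rfl
  rw [lintegral_smul_measure, smul_eq_mul, lintegral_map hF
    (LinearMap.continuous_of_finiteDimensional _).measurable]
  simp_rw [hT]

lemma sv_wt_dil (L : ℕ) {R : ℝ} (hR : 1 ≤ R) :
    SV L R fun z : Fin (n + 1) → ℝ => wt L 1 ((dil n R)⁻¹ * z) := by
  have hm : Measurable fun z : Fin (n + 1) → ℝ => (dil n R)⁻¹ * z := by fun_prop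
  refine ⟨measurable_wt.comp hm, fun z z' => ((sv_wt one_pos).le _ _).trans
    (mul_le_mul' (ENNReal.ofReal_le_ofReal (pow_le_pow_left₀ (by positivity) ?_ _)) le_rfl)⟩
  have hR0 : 0 < R := by linarith
  rw [div_one, ← mul_sub, add_le_add_iff_left]
  refine (pi_norm_le_iff_of_nonneg (by positivity)).2 fun l => ?_
  rw [Pi.mul_apply, norm_mul, mul_comm, div_eq_mul_inv]
  refine mul_le_mul (norm_le_pi_norm _ l) ?_ (norm_nonneg _) (norm_nonneg _)
  rw [Pi.inv_apply, norm_inv]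
  refine inv_anti₀ hR0 ?_
  refine Fin.cases ?_ (fun j => ?_) l
  · simp only [dil, Fin.cons_zero]
    rw [Real.norm_of_nonneg (by positivity)]
    nlinarith
  · simp only [dil, Fin.cons_succ]
    exact le_abs_self R

lemma lintegral_pair_le {f : (Fin n → ℝ) → ℂ} (hfm : Measurable f) (hfs : ∀ η, f η ≠ 0 → ‖η‖ ≤ 1)
    {R : ℝ} {A : ℝ≥0∞} (hA : ∀ η, f η ≠ 0 →
      volume {ζ : Fin n → ℝ | ‖ζ‖ ≤ 1 ∧ ‖dil n R * (Lam η - Lam ζ)‖ < 4} ≤ A) :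
    ∫⁻ p : (Fin n → ℝ) × (Fin n → ℝ), ‖f p.1‖ₑ * ‖f p.2‖ₑ *
      {p : (Fin n → ℝ) × (Fin n → ℝ) | ‖dil n R * (Lam p.1 - Lam p.2)‖ < 4}.indicator 1 p ≤
      2 * A * ∫⁻ η, ‖f η‖ₑ ^ 2 := by
  set S := {p : (Fin n → ℝ) × (Fin n → ℝ) | ‖dil n R * (Lam p.1 - Lam p.2)‖ < 4} with hS
  have hSo : IsOpen S := by
    have h1 : Continuous fun p : (Fin n → ℝ) × (Fin n → ℝ) => Lam p.1 - Lam p.2 :=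
      (continuous_Lam.comp continuous_fst).sub (continuous_Lam.comp continuous_snd)
    exact isOpen_lt (continuous_const.mul h1).norm continuous_const
  set T := S ∩ {p | ‖p.2‖ ≤ 1} with hT
  have hTm : MeasurableSet T :=
    hSo.measurableSet.inter (isClosed_le (by fun_prop) continuous_const).measurableSet
  have hsymm : ∀ η ζ, (η, ζ) ∈ S ↔ (ζ, η) ∈ S := by
    intro η ζ
    simp only [hS, mem_ofPred_eq]
    rw [← norm_neg, ← mul_neg, neg_sub]
  set h : (Fin n → ℝ) × (Fin n → ℝ) → ℝ≥0∞ := fun p => ‖f p.1‖ₑ ^ 2 * T.indicator 1 p with hh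
  have hhm : Measurable h := by
    have h1 : Measurable (T.indicator (1 : (Fin n → ℝ) × (Fin n → ℝ) → ℝ≥0∞)) :=
      measurable_one.indicator hTm
    fun_prop
  have hintg : ∫⁻ p, h p ≤ A * ∫⁻ η, ‖f η‖ₑ ^ 2 := by
    rw [Measure.volume_eq_prod, lintegral_prod _ hhm.aemeasurable,
      ← lintegral_const_mul _ (by fun_prop)]
    refine lintegral_mono fun η => ?_
    by_cases h0 : f η = 0
    · simp [hh, h0]
    have hm1 : MeasurableSet (Prod.mk η ⁻¹' T) := measurable_prodMk_left hTm
    have h2 : ∀ ζ, h (η, ζ) = ‖f η‖ₑ ^ 2 * (Prod.mk η ⁻¹' T).indicator 1 ζ := fun ζ => rfl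
    simp_rw [h2]
    rw [lintegral_const_mul _ (measurable_one.indicator hm1), lintegral_indicator_one hm1, mul_comm]
    refine mul_le_mul' ((measure_mono fun ζ hζ => ?_).trans (hA η h0)) le_rfl
    exact ⟨hζ.2, hζ.1⟩
  calc _ ≤ ∫⁻ p, (h p + h p.swap) := by
        refine lintegral_mono fun p => ?_
        obtain ⟨η, ζ⟩ := p
        dsimp only
        by_cases hp : (η, ζ) ∈ S
        swap
        · simp [hp]
        by_cases h1 : f η = 0
        · simp [h1]
        by_cases h2 : f ζ = 0
        · simp [h2]
        have e1 : h (η, ζ) = ‖f η‖ₑ ^ 2 := by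
          simp only [hh]
          rw [indicator_of_mem (show (η, ζ) ∈ T from ⟨hp, hfs ζ h2⟩), Pi.one_apply, mul_one]
        have e2 : h (ζ, η) = ‖f ζ‖ₑ ^ 2 := by
          simp only [hh]
          rw [indicator_of_mem (show (ζ, η) ∈ T from ⟨(hsymm _ _).1 hp, hfs η h1⟩), Pi.one_apply, mul_one]
        rw [indicator_of_mem hp, Pi.one_apply, mul_one, Prod.swap_prod_mk, e1, e2]
        rcases le_total ‖f η‖ₑ ‖f ζ‖ₑ with h | h
        · refine le_trans ?_ le_add_self
          rw [sq]; exact mul_le_mul' h le_rfl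
        · refine le_trans ?_ le_self_add
          rw [sq]; exact mul_le_mul' le_rfl h
    _ = 2 * ∫⁻ p, h p := by
        rw [lintegral_add_left hhm, two_mul]
        congr 1
        exact (Measure.measurePreserving_swap (μ := volume) (ν := volume)).lintegral_comp hhm
    _ ≤ _ := by
        rw [mul_assoc]
        exact mul_le_mul' le_rfl hintg

lemma exists_local_smoothing (hn : 2 ≤ n) {L : ℕ} (hL : n + 1 < L) :
    ∃ C : ℝ≥0, ∀ (R : ℝ) (_ : 1 ≤ R) (f : (Fin n → ℝ) → ℂ) (_ : Measurable f) (_ : Integrable f)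
      (_ : ∀ η, f η ≠ 0 → ‖η‖ ≤ 1) (_ : ∀ η, f η ≠ 0 → R ≤ 16 ∨ 1 / 2 ≤ ‖η‖),
      ∫⁻ z, ‖Ext f z‖ₑ ^ 2 * wt L 1 ((dil n R)⁻¹ * z) ≤ C * ENNReal.ofReal R * ∫⁻ η, ‖f η‖ₑ ^ 2 := by
  obtain ⟨Om, hc, h0, ⟨C, hC⟩, hf⟩ := exists_band_weight_one (ι := Fin (n + 1)) (L := L) (by simpa using hL)
  obtain ⟨B, hB⟩ := exists_schur hn
  have hfin : ∫⁻ x, ‖Om x‖ₑ < ∞ := by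
    calc ∫⁻ x, ‖Om x‖ₑ ≤ ∫⁻ x, C * wt L 1 x := lintegral_mono fun x => by
          rw [Real.enorm_of_nonneg (h0 x)]; exact (hC x).2
      _ < ∞ := by
          rw [lintegral_const_mul _ (by fun_prop)]
          exact ENNReal.mul_lt_top (by simp) (lintegral_wt_one_lt_top (by simpa using hL))
  have hi : Integrable Om := ⟨hc.aestronglyMeasurable, hfin⟩
  set M := (∫⁻ x, ‖Om x‖ₑ).toNNReal with hM
  have hMc : (M : ℝ≥0∞) = ∫⁻ x, ‖Om x‖ₑ := ENNReal.coe_toNNReal hfin.ne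
  refine ⟨C * (M * (2 * B)), fun R hR f hfm hfi hfs hfa => ?_⟩
  have hR0 : 0 < R := by linarith
  have hdil : ∀ w, (dil n R)⁻¹ * (dil n R * w) = w := by
    intro w
    ext l
    have : dil n R l ≠ 0 := by
      refine Fin.cases ?_ (fun j => ?_) l
      · simp only [dil, Fin.cons_zero]; positivity
      · simp only [dil, Fin.cons_succ]; positivity
    simp [this]
  have hcE : Continuous fun w => Ext f (dil n R * w) := (continuous_ext hfi).comp (by fun_prop)
  have hm1 : Measurable fun z => ‖Ext f z‖ₑ ^ 2 * wt L 1 ((dil n R)⁻¹ * z) := by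
    have h1 : Measurable fun z => wt L 1 ((dil n R)⁻¹ * z) := (sv_wt_dil L hR).meas
    have h2 := (continuous_ext hfi).measurable
    fun_prop
  rw [lintegral_dil hR0 hm1]
  simp_rw [hdil]
  set G : (Fin (n + 1) → ℝ) → ℝ := fun w => ‖Ext f (dil n R * w)‖ ^ 2 * Om w with hG
  have hGc : Continuous G := by fun_prop
  have hG0 : ∀ w, 0 ≤ G w := fun w => mul_nonneg (by positivity) (h0 w)
  have hGi : Integrable G := by
    refine (hi.const_mul ((∫ η, ‖f η‖) ^ 2)).mono' hGc.aestronglyMeasurable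
      (Eventually.of_forall fun w => ?_)
    rw [Real.norm_of_nonneg (hG0 w)]
    exact mul_le_mul_of_nonneg_right (pow_le_pow_left₀ (norm_nonneg _) (norm_ext_le f _) 2) (h0 w)
  set φ : (Fin n → ℝ) × (Fin n → ℝ) → ℂ := fun p => f p.1 * (starRingEnd ℂ) (f p.2) with hφ
  have hφi : Integrable φ := by
    have h2 : Integrable fun η => (starRingEnd ℂ) (f η) := by
      refine hfi.norm.mono' ?_ (Eventually.of_forall fun η => by simp)
      exact (Complex.continuous_conj.measurable.comp hfm).aestronglyMeasurable
    exact hfi.mul_prod h2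
  set θ : (Fin (n + 1) → ℝ) → (Fin n → ℝ) × (Fin n → ℝ) → ℝ :=
    fun w p => (Lam p.1 - Lam p.2) ⬝ᵥ (dil n R * w) with hθ
  have hθ' : ∀ w p, θ w p = -(w ⬝ᵥ -(dil n R * (Lam p.1 - Lam p.2))) := by
    intro w p
    simp only [hθ, dotProduct, ← Finset.sum_neg_distrib]
    refine Finset.sum_congr rfl fun l _ => ?_
    simp only [Pi.mul_apply, Pi.neg_apply]; ring
  have hGe : ∀ w, (G w : ℂ) = ∫ p, (Om w : ℂ) * ch (θ w p) * φ p := by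
    intro w
    have h1 : ((‖Ext f (dil n R * w)‖ ^ 2 : ℝ) : ℂ) = Ext f (dil n R * w) *
        (starRingEnd ℂ) (Ext f (dil n R * w)) := by
      rw [Complex.mul_conj, Complex.normSq_eq_norm_sq]
    simp only [hG]
    rw [Complex.ofReal_mul, h1, Ext, ← integral_conj, ← integral_prod_mul, ← integral_mul_const]
    refine integral_congr_ae (Eventually.of_forall fun p => ?_)
    simp only [hφ, hθ, map_mul, conj_ch, sub_dotProduct, ch_sub]
    ring
  have hswap : ∫ w, (G w : ℂ) = ∫ p, ∫ w, (Om w : ℂ) * ch (θ w p) * φ p := by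
    simp_rw [hGe]
    refine integral_integral_swap ?_
    have h1 : Integrable (fun q : (Fin (n + 1) → ℝ) × ((Fin n → ℝ) × (Fin n → ℝ)) => (Om q.1 : ℂ) * φ q.2)
        (volume.prod volume) := hi.ofReal.mul_prod hφi
    have hcθ : Continuous fun q : (Fin (n + 1) → ℝ) × ((Fin n → ℝ) × (Fin n → ℝ)) => θ q.1 q.2 := by
      have h3 : Continuous fun q : (Fin (n + 1) → ℝ) × ((Fin n → ℝ) × (Fin n → ℝ)) =>
          Lam q.2.1 - Lam q.2.2 := (continuous_Lam.comp (by fun_prop)).sub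
            (continuous_Lam.comp (by fun_prop))
      have h4 : Continuous fun q : (Fin (n + 1) → ℝ) × ((Fin n → ℝ) × (Fin n → ℝ)) =>
          dil n R * q.1 := by fun_prop
      exact h3.dotProduct h4
    refine (h1.mul_bdd (c := 1) (continuous_ch.comp hcθ).aestronglyMeasurable
      (Eventually.of_forall fun q => by simp [norm_ch])).congr (Eventually.of_forall fun q => ?_)
    simp only [Function.uncurry, Function.comp]; ring
  have hin : ∀ p, ‖∫ w, (Om w : ℂ) * ch (θ w p) * φ p‖ₑ ≤ M * (‖f p.1‖ₑ * ‖f p.2‖ₑ *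
      {p : (Fin n → ℝ) × (Fin n → ℝ) | ‖dil n R * (Lam p.1 - Lam p.2)‖ < 4}.indicator 1 p) := by
    intro p
    rw [integral_mul_const, enorm_mul]
    have hφe : ‖φ p‖ₑ = ‖f p.1‖ₑ * ‖f p.2‖ₑ := by
      simp only [hφ, enorm_mul]
      rw [← ofReal_norm (starRingEnd ℂ (f p.2)), RCLike.norm_conj, ofReal_norm]
    by_cases hp : ‖dil n R * (Lam p.1 - Lam p.2)‖ < 4
    · rw [indicator_of_mem (by exact hp), Pi.one_apply, mul_one, hφe]
      refine mul_le_mul' ((enorm_integral_le_lintegral_enorm _).trans ?_) le_rfl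
      rw [hMc]
      refine lintegral_mono fun w => ?_
      rw [enorm_mul, enorm_ch, mul_one]
      rw [← ofReal_norm, Complex.norm_real, ofReal_norm]
    · have := hf (-(dil n R * (Lam p.1 - Lam p.2))) (by rw [norm_neg]; exact not_lt.1 hp)
      simp_rw [hθ', this]
      simp
  have hA : ∀ η, f η ≠ 0 → volume {ζ : Fin n → ℝ | ‖ζ‖ ≤ 1 ∧ ‖dil n R * (Lam η - Lam ζ)‖ < 4} ≤
      B * ENNReal.ofReal ((R ^ (n + 1))⁻¹) := fun η hη => hB R hR η (hfa η hη)
  have hmain : ∫⁻ w, ENNReal.ofReal (G w) ≤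
      M * (2 * (B * ENNReal.ofReal ((R ^ (n + 1))⁻¹)) * ∫⁻ η, ‖f η‖ₑ ^ 2) := by
    have e : ENNReal.ofReal (∫ w, G w) = ‖∫ w, (G w : ℂ)‖ₑ := by
      rw [integral_complex_ofReal, ← ofReal_norm, Complex.norm_real,
        Real.norm_of_nonneg (integral_nonneg hG0)]
    rw [← ofReal_integral_eq_lintegral_ofReal hGi (Eventually.of_forall hG0), e, hswap]
    refine (enorm_integral_le_lintegral_enorm _).trans ((lintegral_mono hin).trans ?_)
    rw [lintegral_const_mul' _ _ ENNReal.coe_ne_top]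
    exact mul_le_mul' le_rfl (lintegral_pair_le hfm hfs hA)
  calc _ ≤ ENNReal.ofReal (R ^ (n + 2)) * ∫⁻ w, C * ENNReal.ofReal (G w) := by
        refine mul_le_mul' le_rfl (lintegral_mono fun w => ?_)
        simp only [hG]
        rw [ENNReal.ofReal_mul (by positivity), ENNReal.ofReal_pow (norm_nonneg _), ofReal_norm,
          mul_left_comm]
        exact mul_le_mul' le_rfl (hC w).1
    _ ≤ ENNReal.ofReal (R ^ (n + 2)) * (C *
          (M * (2 * (B * ENNReal.ofReal ((R ^ (n + 1))⁻¹)) * ∫⁻ η, ‖f η‖ₑ ^ 2))) := by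
        rw [lintegral_const_mul' _ _ ENNReal.coe_ne_top]
        exact mul_le_mul' le_rfl (mul_le_mul' le_rfl hmain)
    _ = _ := by
        have e : ENNReal.ofReal (R ^ (n + 2)) * ENNReal.ofReal ((R ^ (n + 1))⁻¹) = ENNReal.ofReal R := by
          rw [← ENNReal.ofReal_mul (by positivity)]
          congr 1
          rw [pow_succ R (n + 1)]
          field_simp
        rw [← e]; push_cast; ring

end LocalSmoothing

section Unscaled

variable {n : ℕ}

lemma exists_points_L2 (hn : 2 ≤ n) {ε : ℝ} (hε : 0 < ε) {α κ : ℝ} (hα0 : 0 ≤ α)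
    (hα : α ≤ n + 1) (hκ : 2 * κ = (α - (n + 1)) / n + 2 * ε) :
    ∃ C : ℝ≥0, ∀ (R : ℝ) (_ : 1 ≤ R) (f : (Fin n → ℝ) → ℂ) (_ : Measurable f) (_ : Integrable f)
      (_ : ∀ η, f η ≠ 0 → ‖η‖ ≤ 1) (_ : ∀ η, f η ≠ 0 → R ≤ 16 ∨ 1 / 2 ≤ ‖η‖)
      (P : Type) (s : Finset P) (z : P → Fin (n + 1) → ℝ) (μ : P → ℝ≥0) (_ : ThinPts α s z μ)
      (z₀ : Fin (n + 1) → ℝ) (_ : ∀ p ∈ s, ∀ l, |z p l - z₀ l| ≤ dil n R l),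
      ∑ p ∈ s, μ p * ‖Ext f (z p)‖ₑ ^ 2 ≤ C * ENNReal.ofReal (R ^ (κ + 1)) * ∫⁻ η, ‖f η‖ₑ ^ 2 := by
  set L := n + 2 with hL
  obtain ⟨C₁, hC₁⟩ := exists_points_ext hn L hε hα0 hα hκ
  obtain ⟨C₂, hC₂⟩ := exists_local_smoothing hn (L := L) (by omega)
  refine ⟨2 ^ L * (C₁ * C₂), fun R hR f hfm hfi hfs hfa P s z μ hμ z₀ hz => ?_⟩
  have hR0 : 0 < R := by linarith
  set f' : (Fin n → ℝ) → ℂ := fun η => f η * ch (Lam η ⬝ᵥ z₀) with hf'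
  have hf'n : ∀ η, ‖f' η‖ₑ = ‖f η‖ₑ := fun η => by simp [hf', enorm_ch]
  have hf's : ∀ η, f' η ≠ 0 → f η ≠ 0 := fun η h => left_ne_zero_of_mul h
  have hext : ∀ y, Ext f' (y - z₀) = Ext f y := by
    intro y
    unfold Ext
    refine integral_congr_ae (Eventually.of_forall fun η => ?_)
    simp only [hf']
    rw [mul_assoc, ← ch_add, ← dotProduct_add, add_sub_cancel]
  have hf'm : Measurable f' := hfm.mul (continuous_ch_Lam z₀).measurable
  have hf'i : Integrable f' := integrable_ext hfi z₀
  have hμ' : ThinPts α s (fun p => z p - z₀) μ := by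
    intro c ρ hρ t ht h
    refine hμ (c + z₀) ρ hρ t ht fun p hp => ?_
    have := h p hp
    rwa [sub_sub, add_comm z₀] at this
  set g : (Fin (n + 1) → ℝ) → ℝ≥0∞ := fun y => wt L 1 ((dil n R)⁻¹ * y) with hg
  have hgsv : SV L R g := sv_wt_dil L hR
  have hdpos : ∀ l, 0 < dil n R l := by
    refine Fin.cases ?_ fun j => ?_
    · simp only [dil, Fin.cons_zero]; positivity
    · simp only [dil, Fin.cons_succ]; exact hR0
  have hgi : ∫⁻ y, g y ≠ ∞ := by
    rw [lintegral_dil hR0 hgsv.meas]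
    refine ENNReal.mul_ne_top ENNReal.ofReal_ne_top ?_
    have : ∀ w, g (dil n R * w) = wt L 1 w := by
      intro w
      simp only [hg]
      congr 1
      ext l
      simp [(hdpos l).ne']
    simp_rw [this]
    exact (lintegral_wt_one_lt_top (by rw [Fintype.card_fin]; omega)).ne
  have h1 := hC₁ f' hf'i (fun η h => hfs η (hf's η h)) P s (fun p => z p - z₀) μ hμ' R hR g hgsv
    (fun y => wt_ne_top _) hgi
  have h2 := hC₂ R hR f' hf'm hf'i (fun η h => hfs η (hf's η h)) (fun η h => hfa η (hf's η h))
  simp_rw [hf'n] at h2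
  have hg1 : ∀ p ∈ s, 1 ≤ 2 ^ L * g (z p - z₀) := by
    intro p hp
    have hle : ‖(dil n R)⁻¹ * (z p - z₀)‖ ≤ 1 := by
      refine (pi_norm_le_iff_of_nonneg zero_le_one).2 fun l => ?_
      rw [Pi.mul_apply, Pi.inv_apply, norm_mul, norm_inv, Real.norm_of_nonneg (hdpos l).le,
        inv_mul_le_iff₀ (hdpos l), mul_one]
      exact hz p hp l
    simp only [hg, wt]
    have e : (2 : ℝ≥0∞) ^ L = ENNReal.ofReal (2 ^ L) := by
      rw [ENNReal.ofReal_pow zero_le_two]; simp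
    rw [e, ← ENNReal.ofReal_mul (by positivity), ENNReal.one_le_ofReal, div_one, ← div_eq_mul_inv,
      one_le_div (by positivity)]
    exact pow_le_pow_left₀ (by positivity) (by linarith) _
  calc ∑ p ∈ s, μ p * ‖Ext f (z p)‖ₑ ^ 2
      ≤ ∑ p ∈ s, 2 ^ L * (μ p * (‖Ext f' (z p - z₀)‖ₑ ^ 2 * g (z p - z₀))) := by
        refine Finset.sum_le_sum fun p hp => ?_
        rw [hext]
        calc _ ≤ (2 ^ L * g (z p - z₀)) * (μ p * ‖Ext f (z p)‖ₑ ^ 2) :=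
              le_mul_of_one_le_left' (hg1 p hp)
          _ = _ := by ring
    _ ≤ 2 ^ L * (C₁ * ENNReal.ofReal (R ^ κ) * (C₂ * ENNReal.ofReal R * ∫⁻ η, ‖f η‖ₑ ^ 2)) := by
        rw [← Finset.mul_sum]
        exact mul_le_mul' le_rfl (h1.trans (mul_le_mul' le_rfl h2))
    _ = _ := by
        rw [Real.rpow_add hR0, Real.rpow_one, ENNReal.ofReal_mul (by positivity)]
        push_cast; ring

/-- Spatial points carrying masses of dimension `α` down to the scale `1 / R`. -/
def ThinAt {P : Type} (n : ℕ) (α R : ℝ) (s : Finset P) (x : P → Fin n → ℝ) (m : P → ℝ≥0) : Prop :=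
  ∀ c ρ, 1 / R ≤ ρ → ∀ t ⊆ s, (∀ p ∈ t, ‖x p - c‖ ≤ ρ) →
    ∑ p ∈ t, (m p : ℝ≥0∞) ≤ ENNReal.ofReal (ρ ^ α)

lemma exists_points_annulus (hn : 2 ≤ n) {ε : ℝ} (hε : 0 < ε) {α γ : ℝ} (hα0 : 0 ≤ α)
    (hα : α ≤ n + 1) (hγ : γ = n - α + (n - 1 + α) / (2 * n) + ε) :
    ∃ C : ℝ≥0, ∀ (R : ℝ) (_ : 1 ≤ R) (h : (Fin n → ℝ) → ℂ) (_ : Measurable h) (_ : Integrable h)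
      (_ : ∀ η, h η ≠ 0 → ‖η‖ ≤ R) (_ : ∀ η, h η ≠ 0 → R ≤ 16 ∨ R / 2 ≤ ‖η‖)
      (P : Type) (s : Finset P) (x : P → Fin n → ℝ) (t : P → ℝ) (m : P → ℝ≥0) (_ : ThinAt n α R s x m)
      (x₀ : Fin n → ℝ) (_ : ∀ p ∈ s, |t p| ≤ 1 ∧ ‖x p - x₀‖ ≤ 1),
      ∑ p ∈ s, m p * ‖Ext h (Fin.cons (t p) (x p))‖ₑ ^ 2 ≤
        C * ENNReal.ofReal (R ^ γ) * ∫⁻ η, ‖h η‖ₑ ^ 2 := by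
  have hn0 : (0 : ℝ) < n := by exact_mod_cast (by omega : 0 < n)
  obtain ⟨C, hC⟩ := exists_points_L2 hn hε hα0 hα (κ := (α - (n + 1)) / (2 * n) + ε) (by
    field_simp)
  refine ⟨C, fun R hR h hhm hhi hhs hha P s x t m hm x₀ hx => ?_⟩
  have hR0 : 0 < R := by linarith
  set f : (Fin n → ℝ) → ℂ := fun η => h (R • η) with hf
  have hfi : Integrable f := (integrable_comp_smul_iff volume h hR0.ne').2 hhi
  have hnorm : ∀ η : Fin n → ℝ, ‖R • η‖ = R * ‖η‖ := fun η => by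
    rw [norm_smul, Real.norm_of_nonneg hR0.le]
  have hdot : ∀ (η : Fin n → ℝ) y, Lam (R • η) ⬝ᵥ y = Lam η ⬝ᵥ (dil n R * y) := by
    intro η y
    simp only [dotProduct, Fin.sum_univ_succ, Lam, dil, Fin.cons_zero, Fin.cons_succ, Pi.mul_apply,
      Pi.smul_apply, smul_eq_mul]
    congr 1
    · rw [← mul_assoc, neg_mul, neg_mul, neg_mul]
      congr 2
      rw [Finset.sum_mul]
      exact Finset.sum_congr rfl fun j _ => by ring
    · exact Finset.sum_congr rfl fun j _ => by ring
  have hext : ∀ y, Ext h y = (R : ℂ) ^ n * Ext f (dil n R * y) := by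
    intro y
    have h1 := Measure.integral_comp_smul_of_nonneg (volume : Measure (Fin n → ℝ))
      (fun ξ => h ξ * ch (Lam ξ ⬝ᵥ y)) R (hR := hR0.le)
    rw [Module.finrank_fin_fun] at h1
    simp only [hdot] at h1
    unfold Ext
    simp only [hf]
    rw [h1, Complex.real_smul]
    push_cast
    rw [← mul_assoc, mul_inv_cancel₀ (by exact_mod_cast (pow_pos hR0 n).ne'), one_mul]
  have hfn : ∫⁻ η, ‖f η‖ₑ ^ 2 = ENNReal.ofReal ((R ^ n)⁻¹) * ∫⁻ η, ‖h η‖ₑ ^ 2 := by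
    have := lintegral_comp_smul (fun η => ‖h η‖ₑ ^ 2) (by fun_prop) hR0
    rw [Fintype.card_fin] at this
    exact this
  set μ : P → ℝ≥0 := fun p => m p * Real.toNNReal (R ^ α) with hμ
  have hthin : ThinPts α s (fun p => dil n R * Fin.cons (t p) (x p)) μ := by
    intro c ρ hρ t' ht' hp
    have h2 : ∑ p ∈ t', (m p : ℝ≥0∞) ≤ ENNReal.ofReal ((ρ / R) ^ α) := by
      refine hm (R⁻¹ • Fin.tail c) (ρ / R) (by gcongr) t' ht' fun p hpt => ?_
      refine (pi_norm_le_iff_of_nonneg (by positivity)).2 fun l => ?_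
      have h3 := (norm_le_pi_norm _ l.succ).trans (hp p hpt)
      simp only [dil, Pi.sub_apply, Pi.mul_apply, Fin.cons_succ] at h3
      rw [le_div_iff₀ hR0, ← Real.norm_of_nonneg hR0.le, ← norm_mul, Real.norm_of_nonneg hR0.le]
      convert h3 using 2
      simp only [Pi.sub_apply, Pi.smul_apply, smul_eq_mul, Fin.tail]
      field_simp
    simp only [hμ, ENNReal.coe_mul]
    rw [← Finset.sum_mul]
    refine (mul_le_mul' h2 le_rfl).trans ?_
    change _ * ENNReal.ofReal _ ≤ _
    rw [← ENNReal.ofReal_mul (by positivity), Real.div_rpow (by positivity) hR0.le,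
      div_mul_cancel₀ _ (by positivity)]
  have h4 := hC R hR f (hhm.comp (by fun_prop)) hfi (fun η h0 => by
      have := hhs _ h0
      rw [hnorm] at this
      nlinarith) (fun η h0 => (hha _ h0).imp_right fun h5 => by
      rw [hnorm] at h5
      nlinarith) P s _ μ hthin (dil n R * Fin.cons 0 x₀) (fun p hp l => by
      obtain ⟨ht, hx'⟩ := hx p hp
      rw [Pi.mul_apply, Pi.mul_apply, ← mul_sub, abs_mul]
      refine Fin.cases ?_ (fun j => ?_) l
      · simp only [dil, Fin.cons_zero, sub_zero]
        rw [abs_of_pos (by positivity)]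
        exact mul_le_of_le_one_right (by positivity) ht
      · simp only [dil, Fin.cons_succ]
        rw [abs_of_pos hR0]
        exact mul_le_of_le_one_right hR0.le ((norm_le_pi_norm (x p - x₀) j).trans hx'))
  rw [hfn] at h4
  set I := ∫⁻ η, ‖h η‖ₑ ^ 2
  have hRα : ENNReal.ofReal (R ^ (-α)) * ENNReal.ofReal (R ^ α) = 1 := by
    rw [← ENNReal.ofReal_mul (by positivity), ← Real.rpow_add hR0, neg_add_cancel, Real.rpow_zero,
      ENNReal.ofReal_one]
  have hRn : ‖(R : ℂ) ^ n‖ₑ = ENNReal.ofReal (R ^ n) := by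
    rw [← ofReal_norm, norm_pow, Complex.norm_real, Real.norm_of_nonneg hR0.le]
  calc ∑ p ∈ s, m p * ‖Ext h (Fin.cons (t p) (x p))‖ₑ ^ 2
      = ∑ p ∈ s, ENNReal.ofReal (R ^ (-α)) * ENNReal.ofReal (R ^ n) ^ 2 *
          (μ p * ‖Ext f (dil n R * Fin.cons (t p) (x p))‖ₑ ^ 2) := by
        refine Finset.sum_congr rfl fun p _ => ?_
        rw [hext, enorm_mul, hRn, mul_pow]
        have e : (μ p : ℝ≥0∞) = m p * ENNReal.ofReal (R ^ α) := by
          simp only [hμ, ENNReal.coe_mul]; rfl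
        rw [e]
        calc _ = (ENNReal.ofReal (R ^ (-α)) * ENNReal.ofReal (R ^ α)) * (m p *
              (ENNReal.ofReal (R ^ n) ^ 2 * ‖Ext f (dil n R * Fin.cons (t p) (x p))‖ₑ ^ 2)) := by
              rw [hRα, one_mul]
          _ = _ := by ring
    _ ≤ ENNReal.ofReal (R ^ (-α)) * ENNReal.ofReal (R ^ n) ^ 2 *
          (C * ENNReal.ofReal (R ^ ((α - (n + 1)) / (2 * n) + ε + 1)) *
            (ENNReal.ofReal ((R ^ n)⁻¹) * I)) := by
        rw [← Finset.mul_sum]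
        exact mul_le_mul' le_rfl h4
    _ = C * (ENNReal.ofReal (R ^ (-α)) * ENNReal.ofReal (R ^ n) ^ 2 *
          ENNReal.ofReal (R ^ ((α - (n + 1)) / (2 * n) + ε + 1)) * ENNReal.ofReal ((R ^ n)⁻¹)) * I := by
        ring
    _ = _ := by
        congr 2
        rw [← ENNReal.ofReal_pow (by positivity), ← ENNReal.ofReal_mul (by positivity),
          ← ENNReal.ofReal_mul (by positivity), ← ENNReal.ofReal_mul (by positivity)]
        congr 1
        have e : γ = -α + n + ((α - (n + 1)) / (2 * n) + ε + 1) := by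
          rw [hγ]; field_simp; ring
        rw [e, Real.rpow_add hR0 (-α + n), Real.rpow_add hR0 (-α), Real.rpow_natCast]
        field_simp

end Unscaled

section Maximal

variable {n : ℕ}

/-- The Euclidean length of a frequency. -/
def rad (ξ : Fin n → ℝ) : ℝ := √(ξ ⬝ᵥ ξ)

lemma continuous_rad : Continuous (rad : (Fin n → ℝ) → ℝ) := by
  unfold rad dotProduct; fun_prop

lemma rad_nonneg (ξ : Fin n → ℝ) : 0 ≤ rad ξ := Real.sqrt_nonneg _

lemma norm_le_rad (ξ : Fin n → ℝ) : ‖ξ‖ ≤ rad ξ := by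
  refine (pi_norm_le_iff_of_nonneg (rad_nonneg ξ)).2 fun i => Real.le_sqrt_of_sq_le ?_
  rw [Real.norm_eq_abs, sq_abs, sq]
  exact Finset.single_le_sum (f := fun i => ξ i * ξ i) (fun _ _ => mul_self_nonneg _)
    (Finset.mem_univ i)

lemma rad_le (ξ : Fin n → ℝ) : rad ξ ≤ n * ‖ξ‖ := by
  refine Real.sqrt_le_iff.2 ⟨by positivity, ?_⟩
  calc ξ ⬝ᵥ ξ ≤ ∑ _i : Fin n, ‖ξ‖ ^ 2 := Finset.sum_le_sum fun i _ => by
        rw [← sq, ← sq_abs]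
        exact pow_le_pow_left₀ (abs_nonneg _) (norm_le_pi_norm ξ i) 2
    _ = n * ‖ξ‖ ^ 2 := by simp
    _ ≤ (n * ‖ξ‖) ^ 2 := by
        rw [mul_pow]
        refine mul_le_mul_of_nonneg_right ?_ (by positivity)
        exact_mod_cast Nat.le_self_pow two_ne_zero n

/-- The derivative of the cutoff in the truncation parameter, normalised. -/
def cutAmp (φ' : ℝ → ℝ) (R u : ℝ) (ξ : Fin n → ℝ) : ℝ :=
  (1 + u ^ 2) * φ' (rad ξ * (u / R)) * (rad ξ / R)

lemma abs_cutAmp_le (φ' : ℝ → ℝ) {K : ℝ} (hK : ∀ y, |φ' y| ≤ K)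
    (hK2 : ∀ y, y ^ 2 * |φ' y| ≤ K) {R u : ℝ} (hR : 1 ≤ R) (hu : u ∈ Ioc 0 R) {ξ : Fin n → ℝ}
    (hξ : ‖ξ‖ ≤ R) (hξ' : R ≤ 16 ∨ R / 2 ≤ ‖ξ‖) : |cutAmp φ' R u ξ| ≤ 257 * K * n := by
  have hR0 : 0 < R := by linarith
  have hK0 : 0 ≤ K := (abs_nonneg _).trans (hK 0)
  have hr := rad_nonneg ξ
  unfold cutAmp
  rw [abs_mul, abs_mul, abs_of_nonneg (by positivity : 0 ≤ 1 + u ^ 2),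
    abs_of_nonneg (by positivity : 0 ≤ rad ξ / R)]
  refine mul_le_mul ?_ ?_ (by positivity) (by positivity)
  · rcases hξ' with h | h
    · refine mul_le_mul ?_ (hK _) (abs_nonneg _) (by norm_num)
      nlinarith [hu.1, hu.2]
    · set y := rad ξ * (u / R) with hy
      have h1 : R / 2 ≤ rad ξ := h.trans (norm_le_rad ξ)
      have h2 : u / 2 ≤ y := by
        have : y = u * rad ξ / R := by rw [hy]; ring
        rw [this, le_div_iff₀ hR0]
        nlinarith [hu.1]
      have h3 : u ^ 2 ≤ 4 * y ^ 2 := by nlinarith [hu.1]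
      nlinarith [hK y, hK2 y, abs_nonneg (φ' y), mul_le_mul_of_nonneg_right h3 (abs_nonneg (φ' y))]
  · rw [div_le_iff₀ hR0]
    exact (rad_le ξ).trans (mul_le_mul_of_nonneg_left hξ (by positivity))

lemma continuous_cutAmp {φ' : ℝ → ℝ} (hφ' : Continuous φ') (R : ℝ) :
    Continuous fun q : ℝ × (Fin n → ℝ) => cutAmp φ' R q.1 q.2 := by
  have := continuous_rad (n := n)
  unfold cutAmp
  fun_prop

lemma sq_ext_cut_le {φ φ' : ℝ → ℝ} (hφ' : Continuous φ') (hd : ∀ y, HasDerivAt φ (φ' y) y) {K : ℝ}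
    (hK : ∀ y, |φ' y| ≤ K) (hK2 : ∀ y, y ^ 2 * |φ' y| ≤ K) {R : ℝ} (hR : 1 ≤ R)
    {h : (Fin n → ℝ) → ℂ} (hhm : Measurable h) (hhi : Integrable h) (hhs : ∀ η, h η ≠ 0 → ‖η‖ ≤ R)
    (hha : ∀ η, h η ≠ 0 → R ≤ 16 ∨ R / 2 ≤ ‖η‖) {τ : ℝ} (hτ : τ ∈ Icc (0 : ℝ) 1)
    (z : Fin (n + 1) → ℝ) :
    ‖Ext (fun ξ => (φ (rad ξ * τ) : ℂ) * h ξ) z‖ₑ ^ 2 ≤ 2 * (‖(φ 0 : ℂ)‖ₑ ^ 2 * ‖Ext h z‖ₑ ^ 2 +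
      (∫⁻ u : ℝ, ‖(1 + u ^ 2)⁻¹‖ₑ) * ∫⁻ u in Ioc 0 R, ‖(1 + u ^ 2)⁻¹‖ₑ *
        ‖Ext (fun ξ => (cutAmp φ' R u ξ : ℂ) * h ξ) z‖ₑ ^ 2) := by
  have hR0 : 0 < R := by linarith
  have hcA := continuous_cutAmp (n := n) hφ' R
  have hτR : Ioc 0 (R * τ) ⊆ Ioc 0 R := Ioc_subset_Ioc_right (by nlinarith [hτ.2])
  set B : ℝ → (Fin n → ℝ) → ℂ := fun u ξ =>
    (cutAmp φ' R u ξ : ℂ) * h ξ * ch (Lam ξ ⬝ᵥ z) with hB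
  have hBm : Measurable (Function.uncurry B) := by
    refine ((hcA.measurable.complex_ofReal).mul (hhm.comp measurable_snd)).mul ?_
    exact (continuous_ch_Lam z).measurable.comp measurable_snd
  have hBm' : Measurable fun q : (Fin n → ℝ) × ℝ => B q.2 q.1 := by
    refine (((hcA.comp (continuous_snd.prodMk continuous_fst)).measurable.complex_ofReal).mul
      (hhm.comp measurable_fst)).mul ?_
    exact (continuous_ch_Lam z).measurable.comp measurable_fst
  have hEm : Measurable fun u => Ext (fun ξ => (cutAmp φ' R u ξ : ℂ) * h ξ) z :=
    (hBm.stronglyMeasurable.integral_prod_right (ν := volume)).measurable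
  have hFTC : ∀ ξ, ((φ (rad ξ * τ) : ℝ) : ℂ) * h ξ * ch (Lam ξ ⬝ᵥ z) =
      φ 0 * (h ξ * ch (Lam ξ ⬝ᵥ z)) + ∫ u in Ioc 0 (R * τ), ((1 + u ^ 2)⁻¹ : ℝ) * B u ξ := by
    intro ξ
    have h1 : ∀ u, HasDerivAt (fun u => φ (rad ξ * (u / R)))
        (φ' (rad ξ * (u / R)) * (rad ξ / R)) u := by
      intro u
      have h2 : HasDerivAt (fun u => rad ξ * (u / R)) (rad ξ / R) u := by
        simpa [div_eq_mul_inv] using ((hasDerivAt_id u).div_const R).const_mul (rad ξ)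
      exact (hd _).comp u h2
    have h3 := intervalIntegral.integral_eq_sub_of_hasDerivAt (a := 0) (b := R * τ)
      (fun u _ => h1 u) (Continuous.intervalIntegrable (by fun_prop) _ _)
    rw [intervalIntegral.integral_of_le (by have := hτ.1; positivity),
      mul_div_cancel_left₀ _ hR0.ne', zero_div, mul_zero] at h3
    have h4 : ∫ u in Ioc 0 (R * τ), ((1 + u ^ 2)⁻¹ : ℝ) * B u ξ =
        (∫ u in Ioc 0 (R * τ), ((φ' (rad ξ * (u / R)) * (rad ξ / R) : ℝ) : ℂ)) *
          (h ξ * ch (Lam ξ ⬝ᵥ z)) := by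
      rw [← integral_mul_const]
      refine integral_congr_ae (Eventually.of_forall fun u => ?_)
      have h5 : (1 + u ^ 2)⁻¹ * cutAmp φ' R u ξ = φ' (rad ξ * (u / R)) * (rad ξ / R) := by
        unfold cutAmp; field_simp
      simp only [hB]
      rw [← h5]
      push_cast
      ring
    rw [h4, integral_complex_ofReal, h3]
    push_cast
    ring
  have hintg : Integrable (Function.uncurry fun ξ u => (((1 + u ^ 2)⁻¹ : ℝ) : ℂ) * B u ξ)
      ((volume : Measure (Fin n → ℝ)).prod (volume.restrict (Ioc 0 (R * τ)))) := by
    refine Integrable.mono' (g := fun q => ‖h q.1‖ * (257 * K * n)) (hhi.norm.comp_fst _ |>.mul_const _) ?_ ?_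
    · have h2 : Measurable fun q : (Fin n → ℝ) × ℝ => (((1 + q.2 ^ 2)⁻¹ : ℝ) : ℂ) := by fun_prop
      exact (h2.mul hBm').aestronglyMeasurable
    · have hae : ∀ᵐ q : (Fin n → ℝ) × ℝ ∂(volume.prod (volume.restrict (Ioc 0 (R * τ)))),
          q.2 ∈ Ioc 0 (R * τ) := by
        refine Measure.quasiMeasurePreserving_snd.ae ?_
        exact ae_restrict_mem measurableSet_Ioc
      filter_upwards [hae] with q hq
      simp only [Function.uncurry, hB, norm_mul, norm_ch, mul_one, Complex.norm_real]
      rcases eq_or_ne (h q.1) 0 with h0 | h0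
      · simp [h0]
      have h1 := abs_cutAmp_le φ' hK hK2 hR (hτR hq) (hhs _ h0) (hha _ h0)
      have h2 : ‖(1 + q.2 ^ 2)⁻¹‖ ≤ 1 := by
        rw [norm_inv, Real.norm_of_nonneg (by positivity)]
        exact inv_le_one_of_one_le₀ (by nlinarith [sq_nonneg q.2])
      rw [mul_comm ‖h q.1‖]
      calc _ ≤ 1 * (257 * K * n * ‖h q.1‖) := by
            refine mul_le_mul h2 ?_ (by positivity) zero_le_one
            exact mul_le_mul_of_nonneg_right h1 (norm_nonneg _)
        _ = _ := one_mul _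
  have key : Ext (fun ξ => (φ (rad ξ * τ) : ℂ) * h ξ) z = φ 0 * Ext h z +
      ∫ u in Ioc 0 (R * τ), ((1 + u ^ 2)⁻¹ : ℝ) * Ext (fun ξ => (cutAmp φ' R u ξ : ℂ) * h ξ) z := by
    unfold Ext
    simp_rw [hFTC]
    have hintg' : Integrable fun ξ => ∫ u in Ioc 0 (R * τ), ((1 + u ^ 2)⁻¹ : ℝ) * B u ξ :=
      hintg.integral_prod_left
    rw [integral_add ((integrable_ext hhi z).const_mul _) hintg', integral_const_mul, integral_integral_swap hintg]
    simp_rw [integral_const_mul]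
    rfl
  have hle : ‖∫ u in Ioc 0 (R * τ), ((1 + u ^ 2)⁻¹ : ℝ) *
      Ext (fun ξ => (cutAmp φ' R u ξ : ℂ) * h ξ) z‖ₑ ^ 2 ≤ (∫⁻ u : ℝ, ‖(1 + u ^ 2)⁻¹‖ₑ) *
        ∫⁻ u in Ioc 0 R, ‖(1 + u ^ 2)⁻¹‖ₑ *
          ‖Ext (fun ξ => (cutAmp φ' R u ξ : ℂ) * h ξ) z‖ₑ ^ 2 := by
    have hw : Measurable fun u : ℝ => ‖(1 + u ^ 2)⁻¹‖ₑ := by fun_prop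
    calc _ ≤ (∫⁻ u in Ioc 0 R, ‖(1 + u ^ 2)⁻¹‖ₑ *
          ‖Ext (fun ξ => (cutAmp φ' R u ξ : ℂ) * h ξ) z‖ₑ) ^ 2 := by
          refine pow_le_pow_left' ?_ 2
          refine (enorm_integral_le_lintegral_enorm _).trans ?_
          refine (lintegral_mono_set hτR).trans_eq (lintegral_congr fun u => ?_)
          rw [enorm_mul]
          congr 1
          rw [← ofReal_norm, Complex.norm_real, ofReal_norm]
      _ ≤ _ := (sq_lintegral_mul_le hw hEm.enorm).trans
          (mul_le_mul' (setLIntegral_le_lintegral _ _) le_rfl)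
  rw [key]
  refine (sq_enorm_add_le _ _).trans (mul_le_mul' le_rfl (add_le_add ?_ hle))
  rw [enorm_mul, mul_pow]

lemma exists_points_max (hn : 2 ≤ n) {φ φ' : ℝ → ℝ} (hφ' : Continuous φ')
    (hd : ∀ y, HasDerivAt φ (φ' y) y) {K : ℝ} (hK : ∀ y, |φ' y| ≤ K)
    (hK2 : ∀ y, y ^ 2 * |φ' y| ≤ K) {ε : ℝ} (hε : 0 < ε) {α γ : ℝ} (hα0 : 0 ≤ α)
    (hα : α ≤ n + 1) (hγ : γ = n - α + (n - 1 + α) / (2 * n) + ε) :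
    ∃ C : ℝ≥0, ∀ (R : ℝ) (_ : 1 ≤ R) (h : (Fin n → ℝ) → ℂ) (_ : Measurable h) (_ : Integrable h)
      (_ : ∀ η, h η ≠ 0 → ‖η‖ ≤ R) (_ : ∀ η, h η ≠ 0 → R ≤ 16 ∨ R / 2 ≤ ‖η‖)
      (P : Type) (s : Finset P) (x : P → Fin n → ℝ) (t τ : P → ℝ) (m : P → ℝ≥0)
      (_ : ThinAt n α R s x m) (x₀ : Fin n → ℝ) (_ : ∀ p ∈ s, |t p| ≤ 1 ∧ ‖x p - x₀‖ ≤ 1)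
      (_ : ∀ p ∈ s, τ p ∈ Icc (0 : ℝ) 1),
      ∑ p ∈ s, m p * ‖Ext (fun ξ => (φ (rad ξ * τ p) : ℂ) * h ξ) (Fin.cons (t p) (x p))‖ₑ ^ 2 ≤
        C * ENNReal.ofReal (R ^ γ) * ∫⁻ η, ‖h η‖ₑ ^ 2 := by
  obtain ⟨C, hC⟩ := exists_points_annulus hn hε hα0 hα hγ
  obtain ⟨W, hW⟩ : ∃ W : ℝ≥0, (W : ℝ≥0∞) = ∫⁻ u : ℝ, ‖(1 + u ^ 2)⁻¹‖ₑ :=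
    ⟨_, ENNReal.coe_toNNReal integrable_inv_one_add_sq.2.ne⟩
  have hK0 : 0 ≤ K := (abs_nonneg _).trans (hK 0)
  set B : ℝ≥0 := Real.toNNReal (257 * K * n) with hB
  refine ⟨2 * (‖φ 0‖₊ ^ 2 * C + W * (W * (C * B ^ 2))),
    fun R hR h hhm hhi hhs hha P s x t τ m hm x₀ hx hτ => ?_⟩
  set I := ∫⁻ η, ‖h η‖ₑ ^ 2
  set k : ℝ → (Fin n → ℝ) → ℂ := fun u ξ => (cutAmp φ' R u ξ : ℂ) * h ξ with hk
  have hcA := continuous_cutAmp (n := n) hφ' R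
  have hcu : ∀ u, Continuous fun ξ : Fin n → ℝ => (cutAmp φ' R u ξ : ℂ) := fun u =>
    Complex.continuous_ofReal.comp (hcA.comp (Continuous.prodMk_right u))
  have hkn : ∀ u ∈ Ioc 0 R, ∀ ξ, ‖k u ξ‖ ≤ B * ‖h ξ‖ := by
    intro u hu ξ
    simp only [hk, norm_mul, Complex.norm_real]
    rcases eq_or_ne (h ξ) 0 with h0 | h0
    · simp [h0]
    rw [hB, Real.coe_toNNReal _ (by positivity)]
    exact mul_le_mul_of_nonneg_right (abs_cutAmp_le φ' hK hK2 hR hu (hhs _ h0) (hha _ h0))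
      (norm_nonneg _)
  set w : ℝ → ℝ≥0∞ := fun u => ‖(1 + u ^ 2)⁻¹‖ₑ with hw
  have hwm : Measurable w := by simp only [hw]; fun_prop
  have hEm : ∀ z, Measurable fun u => Ext (k u) z := by
    intro z
    have hm : Measurable (Function.uncurry fun u ξ => k u ξ * ch (Lam ξ ⬝ᵥ z)) := by
      refine ((hcA.measurable.complex_ofReal).mul (hhm.comp measurable_snd)).mul ?_
      exact (continuous_ch_Lam z).measurable.comp measurable_snd
    exact (hm.stronglyMeasurable.integral_prod_right (ν := volume)).measurable
  have h1 := hC R hR h hhm hhi hhs hha P s x t m hm x₀ hx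
  have h2 : ∑ p ∈ s, m p * ∫⁻ u in Ioc 0 R, w u * ‖Ext (k u) (Fin.cons (t p) (x p))‖ₑ ^ 2 ≤
      W * (C * ENNReal.ofReal (R ^ γ) * (B ^ 2 * I)) := by
    have e : ∀ p ∈ s, (m p : ℝ≥0∞) * ∫⁻ u in Ioc 0 R, w u * ‖Ext (k u) (Fin.cons (t p) (x p))‖ₑ ^ 2 =
        ∫⁻ u in Ioc 0 R, w u * (m p * ‖Ext (k u) (Fin.cons (t p) (x p))‖ₑ ^ 2) := fun p _ => by
      rw [← lintegral_const_mul' _ _ ENNReal.coe_ne_top]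
      exact lintegral_congr fun u => by ring
    have hm1 : ∀ p ∈ s, Measurable fun u =>
        w u * ((m p : ℝ≥0∞) * ‖Ext (k u) (Fin.cons (t p) (x p))‖ₑ ^ 2) := fun p _ =>
      hwm.mul (((hEm _).enorm.pow_const 2).const_mul _)
    rw [Finset.sum_congr rfl e, ← lintegral_finsetSum _ hm1]
    simp_rw [← Finset.mul_sum]
    refine (setLIntegral_mono' (g := fun u => w u * (C * ENNReal.ofReal (R ^ γ) * (B ^ 2 * I)))
      measurableSet_Ioc fun u hu => mul_le_mul' le_rfl ?_).trans ?_
    · have hki : Integrable (k u) := (hhi.norm.const_mul (B : ℝ)).mono'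
        ((hcu u).measurable.mul hhm).aestronglyMeasurable
        (Eventually.of_forall (hkn u hu))
      refine (hC R hR (k u) ((hcu u).measurable.mul hhm) hki
        (fun η h0 => hhs η (right_ne_zero_of_mul h0)) (fun η h0 => hha η (right_ne_zero_of_mul h0))
        P s x t m hm x₀ hx).trans (mul_le_mul' le_rfl ?_)
      rw [← lintegral_const_mul' _ _ (by simp)]
      refine lintegral_mono fun ξ => ?_
      rw [← mul_pow]
      refine pow_le_pow_left' ?_ 2
      have := hkn u hu ξ
      rw [← ofReal_norm, ← ofReal_norm, ← ENNReal.ofReal_coe_nnreal, ← ENNReal.ofReal_mul B.coe_nonneg]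
      exact ENNReal.ofReal_le_ofReal this
    · rw [lintegral_mul_const _ hwm, hW]
      exact mul_le_mul' (setLIntegral_le_lintegral _ _) le_rfl
  calc _ ≤ ∑ p ∈ s, m p * (2 * (‖(φ 0 : ℂ)‖ₑ ^ 2 * ‖Ext h (Fin.cons (t p) (x p))‖ₑ ^ 2 +
        W * ∫⁻ u in Ioc 0 R, w u * ‖Ext (k u) (Fin.cons (t p) (x p))‖ₑ ^ 2)) := by
        refine Finset.sum_le_sum fun p hp => mul_le_mul' le_rfl ?_
        have := sq_ext_cut_le hφ' hd hK hK2 hR hhm hhi hhs hha (hτ p hp) (Fin.cons (t p) (x p))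
        rwa [← hW] at this
    _ = 2 * (‖(φ 0 : ℂ)‖ₑ ^ 2 * (∑ p ∈ s, m p * ‖Ext h (Fin.cons (t p) (x p))‖ₑ ^ 2) +
        W * ∑ p ∈ s, m p * ∫⁻ u in Ioc 0 R, w u * ‖Ext (k u) (Fin.cons (t p) (x p))‖ₑ ^ 2) := by
        rw [Finset.mul_sum, Finset.mul_sum, ← Finset.sum_add_distrib, Finset.mul_sum]
        exact Finset.sum_congr rfl fun p _ => by ring
    _ ≤ 2 * (‖(φ 0 : ℂ)‖ₑ ^ 2 * (C * ENNReal.ofReal (R ^ γ) * I) +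
        W * (W * (C * ENNReal.ofReal (R ^ γ) * (B ^ 2 * I)))) :=
        mul_le_mul' le_rfl (add_le_add (mul_le_mul' le_rfl h1) (mul_le_mul' le_rfl h2))
    _ = _ := by
        have e : ‖(φ 0 : ℂ)‖ₑ = (‖φ 0‖₊ : ℝ≥0∞) := by
          rw [← ofReal_norm, Complex.norm_real, ofReal_norm]; rfl
        rw [e]
        push_cast
        ring

end Maximal

section Frostman

open scoped Classical in
lemma exists_saturated {Q T : Type*} (anc : ℕ → Q → T) (cap : ℕ → ℝ≥0) (k : ℕ) (S : Finset Q) :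
    ∃ m : Q → ℝ≥0, (∀ h ≤ k, ∀ p, ∑ q ∈ S with anc h q = p, m q ≤ cap h) ∧
      ∀ q ∈ S, ∃ h ≤ k, ∑ q' ∈ S with anc h q' = anc h q, m q' = cap h := by
  induction S using Finset.induction_on with
  | empty => exact ⟨0, by simp, by simp⟩
  | insert q S hq ih =>
    obtain ⟨m, hm, hs⟩ := ih
    obtain ⟨h₀, hh₀, hmin⟩ := Finset.exists_min_image (Finset.range (k + 1))
      (fun h => cap h - ∑ q' ∈ S with anc h q' = anc h q, m q') ⟨0, by simp⟩
    set δ := cap h₀ - ∑ q' ∈ S with anc h₀ q' = anc h₀ q, m q' with hδ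
    have hsum : ∀ h p, ∑ q' ∈ insert q S with anc h q' = p, Function.update m q δ q' =
        (if anc h q = p then δ else 0) + ∑ q' ∈ S with anc h q' = p, m q' := by
      intro h p
      have h1 : ∑ q' ∈ S with anc h q' = p, Function.update m q δ q' =
          ∑ q' ∈ S with anc h q' = p, m q' := Finset.sum_congr rfl fun q' h' =>
        Function.update_of_ne (ne_of_mem_of_not_mem (Finset.mem_filter.1 h').1 hq) _ _
      rw [Finset.filter_insert]
      split_ifs with h2
      · rw [Finset.sum_insert (by simp [hq]), h1, Function.update_self]
      · rw [h1, zero_add]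
    have hcap : ∀ h ≤ k, ∀ p,
        ∑ q' ∈ insert q S with anc h q' = p, Function.update m q δ q' ≤ cap h := by
      intro h hh p
      rw [hsum]
      split_ifs with h2
      · subst h2
        exact add_le_of_le_tsub_right_of_le (hm h hh _)
          (hmin h (Finset.mem_range.2 (by omega)))
      · rw [zero_add]
        exact hm h hh p
    refine ⟨_, hcap, fun q' hq' => ?_⟩
    rcases Finset.mem_insert.1 hq' with rfl | hq'
    · refine ⟨h₀, by simpa [Nat.lt_succ_iff] using hh₀, ?_⟩
      rw [hsum, if_pos rfl]
      exact tsub_add_cancel_of_le (hm _ (by simpa [Nat.lt_succ_iff] using hh₀) _)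
    · obtain ⟨h, hh, e⟩ := hs q' hq'
      refine ⟨h, hh, (hcap h hh _).antisymm ?_⟩
      rw [hsum, ← e]
      exact le_add_of_nonneg_left (zero_le)

open scoped Classical in
/-- A discrete form of Frostman's lemma on a tree of cells. -/
lemma exists_frostman {Q T : Type*} (anc : ℕ → Q → T)
    (hanc : ∀ h h' x y, h ≤ h' → anc h' x = anc h' y → anc h x = anc h y) (cap : ℕ → ℝ≥0) (k : ℕ)
    (S : Finset Q) : ∃ (m : Q → ℝ≥0) (𝒞 : Finset (ℕ × T)),
      (∀ h ≤ k, ∀ p, ∑ q ∈ S with anc h q = p, m q ≤ cap h) ∧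
      (∀ q ∈ S, ∃ c ∈ 𝒞, c.1 ≤ k ∧ anc c.1 q = c.2) ∧ ∑ c ∈ 𝒞, cap c.1 ≤ ∑ q ∈ S, m q := by
  obtain ⟨m, hm, hs⟩ := exists_saturated anc cap k S
  set H : Q → ℕ := fun q => if hq : q ∈ S then Nat.find (hs q hq) else 0 with hH
  have hH1 : ∀ q (hq : q ∈ S), H q = Nat.find (hs q hq) := fun q hq => dif_pos hq
  have hHk : ∀ q ∈ S, H q ≤ k ∧ ∑ q' ∈ S with anc (H q) q' = anc (H q) q, m q' = cap (H q) :=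
    fun q hq => by rw [hH1 q hq]; exact Nat.find_spec (hs q hq)
  have hle : ∀ q₁ ∈ S, ∀ q₂ ∈ S, ∀ q, anc (H q₁) q = anc (H q₁) q₁ → anc (H q₂) q = anc (H q₂) q₂ →
      H q₂ ≤ H q₁ := by
    intro q₁ h₁ q₂ h₂ q e₁ e₂
    by_contra hlt
    push Not at hlt
    have e₃ := (hanc _ _ _ _ hlt.le e₂).symm.trans e₁
    rw [hH1 q₂ h₂] at hlt
    refine Nat.find_min (hs q₂ h₂) hlt ⟨(hHk _ h₁).1, ?_⟩
    rw [e₃]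
    exact (hHk _ h₁).2
  refine ⟨m, S.image fun q => (H q, anc (H q) q), hm, fun q hq =>
    ⟨_, Finset.mem_image_of_mem _ hq, (hHk q hq).1, rfl⟩, ?_⟩
  set 𝒞 := S.image fun q => (H q, anc (H q) q)
  have h1 : ∀ c ∈ 𝒞, cap c.1 = ∑ q' ∈ S with anc c.1 q' = c.2, m q' := by
    intro c hc
    obtain ⟨q, hq, rfl⟩ := Finset.mem_image.1 hc
    exact (hHk q hq).2.symm
  rw [Finset.sum_congr rfl h1, ← Finset.sum_biUnion]
  · exact Finset.sum_le_sum_of_subset fun q hq => by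
      obtain ⟨c, -, hc⟩ := Finset.mem_biUnion.1 hq
      exact (Finset.mem_filter.1 hc).1
  · intro c hc c' hc' hne
    refine Finset.disjoint_left.2 fun q hq hq' => hne ?_
    obtain ⟨q₁, h₁, rfl⟩ := Finset.mem_image.1 hc
    obtain ⟨q₂, h₂, rfl⟩ := Finset.mem_image.1 hc'
    have e₁ := (Finset.mem_filter.1 hq).2
    have e₂ := (Finset.mem_filter.1 hq').2
    have e := (hle q₂ h₂ q₁ h₁ q e₂ e₁).antisymm (hle q₁ h₁ q₂ h₂ q e₁ e₂)
    ext1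
    · exact e
    · simp only at e₁ e₂ ⊢
      rw [← e₁, ← e₂, e]

variable {n : ℕ}

/-- The dyadic cell of generation `h` containing a point. -/
def cell (h : ℕ) (x : Fin n → ℝ) : Fin n → ℤ := fun i => ⌊2 ^ h * x i⌋

lemma cell_mono (h h' : ℕ) (x y : Fin n → ℝ) (hh : h ≤ h') (e : cell h' x = cell h' y) :
    cell h x = cell h y := by
  obtain ⟨d, rfl⟩ := Nat.exists_eq_add_of_le hh
  have h1 : ∀ z : ℝ, ⌊2 ^ h * z⌋ = ⌊2 ^ (h + d) * z⌋ / ((2 ^ d : ℕ) : ℤ) := by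
    intro z
    rw [← Int.floor_div_natCast]
    congr 1
    push_cast
    rw [pow_add]
    field_simp
  funext i
  have := congrFun e i
  simp only [cell] at this ⊢
  rw [h1, h1 (y i), this]

lemma norm_sub_le_of_cell {h : ℕ} {x y : Fin n → ℝ} (e : cell h x = cell h y) :
    ‖x - y‖ ≤ (2 ^ h)⁻¹ := by
  refine (pi_norm_le_iff_of_nonneg (by positivity)).2 fun i => ?_
  have h1 := Int.abs_sub_lt_one_of_floor_eq_floor (congrFun e i)
  rw [← mul_sub, abs_mul, abs_of_pos (by positivity)] at h1
  rw [Pi.sub_apply, Real.norm_eq_abs, ← one_div, le_div_iff₀' (by positivity)]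
  exact h1.le

lemma thinAt_of_cells {α : ℝ} (hα : 0 ≤ α) (k : ℕ) (S : Finset (Fin n → ℝ)) {a : Fin n → ℤ}
    (hS : ∀ x ∈ S, cell 0 x = a) {m : (Fin n → ℝ) → ℝ≥0}
    (hm : ∀ h ≤ k, ∀ p, ∑ q ∈ S with cell h q = p, m q ≤
      (2 ^ α * 3 ^ n)⁻¹ * ((2 : ℝ≥0) ^ (-α)) ^ h) :
    ThinAt n α (2 ^ k) S id m := by
  intro c ρ hρ t ht hc
  have hρ0 : 0 < ρ := lt_of_lt_of_le (by positivity) hρ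
  have hc1 : ((2 : ℝ≥0) ^ α * 3 ^ n)⁻¹ ≤ 1 :=
    inv_le_one_of_one_le₀ (one_le_mul (NNReal.one_le_rpow one_le_two hα) (one_le_pow₀ (by norm_num)))
  rw [← ENNReal.ofNNReal_finsetSum, ENNReal.ofReal, ENNReal.coe_le_coe]
  rcases le_or_gt 1 ρ with h1 | h1
  · calc ∑ p ∈ t, m p ≤ ∑ q ∈ S with cell 0 q = a, m q :=
          Finset.sum_le_sum_of_subset fun p hp => Finset.mem_filter.2 ⟨ht hp, hS p (ht hp)⟩
      _ ≤ 1 := (hm 0 (by omega) a).trans (by simpa using hc1)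
      _ ≤ _ := by
          rw [Real.one_le_toNNReal]
          exact Real.one_le_rpow h1 hα
  · obtain ⟨h, hh1, hh2⟩ := exists_nat_pow_near ((one_le_inv₀ hρ0).2 h1.le) one_lt_two
    have hhk : h ≤ k := by
      have h2 : ρ⁻¹ ≤ 2 ^ k := by
        rw [one_div] at hρ
        exact inv_le_of_inv_le₀ (by positivity) hρ
      exact (pow_le_pow_iff_right₀ one_lt_two).1 (hh1.trans h2)
    set N : Finset (Fin n → ℤ) :=
      Fintype.piFinset fun i => Finset.Icc (⌊2 ^ h * c i⌋ - 1) (⌊2 ^ h * c i⌋ + 1) with hN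
    have hcell : ∀ p ∈ t, cell h p ∈ N := by
      intro p hp
      rw [hN, Fintype.mem_piFinset]
      intro i
      have h2 : |p i - c i| ≤ ρ := (norm_le_pi_norm (p - c) i).trans (hc p hp)
      have h3 : 2 ^ h * ρ ≤ 1 := by
        calc 2 ^ h * ρ ≤ ρ⁻¹ * ρ := by gcongr
          _ = 1 := inv_mul_cancel₀ hρ0.ne'
      have h4 : |2 ^ h * p i - 2 ^ h * c i| ≤ 1 := by
        rw [← mul_sub, abs_mul, abs_of_pos (by positivity)]
        exact (mul_le_mul_of_nonneg_left h2 (by positivity)).trans h3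
      rw [abs_le] at h4
      rw [Finset.mem_Icc, ← Int.floor_sub_one, ← Int.floor_add_one]
      exact ⟨Int.floor_mono (by linarith), Int.floor_mono (by linarith)⟩
    have hcard : N.card = 3 ^ n := by
      rw [hN, Fintype.card_piFinset]
      simp [Int.card_Icc, show ∀ z : ℤ, z + 1 + 1 - (z - 1) = 3 by intro z; ring]
    rw [← Finset.sum_fiberwise_of_maps_to hcell]
    calc ∑ j ∈ N, ∑ p ∈ t with cell h p = j, m p
        ≤ ∑ _j ∈ N, (2 ^ α * 3 ^ n)⁻¹ * ((2 : ℝ≥0) ^ (-α)) ^ h := by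
          refine Finset.sum_le_sum fun j _ => le_trans ?_ (hm h hhk j)
          exact Finset.sum_le_sum_of_subset (Finset.filter_subset_filter _ ht)
      _ = ((2 : ℝ≥0) ^ (-α)) ^ (h + 1) := by
          rw [Finset.sum_const, hcard, nsmul_eq_mul, pow_succ, NNReal.rpow_neg]
          push_cast
          field_simp
      _ ≤ _ := by
          rw [← NNReal.coe_le_coe, Real.coe_toNNReal _ (by positivity)]
          push_cast
          rw [Real.rpow_neg zero_le_two, inv_pow, ← Real.rpow_natCast, ← Real.rpow_mul zero_le_two,
            mul_comm α, Real.rpow_mul zero_le_two, Real.rpow_natCast, ← Real.inv_rpow (by positivity)]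
          exact Real.rpow_le_rpow (by positivity) (inv_le_of_inv_le₀ hρ0 hh2.le) hα

end Frostman

section Cover

variable {n : ℕ}

/-- The points where the truncated evolution of `h` exceeds the level `δ`. -/
def badSet (φ : ℝ → ℝ) (h : (Fin n → ℝ) → ℂ) (δ : ℝ) : Set (Fin n → ℝ) :=
  {x | ∃ t ∈ Icc (0 : ℝ) 1, ∃ τ ∈ Icc (0 : ℝ) 1,
    δ < ‖Ext (fun ξ => (φ (rad ξ * τ) : ℂ) * h ξ) (Fin.cons t x)‖}

lemma exists_cover (hn : 2 ≤ n) {φ φ' : ℝ → ℝ} (hφ' : Continuous φ')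
    (hd : ∀ y, HasDerivAt φ (φ' y) y) {K : ℝ} (hK : ∀ y, |φ' y| ≤ K)
    (hK2 : ∀ y, y ^ 2 * |φ' y| ≤ K) {ε : ℝ} (hε : 0 < ε) {α γ : ℝ} (hα0 : 0 ≤ α)
    (hα : α ≤ n + 1) (hγ : γ = n - α + (n - 1 + α) / (2 * n) + ε) :
    ∃ C : ℝ≥0, ∀ (k : ℕ) (h : (Fin n → ℝ) → ℂ) (_ : Measurable h) (_ : Integrable h)
      (_ : ∀ η, h η ≠ 0 → ‖η‖ ≤ 2 ^ k) (_ : ∀ η, h η ≠ 0 → (2 : ℝ) ^ k ≤ 16 ∨ 2 ^ k / 2 ≤ ‖η‖)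
      (a : Fin n → ℤ), ∃ 𝒞 : Finset (ℕ × (Fin n → ℤ)),
      {x | cell 0 x = a} ∩ badSet φ h ((2 ^ k) ^ (-ε)) ⊆ ⋃ c ∈ 𝒞, {x | cell c.1 x = c.2} ∧
      ∑ c ∈ 𝒞, ((((2 : ℝ≥0) ^ (-α)) ^ c.1 : ℝ≥0) : ℝ≥0∞) ≤
        C * ENNReal.ofReal ((2 ^ k) ^ (γ + 2 * ε)) * ∫⁻ η, ‖h η‖ₑ ^ 2 := by
  classical
  obtain ⟨C, hC⟩ := exists_points_max hn hφ' hd hK hK2 hε hα0 hα hγ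
  refine ⟨(2 ^ α * 3 ^ n) * C, fun k h hhm hhi hhs hha a => ?_⟩
  set R : ℝ := 2 ^ k with hR
  have hR1 : 1 ≤ R := one_le_pow₀ one_le_two
  have hR0 : 0 < R := by positivity
  set E := {x | cell 0 x = a} ∩ badSet φ h (R ^ (-ε))
  have hfin : (cell k '' E).Finite := by
    refine (Set.finite_Icc (fun i => 2 ^ k * a i) fun i => 2 ^ k * (a i + 1)).subset ?_
    rintro _ ⟨x, ⟨hx, -⟩, rfl⟩
    have h1 : ∀ i, (a i : ℝ) ≤ x i ∧ x i < a i + 1 := fun i => by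
      have := congrFun hx i
      simpa [cell, Int.floor_eq_iff] using this
    refine ⟨fun i => Int.le_floor.2 ?_, fun i => Int.floor_le_iff.2 ?_⟩
    · push_cast
      exact mul_le_mul_of_nonneg_left (h1 i).1 (by positivity)
    · push_cast
      nlinarith [mul_lt_mul_of_pos_left (h1 i).2 hR0]
  obtain ⟨S, hSE, hS⟩ := Finset.subset_set_image_iff.1 (hfin.coe_toFinset).subset
  have hrep : ∀ x ∈ E, ∃ q ∈ S, cell k q = cell k x := fun x hx =>
    Finset.mem_image.1 (hS ▸ hfin.mem_toFinset.2 (mem_image_of_mem _ hx))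
  obtain ⟨m, 𝒞, hm, hcov, hsum⟩ := exists_frostman cell cell_mono
    (fun h => (2 ^ α * 3 ^ n)⁻¹ * ((2 : ℝ≥0) ^ (-α)) ^ h) k S
  refine ⟨𝒞, fun x hx => ?_, ?_⟩
  · obtain ⟨q, hq, e⟩ := hrep x hx
    obtain ⟨c, hc, hck, e'⟩ := hcov q hq
    exact mem_biUnion hc ((cell_mono _ _ _ _ hck e).symm.trans e')
  have hthin := thinAt_of_cells hα0 k S (fun x hx => (hSE hx).1) (m := m) fun h hh p => by
    convert hm h hh p
  have hE : ∀ x ∈ S, ∃ t ∈ Icc (0 : ℝ) 1, ∃ τ ∈ Icc (0 : ℝ) 1,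
    R ^ (-ε) < ‖Ext (fun ξ => (φ (rad ξ * τ) : ℂ) * h ξ) (Fin.cons t x)‖ := fun x hx => (hSE hx).2
  choose! t ht τ hτ hbad using hE
  have key := hC R hR1 h hhm hhi hhs hha _ S id t τ m hthin (fun i => a i) (fun p hp => by
    refine ⟨abs_le.2 ⟨by linarith [(ht p hp).1], (ht p hp).2⟩, ?_⟩
    have h1 : cell 0 p = cell 0 (fun i => (a i : ℝ)) := by
      rw [(hSE hp).1]; funext i; simp [cell]
    simpa using norm_sub_le_of_cell h1) hτ
  set I := ∫⁻ η, ‖h η‖ₑ ^ 2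
  have h1 : ENNReal.ofReal (R ^ (-ε)) ^ 2 * ∑ q ∈ S, (m q : ℝ≥0∞) ≤
      C * ENNReal.ofReal (R ^ γ) * I := by
    rw [Finset.mul_sum]
    refine le_trans (Finset.sum_le_sum fun q hq => ?_) key
    rw [mul_comm]
    refine mul_le_mul' le_rfl (pow_le_pow_left' ?_ 2)
    rw [← ofReal_norm]
    exact ENNReal.ofReal_le_ofReal (hbad q hq).le
  have h2 : ∑ c ∈ 𝒞, ((((2 : ℝ≥0) ^ (-α)) ^ c.1 : ℝ≥0) : ℝ≥0∞) ≤
      (2 ^ α * 3 ^ n : ℝ≥0) * ∑ q ∈ S, (m q : ℝ≥0∞) := by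
    rw [← ENNReal.ofNNReal_finsetSum, ← ENNReal.ofNNReal_finsetSum, ← ENNReal.coe_mul,
      ENNReal.coe_le_coe]
    refine le_trans (le_of_eq ?_) (mul_le_mul' le_rfl hsum)
    rw [← Finset.mul_sum, mul_inv_cancel_left₀ (by positivity)]
  have h3 : ENNReal.ofReal (R ^ (2 * ε)) * ENNReal.ofReal (R ^ (-ε)) ^ 2 = 1 := by
    rw [← ENNReal.ofReal_pow (by positivity), ← ENNReal.ofReal_mul (by positivity), ← Real.rpow_natCast,
      ← Real.rpow_mul hR0.le, ← Real.rpow_add hR0]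
    norm_num
    ring_nf
    simp
  calc _ ≤ (2 ^ α * 3 ^ n : ℝ≥0) * ((ENNReal.ofReal (R ^ (2 * ε)) * ENNReal.ofReal (R ^ (-ε)) ^ 2) *
        ∑ q ∈ S, (m q : ℝ≥0∞)) := by rwa [h3, one_mul]
    _ ≤ (2 ^ α * 3 ^ n : ℝ≥0) * (ENNReal.ofReal (R ^ (2 * ε)) * (C * ENNReal.ofReal (R ^ γ) * I)) := by
        rw [mul_assoc (ENNReal.ofReal _)]
        exact mul_le_mul' le_rfl (mul_le_mul' le_rfl h1)
    _ = _ := by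
        rw [Real.rpow_add hR0, ENNReal.ofReal_mul (by positivity),
          ENNReal.coe_mul (2 ^ α * 3 ^ n) C]
        ring

lemma dimH_le_of_cover {α : ℝ≥0} (hα : 0 < α) {E : Set (Fin n → ℝ)}
    (𝒞 : ℕ → Finset (ℕ × (Fin n → ℤ)))
    (hE : ∀ K, E ⊆ ⋃ k, ⋃ c ∈ 𝒞 (k + K), {x | cell c.1 x = c.2})
    (hsum : ∑' k, ∑ c ∈ 𝒞 k, ((((2 : ℝ≥0) ^ (-(α : ℝ))) ^ c.1 : ℝ≥0) : ℝ≥0∞) ≠ ∞) :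
    dimH E ≤ α := by
  have hα' : (0 : ℝ) < α := hα
  set w : ℕ × (Fin n → ℤ) → ℝ≥0∞ := fun c => (((2 : ℝ≥0) ^ (-(α : ℝ))) ^ c.1 : ℝ≥0) with hw
  set A : ℕ → ℝ≥0∞ := fun K => ∑' k, ∑ c ∈ 𝒞 (k + K), w c with hA
  have hA0 : Tendsto A atTop (𝓝 0) := ENNReal.tendsto_sum_nat_add _ hsum
  set U : ℕ × (Fin n → ℤ) → Set (Fin n → ℝ) := fun c => {x | cell c.1 x = c.2}
  have hdiam : ∀ c, ediam (U c) ^ (α : ℝ) ≤ w c := by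
    intro c
    have h1 : ediam (U c) ≤ (((2 : ℝ≥0) ^ c.1)⁻¹ : ℝ≥0) := by
      refine Metric.ediam_le fun x hx y hy => ?_
      rw [edist_nndist, ENNReal.coe_le_coe, ← NNReal.coe_le_coe, coe_nndist, dist_eq_norm]
      simpa using norm_sub_le_of_cell (hx.trans hy.symm)
    refine (ENNReal.rpow_le_rpow h1 hα'.le).trans (le_of_eq ?_)
    rw [← ENNReal.coe_rpow_of_nonneg _ hα'.le, hw]
    simp only [ENNReal.coe_inj]
    rw [NNReal.inv_rpow, ← NNReal.rpow_natCast, ← NNReal.rpow_mul, mul_comm, NNReal.rpow_mul,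
      NNReal.rpow_natCast, NNReal.rpow_neg, inv_pow]
  have hsig : ∀ K, ∑' i : (Σ k, (𝒞 (k + K) : Set (ℕ × (Fin n → ℤ)))), w i.2 = A K := by
    intro K
    rw [ENNReal.tsum_sigma']
    exact tsum_congr fun k => Finset.tsum_subtype (𝒞 (k + K)) w
  have h0 : μH[(α : ℝ)] E ≤ 0 := by
    refine (Measure.hausdorffMeasure_le_liminf_tsum (α : ℝ) E (l := atTop)
      (ι := fun K => (Σ k, (𝒞 (k + K) : Set (ℕ × (Fin n → ℤ)))))
      (fun K => A K ^ (1 / (α : ℝ))) ?_ (fun K i => U i.2) (Eventually.of_forall fun K i => ?_)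
      (Eventually.of_forall fun K x hx => ?_)).trans ?_
    · have := hA0.ennrpow_const (1 / (α : ℝ))
      rwa [ENNReal.zero_rpow_of_pos (by positivity)] at this
    · rw [one_div, ENNReal.le_rpow_inv_iff hα']
      exact (hdiam _).trans ((ENNReal.le_tsum i).trans_eq (hsig K))
    · obtain ⟨k, hk⟩ := mem_iUnion.1 (hE K hx)
      obtain ⟨c, hc, hxc⟩ := mem_iUnion₂.1 hk
      exact mem_iUnion.2 ⟨⟨k, c, hc⟩, hxc⟩
    · refine (liminf_le_liminf (Eventually.of_forall fun K =>
        (ENNReal.tsum_le_tsum fun i => hdiam _).trans_eq (hsig K))).trans_eq ?_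
      exact hA0.liminf_eq
  exact dimH_le_of_hausdorffMeasure_ne_top (h0.trans_lt ENNReal.zero_lt_top).ne

end Cover

section Convergence

variable {n : ℕ}

/-- The dyadic frequency shells. -/
def shell (n k : ℕ) : Set (Fin n → ℝ) := disjointed (fun k => ball 0 (2 ^ k)) k

lemma measurableSet_shell (k : ℕ) : MeasurableSet (shell n k) :=
  MeasurableSet.disjointed (fun _ => measurableSet_ball) k

lemma pairwise_disjoint_shell : Pairwise (Function.onFun Disjoint (shell n)) :=
  disjoint_disjointed _

lemma iUnion_shell : ⋃ k, shell n k = univ := by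
  refine (iUnion_disjointed (f := fun k : ℕ => ball (0 : Fin n → ℝ) (2 ^ k))).trans ?_
  refine eq_univ_of_forall fun x => mem_iUnion.2 ?_
  obtain ⟨k, hk⟩ := pow_unbounded_of_one_lt ‖x‖ (one_lt_two (α := ℝ))
  exact ⟨k, by simpa using hk⟩

lemma norm_lt_of_mem_shell {k : ℕ} {ξ : Fin n → ℝ} (h : ξ ∈ shell n k) : ‖ξ‖ < 2 ^ k := by
  simpa using disjointed_subset (fun k => ball (0 : Fin n → ℝ) (2 ^ k)) k h

lemma le_norm_of_mem_shell {k : ℕ} {ξ : Fin n → ℝ} (h : ξ ∈ shell n k) :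
    k = 0 ∨ (2 : ℝ) ^ k / 2 ≤ ‖ξ‖ := by
  rcases k with _ | k
  · exact Or.inl rfl
  · have hm : Monotone fun k : ℕ => ball (0 : Fin n → ℝ) (2 ^ k) := fun a b hab =>
      ball_subset_ball (pow_le_pow_right₀ one_le_two hab)
    rw [shell, hm.disjointed_add_one] at h
    have := h.2
    simp only [mem_ball_zero_iff, not_lt] at this
    rw [pow_succ, mul_div_cancel_right₀ _ two_ne_zero]
    exact Or.inr this

lemma integrable_indicator_shell {f : (Fin n → ℝ) → ℂ} (hf : MemLp f 2) (k : ℕ) :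
    Integrable ((shell n k).indicator f) := by
  have hfin : volume (shell n k) ≠ ∞ :=
    ((measure_mono (disjointed_subset _ k)).trans_lt measure_ball_lt_top).ne
  have : Fact (volume (shell n k) < ∞) := ⟨hfin.lt_top⟩
  rw [integrable_indicator_iff (measurableSet_shell k)]
  exact (hf.restrict _).integrable (by norm_num)

lemma dimH_frequently_badSet_le (hn : 2 ≤ n) {φ φ' : ℝ → ℝ} (hφ' : Continuous φ')
    (hd : ∀ y, HasDerivAt φ (φ' y) y) {K : ℝ} (hK : ∀ y, |φ' y| ≤ K)
    (hK2 : ∀ y, y ^ 2 * |φ' y| ≤ K) {ε : ℝ} (hε : 0 < ε) {α s : ℝ} (hα0 : 0 < α)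
    (hα : α ≤ n + 1) (hs0 : 0 ≤ s) (hs : n - α + (n - 1 + α) / (2 * n) + 3 * ε ≤ 2 * s)
    {f : (Fin n → ℝ) → ℂ} (hf : Measurable f) (hf2 : MemLp f 2)
    (hW : ∫⁻ ξ, ENNReal.ofReal ((1 + rad ξ ^ 2) ^ s) * ‖f ξ‖ₑ ^ 2 ≠ ∞) :
    dimH {x | ∃ᶠ k : ℕ in atTop, x ∈ badSet φ ((shell n k).indicator f) ((2 ^ k) ^ (-ε))} ≤
      ENNReal.ofReal α := by
  obtain ⟨C, hC⟩ := exists_cover hn hφ' hd hK hK2 hε hα0.le hα rfl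
  set B := {x | ∃ᶠ k : ℕ in atTop, x ∈ badSet φ ((shell n k).indicator f) ((2 ^ k) ^ (-ε))} with hB
  have hBU : B ⊆ ⋃ a : Fin n → ℤ, {x | cell 0 x = a} ∩ B := fun x hx =>
    mem_iUnion.2 ⟨cell 0 x, rfl, hx⟩
  refine (dimH_mono hBU).trans ?_
  rw [dimH_iUnion]
  refine iSup_le fun a => ?_
  have hmem : ∀ k η, (shell n k).indicator f η ≠ 0 → η ∈ shell n k := fun k η h =>
    mem_of_indicator_ne_zero h
  choose 𝒞 hcov hsum using fun k : ℕ => hC k _ (hf.indicator (measurableSet_shell k))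
    (integrable_indicator_shell hf2 k) (fun η h => (norm_lt_of_mem_shell (hmem k η h)).le)
    (fun η h => (le_norm_of_mem_shell (hmem k η h)).imp_left (by rintro rfl; norm_num)) a
  have hαc : ((α.toNNReal : ℝ≥0) : ℝ) = α := Real.coe_toNNReal _ hα0.le
  refine dimH_le_of_cover (Real.toNNReal_pos.2 hα0) 𝒞 (fun K x hx => ?_) ?_
  · obtain ⟨k, hk, hkx⟩ := frequently_atTop.1 hx.2 K
    refine mem_iUnion.2 ⟨k - K, ?_⟩
    rw [Nat.sub_add_cancel hk]
    exact hcov k ⟨hx.1, hkx⟩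
  rw [hαc]
  set w : (Fin n → ℝ) → ℝ≥0∞ := fun ξ => ENNReal.ofReal ((1 + rad ξ ^ 2) ^ s) * ‖f ξ‖ₑ ^ 2
  have hle : ∀ k, ∑ c ∈ 𝒞 k, ((((2 : ℝ≥0) ^ (-α)) ^ c.1 : ℝ≥0) : ℝ≥0∞) ≤
      C * ENNReal.ofReal (4 ^ s) * ∫⁻ ξ in shell n k, w ξ := by
    intro k
    refine (hsum k).trans ?_
    rw [mul_assoc, mul_assoc]
    refine mul_le_mul' le_rfl ?_
    rw [← lintegral_const_mul' _ _ ENNReal.ofReal_ne_top,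
      ← lintegral_const_mul' _ _ ENNReal.ofReal_ne_top,
      ← lintegral_indicator (measurableSet_shell k)]
    refine lintegral_mono fun ξ => ?_
    by_cases hξ : ξ ∈ shell n k
    · simp only [indicator_of_mem hξ, w]
      rw [← mul_assoc, ← ENNReal.ofReal_mul (by positivity)]
      refine mul_le_mul' (ENNReal.ofReal_le_ofReal ?_) le_rfl
      have hk1 : (1 : ℝ) ≤ 2 ^ k := one_le_pow₀ one_le_two
      have hr := norm_le_rad ξ
      rw [← Real.mul_rpow (by norm_num) (by positivity)]
      calc ((2 : ℝ) ^ k) ^ _ ≤ (2 ^ k) ^ (2 * s) :=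
            Real.rpow_le_rpow_of_exponent_le hk1 (by linarith)
        _ = ((2 ^ k) ^ 2) ^ s := by
            rw [Real.rpow_mul (by positivity), Real.rpow_two]
        _ ≤ _ := by
            refine Real.rpow_le_rpow (by positivity) ?_ hs0
            rcases le_norm_of_mem_shell hξ with rfl | h
            · nlinarith [sq_nonneg (rad ξ)]
            · nlinarith
    · simp [indicator_of_notMem hξ]
  refine ((ENNReal.tsum_le_tsum hle).trans_lt ?_).ne
  rw [ENNReal.tsum_mul_left, ← lintegral_iUnion measurableSet_shell pairwise_disjoint_shell,
    iUnion_shell, Measure.restrict_univ]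
  exact ENNReal.mul_lt_top (ENNReal.mul_lt_top ENNReal.coe_lt_top ENNReal.ofReal_lt_top) hW.lt_top

lemma exists_tendsto_of_eventually_notMem {φ : ℝ → ℝ} (hφ : Continuous φ) {K : ℝ}
    (hK : ∀ y, |φ y| ≤ K) (hφ2 : ∀ τ, 0 < τ → MemLp (fun ξ : Fin n → ℝ => (φ (rad ξ * τ) : ℂ)) 2)
    {f : (Fin n → ℝ) → ℂ} (hf2 : MemLp f 2) {ε : ℝ} (hε : 0 < ε) {x : Fin n → ℝ}
    (hx : ∀ᶠ k : ℕ in atTop, x ∉ badSet φ ((shell n k).indicator f) ((2 ^ k) ^ (-ε))) :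
    ∃ u : ℝ → ℂ, ContinuousOn u (Icc 0 1) ∧ ∀ t ∈ Icc (0 : ℝ) 1,
      Tendsto (fun N : ℝ => ∫ ξ, (φ (rad ξ / N) : ℂ) * f ξ * ch (Lam ξ ⬝ᵥ Fin.cons t x)) atTop
        (𝓝 (u t)) := by
  obtain ⟨k₀, hk₀⟩ := eventually_atTop.1 hx
  have hK0 : 0 ≤ K := (abs_nonneg _).trans (hK 0)
  have hrad := continuous_rad (n := n)
  set g : ℕ → ℝ → (Fin n → ℝ) → ℂ := fun k τ ξ => (φ (rad ξ * τ) : ℂ) * (shell n k).indicator f ξ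
  have hfi := integrable_indicator_shell hf2
  have hgn : ∀ k τ ξ, ‖g k τ ξ‖ ≤ K * ‖(shell n k).indicator f ξ‖ := fun k τ ξ => by
    rw [norm_mul, Complex.norm_real]
    exact mul_le_mul_of_nonneg_right (hK _) (norm_nonneg _)
  have hgi : ∀ k τ, Integrable (g k τ) := fun k τ => by
    refine ((hfi k).norm.const_mul K).mono' ?_ (Eventually.of_forall (hgn k τ))
    exact (Continuous.aestronglyMeasurable (by fun_prop)).mul (hfi k).aestronglyMeasurable
  set b : ℕ → ℝ := fun k => ((2 : ℝ) ^ (-ε)) ^ k +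
    if k < k₀ then K * ∫ ξ, ‖(shell n k).indicator f ξ‖ else 0
  have hb : Summable b := by
    refine Summable.add (summable_geometric_of_lt_one (by positivity) ?_)
      (summable_of_hasFiniteSupport ((finite_lt_nat k₀).subset fun k hk => ?_))
    · exact Real.rpow_lt_one_of_one_lt_of_neg one_lt_two (by linarith)
    · by_contra h
      exact hk (if_neg h)
  have hbd : ∀ k, ∀ τ ∈ Icc (0 : ℝ) 1, ∀ t ∈ Icc (0 : ℝ) 1,
      ‖Ext (g k τ) (Fin.cons t x)‖ ≤ b k := by
    intro k τ hτ t ht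
    by_cases hk : k < k₀
    · simp only [b, if_pos hk]
      refine (norm_ext_le _ _).trans (le_trans ?_ (le_add_of_nonneg_left (by positivity)))
      rw [← integral_const_mul]
      exact integral_mono (hgi k τ).norm ((hfi k).norm.const_mul K) (hgn k τ)
    · simp only [b, if_neg hk, add_zero]
      by_contra! h
      refine hk₀ k (not_lt.1 hk) ⟨t, ht, τ, hτ, lt_of_eq_of_lt ?_ h⟩
      rw [← Real.rpow_natCast, ← Real.rpow_natCast, ← Real.rpow_mul zero_le_two,
        ← Real.rpow_mul zero_le_two, mul_comm]
  refine ⟨fun t => ∑' k, Ext (g k 0) (Fin.cons t x), ?_, fun t ht => ?_⟩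
  · refine continuousOn_tsum (fun k => ?_) hb fun k t ht => hbd k 0 (by simp) t ht
    have : Continuous fun t : ℝ => (Fin.cons t x : Fin (n + 1) → ℝ) :=
      continuous_pi fun i => Fin.cases (by simpa using continuous_id')
        (fun j => by simpa using continuous_const) i
    exact ((continuous_ext (hgi k 0)).comp this).continuousOn
  have hinv : Tendsto (fun N : ℝ => N⁻¹) atTop (𝓝 0) := tendsto_inv_atTop_zero
  have hlim := tendsto_tsum_of_dominated_convergence (𝓕 := atTop) hb
    (f := fun (N : ℝ) k => Ext (g k N⁻¹) (Fin.cons t x)) (g := fun k => Ext (g k 0) (Fin.cons t x))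
    (fun k => ?_) ?_
  · refine hlim.congr' ((eventually_gt_atTop 0).mono fun N hN => ?_)
    have hi : Integrable fun ξ => (φ (rad ξ / N) : ℂ) * f ξ * ch (Lam ξ ⬝ᵥ Fin.cons t x) :=
      integrable_ext ((hφ2 _ (inv_pos.2 hN)).integrable_mul hf2) _
    have h1 := integral_iUnion measurableSet_shell pairwise_disjoint_shell hi.integrableOn
    rw [iUnion_shell, Measure.restrict_univ] at h1
    refine Eq.trans ?_ h1.symm
    refine tsum_congr fun k => ?_
    rw [← integral_indicator (measurableSet_shell k), Ext]
    refine integral_congr_ae (Eventually.of_forall fun ξ => ?_)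
    by_cases hξ : ξ ∈ shell n k <;> simp [g, hξ, div_eq_mul_inv]
  · have hc : Continuous fun τ => Ext (g k τ) (Fin.cons t x) := by
      refine continuous_of_dominated (bound := fun ξ => K * ‖(shell n k).indicator f ξ‖)
        (fun τ => (integrable_ext (hgi k τ) _).aestronglyMeasurable)
        (fun τ => Eventually.of_forall fun ξ => ?_) ((hfi k).norm.const_mul K)
        (Eventually.of_forall fun ξ => by fun_prop)
      rw [norm_mul, norm_ch, mul_one]
      exact hgn k τ ξ
    exact (hc.tendsto 0).comp hinv
  · filter_upwards [eventually_ge_atTop 1] with N hN k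
    exact hbd k _ ⟨inv_nonneg.2 (by linarith), inv_le_one_of_one_le₀ hN⟩ t ht

lemma memLp_schwartz_rad (ψ : SchwartzMap ℝ ℝ) {τ : ℝ} (hτ : 0 < τ) :
    MemLp (fun ξ : Fin n → ℝ => (ψ (rad ξ * τ) : ℂ)) 2 := by
  have hrad := continuous_rad (n := n)
  have hψ := ψ.continuous
  rw [memLp_two_iff_integrable_sq_norm (Continuous.aestronglyMeasurable (by fun_prop))]
  set C : ℝ := 2 ^ (n + 1) * (Finset.Iic (n + 1, 0)).sup (fun m => SchwartzMap.seminorm ℝ m.1 m.2) ψ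
  have hC : ∀ y : ℝ, (1 + |y|) ^ (n + 1) * |ψ y| ≤ C := fun y => by
    simpa using SchwartzMap.one_add_le_sup_seminorm_apply (𝕜 := ℝ) (m := (n + 1, 0)) le_rfl le_rfl ψ y
  have hC0 : 0 ≤ C := le_trans (by positivity) (hC 0)
  have h1 : Integrable fun ξ : Fin n → ℝ => (1 + ‖τ • ξ‖) ^ (-((n + 1 : ℕ) : ℝ)) :=
    (integrable_one_add_norm (E := Fin n → ℝ) (μ := volume) (r := ((n + 1 : ℕ) : ℝ))
      (by simp)).comp_smul hτ.ne'
  refine (h1.const_mul (C * C)).mono' (Continuous.aestronglyMeasurable (by fun_prop))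
    (Eventually.of_forall fun ξ => ?_)
  have hy : ‖τ • ξ‖ ≤ |rad ξ * τ| := by
    rw [norm_smul, abs_mul, mul_comm, Real.norm_eq_abs, abs_of_nonneg (rad_nonneg ξ)]
    exact mul_le_mul_of_nonneg_right (norm_le_rad ξ) (abs_nonneg _)
  set y := rad ξ * τ
  have h2 := hC y
  have h3 : |ψ y| ≤ C :=
    (le_mul_of_one_le_left (abs_nonneg _) (one_le_pow₀ (by simp))).trans h2
  have h4 : (1 + ‖τ • ξ‖) ^ (n + 1) * |ψ y| ≤ C := le_trans (by gcongr) h2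
  rw [Complex.norm_real, norm_pow, norm_norm, Real.norm_eq_abs, Real.rpow_neg (by positivity),
    Real.rpow_natCast, ← div_eq_mul_inv, le_div_iff₀ (by positivity)]
  calc |ψ y| ^ 2 * (1 + ‖τ • ξ‖) ^ (n + 1) = |ψ y| * ((1 + ‖τ • ξ‖) ^ (n + 1) * |ψ y|) := by ring
    _ ≤ C * C := mul_le_mul h3 h4 (by positivity) hC0

end Convergence

end

section Transfer

variable {n : ℕ}

lemma sq_rad (ξ : Fin n → ℝ) : rad ξ ^ 2 = ξ ⬝ᵥ ξ :=
  Real.sq_sqrt (Finset.sum_nonneg fun _ _ => mul_self_nonneg _)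

lemma norm_eq_rad (ξ : EuclideanSpace ℝ (Fin n)) : ‖ξ‖ = rad ξ.ofLp := by
  rw [EuclideanSpace.norm_eq, rad]
  simp [dotProduct, ← sq]

lemma schroPartial_eq (ψ : SchwartzMap ℝ ℝ) {F : EuclideanSpace ℝ (Fin n) → ℂ}
    {f : (Fin n → ℝ) → ℂ} (hf : F =ᵐ[volume] f ∘ WithLp.ofLp) (x : EuclideanSpace ℝ (Fin n))
    (t N : ℝ) : schroPartial n ψ F x t N =
      ∫ ξ, (ψ (rad ξ / N) : ℂ) * f ξ * ch (Lam ξ ⬝ᵥ Fin.cons t x.ofLp) := by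
  rw [← (PiLp.volume_preserving_ofLp (Fin n)).integral_comp
    (MeasurableEquiv.toLp 2 (Fin n → ℝ)).symm.measurableEmbedding, schroPartial]
  refine integral_congr_ae (hf.mono fun ξ hξ => ?_)
  have h1 := norm_eq_rad ξ
  have h2 : Lam ξ.ofLp ⬝ᵥ Fin.cons t x.ofLp = ⟪x, ξ⟫_ℝ - t * ‖ξ‖ ^ 2 := by
    rw [Lam, dotProduct_cons, h1, sq_rad, EuclideanSpace.inner_eq_star_dotProduct]
    simp
    ring
  simp only [hξ, Function.comp_apply, h2, h1, ch]
  push_cast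
  ring_nf

/-- If the pointwise limits exist for `t ∈ [0, 1]` and are continuous there, then `x` is not in the
divergence set. -/
lemma notMem_schroDivergenceSet {ψ : SchwartzMap ℝ ℝ} {F : EuclideanSpace ℝ (Fin n) → ℂ}
    {x : EuclideanSpace ℝ (Fin n)} {u : ℝ → ℂ} (hu : ContinuousOn u (Icc 0 1))
    (h : ∀ t ∈ Icc (0 : ℝ) 1, Tendsto (fun N => schroPartial n ψ F x t N) atTop (𝓝 (u t))) :
    x ∉ schroDivergenceSet n ψ F := by
  have hs : ∀ t ∈ Icc (0 : ℝ) 1, schroSol n ψ F x t = u t := fun t ht => (h t ht).limUnder_eq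
  refine not_not.2 ⟨⟨_, h 0 (by simp)⟩, 1, one_pos, fun t ht => ⟨_, h t (Ioo_subset_Icc_self ht)⟩, ?_⟩
  rw [hs 0 (by simp)]
  have hmem : Ioo (0 : ℝ) 1 ∈ 𝓝[>] (0 : ℝ) := Ioo_mem_nhdsGT one_pos
  refine Tendsto.congr' (eventually_of_mem hmem fun t ht => (hs t (Ioo_subset_Icc_self ht)).symm) ?_
  refine (hu 0 (by simp)).mono_left ?_
  exact nhdsWithin_le_of_mem (mem_of_superset hmem Ioo_subset_Icc_self)

lemma dimH_schroDivergenceSet_le (hn : 2 ≤ n) {s : ℝ} (hs : 0 < s) (ψ : SchwartzMap ℝ ℝ)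
    {F : EuclideanSpace ℝ (Fin n) → ℂ} (hFm : AEStronglyMeasurable F volume)
    (hFs : Integrable (fun ξ => (1 + ‖ξ‖ ^ 2) ^ s * ‖F ξ‖ ^ 2) volume) {α : ℝ} (hα0 : 0 < α)
    (hα : α ≤ n + 1) (hlt : n - α + (n - 1 + α) / (2 * n) < 2 * s) :
    dimH (schroDivergenceSet n ψ F) ≤ ENNReal.ofReal α := by
  have hvp := PiLp.volume_preserving_ofLp (Fin n)
  have hemb : MeasurableEmbedding (WithLp.ofLp : EuclideanSpace ℝ (Fin n) → Fin n → ℝ) :=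
    (MeasurableEquiv.toLp 2 (Fin n → ℝ)).symm.measurableEmbedding
  obtain ⟨F', hF', hFF'⟩ := hFm
  set f : (Fin n → ℝ) → ℂ := fun ξ => F' (WithLp.toLp 2 ξ)
  have hf : Measurable f := hF'.measurable.comp (MeasurableEquiv.toLp 2 (Fin n → ℝ)).measurable
  have hFf : F =ᵐ[volume] f ∘ WithLp.ofLp := hFF'
  have hWi : Integrable fun ξ => (1 + rad ξ ^ 2) ^ s * ‖f ξ‖ ^ 2 := by
    rw [← hvp.integrable_comp_emb hemb]
    refine hFs.congr (hFf.mono fun ξ hξ => ?_)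
    simp only [hξ, norm_eq_rad, Function.comp_apply]
  have hf2 : MemLp f 2 := by
    rw [memLp_two_iff_integrable_sq_norm hf.aestronglyMeasurable]
    refine hWi.mono' (hf.norm.pow_const 2).aestronglyMeasurable (Eventually.of_forall fun ξ => ?_)
    rw [Real.norm_of_nonneg (by positivity)]
    refine le_mul_of_one_le_left (by positivity) (Real.one_le_rpow ?_ hs.le)
    nlinarith [sq_nonneg (rad ξ)]
  have hW : ∫⁻ ξ, ENNReal.ofReal ((1 + rad ξ ^ 2) ^ s) * ‖f ξ‖ₑ ^ 2 ≠ ∞ := by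
    refine ne_of_eq_of_ne (lintegral_congr fun ξ => ?_) hWi.2.ne
    rw [enorm_mul, enorm_pow, enorm_norm, Real.enorm_of_nonneg (by positivity)]
  obtain ⟨K₀, -, hK₀⟩ := ψ.decay 0 0
  obtain ⟨K₁, -, hK₁⟩ := (SchwartzMap.derivCLM ℝ ℝ ψ).decay 0 0
  obtain ⟨K₂, -, hK₂⟩ := (SchwartzMap.derivCLM ℝ ℝ ψ).decay 2 0
  simp only [norm_iteratedFDeriv_zero, SchwartzMap.derivCLM_apply, pow_zero, one_mul,
    Real.norm_eq_abs, sq_abs] at hK₀ hK₁ hK₂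
  have hψ' : Continuous (deriv ψ) :=
    (SchwartzMap.derivCLM ℝ ℝ ψ).continuous.congr (SchwartzMap.derivCLM_apply ℝ ψ)
  set ε := (2 * s - (n - α + (n - 1 + α) / (2 * n))) / 3 with hε
  have hε0 : 0 < ε := by linarith
  have key := dimH_frequently_badSet_le hn hψ' ψ.hasDerivAt
    (fun y => (hK₁ y).trans (le_max_left _ K₂)) (fun y => (hK₂ y).trans (le_max_right K₁ _)) hε0 hα0
    hα hs.le (by linarith) hf hf2 hW
  rw [← (PiLp.continuousLinearEquiv 2 ℝ fun _ : Fin n => ℝ).dimH_preimage] at key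
  refine (dimH_mono fun x hx => ?_).trans key
  by_contra hx'
  obtain ⟨u, hu, h⟩ := exists_tendsto_of_eventually_notMem ψ.continuous hK₀
    (fun τ hτ => memLp_schwartz_rad ψ hτ) hf2 hε0 (not_frequently.1 hx')
  refine notMem_schroDivergenceSet hu (fun t ht => ?_) hx
  simp only [schroPartial_eq ψ hFf]
  exact h t ht

lemma dimH_schroDivergenceSet_le_of_pos (hn : 2 ≤ n) {s : ℝ} (hs : 0 < s) (ψ : SchwartzMap ℝ ℝ)
    {F : EuclideanSpace ℝ (Fin n) → ℂ} (hFm : AEStronglyMeasurable F volume)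
    (hFs : Integrable (fun ξ => (1 + ‖ξ‖ ^ 2) ^ s * ‖F ξ‖ ^ 2) volume) :
    dimH (schroDivergenceSet n ψ F) ≤ ENNReal.ofReal ((n : ℝ) + 1 - (2 + 2 / (2 * n - 1)) * s) := by
  have hn' : (2 : ℝ) ≤ n := by exact_mod_cast hn
  have hd : (0 : ℝ) < 2 * n - 1 := by linarith
  refine le_of_forall_gt fun b hb => ?_
  obtain ⟨c, hc, hcb⟩ := exists_between hb
  have hr0 : 0 < c.toReal := ENNReal.toReal_pos (ne_bot_of_gt hc) hcb.ne_top
  rw [← ENNReal.ofReal_toReal hcb.ne_top] at hc hcb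
  rw [ENNReal.ofReal_lt_ofReal_iff hr0] at hc
  set α := min c.toReal (n + 1)
  have hα : (n : ℝ) + 1 - (2 + 2 / (2 * n - 1)) * s < α := by
    refine lt_min hc ?_
    have : 0 < (2 + 2 / (2 * n - 1)) * s := by positivity
    linarith
  refine lt_of_le_of_lt ?_ (lt_of_le_of_lt (ENNReal.ofReal_le_ofReal (min_le_left _ (n + 1 : ℝ))) hcb)
  refine dimH_schroDivergenceSet_le hn hs ψ hFm hFs (lt_min hr0 (by positivity))
    (min_le_right _ _) ?_
  have h1 : (2 * n - 1) * ((n : ℝ) + 1) - 4 * n * s < (2 * n - 1) * α := by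
    refine lt_of_eq_of_lt ?_ (mul_lt_mul_of_pos_left hα hd)
    field_simp
    ring
  rw [← lt_sub_iff_add_lt', div_lt_iff₀ (by positivity)]
  nlinarith

end Transfer

end SchroAux

theorem stmt0 (n : ℕ) (hn : 2 ≤ n) (s : ℝ)
    (ψ : SchwartzMap ℝ ℝ) (hψpos : ∀ y, 0 < ψ y)
    (hψ0 : ψ 0 = (2 * Real.pi) ^ (-(n : ℝ) / 2))
    (F : EuclideanSpace ℝ (Fin n) → ℂ)
    (hFmeas : AEStronglyMeasurable F volume)
    (hFs : Integrable (fun ξ => (1 + ‖ξ‖ ^ 2) ^ s * ‖F ξ‖ ^ 2) volume) :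
    ((1 / 2 - 1 / (4 * n) < s ∧ s ≤ 1 - 3 / (2 * (n + 1))) →
        dimH (schroDivergenceSet n ψ F)
          ≤ ENNReal.ofReal ((n : ℝ) + 1 - (2 + 2 / (2 * n - 1)) * s)) ∧
    ((1 - 3 / (2 * (n + 1)) ≤ s ∧ s < n / 4) →
        dimH (schroDivergenceSet n ψ F)
          ≤ ENNReal.ofReal ((n : ℝ) + 1 - 1 / (n + 1) - 2 * s)) := by
  have hn' : (2 : ℝ) ≤ n := by exact_mod_cast hn
  have h4 : 1 / (4 * (n : ℝ)) < 1 / 2 := by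
    rw [div_lt_div_iff₀ (by positivity) (by norm_num)]; linarith
  refine ⟨fun h => SchroAux.dimH_schroDivergenceSet_le_of_pos hn (by linarith) ψ hFmeas hFs,
    fun h => ?_⟩
  have h3 : 3 / (2 * ((n : ℝ) + 1)) ≤ 1 / 2 := by
    rw [div_le_div_iff₀ (by positivity) (by norm_num)]; linarith
  refine (SchroAux.dimH_schroDivergenceSet_le_of_pos hn (by linarith) ψ hFmeas hFs).trans
    (ENNReal.ofReal_le_ofReal ?_)
  have hd : (0 : ℝ) < 2 * n - 1 := by linarith
  have key : 1 / ((n : ℝ) + 1) ≤ 2 / (2 * n - 1) * s := by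
    refine le_trans (le_of_eq ?_) (mul_le_mul_of_nonneg_left h.1 (by positivity))
    rw [eq_comm, div_mul_eq_mul_div, div_eq_div_iff hd.ne' (by positivity)]
    field_simp
    ring
  linarith
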